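/- Let G be a finite group acting freely on a compact Hausdorff space X, and let f : X → V be a G-equivariant continuous map to a real G-representation V with V^G = 0 (no nonzero fixed vectors). If dim V ≤ the least dimension n such that every G-equivariant map from X to V \ {0} would contradict a nonvanishing Euler class — concretely, for G = (ℤ/p)^k acting on X = SO(d), d = p^k, via left multiplication through an embedding G ↪ SO(d), and V = ℝ^d/Δ the reduced regular representation — then f has a zero: there exists x ∈ X with f(x) = 0. -/

import Mathlib

open Matrix Set

set_option autoImplicit false
set_option linter.unusedSectionVars false
set_option linter.unusedVariables false
set_option linter.style.haveILetI false
set_option linter.unusedSimpArgs false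

namespace Volo
open scoped Topology

section Alg
variable {R : Type} [CommRing R] {Y Y1 : Type}

/-- coboundary on cochains, which are functions on lists -/
def D : (List Y → R) → List Y → R
  | _, [] => 0
  | f, a :: l => f l - D (fun m => f (a :: m)) l

/-- cup product -/
def cup : (List Y → R) → (List Y → R) → List Y → R
  | _, _, [] => 0
  | f, g, a :: l => f [a] * g (a :: l) + cup (fun m => f (a :: m)) g l

/-- sign twist -/
def sg (f : List Y → R) (l : List Y) : R := (-1) ^ (l.length + 1) * f l

/-- prism operator -/
def prism (φ ψ : Y1 → Y) : (List Y → R) → List Y1 → R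
  | _, [] => 0
  | f, a :: l => f (φ a :: (a :: l).map ψ) - prism φ ψ (fun m => f (φ a :: m)) l

@[simp] theorem D_nil (f : List Y → R) : D f [] = 0 := rfl
theorem D_cons (f : List Y → R) (a : Y) (l : List Y) :
    D f (a :: l) = f l - D (fun m => f (a :: m)) l := rfl
@[simp] theorem cup_nil (f g : List Y → R) : cup f g [] = 0 := rfl
theorem cup_cons (f g : List Y → R) (a : Y) (l : List Y) :
    cup f g (a :: l) = f [a] * g (a :: l) + cup (fun m => f (a :: m)) g l := rfl
@[simp] theorem prism_nil (φ ψ : Y1 → Y) (f : List Y → R) : prism φ ψ f [] = 0 := rfl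
theorem prism_cons (φ ψ : Y1 → Y) (f : List Y → R) (a : Y1) (l : List Y1) :
    prism φ ψ f (a :: l) =
      f (φ a :: (a :: l).map ψ) - prism φ ψ (fun m => f (φ a :: m)) l := rfl

theorem D_add (f g : List Y → R) (l : List Y) : D (f + g) l = D f l + D g l := by
  induction l generalizing f g with
  | nil => simp
  | cons a l ih =>
    rw [D_cons, D_cons, D_cons]
    have := ih (fun m => f (a :: m)) (fun m => g (a :: m))
    have e : (fun m => (f + g) (a :: m)) = (fun m => f (a :: m)) + (fun m => g (a :: m)) := rfl
    rw [e, this]; simp only [Pi.add_apply]; ring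

theorem D_smul (c : R) (f : List Y → R) (l : List Y) : D (c • f) l = c * D f l := by
  induction l generalizing f with
  | nil => simp
  | cons a l ih =>
    rw [D_cons, D_cons]
    have := ih (fun m => f (a :: m))
    have e : (fun m => (c • f) (a :: m)) = c • (fun m => f (a :: m)) := rfl
    rw [e, this]; simp only [Pi.smul_apply, smul_eq_mul]; ring

/-- `D` as linear map -/
def DL : (List Y → R) →ₗ[R] (List Y → R) where
  toFun := D
  map_add' f g := funext fun l => D_add f g l
  map_smul' c f := funext fun l => by simp [D_smul]

theorem DL_apply (f : List Y → R) : DL f = D f := rfl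
theorem D_add_fun (f g : List Y → R) : D (f + g) = D f + D g := map_add (DL (R := R)) f g
theorem D_sub_fun (f g : List Y → R) : D (f - g) = D f - D g := map_sub (DL (R := R)) f g
theorem D_neg_fun (f : List Y → R) : D (-f) = - D f := map_neg (DL (R := R)) f
theorem D_smul_fun (c : R) (f : List Y → R) : D (c • f) = c • D f := map_smul (DL (R := R)) c f
theorem D_zero_fun : D (0 : List Y → R) = 0 := map_zero (DL (R := R))
theorem D_sum_fun {ι : Type} (s : Finset ι) (f : ι → List Y → R) :
    D (∑ i ∈ s, f i) = ∑ i ∈ s, D (f i) := map_sum (DL (R := R)) f s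

theorem DD (f : List Y → R) : D (D f) = 0 := by
  funext l
  induction l generalizing f with
  | nil => rfl
  | cons a l ih =>
    rw [D_cons]
    have e : (fun m => D f (a :: m)) = f - D (fun m => f (a :: m)) := by
      funext m; rw [D_cons]; rfl
    rw [e, D_sub_fun, Pi.sub_apply, ih]; simp

theorem D_map (φ : Y1 → Y) (f : List Y → R) (l : List Y1) :
    D (fun m => f (m.map φ)) l = D f (l.map φ) := by
  induction l generalizing f with
  | nil => rfl
  | cons a l ih =>
    rw [D_cons, List.map_cons, D_cons, ← ih]; rfl

theorem D_map_fun (φ : Y1 → Y) (f : List Y → R) :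
    D (fun m => f (m.map φ)) = fun l => D f (l.map φ) := funext (D_map φ f)

theorem cup_map (φ : Y1 → Y) (f g : List Y → R) (l : List Y1) :
    cup (fun m => f (m.map φ)) (fun m => g (m.map φ)) l = cup f g (l.map φ) := by
  induction l generalizing f with
  | nil => rfl
  | cons a l ih =>
    rw [cup_cons, show (a :: l).map φ = φ a :: l.map φ from rfl, cup_cons, ← ih]; rfl

theorem cup_add_left (f f1 g : List Y → R) : cup (f + f1) g = cup f g + cup f1 g := by
  funext l
  induction l generalizing f f1 with
  | nil => simp
  | cons a l ih =>
    have := ih (fun m => f (a :: m)) (fun m => f1 (a :: m))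
    simp only [Pi.add_apply, cup_cons] at this ⊢
    rw [show (fun m => f (a :: m) + f1 (a :: m)) = (fun m => f (a :: m)) + fun m => f1 (a :: m)
      from rfl, this]; ring

theorem cup_smul_left (c : R) (f g : List Y → R) : cup (c • f) g = c • cup f g := by
  funext l
  induction l generalizing f with
  | nil => simp
  | cons a l ih =>
    have := ih (fun m => f (a :: m))
    simp only [Pi.smul_apply, cup_cons, smul_eq_mul] at this ⊢
    rw [show (fun m => c * f (a :: m)) = c • (fun m => f (a :: m)) from rfl, this]; ring

theorem cup_add_right (f g g1 : List Y → R) : cup f (g + g1) = cup f g + cup f g1 := by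
  funext l
  induction l generalizing f with
  | nil => simp
  | cons a l ih =>
    have := ih (fun m => f (a :: m))
    simp only [Pi.add_apply, cup_cons] at this ⊢
    rw [this]; ring

theorem cup_smul_right (c : R) (f g : List Y → R) : cup f (c • g) = c • cup f g := by
  funext l
  induction l generalizing f with
  | nil => simp
  | cons a l ih =>
    have := ih (fun m => f (a :: m))
    simp only [Pi.smul_apply, cup_cons, smul_eq_mul] at this ⊢
    rw [this]; ring

/-- bilinear cup -/
def cupL : (List Y → R) →ₗ[R] (List Y → R) →ₗ[R] (List Y → R) :=
  LinearMap.mk₂ R cup cup_add_left cup_smul_left cup_add_right cup_smul_right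

theorem cup_sub_left (f f1 g : List Y → R) : cup (f - f1) g = cup f g - cup f1 g :=
  LinearMap.map_sub₂ cupL f f1 g
theorem cup_sub_right (f g g1 : List Y → R) : cup f (g - g1) = cup f g - cup f g1 :=
  map_sub (cupL f) g g1
theorem cup_zero_left (g : List Y → R) : cup 0 g = 0 := LinearMap.map_zero₂ cupL g
theorem cup_zero_right (f : List Y → R) : cup f 0 = 0 := map_zero (cupL f)
theorem cup_neg_left (f g : List Y → R) : cup (-f) g = - cup f g := LinearMap.map_neg₂ cupL f g

theorem cup_assoc (f g h : List Y → R) : cup (cup f g) h = cup f (cup g h) := by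
  funext l
  induction l generalizing f g with
  | nil => rfl
  | cons a l ih =>
    rw [cup_cons, cup_cons, cup_cons]
    have e : (fun m => cup f g (a :: m)) =
        f [a] • (fun m => g (a :: m)) + cup (fun m => f (a :: m)) g := by
      funext m; rw [cup_cons]; rfl
    rw [e, cup_add_left, cup_smul_left, Pi.add_apply, ih, cup_cons g h]
    simp only [Pi.smul_apply, smul_eq_mul, cup_nil]; ring

theorem leibniz (f g : List Y → R) (l : List Y) (hg : g [] = 0) :
    D (cup f g) l = cup (D f) g l + cup (sg f) (D g) l - f [] * g l := by
  induction l generalizing f with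
  | nil => simp [hg]
  | cons a l ih =>
    rw [D_cons]
    have e : (fun m => cup f g (a :: m)) =
        f [a] • (fun m => g (a :: m)) + cup (fun m => f (a :: m)) g := by
      funext m; rw [cup_cons]; rfl
    rw [e, D_add, D_smul, ih, cup_cons (D f), cup_cons (sg f), D_cons f, D_cons g]
    have e2 : (fun m => D f (a :: m)) = f - D (fun m => f (a :: m)) := by
      funext m; rw [D_cons]; rfl
    have e3 : (fun m => sg f (a :: m)) = - sg (fun m => f (a :: m)) := by
      funext m; simp [sg, pow_succ]
    rw [e2, e3, cup_sub_left, cup_neg_left]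
    simp only [Pi.sub_apply, Pi.neg_apply, D_nil, sg]
    simp; ring

theorem leibniz_fun (f g : List Y → R) (hf : f [] = 0) (hg : g [] = 0) :
    D (cup f g) = cup (D f) g + cup (sg f) (D g) := by
  funext l; rw [leibniz f g l hg, hf]; simp

theorem prism_eq (φ ψ : Y1 → Y) (f : List Y → R) (l : List Y1) (hl : l ≠ []) :
    D (prism φ ψ f) l + prism φ ψ (D f) l = f (l.map ψ) - f (l.map φ) := by
  induction l generalizing f with
  | nil => exact absurd rfl hl
  | cons a l ih =>
    rw [D_cons, prism_cons]
    have e : (fun m => prism φ ψ f (a :: m)) =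
        (fun m => (fun q => f (φ a :: ψ a :: q)) (m.map ψ)) -
          prism φ ψ (fun m => f (φ a :: m)) := by
      funext m; rw [prism_cons]; rfl
    rw [e, D_sub_fun, Pi.sub_apply, D_map ψ (fun q => f (φ a :: ψ a :: q)) l]
    have e2 : (fun m => D f (φ a :: m)) = f - D (fun m => f (φ a :: m)) := by
      funext m; rw [D_cons]; rfl
    have e3 : ∀ (u v : List Y → R) (m : List Y1), prism φ ψ (u - v) m
        = prism φ ψ u m - prism φ ψ v m := by
      intro u v m
      induction m generalizing u v with
      | nil => simp
      | cons b m ih2 =>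
        rw [prism_cons, prism_cons, prism_cons]
        rw [show (fun q => (u - v) (φ b :: q)) = (fun q => u (φ b :: q)) - (fun q => v (φ b :: q))
          from rfl, ih2]
        simp only [Pi.sub_apply]; ring
    rw [e2, e3, List.map_cons, D_cons, D_cons]
    by_cases h : l = []
    · subst h
      simp [prism]
    · have := ih (fun m => f (φ a :: m)) h
      simp only [List.map_cons] at this ⊢
      linear_combination this

/-- length-n support of `D` -/
theorem D_len (f : List Y → R) (n : ℕ) (hf : ∀ l, l.length = n → f l = 0) (l : List Y)
    (hl : l.length = n + 1) : D f l = 0 := by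
  induction l generalizing f n with
  | nil => simp at hl
  | cons a l ih =>
    have hl' : l.length = n := by simpa using hl
    rw [D_cons, hf l hl']
    cases n with
    | zero =>
      have : l = [] := List.length_eq_zero_iff.1 hl'
      subst this; simp
    | succ n => rw [ih (fun m => f (a :: m)) n (fun m hm => hf _ (by simp [hm])) hl']; simp

theorem D_local (f : List Y → R) (S : Set Y) (n : ℕ)
    (hf : ∀ l, l.length = n → (∀ x ∈ l, x ∈ S) → f l = 0) (l : List Y)
    (hl : l.length = n + 1) (hS : ∀ x ∈ l, x ∈ S) : D f l = 0 := by
  induction l generalizing f n with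
  | nil => simp at hl
  | cons a l ih =>
    have hl' : l.length = n := by simpa using hl
    rw [D_cons, hf l hl' (fun x hx => hS x (by simp [hx]))]
    cases n with
    | zero =>
      have : l = [] := List.length_eq_zero_iff.1 hl'
      subst this; simp
    | succ n =>
      rw [ih (fun m => f (a :: m)) n (fun m hm hm2 => hf _ (by simp [hm]) ?_) hl'
        (fun x hx => hS x (by simp [hx]))]
      · simp
      · intro x hx
        rcases List.mem_cons.1 hx with rfl | hx
        · exact hS _ (by simp)
        · exact hm2 x hx

theorem cup_eq_sum_zero (f g : List Y → R) (l : List Y)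
    (h : ∀ l1 a l2, l = l1 ++ a :: l2 → f (l1 ++ [a]) * g (a :: l2) = 0) : cup f g l = 0 := by
  induction l generalizing f with
  | nil => rfl
  | cons a l ih =>
    rw [cup_cons, ih]
    · have := h [] a l rfl
      simp at this; simp [this]
    · intro l1 b l2 e
      exact h (a :: l1) b l2 (by simp [e])

theorem prism_local (φ ψ : Y1 → Y) (f : List Y → R) (S : Set Y1) (O : Set Y) (n : ℕ)
    (hφ : ∀ x ∈ S, φ x ∈ O) (hψ : ∀ x ∈ S, ψ x ∈ O)
    (hf : ∀ l, l.length = n + 1 → (∀ x ∈ l, x ∈ O) → f l = 0) (l : List Y1)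
    (hl : l.length = n) (hS : ∀ x ∈ l, x ∈ S) : prism φ ψ f l = 0 := by
  induction l generalizing f n with
  | nil => rfl
  | cons a l ih =>
    obtain ⟨m, rfl⟩ : ∃ m, n = m + 1 := ⟨l.length, by simpa using hl.symm⟩
    rw [prism_cons, hf, ih (fun m => f (φ a :: m)) m]
    · simp
    · intro q hq hq2
      apply hf _ (by simp [hq])
      intro x hx
      rcases List.mem_cons.1 hx with rfl | hx
      · exact hφ _ (hS _ (by simp))
      · exact hq2 x hx
    · simpa using hl
    · exact fun x hx => hS x (by simp [hx])
    · simp at hl ⊢; omega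
    · intro x hx
      rcases List.mem_cons.1 hx with rfl | hx
      · exact hφ _ (hS _ (by simp))
      · obtain ⟨b, hb, rfl⟩ := List.mem_map.1 hx
        exact hψ _ (hS _ hb)

theorem prism_map {Y2 Y3 : Type} (φ ψ : Y1 → Y) (u : Y2 → Y1) (v : Y3 → Y) (φ1 ψ1 : Y2 → Y3)
    (h1 : ∀ x, φ (u x) = v (φ1 x)) (h2 : ∀ x, ψ (u x) = v (ψ1 x)) (f : List Y → R)
    (l : List Y2) :
    prism φ ψ f (l.map u) = prism φ1 ψ1 (fun m => f (m.map v)) l := by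
  induction l generalizing f with
  | nil => rfl
  | cons a l ih =>
    rw [List.map_cons, prism_cons, prism_cons, ih]
    simp [h1, h2, Function.comp_def]

end Alg
end Volo

namespace Volo
open scoped Topology

/-- isometric action of a finite abelian group -/
class GSp (Γ : Type) (X : Type) [AddCommGroup Γ] [MetricSpace X] where
  act : Γ → X → X
  act_zero : ∀ x, act 0 x = x
  act_add : ∀ a b x, act (a + b) x = act a (act b x)
  act_dist : ∀ a x y, dist (act a x) (act a y) = dist x y

open GSp

section Basic
variable {Γ X X1 R : Type} [AddCommGroup Γ] [MetricSpace X] [MetricSpace X1] [GSp Γ X] [GSp Γ X1]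
  [CommRing R]

theorem act_neg (γ : Γ) (x : X) : act (-γ) (act γ x) = x := by
  rw [← act_add]; simp [act_zero]
theorem act_neg' (γ : Γ) (x : X) : act γ (act (-γ) x) = x := by
  rw [← act_add]; simp [act_zero]
theorem act_inj (γ : Γ) {x y : X} (h : act γ x = act γ y) : x = y := by
  rw [← act_neg γ x, h, act_neg]
theorem act_cont (γ : Γ) : Continuous (act γ : X → X) :=
  (Isometry.of_dist_eq (act_dist γ)).continuous

/-- equivariant -/
def Eqv (Γ : Type) {X X1 : Type} [AddCommGroup Γ] [MetricSpace X] [MetricSpace X1] [GSp Γ X]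
  [GSp Γ X1] (φ : X1 → X) : Prop := ∀ (γ : Γ) x, φ (act γ x) = act γ (φ x)

/-- invariant set -/
def InvS (Γ : Type) {X : Type} [AddCommGroup Γ] [MetricSpace X] [GSp Γ X] (S : Set X) : Prop :=
  ∀ (γ : Γ) x, x ∈ S → act γ x ∈ S

/-- uniform stabilizers -/
def Unif (Γ X : Type) [AddCommGroup Γ] [MetricSpace X] [GSp Γ X] : Prop :=
  ∀ (γ : Γ) (x y : X), act γ x = x → act γ y = y

/-- invariant cochains -/
def Coch (Γ X R : Type) [AddCommGroup Γ] [MetricSpace X] [GSp Γ X] [CommRing R] :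
    Submodule R (List X → R) where
  carrier := {f | f [] = 0 ∧ ∀ (γ : Γ) l, f (l.map (act γ)) = f l}
  add_mem' := by
    rintro f g ⟨h1, h2⟩ ⟨h3, h4⟩
    exact ⟨by simp [h1, h3], fun γ l => by simp [h2, h4]⟩
  zero_mem' := ⟨rfl, fun _ _ => rfl⟩
  smul_mem' := by
    rintro c f ⟨h1, h2⟩
    exact ⟨by simp [h1], fun γ l => by simp [h2]⟩

/-- pull-back -/
def pb (φ : X1 → X) : (List X → R) →ₗ[R] (List X1 → R) where
  toFun f := fun l => f (l.map φ)
  map_add' _ _ := rfl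
  map_smul' _ _ := rfl

theorem pb_apply (φ : X1 → X) (f : List X → R) (l : List X1) : pb φ f l = f (l.map φ) := rfl
theorem pb_D (φ : X1 → X) (f : List X → R) : pb φ (D f) = D (pb φ f) := (D_map_fun φ f).symm
theorem pb_cup (φ : X1 → X) (f g : List X → R) : pb φ (cup f g) = cup (pb φ f) (pb φ g) :=
  (funext (cup_map φ f g)).symm
theorem pb_sg (φ : X1 → X) (f : List X → R) : pb φ (sg f) = sg (pb φ f) := by
  funext l; simp [pb_apply, sg]
theorem pb_pb {X2 : Type} (φ : X1 → X) (ψ : X2 → X1) (f : List X → R) :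
    pb ψ (pb φ f) = pb (φ ∘ ψ) f := by
  funext l; simp [pb_apply]

theorem Coch.nil {f : List X → R} (h : f ∈ Coch Γ X R) : f [] = 0 := h.1

theorem Coch.pb {f : List X → R} (h : f ∈ Coch Γ X R) {φ : X1 → X} (hφ : Eqv Γ φ) :
    pb φ f ∈ Coch Γ X1 R := by
  refine ⟨h.1, fun γ l => ?_⟩
  rw [pb_apply, pb_apply, ← h.2 γ (l.map φ), List.map_map, List.map_map]
  congr 2; funext x; exact hφ γ x

theorem mem_Coch_iff {f : List X → R} : f ∈ Coch Γ X R ↔ f [] = 0 ∧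
    ∀ γ : Γ, pb (act γ) f = f :=
  ⟨fun h => ⟨h.1, fun γ => funext (h.2 γ)⟩, fun h => ⟨h.1, fun γ l => congrFun (h.2 γ) l⟩⟩

theorem Coch.D {f : List X → R} (h : f ∈ Coch Γ X R) : D f ∈ Coch Γ X R := by
  rw [mem_Coch_iff] at h ⊢
  exact ⟨rfl, fun γ => by rw [pb_D, h.2]⟩
theorem Coch.cup {f g : List X → R} (h : f ∈ Coch Γ X R) (hg : g ∈ Coch Γ X R) :
    cup f g ∈ Coch Γ X R := by
  rw [mem_Coch_iff] at h hg ⊢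
  exact ⟨rfl, fun γ => by rw [pb_cup, h.2, hg.2]⟩
theorem Coch.sg {f : List X → R} (h : f ∈ Coch Γ X R) : sg f ∈ Coch Γ X R := by
  rw [mem_Coch_iff] at h ⊢
  exact ⟨by simp [Volo.sg, h.1], fun γ => by rw [pb_sg, h.2]⟩

theorem Coch.prism {f : List X → R} (h : f ∈ Coch Γ X R) {φ ψ : X1 → X} (hφ : Eqv Γ φ)
    (hψ : Eqv Γ ψ) : prism φ ψ f ∈ Coch Γ X1 R := by
  refine ⟨rfl, fun γ l => ?_⟩
  rw [prism_map φ ψ (act γ) (act γ) φ ψ (hφ γ) (hψ γ)]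
  congr 1; exact (mem_Coch_iff.1 h).2 γ

/-- restriction by an invariant condition -/
theorem Coch.cond {f : List X → R} (h : f ∈ Coch Γ X R) (P : List X → Prop)
    [DecidablePred P] (hP : ∀ (γ : Γ) l, P (l.map (act γ)) ↔ P l) :
    (fun l => if P l then f l else 0) ∈ Coch Γ X R := by
  refine ⟨by simp [h.1], fun γ l => ?_⟩
  simp [hP, h.2]

/-- germ zero at level n -/
def G0 (n : ℕ) (f : List X → R) (x : X) : Prop :=
  ∃ U ∈ 𝓝 x, ∀ l : List X, l.length = n → (∀ a ∈ l, a ∈ U) → f l = 0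

theorem G0_zero (n : ℕ) (x : X) : G0 n (0 : List X → R) x := ⟨univ, Filter.univ_mem, by simp⟩
theorem G0.add {n : ℕ} {f g : List X → R} {x : X} (hf : G0 n f x) (hg : G0 n g x) :
    G0 n (f + g) x := by
  obtain ⟨U, hU, h⟩ := hf
  obtain ⟨V, hV, h'⟩ := hg
  refine ⟨U ∩ V, Filter.inter_mem hU hV, fun l hl ha => ?_⟩
  simp [h l hl (fun a q => (ha a q).1), h' l hl (fun a q => (ha a q).2)]
theorem G0.smul {n : ℕ} {f : List X → R} {x : X} (c : R) (hf : G0 n f x) : G0 n (c • f) x := by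
  obtain ⟨U, hU, h⟩ := hf
  exact ⟨U, hU, fun l hl ha => by simp [h l hl ha]⟩
theorem G0.neg {n : ℕ} {f : List X → R} {x : X} (hf : G0 n f x) : G0 n (-f) x := by
  obtain ⟨U, hU, h⟩ := hf
  exact ⟨U, hU, fun l hl ha => by simp [h l hl ha]⟩
theorem G0.sub {n : ℕ} {f g : List X → R} {x : X} (hf : G0 n f x) (hg : G0 n g x) :
    G0 n (f - g) x := by rw [sub_eq_add_neg]; exact hf.add hg.neg
theorem G0.sum {ι : Type} {n : ℕ} (s : Finset ι) {f : ι → List X → R} {x : X}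
    (hf : ∀ i ∈ s, G0 n (f i) x) : G0 n (∑ i ∈ s, f i) x := by
  classical
  induction s using Finset.induction_on with
  | empty => exact G0_zero n x
  | insert a s ha ih =>
    rw [Finset.sum_insert ha]
    exact (hf a (by simp)).add (ih fun i hi => hf i (by simp [hi]))
theorem G0.sg {n : ℕ} {f : List X → R} {x : X} (hf : G0 n f x) : G0 n (sg f) x := by
  obtain ⟨U, hU, h⟩ := hf
  exact ⟨U, hU, fun l hl ha => by simp [Volo.sg, h l hl ha]⟩
theorem G0.D {n : ℕ} {f : List X → R} {x : X} (hf : G0 n f x) : G0 (n + 1) (D f) x := by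
  obtain ⟨U, hU, h⟩ := hf
  exact ⟨U, hU, fun l hl ha => D_local f U n h l hl ha⟩
theorem G0_lvl0 {f : List X → R} (hf : f [] = 0) (x : X) : G0 0 f x :=
  ⟨univ, Filter.univ_mem, fun l hl _ => by rw [List.length_eq_zero_iff.1 hl, hf]⟩
theorem G0.pb {n : ℕ} {f : List X → R} {φ : X1 → X} {x : X1} (hf : G0 n f (φ x))
    (hφ : ContinuousAt φ x) : G0 n (pb φ f) x := by
  obtain ⟨U, hU, h⟩ := hf
  refine ⟨φ ⁻¹' U, hφ hU, fun l hl ha => h _ (by simpa using hl) ?_⟩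
  intro a q
  obtain ⟨b, hb, rfl⟩ := List.mem_map.1 q
  exact ha b hb
theorem G0_open (n : ℕ) (f : List X → R) : IsOpen {x | G0 n f x} := by
  rw [isOpen_iff_mem_nhds]
  rintro x ⟨U, hU, h⟩
  obtain ⟨V, hVU, hV, hx⟩ := mem_nhds_iff.1 hU
  exact mem_nhds_iff.2 ⟨V, fun y hy => ⟨U, mem_nhds_iff.2 ⟨V, hVU, hV, hy⟩, h⟩, hV, hx⟩
theorem G0.act {n : ℕ} {f : List X → R} (hf : f ∈ Coch Γ X R) {x : X} (γ : Γ) (h : G0 n f x) :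
    G0 n f (GSp.act γ x) := by
  rw [← (mem_Coch_iff.1 hf).2 (-γ)]
  refine G0.pb ?_ (act_cont _).continuousAt
  rwa [act_neg]
/-- total germ zero -/
def Z0 (f : List X → R) (x : X) : Prop := ∀ n, G0 n f x

theorem Z0.cup_left {f g : List X → R} {x : X} (h : Z0 f x) : Z0 (cup f g) x := by
  intro n
  choose U hU h using h
  refine ⟨⋂ i ∈ Finset.range (n + 1), U i, (Filter.biInter_finset_mem _).2 fun i _ => hU i,
    fun l hl ha => cup_eq_sum_zero f g l ?_⟩
  rintro l1 a l2 rfl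
  rw [h (l1.length + 1) (l1 ++ [a]) (by simp), zero_mul]
  intro b hb
  refine mem_iInter₂.1 (ha b ?_) _ ?_
  · simp at hb ⊢; tauto
  · simp at hl ⊢; omega
theorem Z0.cup_right {f g : List X → R} {x : X} (h : Z0 g x) : Z0 (cup f g) x := by
  intro n
  choose U hU h using h
  refine ⟨⋂ i ∈ Finset.range (n + 1), U i, (Filter.biInter_finset_mem _).2 fun i _ => hU i,
    fun l hl ha => cup_eq_sum_zero f g l ?_⟩
  rintro l1 a l2 rfl
  rw [h (l2.length + 1) (a :: l2) (by simp), mul_zero]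
  intro b hb
  refine mem_iInter₂.1 (ha b ?_) _ ?_
  · simp at hb ⊢; tauto
  · simp at hl ⊢; omega

/-- level support -/
def Lv (n : ℕ) (f : List X → R) : Prop := ∀ l : List X, l.length ≠ n → f l = 0

theorem G0.cup_lv {n m : ℕ} {f g : List X → R} {x : X} (h : G0 n f x) (hg : Lv (m + 1) g) :
    G0 (n + m) (cup f g) x := by
  obtain ⟨U, hU, h⟩ := h
  refine ⟨U, hU, fun l hl ha => cup_eq_sum_zero f g l ?_⟩
  rintro l1 a l2 rfl
  by_cases h2 : l2.length = m
  · rw [h, zero_mul]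
    · simp at hl ⊢; omega
    · intro b hb
      apply ha; simp at hb ⊢; tauto
  · rw [hg, mul_zero]
    simpa using h2

theorem Z0.zero (x : X) : Z0 (0 : List X → R) x := fun n => G0_zero n x
theorem Z0.add {f g : List X → R} {x : X} (hf : Z0 f x) (hg : Z0 g x) : Z0 (f + g) x :=
  fun n => (hf n).add (hg n)
theorem Z0.sub {f g : List X → R} {x : X} (hf : Z0 f x) (hg : Z0 g x) : Z0 (f - g) x :=
  fun n => (hf n).sub (hg n)
theorem Z0.neg {f : List X → R} {x : X} (hf : Z0 f x) : Z0 (-f) x := fun n => (hf n).neg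
theorem Z0.smul {f : List X → R} {x : X} (c : R) (hf : Z0 f x) : Z0 (c • f) x :=
  fun n => (hf n).smul c
theorem Z0.sg {f : List X → R} {x : X} (hf : Z0 f x) : Z0 (sg f) x := fun n => (hf n).sg
theorem Z0.D {f : List X → R} {x : X} (hf : Z0 f x) : Z0 (D f) x := by
  intro n
  cases n with
  | zero => exact G0_lvl0 rfl x
  | succ n => exact (hf n).D
theorem Z0.pb {f : List X → R} {φ : X1 → X} {x : X1} (hf : Z0 f (φ x))
    (hφ : ContinuousAt φ x) : Z0 (pb φ f) x := fun n => (hf n).pb hφ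

theorem G0.congr {n : ℕ} {f g : List X → R} {x : X} (h : G0 n f x) (hfg : f = g) : G0 n g x :=
  hfg ▸ h
theorem Z0.congr {f g : List X → R} {x : X} (h : Z0 f x) (hfg : f = g) : Z0 g x :=
  hfg ▸ h

/-- local homotopy by prisms -/
theorem prism_germ {n : ℕ} {f : List X → R} {φ ψ : X1 → X} {x : X1} {O : Set X}
    (hO : ∀ l : List X, l.length = n + 2 → (∀ a ∈ l, a ∈ O) → D f l = 0)
    (hφ : ∀ᶠ y in 𝓝 x, φ y ∈ O) (hψ : ∀ᶠ y in 𝓝 x, ψ y ∈ O) :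
    G0 (n + 1) (pb ψ f - pb φ f - D (prism φ ψ f)) x := by
  refine ⟨_, hφ.and hψ, fun l hl ha => ?_⟩
  have h1 := prism_eq φ ψ f l (by rintro rfl; simp at hl)
  have h2 := prism_local φ ψ (D f) {y | φ y ∈ O ∧ ψ y ∈ O} O (n + 1) (fun x h => h.1)
    (fun x h => h.2) hO l hl ha
  simp only [Pi.sub_apply, pb_apply]
  rw [← h1, h2]; ring

theorem prism_germ' {n : ℕ} {f : List X → R} {φ ψ : X1 → X} {x : X1}
    (hO : G0 (n + 2) (D f) (φ x)) (hφ : ContinuousAt φ x) (hψ : ContinuousAt ψ x)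
    (he : φ x = ψ x) : G0 (n + 1) (pb ψ f - pb φ f - D (prism φ ψ f)) x := by
  obtain ⟨U, hU, h⟩ := hO
  exact prism_germ h (hφ hU) (hψ (he ▸ hU))

end Basic
end Volo

namespace Volo
open scoped Topology
open GSp

section Glob
variable {Γ X X1 R : Type} [AddCommGroup Γ] [Finite Γ] [MetricSpace X] [MetricSpace X1] [GSp Γ X]
  [GSp Γ X1] [CommRing R]

theorem infEDist_act (γ : Γ) (x : X) (A : Set X) (hA : InvS Γ A) :
    Metric.infEDist (act γ x) A = Metric.infEDist x A := by
  have key : ∀ (γ : Γ) (x : X), Metric.infEDist (act γ x) A ≤ Metric.infEDist x A := by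
    intro γ x
    refine le_iInf₂ fun y hy => ?_
    refine (Metric.infEDist_le_edist_of_mem (hA γ y hy)).trans ?_
    rw [edist_dist, edist_dist, act_dist]
  refine le_antisymm (key γ x) ?_
  have := key (-γ) (act γ x)
  rwa [act_neg] at this

theorem exists_sep {B C O : Set X} (hB : IsClosed B) (hC : IsClosed C) (hO : IsOpen O)
    (iB : InvS Γ B) (iC : InvS Γ C) (iO : InvS Γ O) (h : B ∩ C ⊆ O) :
    ∃ S : Set X, InvS Γ S ∧ B \ O ⊆ interior S ∧ C \ O ⊆ interior Sᶜ := by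
  have iO' : ∀ (γ : Γ) x, x ∉ O → act γ x ∉ O := fun γ x hx hn => hx (by
    have := iO (-γ) _ hn; rwa [act_neg] at this)
  have iB' : InvS Γ (B \ O) := fun γ x hx => ⟨iB γ x hx.1, iO' γ x hx.2⟩
  have iC' : InvS Γ (C \ O) := fun γ x hx => ⟨iC γ x hx.1, iO' γ x hx.2⟩
  have cB : IsClosed (B \ O) := hB.sdiff hO
  have cC : IsClosed (C \ O) := hC.sdiff hO
  have c1 : Continuous fun x : X => Metric.infEDist x (B \ O) := Metric.continuous_infEDist
  have c2 : Continuous fun x : X => Metric.infEDist x (C \ O) := Metric.continuous_infEDist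
  refine ⟨{x | Metric.infEDist x (B \ O) < Metric.infEDist x (C \ O)}, ?_, ?_, ?_⟩
  · intro γ x hx
    simp only [mem_ofPred_eq] at hx ⊢
    rwa [infEDist_act γ x _ iB', infEDist_act γ x _ iC']
  · intro x hx
    rw [(isOpen_lt c1 c2).interior_eq]
    simp only [mem_ofPred_eq]
    rw [Metric.infEDist_zero_of_mem hx, pos_iff_ne_zero]
    intro h0
    have : x ∈ C \ O := by
      rw [← cC.closure_eq]; exact Metric.mem_closure_iff_infEDist_zero.2 h0
    exact hx.2 (h ⟨hx.1, this.1⟩)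
  · intro x hx
    refine interior_mono (s := {x | Metric.infEDist x (C \ O) < Metric.infEDist x (B \ O)}) ?_ ?_
    · intro y hy hy2
      simp only [mem_ofPred_eq] at hy hy2
      exact lt_asymm hy hy2
    rw [(isOpen_lt c2 c1).interior_eq]
    simp only [mem_ofPred_eq]
    rw [Metric.infEDist_zero_of_mem hx, pos_iff_ne_zero]
    intro h0
    have : x ∈ B \ O := by
      rw [← cB.closure_eq]; exact Metric.mem_closure_iff_infEDist_zero.2 h0
    exact hx.2 (h ⟨this.1, hx.1⟩)

/-- closed invariant neighbourhoods -/
theorem exists_closed_nhd {O : Set X} (hO : IsOpen O) (iO : InvS Γ O) (x : X) (hx : x ∈ O) :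
    ∃ C : Set X, IsClosed C ∧ InvS Γ C ∧ C ∈ 𝓝 x ∧ C ⊆ O := by
  obtain ⟨ε, he, hb⟩ := Metric.nhds_basis_closedBall.mem_iff.1 (hO.mem_nhds hx)
  refine ⟨⋃ γ : Γ, Metric.closedBall (act γ x) ε, isClosed_iUnion_of_finite
    fun γ => Metric.isClosed_closedBall, ?_, ?_, ?_⟩
  · intro γ y hy
    obtain ⟨δ, hδ⟩ := mem_iUnion.1 hy
    refine mem_iUnion.2 ⟨γ + δ, ?_⟩
    rw [Metric.mem_closedBall, act_add, act_dist]; exact hδ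
  · refine Filter.mem_of_superset (Metric.closedBall_mem_nhds x he) fun y hy => ?_
    exact mem_iUnion.2 ⟨0, by rwa [act_zero]⟩
  · intro y hy
    obtain ⟨δ, hδ⟩ := mem_iUnion.1 hy
    have : act (-δ) y ∈ O := hb (by
      rw [Metric.mem_closedBall] at hδ ⊢
      rwa [← act_neg δ x, act_dist])
    have := iO δ _ this
    rwa [act_neg'] at this

/-- Local to global principle. -/
theorem local_global [CompactSpace X] {M : Type} [AddCommGroup M] (d : M →+ M)
    (N : ℕ → M → X → Prop)
    (h0 : ∀ m y, N 0 m y)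
    (hadd : ∀ n m m' y, N n m y → N n m' y → N n (m + m') y)
    (hneg : ∀ n m y, N n m y → N n (-m) y)
    (hd : ∀ n m y, N n m y → N (n + 1) (d m) y)
    (hdd : ∀ n m y, N n (d (d m)) y)
    (hop : ∀ n m, IsOpen {y | N n m y})
    (hinv : ∀ n m (γ : Γ) y, N n m y → N n m (act γ y))
    (hsplit : ∀ S : Set X, InvS Γ S → ∀ m, ∃ m1 m2, m = m1 + m2 ∧
      (∀ n, ∀ y ∈ interior S, N n m1 y) ∧ (∀ n, ∀ y ∈ interior Sᶜ, N n m2 y) ∧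
      (∀ n y, N n m y → N n m1 y ∧ N n m2 y))
    (hloc : ∀ n m y, N (n + 1) (d m) y → ∃ m', N n (m - d m') y) :
    ∀ n (B : Set X), IsClosed B → InvS Γ B → ∀ m, (∀ y ∈ B, N (n + 1) (d m) y) →
      ∃ m', ∀ y ∈ B, N n (m - d m') y := by
  have hsub : ∀ n m m' y, N n m y → N n m' y → N n (m - m') y := fun n m m' y h h' => by
    rw [sub_eq_add_neg]; exact hadd _ _ _ _ h (hneg _ _ _ h')
  intro n
  induction n with
  | zero => exact fun B _ _ m _ => ⟨0, fun y _ => h0 _ _⟩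
  | succ n ih =>
    intro B hB iB m hm
    have glue : ∀ B1 B2 : Set X, IsClosed B1 → InvS Γ B1 → IsClosed B2 → InvS Γ B2 →
        (∃ m', ∀ y ∈ B1, N (n + 1) (m - d m') y) → (∃ m', ∀ y ∈ B2, N (n + 1) (m - d m') y) →
        ∃ m', ∀ y ∈ B1 ∪ B2, N (n + 1) (m - d m') y := by
      rintro B1 B2 hB1 iB1 hB2 iB2 ⟨m1, h1⟩ ⟨m2, h2⟩
      obtain ⟨e, he⟩ := ih (B1 ∩ B2) (hB1.inter hB2) (fun γ x hx => ⟨iB1 γ x hx.1, iB2 γ x hx.2⟩)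
        (m2 - m1) (fun y hy => by
          have := hsub _ _ _ _ (h1 y hy.1) (h2 y hy.2)
          convert this using 1
          rw [map_sub]; abel)
      obtain ⟨S, iS, hS1, hS2⟩ := exists_sep (Γ := Γ) hB1 hB2 (hop n (m2 - m1 - d e)) iB1 iB2
        (fun γ x hx => hinv _ _ γ x hx) he
      obtain ⟨q1, q2, hq, a1, a2, a3⟩ := hsplit S iS (m2 - m1 - d e)
      have b1 : ∀ y ∈ B1, N n q1 y := fun y hy => by
        by_cases hO : N n (m2 - m1 - d e) y
        · exact (a3 n y hO).1
        · exact a1 n y (hS1 ⟨hy, hO⟩)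
      have b2 : ∀ y ∈ B2, N n q2 y := fun y hy => by
        by_cases hO : N n (m2 - m1 - d e) y
        · exact (a3 n y hO).2
        · exact a2 n y (hS2 ⟨hy, hO⟩)
      refine ⟨m1 + q1, ?_⟩
      rintro y (hy | hy)
      · have := hsub _ _ _ _ (h1 y hy) (hd _ _ _ (b1 y hy))
        convert this using 1
        rw [map_add]; abel
      · have e1 : m1 + q1 = m2 - d e - q2 := by
          have : q1 = m2 - m1 - d e - q2 := by rw [hq]; abel
          rw [this]; abel
        rw [e1]
        have := hadd _ _ _ _ (hadd _ _ _ _ (h2 y hy) (hdd (n + 1) e y)) (hd _ _ _ (b2 y hy))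
        convert this using 1
        rw [map_sub, map_sub]; abel
    have := hB.isCompact.induction_on (p := fun S => ∃ C, IsClosed C ∧ InvS Γ C ∧ S ⊆ C ∧
      ∃ m', ∀ y ∈ C ∩ B, N (n + 1) (m - d m') y)
      ⟨∅, isClosed_empty, fun _ _ h => h.elim, le_rfl, 0, by simp⟩
      (fun S T hST ⟨C, h1, h2, h3, h4⟩ => ⟨C, h1, h2, hST.trans h3, h4⟩)
      (by
        rintro S T ⟨C, h1, h2, h3, h4⟩ ⟨C', h1', h2', h3', h4'⟩
        refine ⟨C ∪ C', h1.union h1', ?_, union_subset_union h3 h3', ?_⟩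
        · rintro γ x (hx | hx)
          · exact Or.inl (h2 γ x hx)
          · exact Or.inr (h2' γ x hx)
        · rw [union_inter_distrib_right]
          exact glue _ _ (h1.inter hB) (fun γ x hx => ⟨h2 γ x hx.1, iB γ x hx.2⟩)
            (h1'.inter hB) (fun γ x hx => ⟨h2' γ x hx.1, iB γ x hx.2⟩) h4 h4')
      (by
        intro x hx
        obtain ⟨m', hm'⟩ := hloc _ _ _ (hm x hx)
        obtain ⟨C, c1, c2, c3, c4⟩ := exists_closed_nhd (Γ := Γ) (hop (n + 1) (m - d m'))
          (fun γ x hx => hinv _ _ γ x hx) x hm'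
        exact ⟨C, mem_nhdsWithin_of_mem_nhds c3, C, c1, c2, le_rfl, m', fun y hy => c4 hy.1⟩)
    obtain ⟨C, _, _, hC, m', hm'⟩ := this
    exact ⟨m', fun y hy => hm' y ⟨hC hy, hy⟩⟩

open Classical in
/-- multiplication by an indicator function of the head -/
noncomputable def headS (S : Set X) : (List X → R) →ₗ[R] (List X → R) where
  toFun f := fun l => if (∃ a ∈ l.head?, a ∈ S) then f l else 0
  map_add' f g := by funext l; simp only [Pi.add_apply]; split_ifs <;> simp
  map_smul' c f := by funext l; simp only [Pi.smul_apply, RingHom.id_apply]; split_ifs <;> simp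

theorem Coch.headS {S : Set X} (hS : InvS Γ S) {f : List X → R} (hf : f ∈ Coch Γ X R) :
    headS S f ∈ Coch Γ X R := by
  classical
  refine Coch.cond hf _ fun γ l => ?_
  cases l with
  | nil => simp
  | cons a l =>
    simp only [List.map_cons, List.head?_cons, Option.mem_def, Option.some.injEq, exists_eq_left']
    exact ⟨fun h => by have := hS (-γ) _ h; rwa [act_neg] at this, hS γ a⟩

theorem headS_G0 {S : Set X} {n : ℕ} {f : List X → R} {x : X} (h : G0 n f x) :
    G0 n (headS S f) x := by
  obtain ⟨U, hU, h⟩ := h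
  refine ⟨U, hU, fun l hl ha => ?_⟩
  simp only [headS, LinearMap.coe_mk, AddHom.coe_mk]
  rw [h l hl ha]; simp

theorem headS_out {S : Set X} {n : ℕ} {f : List X → R} {x : X} (h : x ∈ interior Sᶜ) :
    G0 n (headS S f) x := by
  refine ⟨Sᶜ, mem_interior_iff_mem_nhds.1 h, fun l hl ha => ?_⟩
  simp only [headS, LinearMap.coe_mk, AddHom.coe_mk]
  rw [if_neg]
  rintro ⟨a, h1, h2⟩
  exact ha a (List.mem_of_mem_head? h1) h2

theorem headS_in {S : Set X} {n : ℕ} {f : List X → R} (hf : f [] = 0) {x : X}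
    (h : x ∈ interior S) :
    G0 n (f - headS S f) x := by
  refine ⟨S, mem_interior_iff_mem_nhds.1 h, fun l hl ha => ?_⟩
  simp only [headS, LinearMap.coe_mk, AddHom.coe_mk, Pi.sub_apply]
  cases l with
  | nil => simp [hf]
  | cons a l => rw [if_pos ⟨a, by simp, ha a (by simp)⟩]; simp

/-- Splitting and gluing (Mayer-Vietoris). -/
theorem mv_glue {B C : Set X} (hB : IsClosed B) (hC : IsClosed C) (iB : InvS Γ B) (iC : InvS Γ C)
    {n : ℕ} {f g1 g2 m : List X → R} (h1 : g1 ∈ Coch Γ X R) (h2 : g2 ∈ Coch Γ X R)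
    (hm : m ∈ Coch Γ X R) (e1 : ∀ x ∈ B, G0 (n + 1) (f - D g1) x)
    (e2 : ∀ x ∈ C, G0 (n + 1) (f - D g2) x) (e3 : ∀ x ∈ B ∩ C, G0 n (g1 - g2 - D m) x) :
    ∃ g ∈ Coch Γ X R, ∀ x ∈ B ∪ C, G0 (n + 1) (f - D g) x := by
  set q := g1 - g2 - D m with hq
  have mq : q ∈ Coch Γ X R := sub_mem (sub_mem h1 h2) (Coch.D hm)
  obtain ⟨S, iS, hS1, hS2⟩ := exists_sep (Γ := Γ) hB hC (G0_open n q) iB iC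
    (fun γ x hx => hx.act mq γ) e3
  have a1 : ∀ x ∈ B, G0 n (q - headS S q) x := fun x hx => by
    by_cases hO : G0 n q x
    · exact hO.sub (headS_G0 hO)
    · exact headS_in mq.1 (hS1 ⟨hx, hO⟩)
  have a2 : ∀ x ∈ C, G0 n (headS S q) x := fun x hx => by
    by_cases hO : G0 n q x
    · exact headS_G0 hO
    · exact headS_out (hS2 ⟨hx, hO⟩)
  refine ⟨g1 - (q - headS S q), sub_mem h1 (sub_mem mq (Coch.headS iS mq)), ?_⟩
  rintro x (hx | hx)
  · refine ((e1 x hx).add (a1 x hx).D).congr ?_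
    simp only [D_sub_fun]; abel
  · refine ((e2 x hx).sub (a2 x hx).D).congr ?_
    rw [hq]
    simp only [D_sub_fun, DD]; abel

/-- equivariant retractions -/
theorem exists_retract [CompactSpace X1] [Nonempty X1] (hU : Unif Γ X) (e : X1 → X)
    (he : Continuous e) (hi : Function.Injective e) (heq : Eqv Γ e) :
    ∃ r : X → X1, Eqv Γ r ∧ (∀ s, r (e s) = s) ∧ ∀ s, ContinuousAt r (e s) := by
  classical
  have hmin : ∀ x : X, ∃ s : X1, ∀ t, dist x (e s) ≤ dist x (e t) := fun x => by
    obtain ⟨s, hs⟩ := isCompact_univ.exists_isMinOn (univ_nonempty (α := X1))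
      ((continuous_const.dist he : Continuous fun s => dist x (e s)).continuousOn)
    exact ⟨s, fun t => hs.2 (mem_univ t)⟩
  choose m hm using hmin
  let st : Setoid X := ⟨fun x y => ∃ γ : Γ, act γ x = y, ⟨fun x => ⟨0, act_zero x⟩,
    fun {x y} ⟨γ, h⟩ => ⟨-γ, by rw [← h, act_neg]⟩,
    fun {x y z} ⟨γ, h⟩ ⟨δ, h'⟩ => ⟨δ + γ, by rw [act_add, h, h']⟩⟩⟩
  let rep : X → X := fun x => (Quotient.mk st x).out
  have hrep : ∀ x, ∃ γ : Γ, act γ (rep x) = x := fun x => Quotient.mk_out (s := st) x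
  have hrep2 : ∀ (γ : Γ) x, rep (act γ x) = rep x := fun γ x => by
    show (Quotient.mk st _).out = (Quotient.mk st _).out
    congr 1
    exact Quotient.sound ⟨-γ, act_neg γ x⟩
  choose g hg using hrep
  have key : ∀ (a b : Γ) (x : X) (s : X1), act a x = act b x → act a s = act b s := by
    intro a b x s h
    have h1 : act (-b + a) x = x := by rw [act_add, h, act_neg]
    have h2 : act (-b + a) (e s) = e s := hU _ _ _ h1
    rw [← heq] at h2
    have h3 := hi h2
    rw [act_add] at h3
    rw [← act_neg' b (act a s), h3]
  let r : X → X1 := fun x => act (g x) (m (rep x))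
  have hr : ∀ x t, dist x (e (r x)) ≤ dist x (e t) := by
    intro x t
    have h1 : dist x (e (r x)) = dist (rep x) (e (m (rep x))) := by
      have := act_dist (g x) (rep x) (e (m (rep x)))
      rw [hg x] at this
      show dist x (e (act (g x) (m (rep x)))) = _
      rw [heq]; exact this
    have h2 : dist x (e t) = dist (rep x) (e (act (-(g x)) t)) := by
      rw [heq, ← act_dist (g x) (rep x), hg, act_neg']
    rw [h1, h2]
    exact hm _ _
  have hre : ∀ s, r (e s) = s := fun s => by
    have := hr (e s) s
    rw [dist_self] at this
    exact (hi (dist_le_zero.1 this)).symm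
  refine ⟨r, ?_, hre, ?_⟩
  · intro γ x
    show act _ _ = act γ (act _ _)
    rw [hrep2, ← act_add]
    apply key _ _ (rep x)
    rw [act_add, hg, ← hrep2 γ x, hg]
  · intro s
    have hce : Topology.IsClosedEmbedding e := he.isClosedEmbedding hi
    rw [hce.isInducing.continuousAt_iff]
    show Filter.Tendsto _ _ (𝓝 (e (r (e s))))
    rw [hre, tendsto_iff_dist_tendsto_zero]
    have h0 : Filter.Tendsto (fun x => 2 * dist x (e s)) (𝓝 (e s)) (𝓝 0) := by
      have : Continuous fun x => 2 * dist x (e s) := by fun_prop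
      have := this.tendsto (e s)
      simpa using this
    refine squeeze_zero (fun _ => dist_nonneg) (fun x => ?_) h0
    have := hr x s
    have h2 := dist_triangle_left (e (r x)) (e s) x
    simp only [Function.comp_apply]
    linarith

/-- tautness -/
theorem taut [CompactSpace X1] (hU : Unif Γ X) (e : X1 → X)
    (he : Continuous e) (hi : Function.Injective e) (heq : Eqv Γ e) {n : ℕ} {f : List X → R}
    (hf : f ∈ Coch Γ X R) (hD : ∀ s, G0 (n + 2) (D f) (e s)) {g : List X1 → R}
    (hg : g ∈ Coch Γ X1 R) (h : ∀ s, G0 (n + 1) (pb e f - D g) s) :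
    ∃ g' ∈ Coch Γ X R, ∀ s, G0 (n + 1) (f - D g') (e s) := by
  rcases isEmpty_or_nonempty X1 with hE | hE
  · exact ⟨0, zero_mem _, fun s => (hE.false s).elim⟩
  obtain ⟨r, r1, r2, r3⟩ := exists_retract hU e he hi heq
  have eid : Eqv Γ (id : X → X) := fun _ _ => rfl
  have eer : Eqv Γ (e ∘ r) := fun γ x => by simp [r1 γ x, heq γ]
  refine ⟨pb r g - prism id (e ∘ r) f, sub_mem (Coch.pb hg r1) (Coch.prism hf eid eer), fun s => ?_⟩
  have h1 : G0 (n + 1) (pb (e ∘ r) f - pb id f - D (prism id (e ∘ r) f)) (e s) := by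
    refine prism_germ' (hD s) continuousAt_id ?_ (by simp [r2])
    exact ContinuousAt.comp (by rw [r2]; exact he.continuousAt) (r3 s)
  have h2 : G0 (n + 1) (pb r (pb e f - D g)) (e s) := G0.pb (by rw [r2]; exact h s) (r3 s)
  refine (h2.sub h1).congr ?_
  rw [map_sub, pb_pb, pb_D, D_sub_fun]
  have : pb id f = f := by funext l; simp [pb_apply]
  rw [this]; abel

/-- homotopy invariance -/
theorem homotopy [CompactSpace X1] (H : ℝ → X1 → X) (hH : Continuous fun q : ℝ × X1 => H q.1 q.2)
    (heq : ∀ s, Eqv Γ (H s)) {n : ℕ} {f : List X → R}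
    (hf : f ∈ Coch Γ X R) (hD : ∀ x, G0 (n + 2) (D f) x) :
    ∃ g ∈ Coch Γ X1 R, ∀ x, G0 (n + 1) (pb (H 1) f - pb (H 0) f - D g) x := by
  have := isPreconnected_univ.induction₂ (α := ℝ) (fun s t => ∃ g ∈ Coch Γ X1 R, ∀ x,
    G0 (n + 1) (pb (H t) f - pb (H s) f - D g) x) ?_ ?_ ?_ (x := 0) (y := 1) trivial trivial
  · exact this
  · intro s0 _
    rw [nhdsWithin_univ]
    have hc := isCompact_univ.eventually_forall_of_forall_eventually (x₀ := s0) (K := (univ : Set X1))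
      (P := fun s x => G0 (n + 1) (pb (H s) f - pb (H s0) f - D (prism (H s0) (H s) f)) x) ?_
    · filter_upwards [hc] with s hs
      exact ⟨prism (H s0) (H s) f, Coch.prism hf (heq _) (heq _), fun x => hs x trivial⟩
    · intro x _
      obtain ⟨U, hU, h⟩ := hD (H s0 x)
      have h1 : ∀ᶠ q : ℝ × X1 in 𝓝 (s0, x), H q.1 q.2 ∈ U := hH.continuousAt hU
      have h2 : ∀ᶠ y in 𝓝 x, H s0 y ∈ U :=
        (hH.comp (Continuous.prodMk_right s0)).continuousAt (x := x) hU
      have h3 := h1.eventually_nhds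
      have h4 := h2.eventually_nhds
      have h5 : ∀ᶠ q : ℝ × X1 in 𝓝 (s0, x), ∀ᶠ y in 𝓝 q.2, H s0 y ∈ U :=
        (continuous_snd.tendsto (s0, x)).eventually h4
      filter_upwards [h3, h5] with q hq1 hq2
      refine prism_germ h hq2 ?_
      exact ((Continuous.prodMk_right q.1).tendsto q.2).eventually hq1
  · rintro s t u _ _ _ ⟨g, hg, h⟩ ⟨g', hg', h'⟩
    refine ⟨g + g', add_mem hg hg', fun x => ((h x).add (h' x)).congr ?_⟩
    rw [D_add_fun]; abel
  · rintro s t _ _ ⟨g, hg, h⟩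
    refine ⟨-g, neg_mem hg, fun x => (h x).neg.congr ?_⟩
    rw [D_neg_fun]; abel

end Glob
end Volo

namespace Volo
open scoped Topology
open GSp

section Sub
variable {Γ X X1 R : Type} [AddCommGroup Γ] [Finite Γ] [MetricSpace X] [MetricSpace X1] [GSp Γ X]
  [GSp Γ X1] [CommRing R]

/-- action on an invariant subset -/
@[reducible] def subG {S : Set X} (hS : InvS Γ S) : GSp Γ S where
  act γ x := ⟨act γ x.1, hS γ x.1 x.2⟩
  act_zero x := Subtype.ext (act_zero x.1)
  act_add a b x := Subtype.ext (act_add a b x.1)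
  act_dist a x y := act_dist a x.1 y.1

theorem subG_val {S : Set X} (hS : InvS Γ S) :
    letI := subG hS
    Eqv Γ (Subtype.val : S → X) := by
  intro γ x; rfl

theorem subG_unif {S : Set X} (hS : InvS Γ S) (hU : Unif Γ X) :
    letI := subG hS
    Unif Γ S := by
  intro γ x y h
  exact Subtype.ext (hU γ x.1 y.1 (congrArg Subtype.val h))

theorem InvS.mem_iff {S : Set X} (hS : InvS Γ S) (γ : Γ) (x : X) : act γ x ∈ S ↔ x ∈ S :=
  ⟨fun h => by have := hS (-γ) _ h; rwa [act_neg] at this, hS γ x⟩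

/-- orbit -/
def orb (Γ : Type) {X : Type} [AddCommGroup Γ] [MetricSpace X] [GSp Γ X] (y : X) : Set X :=
  range fun γ : Γ => act γ y

theorem orb_inv (y : X) : InvS Γ (orb Γ y) := by
  rintro γ _ ⟨δ, rfl⟩
  exact ⟨γ + δ, act_add _ _ _⟩
theorem orb_finite (y : X) : (orb Γ y).Finite := finite_range _
theorem orb_self (y : X) : y ∈ orb Γ y := ⟨0, act_zero y⟩

/-- unit cochain -/
def one : List X → R := fun l => if l.length = 1 then 1 else 0

theorem one_mem : (one : List X → R) ∈ Coch Γ X R := ⟨by simp [one], fun γ l => by simp [one]⟩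

theorem pb_one (φ : X1 → X) : pb φ (one : List X → R) = one := by
  funext l; simp [pb_apply, one]

theorem cup_one (f : List X → R) (hf : f [] = 0) : cup one f = f := by
  funext l
  cases l with
  | nil => rw [hf]; rfl
  | cons a l =>
    rw [cup_cons, cup_eq_sum_zero]
    · simp [one]
    · rintro l1 b l2 rfl
      simp [one]

theorem D_one : D (one : List X → R) = 0 := by
  funext l
  rcases l with _ | ⟨a, _ | ⟨b, _ | ⟨c, l⟩⟩⟩
  · rfl
  · simp [D, one]
  · simp [D, one]
  · exact D_local one univ (l.length + 2) (fun l hl _ => by simp [one, hl]) _ (by simp) (by simp)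

theorem sg_sg (f : List X → R) : sg (sg f) = f := by
  funext l
  simp only [sg]
  rw [← mul_assoc, ← mul_pow]; simp

theorem sg_add (f g : List X → R) : sg (f + g) = sg f + sg g := by
  funext l; simp [sg, mul_add]
theorem sg_sub (f g : List X → R) : sg (f - g) = sg f - sg g := by
  funext l; simp [sg, mul_sub]
theorem sg_neg (f : List X → R) : sg (-f) = - sg f := by
  funext l; simp [sg]
theorem sg_smul (c : R) (f : List X → R) : sg (c • f) = c • sg f := by
  funext l; simp [sg]; ring
theorem sg_zero : sg (0 : List X → R) = 0 := by
  funext l; simp [sg]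

theorem D_sg (f : List X → R) : D (sg f) = - sg (D f) := by
  have key : ∀ (l : List X) (c : R) (f : List X → R),
      D (fun m => c * ((-1) ^ (m.length + 1) * f m)) l = - (c * ((-1) ^ (l.length + 1) * D f l)) := by
    intro l
    induction l with
    | nil => intro c f; simp [D]
    | cons a l ih =>
      intro c f
      rw [D_cons, D_cons]
      have : (fun m => c * ((-1 : R) ^ ((a :: m).length + 1) * f (a :: m))) =
        fun m => (-c) * ((-1) ^ (m.length + 1) * (fun m => f (a :: m)) m) := by
        funext m; simp only [List.length_cons]; ring
      rw [this, ih]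
      simp only [List.length_cons]; ring
  funext l
  have := key l 1 f
  simp only [one_mul] at this
  exact this

/-- level truncation -/
def lev (n : ℕ) (f : List X → R) : List X → R := fun l => if l.length = n then f l else 0
theorem lev_mem (n : ℕ) {f : List X → R} (hf : f ∈ Coch Γ X R) : lev n f ∈ Coch Γ X R :=
  Coch.cond hf (fun l => l.length = n) (fun γ l => by simp)
theorem lev_lv (n : ℕ) (f : List X → R) : Lv n (lev n f) := fun l hl => by simp [lev, hl]
theorem D_congr_len {n : ℕ} {f g : List X → R} (h : ∀ l, l.length = n → f l = g l) (l : List X)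
    (hl : l.length = n + 1) : D f l = D g l := by
  have := D_len (f - g) n (fun l hl => by simp [h l hl]) l hl
  rw [D_sub_fun] at this
  simpa [sub_eq_zero] using this
theorem Lv.D {n : ℕ} {f : List X → R} (hn : 0 < n) (h : Lv n f) : Lv (n + 1) (D f) := by
  intro l hl
  cases l with
  | nil => rfl
  | cons a l =>
    refine D_len f l.length (fun m hm => h m ?_) _ (by simp)
    simp at hl; omega

theorem Lv.z0 {n : ℕ} {f : List X → R} (h : Lv n f) {x : X} (hx : G0 n f x) : Z0 f x := by
  intro m
  by_cases hm : m = n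
  · subst hm; exact hx
  · exact ⟨univ, Filter.univ_mem, fun l hl _ => h l (by omega)⟩

theorem cup_low {f g : List X → R} {n : ℕ} (hg : Lv n g) (l : List X) (hl : l.length < n) :
    cup f g l = 0 :=
  cup_eq_sum_zero f g l fun l1 a l2 h => by
    rw [hg (a :: l2), mul_zero]
    subst h; simp at hl ⊢; omega

theorem G0_low {n : ℕ} {f : List X → R} (h : ∀ l, l.length = n → f l = 0) (x : X) : G0 n f x :=
  ⟨univ, Filter.univ_mem, fun l hl _ => h l hl⟩

/-- value of the coboundary on constant lists -/
theorem D_repl (f : List X → R) (x : X) (n : ℕ) :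
    D f (List.replicate (n + 1) x) = if Even n then f (List.replicate n x) else 0 := by
  induction n generalizing f with
  | zero => simp [D]
  | succ n ih =>
    rw [List.replicate_succ, D_cons, ih]
    rcases Nat.even_or_odd n with h | h
    · simp [h, Nat.even_add_one, List.replicate_succ]
    · simp [h, Nat.even_add_one]

/-- one orbit spaces are acyclic -/
theorem orbit_acyclic [DiscreteTopology X] (hX : ∀ x y : X, ∃ γ : Γ, act γ x = y)
    {n : ℕ} {f : List X → R} (hf : f ∈ Coch Γ X R) (hD : ∀ x, G0 (n + 3) (D f) x) :
    ∃ g ∈ Coch Γ X R, ∀ x, G0 (n + 2) (f - D g) x := by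
  classical
  have hg0 : ∀ (m : ℕ) (h : List X → R) x, h (List.replicate m x) = 0 → G0 m h x := by
    intro m h x hh
    refine ⟨{x}, by simp [nhds_discrete], fun l hl ha => ?_⟩
    rw [List.eq_replicate_of_mem (a := x) (l := l) (fun b hb => by simpa using ha b hb), hl, hh]
  have hg1 : ∀ (m : ℕ) (h : List X → R) x, G0 m h x → h (List.replicate m x) = 0 := by
    rintro m h x ⟨U, hU, hh⟩
    exact hh _ (by simp) fun a ha => by
      rw [List.eq_of_mem_replicate ha]; exact mem_of_mem_nhds hU
  rcases isEmpty_or_nonempty X with hE | ⟨⟨x0⟩⟩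
  · exact ⟨0, zero_mem _, fun x => (hE.false x).elim⟩
  by_cases hn : Even n
  · refine ⟨0, zero_mem _, fun x => hg0 _ _ _ ?_⟩
    have := hg1 _ _ _ (hD x)
    rw [D_repl, if_pos (by simpa [Nat.even_add_one] using hn)] at this
    simp [D_zero_fun, this]
  · refine ⟨fun l => if l.length = n + 1 then f (List.replicate (n + 2) x0) else 0,
      ⟨by simp, fun γ l => by simp⟩, fun x => hg0 _ _ _ ?_⟩
    rw [Pi.sub_apply, D_repl, if_pos (by simpa [Nat.even_add_one] using hn)]
    obtain ⟨γ, hγ⟩ := hX x0 x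
    have := hf.2 γ (List.replicate (n + 2) x0)
    rw [List.map_replicate, hγ] at this
    simp [this]

/-- The point lemma. -/
theorem point_lemma (hU : Unif Γ X) (x : X) {n : ℕ} {f : List X → R} (hf : f ∈ Coch Γ X R)
    (hD : G0 (n + 3) (D f) x) : ∃ g ∈ Coch Γ X R, G0 (n + 2) (f - D g) x := by
  letI := subG (Γ := Γ) (orb_inv x)
  haveI : Finite (orb Γ x) := orb_finite x
  have hX : ∀ a b : orb Γ x, ∃ γ : Γ, act γ a = b := by
    rintro ⟨_, a, rfl⟩ ⟨_, b, rfl⟩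
    refine ⟨b - a, Subtype.ext ?_⟩
    show act (b - a) (act a x) = act b x
    rw [← act_add]; simp
  have h1 : ∀ s : orb Γ x, G0 (n + 3) (D f) s.1 := by
    rintro ⟨_, γ, rfl⟩
    exact hD.act (Coch.D hf) γ
  obtain ⟨g, hg, h⟩ := orbit_acyclic hX (Coch.pb hf (subG_val (orb_inv x)))
    (n := n) (fun s => by rw [← pb_D]; exact (h1 s).pb continuous_subtype_val.continuousAt)
  obtain ⟨g', hg', h'⟩ := taut hU (Subtype.val : orb Γ x → X) continuous_subtype_val
    Subtype.val_injective (subG_val (orb_inv x)) (n := n + 1) hf h1 hg h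
  exact ⟨g', hg', h' ⟨x, orb_self x⟩⟩

theorem point_lemma1 (x : X) {f : List X → R} (hf : f ∈ Coch Γ X R)
    (hD : G0 2 (D f) x) : G0 1 (f - f [x] • one) x := by
  obtain ⟨U, hU, h⟩ := hD
  refine ⟨U, hU, fun l hl ha => ?_⟩
  obtain ⟨a, rfl⟩ := List.length_eq_one_iff.1 hl
  have := h [x, a] rfl (by
    intro b hb
    simp at hb
    rcases hb with rfl | rfl
    · exact mem_of_mem_nhds hU
    · exact ha _ (by simp))
  simp [D, Volo.one] at this ⊢
  rw [sub_eq_zero] at this ⊢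
  exact this
end Sub
end Volo

namespace Volo
open scoped Topology
open GSp

/-- fibre hypotheses -/
structure FibOK (Γ F R : Type) [AddCommGroup Γ] [MetricSpace F] [GSp Γ F] [CommRing R]
    (Jp : Prop) (τ : List F → R) : Prop where
  lv1 : ∀ f ∈ Coch Γ F R, (∀ x, G0 2 (D f) x) → ∃ c : R, ∀ x, G0 1 (f - c • one) x
  lv2 : ∀ n, ∀ f ∈ Coch Γ F R, (∀ x, G0 (n + 3) (D f) x) → ∃ c : R, (¬ Jp → c = 0) ∧
    ∃ g ∈ Coch Γ F R, ∀ x, G0 (n + 2) (f - c • τ - D g) x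
  fi : Jp → ∀ c : R, ∀ g ∈ Coch Γ F R, (∀ x, G0 2 (c • τ - D g) x) → c = 0

section LH
variable {Γ Y W R : Type} [AddCommGroup Γ] [Finite Γ] [MetricSpace Y] [MetricSpace W] [GSp Γ Y]
  [GSp Γ W] [CommRing R]

theorem fib_inv {π : W → Y} (hπ : Eqv Γ π) (y : Y) : InvS Γ (π ⁻¹' orb Γ y) := by
  intro γ x hx
  show π (act γ x) ∈ orb Γ y
  rw [hπ]; exact orb_inv y γ _ hx

/-- the triples -/
def MM (Γ Y W R : Type) [AddCommGroup Γ] [MetricSpace Y] [MetricSpace W] [GSp Γ Y]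
  [GSp Γ W] [CommRing R] (Jp : Prop) :
    AddSubgroup ((List Y → R) × (List Y → R) × (List W → R)) where
  carrier := {m | m.1 ∈ Coch Γ Y R ∧ m.2.1 ∈ Coch Γ Y R ∧ m.2.2 ∈ Coch Γ W R ∧ (¬ Jp → m.2.1 = 0)}
  add_mem' := by
    rintro a b ⟨h1, h2, h3, h4⟩ ⟨h1', h2', h3', h4'⟩
    exact ⟨add_mem h1 h1', add_mem h2 h2', add_mem h3 h3', fun h => by simp [h4 h, h4' h]⟩
  zero_mem' := ⟨zero_mem _, zero_mem _, zero_mem _, fun _ => rfl⟩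
  neg_mem' := by
    rintro a ⟨h1, h2, h3, h4⟩
    exact ⟨neg_mem h1, neg_mem h2, neg_mem h3, fun h => by simp [h4 h]⟩

/-- local vanishing of triples -/
def NN (π : W → Y) (n : ℕ) (m : (List Y → R) × (List Y → R) × (List W → R)) (y : Y) : Prop :=
  G0 n m.1 y ∧ G0 (n - 1) m.2.1 y ∧ ∀ x, π x = y → G0 (n - 1) m.2.2 x

theorem NN.sub {π : W → Y} {n : ℕ} {m m' : (List Y → R) × (List Y → R) × (List W → R)} {y : Y}
    (h : NN π n m y) (h' : NN π n m' y) : NN π n (m - m') y :=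
  ⟨h.1.sub h'.1, h.2.1.sub h'.2.1, fun x hx => (h.2.2 x hx).sub (h'.2.2 x hx)⟩

/-- differential of triples -/
def dM (π : W → Y) (θ : List Y → R) (τ : List W → R) :
    (List Y → R) × (List Y → R) × (List W → R) →+ (List Y → R) × (List Y → R) × (List W → R) where
  toFun m := (D m.1 + cup (sg m.2.1) θ, D m.2.1,
    pb π m.1 + cup (pb π m.2.1) τ - D m.2.2)
  map_zero' := by
    simp [D_zero_fun, sg_zero, cup_zero_left]
  map_add' m m' := by
    ext1
    · simp only [Prod.fst_add, Prod.snd_add, D_add_fun, sg_add, cup_add_left]; abel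
    ext1
    · simp only [Prod.fst_add, Prod.snd_add, D_add_fun]
    · simp only [Prod.fst_add, Prod.snd_add, D_add_fun, map_add, cup_add_left]; abel

theorem dM_mem {Jp : Prop} {π : W → Y} (hπ : Eqv Γ π) {θ : List Y → R} {τ : List W → R}
    (hθ : θ ∈ Coch Γ Y R) (hτ : τ ∈ Coch Γ W R) {m} (hm : m ∈ MM Γ Y W R Jp) :
    dM π θ τ m ∈ MM Γ Y W R Jp := by
  obtain ⟨h1, h2, h3, h4⟩ := hm
  refine ⟨add_mem (Coch.D h1) (Coch.cup (Coch.sg h2) hθ), Coch.D h2,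
    sub_mem (add_mem (Coch.pb h1 hπ) (Coch.cup (Coch.pb h2 hπ) hτ)) (Coch.D h3), fun h => ?_⟩
  show D m.2.1 = 0
  rw [h4 h, D_zero_fun]

theorem dM_NN {Jp : Prop} {π : W → Y} (hc : Continuous π) {θ : List Y → R} {τ : List W → R}
    (hθ : Lv 3 θ) (hτ : Lv 2 τ) {m : (List Y → R) × (List Y → R) × (List W → R)}
    (hm : m ∈ MM Γ Y W R Jp) {n : ℕ} {y : Y} (h : NN π n m y) :
    NN π (n + 1) (dM π θ τ m) y := by
  obtain ⟨h1, h2, h3⟩ := h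
  cases n with
  | zero =>
    refine ⟨G0_low (fun l hl => ?_) y, G0_lvl0 rfl y, fun x hx => G0_lvl0 ?_ x⟩
    · show D m.1 l + cup (sg m.2.1) θ l = 0
      obtain ⟨a, rfl⟩ := List.length_eq_one_iff.1 hl
      rw [cup_low hθ _ (by simp)]
      simp [D, hm.1.1]
    · show m.1 [] + 0 - 0 = (0 : R)
      rw [hm.1.1]; simp
  | succ n =>
    simp only [Nat.add_sub_cancel] at h1 h2 h3
    refine ⟨h1.D.add ?_, h2.D, fun x hx => ?_⟩
    · exact h2.sg.cup_lv (m := 2) hθ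
    · subst hx
      refine ((h1.pb hc.continuousAt).add ?_).sub (h3 x rfl).D
      exact (h2.pb hc.continuousAt).cup_lv (m := 1) hτ

theorem dMdM {Jp : Prop} {π : W → Y} (hc : Continuous π) {θ : List Y → R} {τ : List W → R}
    (hθm : θ [] = 0) (hτm : τ [] = 0)
    (hDθ : ∀ y, Z0 (D θ) y) (hDτ : ∀ x, Z0 (pb π θ - D τ) x)
    {m : (List Y → R) × (List Y → R) × (List W → R)}
    (hm : m ∈ MM Γ Y W R Jp) (n : ℕ) (y : Y) : NN π n (dM π θ τ (dM π θ τ m)) y := by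
  have hs : sg m.2.1 [] = 0 := by simp [sg, hm.2.1.1]
  have hp : pb π m.2.1 [] = 0 := by simp [pb_apply, hm.2.1.1]
  refine ⟨?_, ?_, fun x hx => ?_⟩
  · refine ((hDθ y).cup_right (f := m.2.1) n).congr ?_
    show _ = D (D m.1 + cup (sg m.2.1) θ) + cup (sg (D m.2.1)) θ
    rw [D_add_fun, DD, leibniz_fun _ _ hs hθm, D_sg, sg_sg, cup_neg_left]; abel
  · refine (G0_zero _ _).congr ?_
    show 0 = D (D m.2.1)
    rw [DD]
  · refine ((hDτ x).cup_right (f := sg (pb π m.2.1)) _).congr ?_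
    show _ = pb π (D m.1 + cup (sg m.2.1) θ) + cup (pb π (D m.2.1)) τ -
      D (pb π m.1 + cup (pb π m.2.1) τ - D m.2.2)
    rw [D_sub_fun, DD, D_add_fun, leibniz_fun _ _ hp hτm, map_add, pb_D, pb_D, pb_cup, pb_sg,
      cup_sub_right]; abel

theorem NN_open [CompactSpace W] {π : W → Y} (hc : Continuous π) (n : ℕ)
    (m : (List Y → R) × (List Y → R) × (List W → R)) : IsOpen {y | NN π n m y} := by
  have h3 : IsOpen {y | ∀ x, π x = y → G0 (n - 1) m.2.2 x} := by
    have : {y | ∀ x, π x = y → G0 (n - 1) m.2.2 x} = (Set.image π {x | G0 (n - 1) m.2.2 x}ᶜ)ᶜ := by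
      ext y
      simp only [mem_ofPred_eq, mem_compl_iff, mem_image, not_exists, not_and, not_not]
      exact ⟨fun h x hx hxy => hx (h x hxy), fun h x hxy => by
        by_contra hx; exact h x hx hxy⟩
    rw [this, isOpen_compl_iff]
    exact hc.isClosedMap _ (G0_open _ _).isClosed_compl
  exact (G0_open n m.1).inter ((G0_open (n - 1) m.2.1).inter h3)

theorem NN_act {Jp : Prop} {π : W → Y} (hπ : Eqv Γ π)
    {m : (List Y → R) × (List Y → R) × (List W → R)}
    (hm : m ∈ MM Γ Y W R Jp) {n : ℕ} (γ : Γ) {y : Y} (h : NN π n m y) : NN π n m (act γ y) := by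
  refine ⟨h.1.act hm.1 γ, h.2.1.act hm.2.1 γ, fun x hx => ?_⟩
  have := (h.2.2 (act (-γ) x) (by rw [hπ, hx, act_neg])).act hm.2.2.1 γ
  rwa [act_neg'] at this

/-- fibre cocycles -/
theorem fib_lv2 [CompactSpace W] (hUW : Unif Γ W) {π : W → Y} (hc : Continuous π) (hπ : Eqv Γ π)
    {Jp : Prop} {τ : List W → R} (hτ : τ ∈ Coch Γ W R) (y : Y)
    (hF : letI := subG (fib_inv hπ y)
      FibOK Γ (π ⁻¹' orb Γ y) R Jp (pb Subtype.val τ)) {n : ℕ} {f : List W → R}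
    (hf : f ∈ Coch Γ W R) (hD : ∀ x, π x = y → G0 (n + 3) (D f) x)
    (hDτ : ∀ x, π x = y → G0 (n + 3) (D τ) x) :
    ∃ c : R, (¬ Jp → c = 0) ∧ ∃ g ∈ Coch Γ W R,
      ∀ x, π x = y → G0 (n + 2) (f - c • τ - D g) x := by
  letI := subG (fib_inv hπ y)
  have ext : ∀ (k : ℕ) (h : List W → R), h ∈ Coch Γ W R → (∀ x, π x = y → G0 k h x) →
      ∀ s : π ⁻¹' orb Γ y, G0 k h s.1 := by
    rintro k h hh hx ⟨x, γ, hγ⟩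
    have := (hx (act (-γ) x) (by rw [hπ, ← hγ]; exact act_neg γ y)).act hh γ
    rwa [act_neg'] at this
  have hD' := ext _ _ (Coch.D hf) hD
  have hDτ' := ext _ _ (Coch.D hτ) hDτ
  obtain ⟨c, hc1, g, hg, h⟩ := hF.lv2 n (pb Subtype.val f) (Coch.pb hf (subG_val (fib_inv hπ y)))
    (fun s => by rw [← pb_D]; exact (hD' s).pb continuous_subtype_val.continuousAt)
  haveI : CompactSpace (π ⁻¹' orb Γ y) :=
    isCompact_iff_compactSpace.1 (((orb_finite y).isClosed.preimage hc).isCompact)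
  obtain ⟨g', hg', h'⟩ := taut hUW (Subtype.val : π ⁻¹' orb Γ y → W) continuous_subtype_val
    Subtype.val_injective (subG_val (fib_inv hπ y)) (n := n + 1) (f := f - c • τ)
    (sub_mem hf ((Coch Γ W R).smul_mem c hτ))
    (fun s => by rw [D_sub_fun, D_smul_fun]; exact (hD' s).sub ((hDτ' s).smul c)) hg
    (fun s => by rw [map_sub, map_smul]; exact h s)
  exact ⟨c, hc1, g', hg', fun x hx => h' ⟨x, by
    show π x ∈ orb Γ y
    rw [hx]; exact orb_self y⟩⟩

theorem fib_lv1 [CompactSpace W] (hUW : Unif Γ W) {π : W → Y} (hc : Continuous π) (hπ : Eqv Γ π)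
    {Jp : Prop} {τ : List W → R} (y : Y)
    (hF : letI := subG (fib_inv hπ y)
      FibOK Γ (π ⁻¹' orb Γ y) R Jp (pb Subtype.val τ)) {f : List W → R}
    (hf : f ∈ Coch Γ W R) (hD : ∀ x, π x = y → G0 2 (D f) x) :
    ∃ c : R, ∀ x, π x = y → G0 1 (f - c • one) x := by
  letI := subG (fib_inv hπ y)
  have hD' : ∀ s : π ⁻¹' orb Γ y, G0 2 (D f) s.1 := by
    rintro ⟨x, γ, hγ⟩
    have := (hD (act (-γ) x) (by rw [hπ, ← hγ]; exact act_neg γ y)).act (Coch.D hf) γ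
    rwa [act_neg'] at this
  obtain ⟨c, h⟩ := hF.lv1 (pb Subtype.val f) (Coch.pb hf (subG_val (fib_inv hπ y)))
    (fun s => by rw [← pb_D]; exact (hD' s).pb continuous_subtype_val.continuousAt)
  haveI : CompactSpace (π ⁻¹' orb Γ y) :=
    isCompact_iff_compactSpace.1 (((orb_finite y).isClosed.preimage hc).isCompact)
  obtain ⟨g', hg', h'⟩ := taut hUW (Subtype.val : π ⁻¹' orb Γ y → W) continuous_subtype_val
    Subtype.val_injective (subG_val (fib_inv hπ y)) (n := 0) (f := f - c • one)
    (sub_mem hf ((Coch Γ W R).smul_mem c one_mem))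
    (fun s => by rw [D_sub_fun, D_smul_fun, D_one]; simpa using (hD' s)) (zero_mem _)
    (fun s => by rw [map_sub, map_smul, D_zero_fun, sub_zero, pb_one]; exact h s)
  refine ⟨c, fun x hx => ?_⟩
  have h1 : G0 1 (D g') x := G0_low (fun l hl => by
    obtain ⟨a, rfl⟩ := List.length_eq_one_iff.1 hl
    simp [D, hg'.1]) x
  refine ((h' ⟨x, by
    show π x ∈ orb Γ y
    rw [hx]; exact orb_self y⟩).add h1).congr ?_
  abel

theorem fib_fi {π : W → Y} (hπ : Eqv Γ π)
    {Jp : Prop} {τ : List W → R} (hτ : τ ∈ Coch Γ W R) (y : Y)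
    (hF : letI := subG (fib_inv hπ y)
      FibOK Γ (π ⁻¹' orb Γ y) R Jp (pb Subtype.val τ)) (hJ : Jp) (c : R) {g : List W → R}
    (hg : g ∈ Coch Γ W R) (h : ∀ x, π x = y → G0 2 (c • τ - D g) x) : c = 0 := by
  letI := subG (fib_inv hπ y)
  refine hF.fi hJ c (pb Subtype.val g) (Coch.pb hg (subG_val (fib_inv hπ y))) fun s => ?_
  rw [← pb_D, ← map_smul, ← map_sub]
  refine G0.pb ?_ continuous_subtype_val.continuousAt
  obtain ⟨x, γ, hγ⟩ := s
  have := (h (act (-γ) x) (by rw [hπ, ← hγ]; exact act_neg γ y)).act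
    (sub_mem ((Coch Γ W R).smul_mem c hτ) (Coch.D hg)) γ
  rwa [act_neg'] at this

theorem fib_congr {F : Type} [MetricSpace F] [GSp Γ F] {Jp : Prop} {τ τ' : List F → R}
    (h : FibOK Γ F R Jp τ) (hτ : ∀ x, Z0 (τ' - τ) x) : FibOK Γ F R Jp τ' := by
  refine ⟨h.lv1, fun n f hf hD => ?_, fun hJ c g hg hh => ?_⟩
  · obtain ⟨c, h1, g, hg, h2⟩ := h.lv2 n f hf hD
    refine ⟨c, h1, g, hg, fun x => ((h2 x).sub (((hτ x) _).smul c)).congr ?_⟩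
    rw [smul_sub]; abel
  · refine h.fi hJ c g hg fun x => ((hh x).sub (((hτ x) _).smul c)).congr ?_
    rw [smul_sub]; abel

end LH
end Volo

namespace Volo
open scoped Topology
open GSp

section LH
variable {Γ Y W R : Type} [AddCommGroup Γ] [Finite Γ] [MetricSpace Y] [MetricSpace W] [GSp Γ Y]
  [GSp Γ W] [CommRing R]

theorem local_untw [CompactSpace W] (hUY : Unif Γ Y) (hUW : Unif Γ W) {π : W → Y}
    (hc : Continuous π) (hsurj : Function.Surjective π) (hπ : Eqv Γ π)
    {Jp : Prop} {τ : List W → R} (hτ : τ ∈ Coch Γ W R) (hτ2 : Lv 2 τ) (y : Y)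
    (hDτ : ∀ x, π x = y → Z0 (D τ) x)
    (hF : letI := subG (fib_inv hπ y)
      FibOK Γ (π ⁻¹' orb Γ y) R Jp (pb Subtype.val τ))
    {a0 a1 : List Y → R} {c : List W → R} (m0 : a0 ∈ Coch Γ Y R) (m1 : a1 ∈ Coch Γ Y R)
    (mc : c ∈ Coch Γ W R) (hJ : ¬ Jp → a1 = 0) (n : ℕ)
    (h0 : G0 (n + 1) (D a0) y) (h1 : G0 n (D a1) y)
    (h2 : ∀ x, π x = y → G0 n (pb π a0 + cup (pb π a1) τ - D c) x) :
    ∃ b0 ∈ Coch Γ Y R, ∃ b1 ∈ Coch Γ Y R, ∃ e ∈ Coch Γ W R, (¬ Jp → b1 = 0) ∧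
      G0 n (a0 - D b0) y ∧ G0 (n - 1) (a1 - D b1) y ∧
      ∀ x, π x = y → G0 (n - 1) (c - (pb π b0 + cup (pb π b1) τ - D e)) x := by
  have hτ0 : τ [] = 0 := hτ.1
  have z0 : G0 (n - 1) (a1 - D 0) y → n ≤ 1 → True := fun _ _ => trivial
  rcases n with _ | _ | _ | n
  · refine ⟨0, zero_mem _, 0, zero_mem _, 0, zero_mem _, fun _ => rfl, G0_lvl0 ?_ _, G0_lvl0 ?_ _,
      fun x _ => G0_lvl0 ?_ _⟩ <;> simp [D, m0.1, m1.1, mc.1, pb_apply]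
  · refine ⟨0, zero_mem _, 0, zero_mem _, 0, zero_mem _, fun _ => rfl, ?_, G0_lvl0 ?_ _,
      fun x _ => G0_lvl0 ?_ _⟩
    · rw [D_zero_fun, sub_zero]
      have := hc.isClosedMap.eventually_nhds_fiber (p := fun x => a0 [π x] = 0) y (by
        intro x hx
        obtain ⟨U, hU, h⟩ := h2 x hx
        filter_upwards [hU] with x' hx'
        have := h [x'] rfl (by simpa using hx')
        simpa [pb_apply, D, cup, mc.1, hτ2 [x'] (by simp)] using this)
      refine ⟨_, this, fun l hl ha => ?_⟩
      obtain ⟨a, rfl⟩ := List.length_eq_one_iff.1 hl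
      obtain ⟨x, hx⟩ := hsurj a
      have := ha a (by simp) x hx
      rwa [hx] at this
    all_goals simp [D, m0.1, m1.1, mc.1, pb_apply]
  · -- level two
    obtain ⟨b0, mb0, hb0⟩ := point_lemma hUY y m0 (n := 0) h0
    have ha1 := point_lemma1 y m1 h1
    set q := a1 [y] with hq
    have key : ∀ x, π x = y → G0 2 (q • τ - D (c - pb π b0)) x := by
      rintro x rfl
      have e1 := (hb0.pb (φ := π) hc.continuousAt)
      have e2 := (ha1.pb (φ := π) hc.continuousAt).cup_lv (m := 1) hτ2
      refine (((h2 x rfl).sub e1).sub e2).congr ?_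
      rw [map_sub, map_sub, pb_D, map_smul, pb_one, cup_sub_left, cup_smul_left, cup_one τ hτ0,
        D_sub_fun]
      abel
    have hq0 : q = 0 := by
      by_cases hJp : Jp
      · exact fib_fi hπ hτ y hF hJp q (sub_mem mc (Coch.pb mb0 hπ)) key
      · rw [hq, hJ hJp]; rfl
    obtain ⟨u, hu⟩ := fib_lv1 hUW hc hπ y hF (f := c - pb π b0) (sub_mem mc (Coch.pb mb0 hπ))
      (fun x hx => by
        refine (key x hx).neg.congr ?_
        rw [hq0]; simp)
    refine ⟨b0 + u • one, add_mem mb0 (Submodule.smul_mem _ _ one_mem), 0, zero_mem _, 0,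
      zero_mem _, fun _ => rfl, ?_, ?_, fun x hx => ?_⟩
    · rw [D_add_fun, D_smul_fun, D_one, smul_zero, add_zero]; exact hb0
    · rw [hq0, zero_smul, sub_zero] at ha1
      rw [D_zero_fun, sub_zero]; exact ha1
    · refine (hu x hx).congr ?_
      rw [map_add, map_smul, pb_one, map_zero, cup_zero_left, D_zero_fun]; abel
  · obtain ⟨b0, mb0, hb0⟩ := point_lemma hUY y m0 (n := n + 1) h0
    obtain ⟨b1, mb1, hb1J, hb1⟩ : ∃ b1 ∈ Coch Γ Y R, (¬ Jp → b1 = 0) ∧ G0 (n + 2) (a1 - D b1) y := by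
      by_cases hJp : Jp
      · obtain ⟨b1, mb1, hb1⟩ := point_lemma hUY y m1 (n := n) h1
        exact ⟨b1, mb1, fun h => absurd hJp h, hb1⟩
      · refine ⟨0, zero_mem _, fun _ => rfl, ?_⟩
        rw [hJ hJp, D_zero_fun, sub_zero]; exact G0_zero _ _
    have mcc : c - pb π b0 - cup (pb π b1) τ ∈ Coch Γ W R :=
      sub_mem (sub_mem mc (Coch.pb mb0 hπ)) (Coch.cup (Coch.pb mb1 hπ) hτ)
    obtain ⟨u, huJ, e, me, he⟩ := fib_lv2 hUW hc hπ hτ y hF (n := n) mcc (fun x hx => by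
        subst hx
        have e1 := (hb0.pb (φ := π) hc.continuousAt)
        have e2 := (hb1.pb (φ := π) hc.continuousAt).cup_lv (m := 1) hτ2
        have e3 := (hDτ x rfl).cup_right (f := sg (pb π b1)) (n + 3)
        refine ((((e1.add e2).sub (h2 x rfl)).sub e3)).congr ?_
        have p0 : pb π b1 [] = 0 := mb1.1
        rw [D_sub_fun, D_sub_fun, leibniz_fun _ _ p0 hτ0, map_sub, map_sub, pb_D, pb_D,
          cup_sub_left]
        abel) (fun x hx => hDτ x hx _)
    refine ⟨b0, mb0, b1 + u • one, add_mem mb1 (Submodule.smul_mem _ _ one_mem), -e, neg_mem me,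
      fun h => by rw [hb1J h, huJ h]; simp, hb0, ?_, fun x hx => (he x hx).congr ?_⟩
    · rw [D_add_fun, D_smul_fun, D_one, smul_zero, add_zero]; exact hb1
    · rw [map_add, map_smul, pb_one, cup_add_left, cup_smul_left, cup_one τ hτ0, D_neg_fun]; abel

/-- local acyclicity -/
theorem local_tw [CompactSpace W] (hUY : Unif Γ Y) (hUW : Unif Γ W) {π : W → Y}
    (hc : Continuous π) (hsurj : Function.Surjective π) (hπ : Eqv Γ π)
    {Jp : Prop} {θ : List Y → R} {τ : List W → R} (hτ : τ ∈ Coch Γ W R) (hτ2 : Lv 2 τ)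
    (hθ : θ ∈ Coch Γ Y R) (hθ3 : Lv 3 θ) (hDθ : ∀ y, Z0 (D θ) y)
    (hDτ : ∀ x, Z0 (pb π θ - D τ) x) (hθd : ∀ y, θ [y, y, y] = 0) (y : Y)
    (hF : letI := subG (fib_inv hπ y)
      FibOK Γ (π ⁻¹' orb Γ y) R Jp (pb Subtype.val τ))
    (n : ℕ) (m : (List Y → R) × (List Y → R) × (List W → R)) (hm : m ∈ MM Γ Y W R Jp)
    (h : NN π (n + 1) (dM π θ τ m) y) : ∃ m' ∈ MM Γ Y W R Jp, NN π n (m - dM π θ τ m') y := by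
  obtain ⟨η', mη', hη'⟩ := point_lemma hUY y hθ (n := 1) (hDθ y 4)
  set η := lev 2 η' with hηd
  have mη : η ∈ Coch Γ Y R := lev_mem 2 mη'
  have hη2 : Lv 2 η := lev_lv 2 η'
  have mθη : θ - D η ∈ Coch Γ Y R := sub_mem hθ (Coch.D mη)
  have hη : Z0 (θ - D η) y := by
    refine Lv.z0 (n := 3) (fun l hl => ?_) ?_
    · simp [hθ3 l hl, hη2.D (by norm_num) l hl]
    · obtain ⟨U, hU, hh⟩ := hη'
      refine ⟨U, hU, fun l hl ha => ?_⟩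
      have e := hh l hl ha
      rw [Pi.sub_apply] at e ⊢
      rw [← e, D_congr_len (n := 2) (f := η) (g := η') (fun l hl => by simp [hηd, lev, hl]) l hl]
  have mτ' : τ - pb π η ∈ Coch Γ W R := sub_mem hτ (Coch.pb mη hπ)
  have hτ2' : Lv 2 (τ - pb π η) := fun l hl => by
    rw [Pi.sub_apply, hτ2 l hl, pb_apply, hη2 _ (by simpa using hl)]; simp
  have hF' : letI := subG (fib_inv hπ y)
      FibOK Γ (π ⁻¹' orb Γ y) R Jp (pb Subtype.val (τ - pb π η)) := by
    letI := subG (fib_inv hπ y)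
    refine fib_congr hF fun s => ?_
    refine Lv.z0 (n := 2) ?_ ?_
    · intro l hl
      simp only [Pi.sub_apply, pb_apply]
      rw [hη2 _ (by simpa using hl)]; simp
    · have hz : ∀ t ∈ orb Γ y, η [t, t] = 0 := by
        rintro _ ⟨γ, rfl⟩
        have e1 := hη.D
        have e2 : G0 3 (θ - D η) (act γ y) := (hη 3).act mθη γ
        obtain ⟨U, hU, hh⟩ := e2
        have e3 := hh (List.replicate 3 (act γ y)) rfl (fun a ha => by
          rw [List.eq_of_mem_replicate ha]; exact mem_of_mem_nhds hU)
        rw [Pi.sub_apply, D_repl, if_pos (by decide)] at e3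
        simp only [List.replicate] at e3
        rw [hθd] at e3
        simpa using e3
      obtain ⟨x, hx⟩ := s
      have hd : {t | t ∈ orb Γ y → t = π x} ∈ 𝓝 (π x) := by
        have : IsClosed (orb Γ y \ {π x}) := ((orb_finite y).subset sdiff_subset).isClosed
        have := this.isOpen_compl.mem_nhds (x := π x) (by simp)
        filter_upwards [this] with t ht hto
        by_contra hne
        exact ht ⟨hto, hne⟩
      refine ⟨{s | π s.1 = π x}, ?_, fun l hl ha => ?_⟩
      · have hcc : Continuous fun s : π ⁻¹' orb Γ y => π s.1 := hc.comp continuous_subtype_val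
        have := hcc.continuousAt (x := ⟨x, hx⟩) hd
        filter_upwards [this] with s hs
        exact hs s.2
      · obtain ⟨a, b, rfl⟩ := List.length_eq_two.1 hl
        have ea : π a.1 = π x := ha a (by simp)
        have eb : π b.1 = π x := ha b (by simp)
        simp only [Pi.sub_apply, pb_apply, List.map_cons, List.map_nil, ea, eb]
        rw [hz _ hx]; simp
  obtain ⟨a0, a1, c⟩ := m
  obtain ⟨m0, m1, mc, hJ⟩ := hm
  obtain ⟨h0, h1, h2⟩ := h
  simp only [dM, AddMonoidHom.coe_mk, ZeroHom.coe_mk, Nat.add_sub_cancel] at h0 h1 h2 m0 m1 mc hJ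
  have n1 : sg a1 [] = 0 := by simp [sg, m1.1]
  have n1' : a1 [] = 0 := m1.1
  obtain ⟨b0, mb0, b1, mb1, e, me, hbJ, r0, r1, r2⟩ := local_untw hUY hUW hc hsurj hπ mτ' hτ2' y
    (fun x hx => by
      subst hx
      refine ((hη.pb (φ := π) hc.continuousAt).sub (hDτ x)).congr ?_
      rw [D_sub_fun, map_sub, pb_D]; abel) hF' (a0 := a0 + cup a1 η) (a1 := a1) (c := c)
      (add_mem m0 (Coch.cup m1 mη)) m1 mc hJ n (by
        refine ((h0.add (h1.cup_lv (m := 1) hη2)).sub (hη.cup_right (f := sg a1) _)).congr ?_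
        rw [D_add_fun, leibniz_fun _ _ n1' mη.1, cup_sub_right]; abel) h1
      (fun x hx => (h2 x hx).congr (by
        rw [map_add, pb_cup, cup_sub_right]; abel))
  refine ⟨(b0 - cup b1 η, b1, e), ⟨sub_mem mb0 (Coch.cup mb1 mη), mb1, me, hbJ⟩, ?_, r1,
    fun x hx => (r2 x hx).congr ?_⟩
  · have n2 : b1 [] = 0 := mb1.1
    have s1 : G0 n (cup (a1 - D b1) η) y := by
      cases n with
      | zero => exact G0_lvl0 rfl _
      | succ n => exact r1.cup_lv (m := 1) hη2
    refine ((r0.sub s1).sub (hη.cup_right (f := sg b1) n)).congr ?_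
    show _ = a0 - (D (b0 - cup b1 η) + cup (sg b1) θ)
    rw [D_sub_fun, leibniz_fun _ _ n2 mη.1, cup_sub_right, cup_sub_left]; abel
  · show _ = c - (pb π (b0 - cup b1 η) + cup (pb π b1) τ - D e)
    rw [map_sub, pb_cup, cup_sub_right]; abel

/-- assembling levels -/
def asm (k : ℕ) (F : ℕ → List Y → R) : List Y → R := fun l => F (l.length + k) l
theorem asm_mem (k : ℕ) {F : ℕ → List Y → R} (hF : ∀ n, F n ∈ Coch Γ Y R) :
    asm k F ∈ Coch Γ Y R :=
  ⟨(hF _).1, fun γ l => by simp only [asm, List.length_map]; exact (hF _).2 γ l⟩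

/-- The Leray-Hirsch theorem. -/
theorem LH [CompactSpace Y] [CompactSpace W] (hUY : Unif Γ Y) (hUW : Unif Γ W) {π : W → Y}
    (hc : Continuous π) (hsurj : Function.Surjective π) (hπ : Eqv Γ π)
    {Jp : Prop} {θ : List Y → R} {τ : List W → R} (hτ : τ ∈ Coch Γ W R) (hτ2 : Lv 2 τ)
    (hθ : θ ∈ Coch Γ Y R) (hθ3 : Lv 3 θ) (hDθ : ∀ y, Z0 (D θ) y)
    (hDτ : ∀ x, Z0 (pb π θ - D τ) x) (hθd : ∀ y, θ [y, y, y] = 0)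
    (hF : ∀ y, letI := subG (fib_inv hπ y)
      FibOK Γ (π ⁻¹' orb Γ y) R Jp (pb Subtype.val τ))
    {a0 a1 : List Y → R} {c : List W → R} (m0 : a0 ∈ Coch Γ Y R) (m1 : a1 ∈ Coch Γ Y R)
    (mc : c ∈ Coch Γ W R) (hJ : ¬ Jp → a1 = 0)
    (h0 : ∀ y, Z0 (D a0 + cup (sg a1) θ) y) (h1 : ∀ y, Z0 (D a1) y)
    (h2 : ∀ x, Z0 (pb π a0 + cup (pb π a1) τ - D c) x) :
    ∃ b0 ∈ Coch Γ Y R, ∃ b1 ∈ Coch Γ Y R, ∃ e ∈ Coch Γ W R, (¬ Jp → b1 = 0) ∧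
      (∀ y, Z0 (a0 - (D b0 + cup (sg b1) θ)) y) ∧ (∀ y, Z0 (a1 - D b1) y) ∧
      ∀ x, Z0 (c - (pb π b0 + cup (pb π b1) τ - D e)) x := by
  classical
  let d : MM Γ Y W R Jp →+ MM Γ Y W R Jp :=
    ((dM π θ τ).comp (MM Γ Y W R Jp).subtype).codRestrict _ fun m => dM_mem hπ hθ hτ m.2
  have hd : ∀ m, (d m).1 = dM π θ τ m.1 := fun m => rfl
  have main := local_global (Γ := Γ) d (fun n m y => NN π n m.1 y)
    (fun m y => ⟨G0_lvl0 m.2.1.1 _, G0_lvl0 m.2.2.1.1 _, fun x _ => G0_lvl0 m.2.2.2.1.1 _⟩)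
    (fun n m m' y h h' => ⟨h.1.add h'.1, h.2.1.add h'.2.1,
      fun x hx => (h.2.2 x hx).add (h'.2.2 x hx)⟩)
    (fun n m y h => ⟨h.1.neg, h.2.1.neg, fun x hx => (h.2.2 x hx).neg⟩)
    (fun n m y h => dM_NN hc hθ3 hτ2 m.2 h)
    (fun n m y => dMdM hc hθ.1 hτ.1 hDθ hDτ m.2 n y)
    (fun n m => NN_open hc n m.1)
    (fun n m γ y h => NN_act hπ m.2 γ h)
    (by
      rintro S iS ⟨⟨u0, u1, u2⟩, k0, k1, k2, k3⟩
      simp only at k0 k1 k2 k3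
      have iS' : InvS Γ (π ⁻¹' S) := fun γ x hx => by
        show π (act γ x) ∈ S
        rw [hπ]; exact iS γ _ hx
      have hin : ∀ x, π x ∈ interior S → x ∈ interior (π ⁻¹' S) := fun x hx =>
        preimage_interior_subset_interior_preimage hc hx
      have hout : ∀ x, π x ∈ interior Sᶜ → x ∈ interior (π ⁻¹' S)ᶜ := fun x hx =>
        preimage_interior_subset_interior_preimage hc hx
      have hm2 : ((headS S u0, headS S u1, headS (π ⁻¹' S) u2) :
          (List Y → R) × (List Y → R) × (List W → R)) ∈ MM Γ Y W R Jp :=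
        ⟨Coch.headS iS k0, Coch.headS iS k1, Coch.headS iS' k2, fun h => by simp [k3 h]⟩
      refine ⟨⟨(u0, u1, u2), k0, k1, k2, k3⟩ - ⟨_, hm2⟩, ⟨_, hm2⟩, by abel, ?_, ?_, ?_⟩
      · intro n y hy
        exact ⟨headS_in k0.1 hy, headS_in k1.1 hy, fun x hx =>
          headS_in k2.1 (hin x (hx ▸ hy))⟩
      · intro n y hy
        exact ⟨headS_out hy, headS_out hy, fun x hx => headS_out (hout x (hx ▸ hy))⟩
      · intro n y hy
        have : NN π n (headS S u0, headS S u1, headS (π ⁻¹' S) u2) y :=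
          ⟨headS_G0 hy.1, headS_G0 hy.2.1, fun x hx => headS_G0 (hy.2.2 x hx)⟩
        exact ⟨NN.sub hy this, this⟩)
    (by
      rintro n m y h
      obtain ⟨m', hm', h'⟩ := local_tw hUY hUW hc hsurj hπ hτ hτ2 hθ hθ3 hDθ hDτ hθd y (hF y)
        n m.1 m.2 h
      exact ⟨⟨m', hm'⟩, h'⟩)
  let m : MM Γ Y W R Jp := ⟨(a0, a1, c), m0, m1, mc, hJ⟩
  have hm : ∀ n, ∃ m' : MM Γ Y W R Jp, ∀ y, NN π n (m - d m').1 y := by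
    intro n
    obtain ⟨m', h'⟩ := main n univ isClosed_univ (fun _ _ _ => trivial) m
      (fun y _ => ⟨h0 y _, h1 y _, fun x hx => h2 x _⟩)
    exact ⟨m', fun y => h' y trivial⟩
  choose F hFm using hm
  let M : MM Γ Y W R Jp := ⟨(asm 1 fun n => (F n).1.1, asm 2 fun n => (F n).1.2.1,
    asm 2 fun n => (F n).1.2.2), asm_mem 1 fun n => (F n).2.1, asm_mem 2 fun n => (F n).2.2.1,
    asm_mem 2 fun n => (F n).2.2.2.1, fun h => by
      funext l
      show (F _).1.2.1 l = 0
      rw [(F _).2.2.2.2 h]; rfl⟩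
  have hM : ∀ n y, NN π n (m - d M).1 y := by
    intro n y
    cases n with
    | zero => exact ⟨G0_lvl0 (m - d M).2.1.1 _, G0_lvl0 (m - d M).2.2.1.1 _,
        fun x _ => G0_lvl0 (m - d M).2.2.2.1.1 _⟩
    | succ n =>
      have e1 : NN π n (F (n + 1) - M).1 y := by
        refine ⟨G0_low (fun l hl => ?_) y, ?_, fun x hx => ?_⟩
        · show (F (n + 1)).1.1 l - (F (l.length + 1)).1.1 l = 0
          rw [hl, sub_self]
        · cases n with
          | zero => exact G0_lvl0 (F 1 - M).2.2.1.1 _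
          | succ n =>
            refine G0_low (fun l hl => ?_) y
            show (F (n + 2)).1.2.1 l - (F (l.length + 2)).1.2.1 l = 0
            simp only [Nat.add_sub_cancel] at hl
            rw [hl, sub_self]
        · cases n with
          | zero => exact G0_lvl0 (F 1 - M).2.2.2.1.1 _
          | succ n =>
            refine G0_low (fun l hl => ?_) x
            show (F (n + 2)).1.2.2 l - (F (l.length + 2)).1.2.2 l = 0
            simp only [Nat.add_sub_cancel] at hl
            rw [hl, sub_self]
      have e2 := dM_NN hc hθ3 hτ2 (F (n + 1) - M).2 e1
      have e3 := hFm (n + 1) y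
      have e4 := NN.sub e3 (m' := - dM π θ τ (F (n + 1) - M).1)
        ⟨e2.1.neg, e2.2.1.neg, fun x hx => (e2.2.2 x hx).neg⟩
      convert e4 using 1
      show m.1 - dM π θ τ M.1 = m.1 - dM π θ τ (F (n + 1)).1 - - dM π θ τ ((F (n + 1)).1 - M.1)
      rw [map_sub]; abel
  refine ⟨M.1.1, M.2.1, M.1.2.1, M.2.2.1, M.1.2.2, M.2.2.2.1, M.2.2.2.2, fun y n => (hM n y).1,
    fun y n => ?_, fun x n => ?_⟩
  · exact (hM (n + 1) y).2.1
  · exact (hM (n + 1) (π x)).2.2 x rfl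

end LH
end Volo

namespace Volo
open scoped Topology
open GSp

section Contr
variable {Γ X R : Type} [AddCommGroup Γ] [Finite Γ] [MetricSpace X] [GSp Γ X]
  [CommRing R]

theorem contr (hU : Unif Γ X) {A : Set X} (iA : InvS Γ A) (hA : IsCompact A) (o : X)
    (H : ℝ → A → X) (hH : Continuous fun q : ℝ × A => H q.1 q.2)
    (heq : letI := subG iA
      ∀ s, Eqv Γ (H s)) (h0 : ∀ a, H 0 a = a.1) (h1 : ∀ a, H 1 a ∈ orb Γ o) {n : ℕ}
    {f : List X → R} (hf : f ∈ Coch Γ X R) (hD : ∀ x, G0 (n + 3) (D f) x) :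
    ∃ g ∈ Coch Γ X R, ∀ x ∈ A, G0 (n + 2) (f - D g) x := by
  letI := subG iA
  haveI : CompactSpace A := isCompact_iff_compactSpace.1 hA
  obtain ⟨g, hg, h⟩ := homotopy H hH heq (n := n + 1) hf hD
  obtain ⟨k, mk, hk⟩ := point_lemma hU o hf (n := n) (hD o)
  have hk' : ∀ y ∈ orb Γ o, G0 (n + 2) (f - D k) y := by
    rintro _ ⟨γ, rfl⟩
    exact hk.act (sub_mem hf (Coch.D mk)) γ
  obtain ⟨g', hg', h'⟩ := taut hU (Subtype.val : A → X) continuous_subtype_val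
    Subtype.val_injective (subG_val iA) (n := n + 1) hf (fun s => hD s.1)
    (g := pb (H 1) k - g) (sub_mem (Coch.pb mk (heq 1)) hg) (fun s => by
      have e1 := (hk' _ (h1 s)).pb (φ := H 1) (x := s)
        (hH.comp (Continuous.prodMk_right 1)).continuousAt
      refine (e1.sub (h s)).congr ?_
      rw [map_sub, D_sub_fun, pb_D]
      have : pb (H 0) f = pb Subtype.val f := by
        have : H 0 = Subtype.val := funext h0
        rw [this]
      rw [this]; abel)
  exact ⟨g', hg', fun x hx => h' ⟨x, hx⟩⟩

theorem contr1 {A : Set X} (iA : InvS Γ A) (hA : IsCompact A) (o : X)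
    (H : ℝ → A → X) (hH : Continuous fun q : ℝ × A => H q.1 q.2)
    (heq : letI := subG iA
      ∀ s, Eqv Γ (H s)) (h0 : ∀ a, H 0 a = a.1) (h1 : ∀ a, H 1 a ∈ orb Γ o)
    {f : List X → R} (hf : f ∈ Coch Γ X R) (hD : ∀ x, G0 2 (D f) x) :
    ∀ x ∈ A, f [x] = f [o] := by
  letI := subG iA
  haveI : CompactSpace A := isCompact_iff_compactSpace.1 hA
  obtain ⟨g, hg, h⟩ := homotopy H hH heq (n := 0) hf hD
  intro x hx
  obtain ⟨U, hU, hh⟩ := h ⟨x, hx⟩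
  have := hh [⟨x, hx⟩] rfl (by simpa using mem_of_mem_nhds hU)
  simp only [Pi.sub_apply, pb_apply, List.map_cons, List.map_nil, h0] at this
  obtain ⟨γ, hγ⟩ := h1 ⟨x, hx⟩
  have e2 := hf.2 γ [o]
  simp only [List.map_cons, List.map_nil] at e2
  rw [← hγ] at this
  simp only at this
  rw [e2] at this
  simp [D, hg.1] at this
  rw [sub_eq_zero] at this
  exact this.symm

theorem G0_one_of {f : List X → R} (x : X) (h : ∀ y, f [y] = 0) : G0 1 f x :=
  G0_low (fun l hl => by
    obtain ⟨a, rfl⟩ := List.length_eq_one_iff.1 hl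
    exact h a) x

theorem G0_one_at {f : List X → R} {x : X} (h : G0 1 f x) : f [x] = 0 := by
  obtain ⟨U, hU, hh⟩ := h
  exact hh [x] rfl (by simpa using mem_of_mem_nhds hU)

theorem D_lvl1 {g : List X → R} (hg : g [] = 0) (x : X) : G0 1 (D g) x :=
  G0_one_of x fun y => by simp [D, hg]

end Contr

section Circ
variable {Γ F R : Type} [AddCommGroup Γ] [Finite Γ] [MetricSpace F] [CompactSpace F] [GSp Γ F]
  [Field R]

/-- circle like spaces -/
structure CircL (Γ F : Type) [AddCommGroup Γ] [MetricSpace F] [GSp Γ F] (q : F → ℂ)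
    (ρ : ℝ → F → F) : Prop where
  qc : Continuous q
  qn : ∀ x, ‖q x‖ = 1
  qi : ∀ (γ : Γ) x, q (act γ x) = q x
  qo : ∀ x y, q x = q y → ∃ γ : Γ, act γ x = y
  ρc : Continuous fun u : ℝ × F => ρ u.1 u.2
  ρe : ∀ s, Eqv Γ (ρ s)
  ρ0 : ∀ x, ρ 0 x = x
  ρq : ∀ s x, q (ρ s x) = Complex.exp (s * Complex.I) * q x
  ne : Nonempty F

variable {q : F → ℂ} {ρ : ℝ → F → F}

theorem CircL.surj (h : CircL Γ F q ρ) (z : ℂ) (hz : ‖z‖ = 1) : ∃ x, q x = z := by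
  obtain ⟨x⟩ := h.ne
  refine ⟨ρ (Complex.arg z - Complex.arg (q x)) x, ?_⟩
  rw [h.ρq]
  have e1 := Complex.norm_mul_exp_arg_mul_I z
  have e2 := Complex.norm_mul_exp_arg_mul_I (q x)
  rw [h.qn] at e2
  rw [hz] at e1
  simp only [Complex.ofReal_one, one_mul] at e1 e2
  generalize Complex.arg (q x) = t at e2 ⊢
  generalize Complex.arg z = u at e1 ⊢
  rw [← e1, ← e2, ← Complex.exp_add]
  congr 1
  push_cast; ring

/-- the homotopy on a half circle -/
theorem CircL.half (h : CircL Γ F q ρ) (σ : ℂ) (hσ : ‖σ‖ = 1) (o : F) (ho : q o = σ) :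
    ∃ H : ℝ → {x | 0 ≤ (q x / σ).re} → F, Continuous (fun u : ℝ × {x | 0 ≤ (q x / σ).re} => H u.1 u.2) ∧
      (∀ (s : ℝ) (γ : Γ) (x y : {x | 0 ≤ (q x / σ).re}), y.1 = act γ x.1 → H s y = act γ (H s x)) ∧
      (∀ a, H 0 a = a.1) ∧ (∀ a, H 1 a ∈ orb Γ o) := by
  have hσ0 : σ ≠ 0 := by rintro rfl; simp at hσ
  refine ⟨fun s x => ρ (-(s * Complex.arg (q x.1 / σ))) x.1, ?_, ?_, ?_, ?_⟩
  · have hq : Continuous fun x : {x | 0 ≤ (q x / σ).re} => Complex.arg (q x.1 / σ) := by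
      rw [continuous_iff_continuousAt]
      intro x
      refine (Complex.continuousAt_arg ?_).comp
        (h.qc.comp continuous_subtype_val |>.div_const σ).continuousAt
      rw [Complex.mem_slitPlane_iff]
      have hx : 0 ≤ (q x.1 / σ).re := x.2
      by_contra hcon
      push Not at hcon
      have h0 : q x.1 / σ = 0 := Complex.ext (le_antisymm hcon.1 hx) (by simpa using hcon.2)
      have := h.qn x.1
      rw [div_eq_zero_iff] at h0
      rcases h0 with h0 | h0
      · rw [h0] at this; simp at this
      · exact hσ0 h0
    exact h.ρc.comp ((continuous_fst.mul (hq.comp continuous_snd)).neg.prodMk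
      (continuous_subtype_val.comp continuous_snd))
  · intro s γ x y hy
    simp only
    rw [hy, h.qi, h.ρe]
  · intro a
    simp [h.ρ0]
  · intro a
    obtain ⟨γ, hγ⟩ := h.qo o (ρ (-(1 * Complex.arg (q a.1 / σ))) a.1) (by
      rw [h.ρq, ho]
      have e2 := Complex.norm_mul_exp_arg_mul_I (q a.1 / σ)
      rw [norm_div, h.qn, hσ] at e2
      have e3 : q a.1 = Complex.exp (Complex.arg (q a.1 / σ) * Complex.I) * σ := by
        rw [eq_comm, ← eq_div_iff hσ0]; simpa using e2
      conv_rhs => rw [e3]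
      rw [← mul_assoc, ← Complex.exp_add]
      have : (((-(1 * Complex.arg (Complex.exp (Complex.arg (q a.1 / σ) * Complex.I) * σ / σ))) : ℝ) : ℂ)
        * Complex.I + Complex.arg (q a.1 / σ) * Complex.I = 0 := by
        rw [mul_div_assoc, div_self hσ0, mul_one]
        have : Complex.exp (Complex.arg (q a.1 / σ) * Complex.I) = q a.1 / σ := by simpa using e2
        rw [this]; push_cast; ring
      rw [this]; simp)
    exact ⟨γ, hγ⟩

theorem half_inv (h : CircL Γ F q ρ) (σ : ℂ) : InvS Γ {x | 0 ≤ (q x / σ).re} := by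
  intro γ x hx
  simp only [mem_ofPred_eq] at hx ⊢
  rw [h.qi]; exact hx

theorem half_closed (h : CircL Γ F q ρ) (σ : ℂ) : IsClosed {x | 0 ≤ (q x / σ).re} :=
  isClosed_le continuous_const (Complex.continuous_re.comp (h.qc.div_const σ))

theorem CircL.half_co (h : CircL Γ F q ρ) (hU : Unif Γ F) (σ : ℂ) (hσ : ‖σ‖ = 1) {n : ℕ}
    {f : List F → R} (hf : f ∈ Coch Γ F R) (hD : ∀ x, G0 (n + 3) (D f) x) :
    ∃ g ∈ Coch Γ F R, ∀ x, 0 ≤ (q x / σ).re → G0 (n + 2) (f - D g) x := by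
  obtain ⟨o, ho⟩ := h.surj σ hσ
  obtain ⟨H, h1, h2, h3, h4⟩ := h.half σ hσ o ho
  exact contr hU (half_inv h σ) (half_closed h σ).isCompact o H h1
    (fun s γ x => h2 s γ x _ rfl) h3 h4 hf hD

theorem CircL.half_co1 (h : CircL Γ F q ρ) (σ : ℂ) (hσ : ‖σ‖ = 1)
    {f : List F → R} (hf : f ∈ Coch Γ F R) (hD : ∀ x, G0 2 (D f) x) :
    ∃ c : R, ∀ x, 0 ≤ (q x / σ).re → f [x] = c := by
  obtain ⟨o, ho⟩ := h.surj σ hσ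
  obtain ⟨H, h1, h2, h3, h4⟩ := h.half σ hσ o ho
  exact ⟨_, contr1 (half_inv h σ) (half_closed h σ).isCompact o H h1
    (fun s γ x => h2 s γ x _ rfl) h3 h4 hf hD⟩
end Circ
end Volo

namespace Volo
open scoped Topology
open GSp

section Circ2
variable {Γ F R : Type} [AddCommGroup Γ] [Finite Γ] [MetricSpace F] [CompactSpace F] [GSp Γ F]
  [Field R] {q : F → ℂ} {ρ : ℝ → F → F}

theorem D_two {X R : Type} [CommRing R] (f : List X → R) (hf : f [] = 0) (a b : X) :
    D f [a, b] = f [b] - f [a] := by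
  simp [D, hf]

theorem path_const {X R : Type} [MetricSpace X] [CommRing R] {f : List X → R} (hf : f [] = 0)
    (c : ℝ → X) (hc : Continuous c)
    (h : ∀ s, 0 ≤ s → s ≤ 1 → G0 2 (D f) (c s)) : f [c 0] = f [c 1] := by
  have : IsLocallyConstant fun s : Icc (0 : ℝ) 1 => f [c s.1] := by
    rw [IsLocallyConstant.iff_eventually_eq]
    rintro ⟨s, h0, h1⟩
    obtain ⟨U, hU, hh⟩ := h s h0 h1
    filter_upwards [(hc.comp continuous_subtype_val).continuousAt (x := (⟨s, h0, h1⟩ : Icc (0 : ℝ) 1)) hU]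
      with y hy
    have := hh [c s, c y.1] rfl (by
      simp only [List.mem_cons, List.not_mem_nil, or_false, forall_eq_or_imp, forall_eq]
      exact ⟨mem_of_mem_nhds hU, hy⟩)
    rw [D_two f hf, sub_eq_zero] at this
    exact this
  exact this.apply_eq_of_preconnectedSpace ⟨0, by simp⟩ ⟨1, by simp⟩

theorem CircL.pm (h : CircL Γ F q ρ) {x : F} (h1 : 0 ≤ (q x / 1).re) (h2 : 0 ≤ (q x / (-1)).re) :
    q x = Complex.I ∨ q x = -Complex.I := by
  have h3 := h.qn x
  simp only [div_one, div_neg, Complex.neg_re] at h1 h2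
  have hr : (q x).re = 0 := by linarith
  rw [← sq_eq_sq₀ (by positivity) (by positivity), ← Complex.normSq_eq_norm_sq,
    Complex.normSq_apply, hr] at h3
  have : ((q x).im - 1) * ((q x).im + 1) = 0 := by linarith
  rcases mul_eq_zero.1 this with h4 | h4
  · left; apply Complex.ext <;> simp <;> linarith
  · right; apply Complex.ext <;> simp <;> linarith

theorem CircL.orbv (h : CircL Γ F q ρ) {f : List F → R} (hf : f ∈ Coch Γ F R) {x y : F}
    (e : q x = q y) : f [x] = f [y] := by
  obtain ⟨γ, rfl⟩ := h.qo x y e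
  exact (hf.2 γ [x]).symm

theorem CircL.orbG (h : CircL Γ F q ρ) {f : List F → R} (hf : f ∈ Coch Γ F R) {x y : F}
    (e : q x = q y) {n : ℕ} (hx : G0 n f x) : G0 n f y := by
  obtain ⟨γ, rfl⟩ := h.qo x y e
  exact hx.act hf γ

theorem CircL.half_eq (h : CircL Γ F q ρ) {σ : ℂ} (hσ : σ = 1 ∨ σ = -1) {f : List F → R}
    (hf : f ∈ Coch Γ F R) (hD : ∀ x, 0 ≤ (q x / σ).re → G0 2 (D f) x) {x y : F}
    (hx : q x = Complex.I) (hy : q y = -Complex.I) : f [x] = f [y] := by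
  rcases hσ with rfl | rfl
  · have := path_const hf.1 (fun s => ρ (-(s * Real.pi)) x)
      (h.ρc.comp (by fun_prop : Continuous fun s : ℝ => (-(s * Real.pi), x))) (fun s h0 h1 => hD _ (by
        rw [h.ρq, hx, Complex.exp_mul_I, ← Complex.ofReal_cos, ← Complex.ofReal_sin]
        simp only [div_one, Real.cos_neg, Real.sin_neg]
        simp
        rw [← Complex.ofReal_mul, ← Complex.ofReal_cos, ← Complex.ofReal_sin, Complex.ofReal_re,
          Complex.ofReal_im]
        simpa using Real.sin_nonneg_of_nonneg_of_le_pi (mul_nonneg h0 Real.pi_pos.le)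
          (mul_le_of_le_one_left Real.pi_pos.le h1)))
    simp only [zero_mul, neg_zero, h.ρ0, one_mul] at this
    rw [this]
    refine h.orbv hf ?_
    rw [h.ρq, hx, hy, Complex.exp_mul_I, ← Complex.ofReal_cos, ← Complex.ofReal_sin]
    simp
  · have := path_const hf.1 (fun s => ρ (s * Real.pi) x)
      (h.ρc.comp (by fun_prop : Continuous fun s : ℝ => (s * Real.pi, x))) (fun s h0 h1 => hD _ (by
        rw [h.ρq, hx, Complex.exp_mul_I, ← Complex.ofReal_cos, ← Complex.ofReal_sin]
        simp [div_neg]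
        rw [← Complex.ofReal_mul, ← Complex.ofReal_cos, ← Complex.ofReal_sin, Complex.ofReal_re,
          Complex.ofReal_im]
        simpa using Real.sin_nonneg_of_nonneg_of_le_pi (mul_nonneg h0 Real.pi_pos.le)
          (mul_le_of_le_one_left Real.pi_pos.le h1)))
    simp only [zero_mul, neg_zero, h.ρ0, one_mul] at this
    rw [this]
    refine h.orbv hf ?_
    rw [h.ρq, hx, hy, Complex.exp_mul_I, ← Complex.ofReal_cos, ← Complex.ofReal_sin]
    simp

theorem CircL.fibOK (h : CircL Γ F q ρ) (hU : Unif Γ F) {τ tA tB : List F → R}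
    (mτ : τ ∈ Coch Γ F R) (mA : tA ∈ Coch Γ F R) (mB : tB ∈ Coch Γ F R)
    (hA : ∀ x, 0 ≤ (q x / 1).re → G0 2 (τ - D tA) x)
    (hB : ∀ x, 0 ≤ (q x / (-1)).re → G0 2 (τ - D tB) x) {xp xm : F}
    (hp : q xp = Complex.I) (hm : q xm = -Complex.I)
    (hne : (tA - tB) [xp] - (tA - tB) [xm] ≠ 0) : FibOK Γ F R True τ := by
  have Ap : 0 ≤ (q xp / 1).re := by simp [hp]
  have Am : 0 ≤ (q xm / 1).re := by simp [hm]
  have Bp : 0 ≤ (q xp / (-1)).re := by simp [hp, div_neg]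
  have Bm : 0 ≤ (q xm / (-1)).re := by simp [hm, div_neg]
  have hcov : ∀ x, x ∈ {x | 0 ≤ (q x / 1).re} ∪ {x | 0 ≤ (q x / (-1)).re} := by
    intro x
    simp only [mem_union, mem_ofPred_eq, div_one, div_neg, Complex.neg_re]
    rcases le_total 0 (q x).re with h | h
    · exact Or.inl h
    · exact Or.inr (by linarith)
  refine ⟨fun f hf hD => ⟨f [xp], fun x => G0_one_of x fun y => ?_⟩, fun n f hf hD => ?_,
    fun _ c g hg hh => ?_⟩
  · have e : f [xp] = f [y] := by
      have := path_const hf.1 (fun s => ρ (s * (Complex.arg (q y) - Complex.arg (q xp))) xp)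
        (h.ρc.comp (by fun_prop : Continuous fun s : ℝ =>
          (s * (Complex.arg (q y) - Complex.arg (q xp)), xp))) (fun s h0 h1 => hD _)
      simp only [zero_mul, h.ρ0, one_mul] at this
      rw [this]
      refine h.orbv hf ?_
      rw [h.ρq]
      have e1 := Complex.norm_mul_exp_arg_mul_I (q y)
      have e2 := Complex.norm_mul_exp_arg_mul_I (q xp)
      rw [h.qn] at e2 e1
      simp only [Complex.ofReal_one, one_mul] at e1 e2
      generalize Complex.arg (q xp) = t at e2 ⊢
      generalize Complex.arg (q y) = u at e1 ⊢
      rw [← e1, ← e2, ← Complex.exp_add]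
      congr 1
      push_cast; ring
    simp [one, e]
  · obtain ⟨gA, mgA, hgA⟩ := h.half_co hU 1 (by simp) hf hD
    obtain ⟨gB, mgB, hgB⟩ := h.half_co hU (-1) (by simp) hf hD
    cases n with
    | succ n =>
      refine ⟨0, fun _ => rfl, ?_⟩
      have hm1 : gA - gB ∈ Coch Γ F R := sub_mem mgA mgB
      have hDh : ∀ x, 0 ≤ (q x / 1).re → 0 ≤ (q x / (-1)).re → G0 (n + 3) (D (gA - gB)) x := by
        intro x h1 h2
        refine ((hgB x h2).sub (hgA x h1)).congr ?_
        rw [D_sub_fun]; abel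
      obtain ⟨mp, mmp, hmp⟩ := point_lemma hU xp hm1 (hDh xp Ap Bp)
      obtain ⟨mm, mmm, hmm⟩ := point_lemma hU xm hm1 (hDh xm Am Bm)
      obtain ⟨m, mm', hm'⟩ := mv_glue (B := orb Γ xp) (C := orb Γ xm) (m := 0)
        (orb_finite xp).isClosed (orb_finite xm).isClosed (orb_inv xp)
        (orb_inv xm) (n := n + 1) mmp mmm (zero_mem _)
        (fun x hx => by
          obtain ⟨γ, rfl⟩ := hx
          exact hmp.act (sub_mem hm1 (Coch.D mmp)) γ)
        (fun x hx => by
          obtain ⟨γ, rfl⟩ := hx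
          exact hmm.act (sub_mem hm1 (Coch.D mmm)) γ)
        (fun x hx => by
          obtain ⟨⟨γ, h1⟩, ⟨γ', h2⟩⟩ := hx
          exfalso
          have e1 := h.qi γ xp
          have e2 := h.qi γ' xm
          simp only at h1 h2
          rw [h1, hp] at e1
          rw [h2, hm, e1] at e2
          have := congrArg Complex.im e2
          simp at this
          norm_num at this)
      obtain ⟨g, mg, hg⟩ := mv_glue (half_closed h 1) (half_closed h (-1)) (half_inv h 1)
        (half_inv h (-1)) (n := n + 2) mgA mgB mm' (f := f) (fun x hx => hgA x hx)
        (fun x hx => hgB x hx) (fun x hx => hm' x (by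
          rcases h.pm hx.1 hx.2 with e | e
          · left
            obtain ⟨γ, hγ⟩ := h.qo xp x (by rw [hp, e])
            exact ⟨γ, hγ⟩
          · right
            obtain ⟨γ, hγ⟩ := h.qo xm x (by rw [hm, e])
            exact ⟨γ, hγ⟩))
      exact ⟨g, mg, fun x => (hg x (hcov x)).congr (by simp)⟩
    | zero =>
      set c := ((gA - gB) [xp] - (gA - gB) [xm]) / ((tA - tB) [xp] - (tA - tB) [xm]) with hc
      refine ⟨c, fun h => absurd trivial h, ?_⟩
      have hceq : c * ((tA - tB) [xp] - (tA - tB) [xm]) = (gA - gB) [xp] - (gA - gB) [xm] := by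
        rw [hc]; field_simp
      simp only [Pi.sub_apply] at hceq
      set k : R := (gA - gB) [xp] - c * (tA - tB) [xp] with hk
      simp only [Pi.sub_apply] at hk
      have m1 : gA - c • tA ∈ Coch Γ F R := sub_mem mgA (Submodule.smul_mem _ c mA)
      have m2 : gB - c • tB + k • one ∈ Coch Γ F R := add_mem (sub_mem mgB
        (Submodule.smul_mem _ c mB)) (Submodule.smul_mem _ k one_mem)
      have d1 : ∀ x, 0 ≤ (q x / 1).re → G0 2 (f - c • τ - D (gA - c • tA)) x := fun x hx => by
        refine ((hgA x hx).sub ((hA x hx).smul c)).congr ?_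
        rw [D_sub_fun, D_smul_fun, smul_sub]; abel
      have d2 : ∀ x, 0 ≤ (q x / (-1)).re → G0 2 (f - c • τ - D (gB - c • tB + k • one)) x :=
        fun x hx => by
        refine ((hgB x hx).sub ((hB x hx).smul c)).congr ?_
        rw [D_add_fun, D_sub_fun, D_smul_fun, D_smul_fun, D_one, smul_sub]; simp; abel
      obtain ⟨g, mg, hg⟩ := mv_glue (half_closed h 1) (half_closed h (-1)) (half_inv h 1)
        (half_inv h (-1)) (n := 1) m1 m2 (zero_mem _) (f := f - c • τ) (fun x hx => d1 x hx)
        (fun x hx => d2 x hx) (fun x hx => by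
          have hd : G0 2 (D (gA - c • tA - (gB - c • tB + k • one))) x := by
            refine ((d2 x hx.2).sub (d1 x hx.1)).congr ?_
            rw [D_sub_fun (gA - c • tA) (gB - c • tB + k • one)]; abel
          have := point_lemma1 x (sub_mem m1 m2) hd
          have e0 : (gA - c • tA - (gB - c • tB + k • one) : List F → R) [x] = 0 := by
            rcases h.pm hx.1 hx.2 with e | e
            · rw [h.orbv (sub_mem m1 m2) (y := xp) (by rw [e, hp])]
              simp [one]; rw [hk]; ring
            · rw [h.orbv (sub_mem m1 m2) (y := xm) (by rw [e, hm])]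
              simp [one]; rw [hk]; linear_combination hceq
          rw [e0] at this
          refine this.congr ?_
          rw [show D (0 : List F → R) = 0 from by
            have := D_smul_fun (0 : R) (0 : List F → R); simpa using this]
          simp)
      exact ⟨g, mg, fun x => hg x (hcov x)⟩
  · have m1 : c • tA - g ∈ Coch Γ F R := sub_mem (Submodule.smul_mem _ c mA) hg
    have m2 : c • tB - g ∈ Coch Γ F R := sub_mem (Submodule.smul_mem _ c mB) hg
    have e1 := h.half_eq (Or.inl rfl) m1 (fun x hx => by
      refine ((hh x).sub ((hA x hx).smul c)).congr ?_
      rw [D_sub_fun, D_smul_fun, smul_sub]; abel) hp hm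
    have e2 := h.half_eq (Or.inr rfl) m2 (fun x hx => by
      refine ((hh x).sub ((hB x hx).smul c)).congr ?_
      rw [D_sub_fun, D_smul_fun, smul_sub]; abel) hp hm
    simp only [Pi.sub_apply, Pi.smul_apply, smul_eq_mul] at e1 e2 hne
    have : c * (tA [xp] - tB [xp] - (tA [xm] - tB [xm])) = 0 := by
      linear_combination e1 - e2
    exact (mul_eq_zero.1 this).resolve_right hne

end Circ2
end Volo

namespace Volo
open scoped Topology
open GSp

section Bock
variable {Γ X : Type} [AddCommGroup Γ] [Finite Γ] [MetricSpace X] [GSp Γ X]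
variable {p : ℕ} [Fact p.Prime]

/-- cochain on pairs -/
def c2 {X R : Type} [Zero R] (n : X → X → R) : List X → R
  | [a, b] => n a b
  | _ => 0

/-- invariance of a function of pairs -/
def Inv2 (Γ : Type) {X R : Type} [AddCommGroup Γ] [MetricSpace X] [GSp Γ X] (n : X → X → R) : Prop :=
  ∀ (γ : Γ) a b, n (act γ a) (act γ b) = n a b

theorem c2_mem {R : Type} [CommRing R] {n : X → X → R} (hn : Inv2 Γ n) : c2 n ∈ Coch Γ X R := by
  refine ⟨rfl, fun γ l => ?_⟩
  rcases l with _ | ⟨a, _ | ⟨b, _ | ⟨c, l⟩⟩⟩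
  · rfl
  · rfl
  · exact hn γ a b
  · rfl

theorem c2_lv {R : Type} [CommRing R] (n : X → X → R) : Lv 2 (c2 n) := by
  intro l hl
  rcases l with _ | ⟨a, _ | ⟨b, _ | ⟨c, l⟩⟩⟩
  · rfl
  · rfl
  · simp at hl
  · rfl

/-- the Bockstein cochain -/
def bock (p : ℕ) {X : Type} (n : X → X → ℤ) : List X → ZMod p
  | [a, b, c] => (((n b c - n a c + n a b) / (p : ℤ) : ℤ) : ZMod p)
  | _ => 0

/-- cocycle mod p -/
def Cyc (p : ℕ) {X : Type} (n : X → X → ℤ) : Prop := ∀ a b c, (p : ℤ) ∣ n b c - n a c + n a b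

theorem bock_mem {n : X → X → ℤ} (hn : Inv2 Γ n) : bock p n ∈ Coch Γ X (ZMod p) := by
  refine ⟨rfl, fun γ l => ?_⟩
  rcases l with _ | ⟨a, _ | ⟨b, _ | ⟨c, _ | ⟨d, l⟩⟩⟩⟩
  · rfl
  · rfl
  · rfl
  · simp [bock, hn γ]
  · rfl

theorem bock_lv (n : X → X → ℤ) : Lv 3 (bock p n) := by
  intro l hl
  rcases l with _ | ⟨a, _ | ⟨b, _ | ⟨c, _ | ⟨d, l⟩⟩⟩⟩
  · rfl
  · rfl
  · rfl
  · simp at hl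
  · rfl

theorem eq_of_lv {X R : Type} [CommRing R] {k : ℕ} {f g : List X → R} (hf : Lv k f) (hg : Lv k g)
    (h : ∀ l, l.length = k → f l = g l) : f = g := by
  funext l
  by_cases hl : l.length = k
  · exact h l hl
  · rw [hf l hl, hg l hl]

theorem len3 {X : Type} {P : List X → Prop} (h : ∀ a b c, P [a, b, c]) : ∀ l, l.length = 3 → P l := by
  intro l hl
  obtain ⟨a, b, c, rfl⟩ := List.length_eq_three.1 hl
  exact h a b c

theorem len4 {X : Type} {P : List X → Prop} (h : ∀ a b c d, P [a, b, c, d]) :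
    ∀ l, l.length = 4 → P l := by
  intro l hl
  rcases l with _ | ⟨a, _ | ⟨b, _ | ⟨c, _ | ⟨d, _ | ⟨e, l⟩⟩⟩⟩⟩ <;> simp at hl
  exact h a b c d

theorem D3 {X R : Type} [CommRing R] (f : List X → R) (a b c : X) :
    D f [a, b, c] = f [b, c] - f [a, c] + f [a, b] := by
  simp [D, DL]; ring
theorem D4 {X R : Type} [CommRing R] (f : List X → R) (a b c d : X) :
    D f [a, b, c, d] = f [b, c, d] - f [a, c, d] + f [a, b, d] - f [a, b, c] := by
  simp [D, DL]; ring

theorem bock_D {n : X → X → ℤ} (hn : Cyc p n) : D (bock p n) = 0 := by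
  have hp : (p : ℤ) ≠ 0 := by exact_mod_cast (Fact.out : p.Prime).ne_zero
  refine eq_of_lv ((bock_lv n).D (by norm_num)) (fun _ _ => rfl) (len4 fun a b c d => ?_)
  rw [D4]
  simp only [bock, Pi.zero_apply]
  obtain ⟨x, hx⟩ := hn b c d
  obtain ⟨y, hy⟩ := hn a c d
  obtain ⟨z, hz⟩ := hn a b d
  obtain ⟨w, hw⟩ := hn a b c
  rw [hx, hy, hz, hw]
  simp only [Int.mul_ediv_cancel_left _ hp]
  have : x - y + z - w = 0 := by
    apply mul_left_cancel₀ hp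
    linear_combination -hx + hy - hz + hw
  have h2 := congrArg (fun m : ℤ => (m : ZMod p)) this
  push_cast at h2
  exact h2

theorem bock_add {n n' r : X → X → ℤ} (hn : Cyc p n) (hn' : Cyc p n') :
    bock p (fun a b => n a b + n' a b + p * r a b) = bock p n + bock p n' + D (c2 fun a b => (r a b : ZMod p)) := by
  have hp : (p : ℤ) ≠ 0 := by exact_mod_cast (Fact.out : p.Prime).ne_zero
  refine eq_of_lv (bock_lv _) ?_ (len3 fun a b c => ?_)
  · intro l hl
    simp only [Pi.add_apply]
    rw [bock_lv n l hl, bock_lv n' l hl, (c2_lv _).D (by norm_num) l hl]; simp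
  simp only [Pi.add_apply]
  rw [D3]
  simp only [bock, c2]
  obtain ⟨x, hx⟩ := hn a b c
  obtain ⟨y, hy⟩ := hn' a b c
  have : n b c + n' b c + p * r b c - (n a c + n' a c + p * r a c) + (n a b + n' a b + p * r a b)
    = p * (x + y + (r b c - r a c + r a b)) := by linear_combination hx + hy
  rw [this, hx, hy]
  simp only [Int.mul_ediv_cancel_left _ hp]
  push_cast; ring

theorem bock_cob (v : X → ℤ) : bock p (fun a b => v b - v a) = 0 := by
  refine eq_of_lv (bock_lv _) (fun _ _ => rfl) (len3 fun a b c => ?_)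
  simp [bock]

/-- section of a character -/
def IsSec (χ : Γ →+ ZMod p) (s : X → ZMod p) : Prop := ∀ γ x, s (act γ x) = s x + χ γ

theorem exists_sec (χ : Γ →+ ZMod p) (h : ∀ γ (x : X), act γ x = x → χ γ = 0) :
    ∃ s : X → ZMod p, IsSec χ s := by
  classical
  let st : Setoid X := ⟨fun x y => ∃ γ : Γ, act γ x = y, fun x => ⟨0, act_zero x⟩,
    fun {x y} ⟨γ, hγ⟩ => ⟨-γ, by rw [← hγ, act_neg]⟩,
    fun {x y z} ⟨γ, hγ⟩ ⟨δ, hδ⟩ => ⟨δ + γ, by rw [act_add, hγ, hδ]⟩⟩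
  have hr : ∀ x : X, ∃ γ : Γ, act γ (Quotient.out (Quotient.mk st x)) = x := fun x =>
    Quotient.exact (Quotient.out_eq (Quotient.mk st x))
  choose g hg using hr
  refine ⟨fun x => χ (g x), fun γ x => ?_⟩
  have e : Quotient.mk st (act γ x) = Quotient.mk st x := Quotient.sound
    ((⟨-γ, act_neg γ x⟩ : ∃ δ : Γ, act δ (act γ x) = x))
  have h1 := hg (act γ x)
  rw [e] at h1
  have h2 := hg x
  have : act (-(γ + g x) + g (act γ x)) (Quotient.out (Quotient.mk st x)) =
      Quotient.out (Quotient.mk st x) := by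
    have h3 : act γ x = act (γ + g x) (Quotient.out (Quotient.mk st x)) := by
      rw [act_add, h2]
    rw [act_add, h1, h3, act_neg]
  have := h _ _ this
  rw [map_add, map_neg, map_add] at this
  linear_combination this

/-- integer lift of the differences -/
def nS (s : X → ZMod p) (a b : X) : ℤ := ((s b - s a).val : ℤ)

theorem nS_inv {χ : Γ →+ ZMod p} {s : X → ZMod p} (hs : IsSec χ s) : Inv2 Γ (nS s) := by
  intro γ a b
  simp [nS, hs γ]

theorem nS_cast (s : X → ZMod p) (a b : X) : ((nS s a b : ℤ) : ZMod p) = s b - s a := by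
  simp [nS]

theorem cyc_of_cast {n : X → X → ℤ} {s : X → ZMod p} (h : ∀ a b, (n a b : ZMod p) = s b - s a) :
    Cyc p n := by
  intro a b c
  rw [← ZMod.intCast_zmod_eq_zero_iff_dvd]
  push_cast
  rw [h, h, h]; ring

/-- the class of a section -/
def tS (s : X → ZMod p) : List X → ZMod p := bock p (nS s)

theorem tS_mem {χ : Γ →+ ZMod p} {s : X → ZMod p} (hs : IsSec χ s) : tS s ∈ Coch Γ X (ZMod p) :=
  bock_mem (nS_inv hs)
theorem tS_lv (s : X → ZMod p) : Lv 3 (tS s) := bock_lv _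
theorem tS_D (s : X → ZMod p) : D (tS s) = 0 := bock_D (cyc_of_cast (nS_cast s))
theorem tS_diag (s : X → ZMod p) (x : X) : tS s [x, x, x] = 0 := by simp [tS, bock, nS]
theorem tS_pb {X1 : Type} (s : X → ZMod p) (φ : X1 → X) : pb φ (tS s) = tS (s ∘ φ) := by
  funext l
  rcases l with _ | ⟨a, _ | ⟨b, _ | ⟨c, _ | ⟨d, l⟩⟩⟩⟩ <;> rfl

theorem tS_add {χ χ' : Γ →+ ZMod p} {s s' s'' : X → ZMod p} (hs : IsSec χ s) (hs' : IsSec χ' s')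
    (hs'' : IsSec (χ + χ') s'') :
    ∃ r ∈ Coch Γ X (ZMod p), tS s'' = tS s + tS s' + D r := by
  have hp : (p : ℤ) ≠ 0 := by exact_mod_cast (Fact.out : p.Prime).ne_zero
  let w : X → ℤ := fun x => ((s'' x - s x - s' x).val : ℤ)
  have hw : ∀ (γ : Γ) x, w (act γ x) = w x := by
    intro γ x
    simp only [w]; congr 2
    rw [hs'', hs, hs', AddMonoidHom.add_apply]; ring
  let r : X → X → ℤ := fun a b => (nS s'' a b - nS s a b - nS s' a b - (w b - w a)) / p
  have hr : ∀ a b, nS s'' a b = nS s a b + (nS s' a b + (w b - w a)) + p * r a b := by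
    intro a b
    have : (p : ℤ) ∣ nS s'' a b - nS s a b - nS s' a b - (w b - w a) := by
      rw [← ZMod.intCast_zmod_eq_zero_iff_dvd]
      push_cast
      rw [nS_cast, nS_cast, nS_cast]
      simp [w]
      ring
    simp only [r]
    rw [Int.mul_ediv_cancel' this]; ring
  refine ⟨c2 fun a b => (r a b : ZMod p), c2_mem fun γ a b => ?_, ?_⟩
  · simp only [r, hw, nS_inv hs γ, nS_inv hs' γ, nS_inv hs'' γ]
  · have e : nS s'' = fun a b => nS s a b + (nS s' a b + (w b - w a)) + p * r a b := by
      funext a b; exact hr a b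
    have e2 : bock p (fun a b => nS s' a b + (w b - w a)) = tS s' := by
      have := bock_add (p := p) (r := fun _ _ => 0) (cyc_of_cast (nS_cast s')) (n' := fun a b => w b - w a)
        (fun a b c => by simp)
      simp only [mul_zero, add_zero, bock_cob, Int.cast_zero] at this
      rw [this, tS]
      have : c2 (fun _ _ : X => (0 : ZMod p)) = 0 := by
        funext l
        rcases l with _ | ⟨a, _ | ⟨b, _ | ⟨c, l⟩⟩⟩ <;> rfl
      rw [this]
      have := D_smul_fun (0 : ZMod p) (0 : List X → ZMod p)
      rw [zero_smul, zero_smul] at this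
      rw [this]; simp
    have e3 : Cyc p (fun a b => nS s' a b + (w b - w a)) := by
      intro a b c
      have := cyc_of_cast (nS_cast s') a b c
      convert this using 1; ring
    have e4 := bock_add (p := p) (r := r) (cyc_of_cast (nS_cast s)) e3
    rw [e2] at e4
    rw [show tS s'' = bock p (nS s'') from rfl, e]
    exact e4

theorem tS_zero : tS (fun _ : X => (0 : ZMod p)) = 0 := by
  have := bock_cob (p := p) (fun _ : X => 0)
  have e : nS (fun _ : X => (0 : ZMod p)) = fun a b => 0 - 0 := by
    funext a b; simp [nS]
  rw [tS, e]; exact this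
end Bock
end Volo

namespace Volo
open scoped Topology
open GSp

section UU
variable (p : ℕ) [hp : Fact p.Prime]

/-- the sector function -/
noncomputable def fl (θ : ℝ) : ℤ := ⌊p * θ / (2 * Real.pi)⌋
noncomputable def uu (z : ℂ) : ZMod p := (fl p (Complex.arg z) : ZMod p)
/-- the standard character -/
noncomputable def ch (c : ZMod p) : ℂ := ZMod.stdAddChar c

variable {p}
theorem ch_add (a b : ZMod p) : ch p (a + b) = ch p a * ch p b := AddChar.map_add_eq_mul _ _ _
theorem ch_zero : ch p 0 = 1 := AddChar.map_zero_eq_one _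
theorem ch_norm (c : ZMod p) : ‖ch p c‖ = 1 := by
  rw [ch, ZMod.stdAddChar_apply]; exact Circle.norm_coe _
theorem ch_ne (c : ZMod p) : ch p c ≠ 0 := by
  intro h; have := ch_norm c; rw [h] at this; simp at this
theorem ch_inj {a b : ZMod p} (h : ch p a = ch p b) : a = b := ZMod.injective_stdAddChar h
theorem ch_exp (j : ℤ) : ch p (j : ZMod p) = Complex.exp ((2 * Real.pi * j / p : ℝ) * Complex.I) := by
  rw [ch, ZMod.stdAddChar_coe]
  congr 1; push_cast; ring

theorem ch_pow (c : ZMod p) : ch p c ^ p = 1 := by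
  have h : ∀ n : ℕ, ch p c ^ n = ch p (n • c) := by
    intro n
    induction n with
    | zero => simp [ch_zero]
    | succ n ih => rw [pow_succ, ih, ← ch_add, succ_nsmul]
  rw [h]; simp [ch_zero]

theorem root_ch {z : ℂ} (h : z ^ p = 1) : ∃ c : ZMod p, ch p c = z := by
  have hp0 : (p : ℂ) ≠ 0 := by exact_mod_cast hp.out.ne_zero
  haveI : NeZero p := ⟨hp.out.ne_zero⟩
  obtain ⟨i, hi, e⟩ := (Complex.isPrimitiveRoot_exp p hp.out.ne_zero).eq_pow_of_pow_eq_one h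
  refine ⟨((i : ℤ) : ZMod p), ?_⟩
  rw [ch_exp, ← e, ← Complex.exp_nat_mul]
  congr 1; push_cast; field_simp

theorem pi2 : (0 : ℝ) < 2 * Real.pi := by positivity

theorem fl_add (θ : ℝ) (c k : ℤ) : fl p (θ + 2 * Real.pi * c / p + k * (2 * Real.pi)) = fl p θ + c + k * p := by
  have hp0 : (p : ℝ) ≠ 0 := by exact_mod_cast hp.out.ne_zero
  have := Real.pi_ne_zero
  rw [fl, fl, ← Int.floor_add_intCast, add_assoc, ← Int.floor_add_intCast]
  congr 1; push_cast
  field_simp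
  ring

theorem uu_of {z : ℂ} (hz : z ≠ 0) {θ : ℝ} (h : z = ‖z‖ * Complex.exp (θ * Complex.I)) :
    uu p z = (fl p θ : ZMod p) := by
  have e := Complex.norm_mul_exp_arg_mul_I z
  have e2 : Complex.exp (θ * Complex.I) = Complex.exp (Complex.arg z * Complex.I) := by
    have : (‖z‖ : ℂ) ≠ 0 := by simpa using hz
    apply mul_left_cancel₀ this
    rw [e, ← h]
  obtain ⟨k, hk⟩ := Complex.exp_eq_exp_iff_exists_int.1 e2
  have hk' : θ = Complex.arg z + k * (2 * Real.pi) := by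
    have : (θ : ℂ) = Complex.arg z + k * (2 * Real.pi) := by
      apply mul_right_cancel₀ Complex.I_ne_zero
      rw [hk]; ring
    exact_mod_cast this
  have := fl_add (p := p) (Complex.arg z) 0 k
  simp only [Int.cast_zero, mul_zero, zero_div, add_zero] at this
  rw [hk', this, uu]; simp

theorem uu_ch (c : ZMod p) {z : ℂ} (hz : z ≠ 0) : uu p (ch p c * z) = uu p z + c := by
  obtain ⟨j, rfl⟩ := ZMod.intCast_surjective c
  have := fl_add (p := p) (Complex.arg z) j 0
  simp only [Int.cast_zero, zero_mul, add_zero] at this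
  rw [uu_of (mul_ne_zero (ch_ne _) hz) (θ := Complex.arg z + 2 * Real.pi * j / p), this, uu]
  · push_cast; rfl
  · rw [norm_mul, ch_norm, one_mul]
    conv_lhs => rw [← Complex.norm_mul_exp_arg_mul_I z, ch_exp]
    push_cast
    rw [add_mul, Complex.exp_add]; ring

theorem uu_pos {r : ℝ} (hr : 0 < r) (z : ℂ) : uu p (r * z) = uu p z := by
  rw [uu, Complex.arg_real_mul z hr, uu]

/-- a second continuous argument -/
noncomputable def arg2 (z : ℂ) : ℝ := Complex.arg (-z) + Real.pi
theorem arg2_exp (z : ℂ) : z = ‖z‖ * Complex.exp (arg2 z * Complex.I) := by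
  have := Complex.norm_mul_exp_arg_mul_I (-z)
  rw [norm_neg] at this
  rw [arg2]; push_cast
  rw [add_mul, Complex.exp_add, ← mul_assoc, this]; simp
theorem arg_exp (z : ℂ) : z = ‖z‖ * Complex.exp (Complex.arg z * Complex.I) :=
  (Complex.norm_mul_exp_arg_mul_I z).symm
theorem arg2_cont {z : ℂ} (h : -z ∈ Complex.slitPlane) : ContinuousAt arg2 z := by
  have := (Complex.continuousAt_arg h).comp (f := fun z : ℂ => -z) continuous_neg.continuousAt
  exact this.add continuousAt_const

theorem fl_near {f : ℂ → ℝ} {z : ℂ} (hf : ContinuousAt f z) :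
    ∃ N ∈ 𝓝 z, ∀ a ∈ N, ∀ b ∈ N, |fl p (f b) - fl p (f a)| ≤ 1 := by
  have h1 : ContinuousAt (fun z => p * f z / (2 * Real.pi)) z := (continuousAt_const.mul hf).div_const _
  have h2 := h1.eventually (Metric.ball_mem_nhds _ (by norm_num : (0 : ℝ) < 1 / 2))
  refine ⟨_, h2, fun a ha b hb => ?_⟩
  simp only [mem_ofPred_eq, Metric.mem_ball] at ha hb
  have h3 : |p * f b / (2 * Real.pi) - p * f a / (2 * Real.pi)| < 1 := by
    rw [← Real.dist_eq]
    calc _ ≤ _ := dist_triangle_right _ _ _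
      _ < 1 / 2 + 1 / 2 := add_lt_add hb ha
      _ = 1 := by norm_num
  rw [fl, fl]
  generalize p * f b / (2 * Real.pi) = x at h3 ⊢
  generalize p * f a / (2 * Real.pi) = y at h3 ⊢
  rw [abs_lt] at h3
  have e1 := Int.floor_le x
  have e2 := Int.lt_floor_add_one x
  have e3 := Int.floor_le y
  have e4 := Int.lt_floor_add_one y
  rw [abs_le]
  constructor
  · have : (⌊y⌋ : ℝ) < ⌊x⌋ + 2 := by linarith
    have : ⌊y⌋ < ⌊x⌋ + 2 := by exact_mod_cast this
    omega
  · have : (⌊x⌋ : ℝ) < ⌊y⌋ + 2 := by linarith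
    have : ⌊x⌋ < ⌊y⌋ + 2 := by exact_mod_cast this
    omega

theorem uu_loc {z : ℂ} (hz : z ≠ 0) : ∃ N ∈ 𝓝 z, ∃ v : ℂ → ℤ, (∀ a ∈ N, uu p a = v a) ∧
    ∀ a ∈ N, ∀ b ∈ N, |v b - v a| ≤ 1 := by
  by_cases h : z ∈ Complex.slitPlane
  · obtain ⟨N, hN, h1⟩ := fl_near (p := p) (Complex.continuousAt_arg h)
    exact ⟨N, hN, fun z => fl p (Complex.arg z), fun a _ => rfl, h1⟩
  · have h' : -z ∈ Complex.slitPlane := by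
      rw [Complex.mem_slitPlane_iff] at h ⊢
      push Not at h
      left
      rw [Complex.neg_re]
      rcases h.1.lt_or_eq with h2 | h2
      · linarith
      · exact absurd (Complex.ext h2 h.2) hz
    obtain ⟨N, hN, h1⟩ := fl_near (p := p) (arg2_cont h')
    refine ⟨N ∩ {0}ᶜ, Filter.inter_mem hN (isOpen_compl_singleton.mem_nhds hz),
      fun z => fl p (arg2 z), fun a ha => uu_of ha.2 (arg2_exp a), fun a ha b hb => h1 a ha.1 b hb.1⟩

theorem fl_range {θ : ℝ} (h0 : 0 ≤ θ) (h1 : θ < 2 * Real.pi) : 0 ≤ fl p θ ∧ fl p θ < p := by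
  have hp0 : (0 : ℝ) < p := by exact_mod_cast hp.out.pos
  constructor
  · exact Int.floor_nonneg.2 (by positivity)
  · rw [fl, Int.floor_lt]
    rw [div_lt_iff₀ pi2]
    push_cast
    exact mul_lt_mul_of_pos_left h1 hp0

theorem uu_val2 {z : ℂ} (hz : -z ∈ Complex.slitPlane) : ((uu p z).val : ℤ) = fl p (arg2 z) := by
  have hz0 : z ≠ 0 := by
    rintro rfl; simp at hz
  rw [uu_of hz0 (arg2_exp z)]
  have h := fl_range (p := p) (θ := arg2 z) (by
    have := Complex.neg_pi_lt_arg (-z)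
    rw [arg2]; linarith) (by
    have h1 := Complex.arg_le_pi (-z)
    have h2 := (Complex.mem_slitPlane_iff_arg.1 hz).1
    have : Complex.arg (-z) < Real.pi := lt_of_le_of_ne h1 h2
    rw [arg2]; linarith)
  haveI : NeZero p := ⟨hp.out.ne_zero⟩
  rw [ZMod.val_intCast, Int.emod_eq_of_lt h.1 h.2]

theorem uu_val1 {z : ℂ} (hz : 0 < z.re) :
    ((uu p z).val : ℤ) = fl p (Complex.arg z) + p * (if z.im < 0 then 1 else 0) := by
  have hz0 : z ≠ 0 := by
    rintro rfl; simp at hz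
  haveI : NeZero p := ⟨hp.out.ne_zero⟩
  have hp0 : (p : ℝ) ≠ 0 := by exact_mod_cast hp.out.ne_zero
  have ha := Complex.abs_arg_lt_pi_div_two_iff.2 (Or.inl hz)
  rw [abs_lt] at ha
  have := Real.pi_pos
  split_ifs with him
  · have h0 : Complex.arg z < 0 := Complex.arg_neg_iff.2 him
    have h := fl_range (p := p) (θ := Complex.arg z + 2 * Real.pi * 0 / p + 1 * (2 * Real.pi)) (by
      rw [mul_zero, zero_div]; linarith [ha.1]) (by rw [mul_zero, zero_div]; linarith)
    have e := fl_add (p := p) (Complex.arg z) 0 1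
    push_cast at e
    rw [e] at h
    have : uu p z = ((fl p (Complex.arg z) + 0 + 1 * p : ℤ) : ZMod p) := by
      simp [uu]
    rw [this, ZMod.val_intCast, Int.emod_eq_of_lt h.1 h.2]; ring
  · have h0 : 0 ≤ Complex.arg z := Complex.arg_nonneg_iff.2 (not_lt.1 him)
    have h := fl_range (p := p) (θ := Complex.arg z) h0 (by linarith)
    rw [uu, ZMod.val_intCast, Int.emod_eq_of_lt h.1 h.2]; ring

/-- local behaviour on the unit circle relative to the p-th power -/
theorem uu_root {α : ℂ → ℝ} {w0 : ℂ} (h0 : ‖w0‖ = 1)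
    (hα : ContinuousAt α (w0 ^ p)) (he : ∀ z : ℂ, z = ‖z‖ * Complex.exp (α z * Complex.I)) :
    ∃ N ∈ 𝓝 w0, ∃ m : ZMod p, ∀ w ∈ N, ‖w‖ = 1 →
      uu p w = m + ((⌊α (w ^ p) / (2 * Real.pi)⌋ : ℤ) : ZMod p) := by
  have hpc : (p : ℂ) ≠ 0 := by exact_mod_cast hp.out.ne_zero
  have hp0 : (p : ℝ) ≠ 0 := by exact_mod_cast hp.out.ne_zero
  let ω : ℂ → ℂ := fun w => w * Complex.exp (-(α (w ^ p) / p * Complex.I))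
  have hω : ContinuousAt ω w0 := by
    have h1 : ContinuousAt (fun w : ℂ => α (w ^ p)) w0 :=
      ContinuousAt.comp (g := α) (f := fun w : ℂ => w ^ p) hα (continuous_pow p).continuousAt
    have h2 : ContinuousAt (fun w : ℂ => ((α (w ^ p) : ℝ) : ℂ)) w0 :=
      Complex.continuous_ofReal.continuousAt.comp h1
    exact continuousAt_id.mul (Complex.continuous_exp.continuousAt.comp
      ((h2.div_const _).mul continuousAt_const).neg)
  have hωp : ∀ w : ℂ, ‖w‖ = 1 → ω w ^ p = 1 := by
    intro w hw
    simp only [ω]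
    rw [mul_pow, ← Complex.exp_nat_mul]
    have := he (w ^ p)
    rw [norm_pow, hw] at this
    nth_rewrite 1 [this]
    simp only [one_pow, Complex.ofReal_one, one_mul]
    rw [← Complex.exp_add]
    rw [show (α (w ^ p) : ℂ) * Complex.I + p * -(α (w ^ p) / p * Complex.I) = 0 by field_simp; ring]
    simp
  obtain ⟨m, hm⟩ := root_ch (hωp w0 h0)
  have hfin : ((Set.range (ch p)) \ {ω w0}).Finite := (Set.finite_range _).sdiff
  have hN : ((Set.range (ch p)) \ {ω w0})ᶜ ∈ 𝓝 (ω w0) :=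
    hfin.isClosed.isOpen_compl.mem_nhds (by simp)
  refine ⟨_, hω hN, m, fun w hw hw1 => ?_⟩
  have e : ω w = ch p m := by
    by_contra hne
    apply hw
    obtain ⟨c, hc⟩ := root_ch (hωp w hw1)
    exact ⟨⟨c, hc⟩, by rw [mem_singleton_iff, ← hm]; exact hne⟩
  have e2 : w = ch p m * Complex.exp (((α (w ^ p) / p : ℝ) : ℂ) * Complex.I) := by
    rw [← e]; simp only [ω]
    rw [mul_assoc, ← Complex.exp_add]; push_cast; simp
  have e3 : uu p (Complex.exp (((α (w ^ p) / p : ℝ) : ℂ) * Complex.I)) =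
      (fl p (α (w ^ p) / p) : ZMod p) :=
    uu_of (Complex.exp_ne_zero _) (by rw [Complex.norm_exp_ofReal_mul_I]; simp)
  conv_lhs => rw [e2]
  rw [uu_ch _ (Complex.exp_ne_zero _), e3, add_comm, fl]
  rw [mul_div_cancel₀ _ hp0]

end UU

end Volo

namespace Volo
open scoped Topology
open GSp

section WSec
variable {Γ X : Type} [AddCommGroup Γ] [Finite Γ] [MetricSpace X] [GSp Γ X]
variable {p : ℕ} [hp : Fact p.Prime]

/-- small lift -/
noncomputable def nP (s : X → ZMod p) (a b : X) : ℤ :=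
  open Classical in if s b - s a = -1 then -1 else nS s a b

theorem nP_cast (s : X → ZMod p) (a b : X) : ((nP s a b : ℤ) : ZMod p) = s b - s a := by
  unfold nP
  split_ifs with h
  · simp [h]
  · exact nS_cast s a b

theorem nP_eq (hodd : Odd p) (s : X → ZMod p) {a b : X} {va vb : ℤ} (ha : s a = va) (hb : s b = vb)
    (h : |vb - va| ≤ 1) : nP s a b = vb - va := by
  haveI : NeZero p := ⟨hp.out.ne_zero⟩
  have h3 : 3 ≤ p := by
    have := hp.out.two_le
    rcases hodd with ⟨k, hk⟩; omega
  have e : s b - s a = ((vb - va : ℤ) : ZMod p) := by rw [ha, hb]; push_cast; rfl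
  rw [nP, nS, e]
  rw [abs_le] at h
  have hh : vb - va = -1 ∨ vb - va = 0 ∨ vb - va = 1 := by omega
  rcases hh with h1 | h1 | h1
  · rw [h1]; simp
  · rw [h1]
    split_ifs with h2
    · exfalso
      have : ((1 : ℤ) : ZMod p) = 0 := by
        push_cast at h2 ⊢; linear_combination h2
      rw [ZMod.intCast_zmod_eq_zero_iff_dvd] at this
      have := Int.le_of_dvd (by norm_num) this
      omega
    · simp
  · rw [h1]
    split_ifs with h2
    · exfalso
      have : ((2 : ℤ) : ZMod p) = 0 := by
        push_cast at h2 ⊢; linear_combination h2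
      rw [ZMod.intCast_zmod_eq_zero_iff_dvd] at this
      have := Int.le_of_dvd (by norm_num) this
      omega
    · rw [ZMod.val_intCast, Int.emod_eq_of_lt] <;> omega

theorem nP_inv {χ : Γ →+ ZMod p} {s : X → ZMod p} (hs : IsSec χ s) : Inv2 Γ (nP s) := by
  intro γ a b
  simp [nP, nS, hs γ]

/-- integral comparison -/
noncomputable def rS (s u : X → ZMod p) (a b : X) : ℤ :=
  (nP u a b - nS s a b - (((u b - s b).val : ℤ) - ((u a - s a).val : ℤ))) / p

theorem rS_eq (s u : X → ZMod p) (a b : X) :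
    nP u a b = nS s a b + (((u b - s b).val : ℤ) - ((u a - s a).val : ℤ)) + p * rS s u a b := by
  have : (p : ℤ) ∣ nP u a b - nS s a b - (((u b - s b).val : ℤ) - ((u a - s a).val : ℤ)) := by
    rw [← ZMod.intCast_zmod_eq_zero_iff_dvd]
    push_cast
    rw [nS_cast, nP_cast]
    simp
    ring
  rw [rS, Int.mul_ediv_cancel' this]; ring

noncomputable def WS (s u : X → ZMod p) : List X → ZMod p := c2 fun a b => ((-rS s u a b : ℤ) : ZMod p)

theorem WS_lv (s u : X → ZMod p) : Lv 2 (WS s u) := c2_lv _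
theorem WS_mem {χ : Γ →+ ZMod p} {s u : X → ZMod p} (hs : IsSec χ s) (hu : IsSec χ u) :
    WS s u ∈ Coch Γ X (ZMod p) := c2_mem fun γ a b => by
  simp only [rS, nP_inv hu γ, nS_inv hs γ, hs γ, hu γ]
  simp
theorem WS_pb {X1 : Type} [MetricSpace X1] (s u : X → ZMod p) (φ : X1 → X) :
    pb φ (WS s u) = WS (s ∘ φ) (u ∘ φ) := by
  funext l
  rcases l with _ | ⟨a, _ | ⟨b, _ | ⟨c, l⟩⟩⟩ <;> rfl

theorem WS_D (s u : X → ZMod p) : tS s - D (WS s u) = bock p (nP u) := by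
  have e3 : Cyc p (fun a b : X => (((u b - s b).val : ℤ) - ((u a - s a).val : ℤ))) := by
    intro a b c
    simp
  have e4 := bock_add (p := p) (r := rS s u) (cyc_of_cast (nS_cast s)) e3
  have e5 : (fun a b => nS s a b + (((u b - s b).val : ℤ) - ((u a - s a).val : ℤ)) + p * rS s u a b)
    = nP u := by
    funext a b; exact (rS_eq s u a b).symm
  rw [e5, bock_cob (fun a => ((u a - s a).val : ℤ))] at e4
  rw [e4]
  have e6 : WS s u = - c2 fun a b => (rS s u a b : ZMod p) := by
    funext l
    rcases l with _ | ⟨a, _ | ⟨b, _ | ⟨c, l⟩⟩⟩ <;> simp [WS, c2]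
  rw [e6, D_neg_fun, tS]; simp

theorem bock_nP_Z0 (hodd : Odd p) {u : X → ZMod p} {x : X}
    (h : ∃ N ∈ 𝓝 x, ∃ v : X → ℤ, (∀ a ∈ N, u a = v a) ∧ ∀ a ∈ N, ∀ b ∈ N, |v b - v a| ≤ 1) :
    Z0 (bock p (nP u)) x := by
  obtain ⟨N, hN, v, h1, h2⟩ := h
  refine (bock_lv _).z0 ⟨N, hN, fun l hl => ?_⟩
  revert l
  refine len3 fun a b c ha => ?_
  simp only [List.mem_cons, List.not_mem_nil, or_false, forall_eq_or_imp, forall_eq] at ha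
  obtain ⟨ha, hb, hc⟩ := ha
  simp only [bock]
  rw [nP_eq hodd u (h1 b hb) (h1 c hc) (h2 _ hb _ hc), nP_eq hodd u (h1 a ha) (h1 c hc) (h2 _ ha _ hc),
    nP_eq hodd u (h1 a ha) (h1 b hb) (h2 _ ha _ hb)]
  simp

/-- section obtained from a complex function -/
noncomputable def uh (s : X → ZMod p) (h : X → ℂ) (x : X) : ZMod p :=
  open Classical in if h x = 0 then s x else uu p (h x)

theorem uh_sec {χ : Γ →+ ZMod p} {s : X → ZMod p} (hs : IsSec χ s) {h : X → ℂ}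
    (hh : ∀ γ x, h (act γ x) = ch p (χ γ) * h x) : IsSec χ (uh s h) := by
  intro γ x
  simp only [uh, hh γ x, mul_eq_zero, ch_ne, false_or]
  split_ifs with h0
  · exact hs γ x
  · exact uu_ch _ h0

theorem uh_Z0 (hodd : Odd p) (s : X → ZMod p) {h : X → ℂ} {x : X} (hc : ContinuousAt h x) (hx : h x ≠ 0) :
    Z0 (tS s - D (WS s (uh s h))) x := by
  rw [WS_D]
  apply bock_nP_Z0 hodd
  obtain ⟨N, hN, v, h1, h2⟩ := uu_loc (p := p) hx
  refine ⟨h ⁻¹' (N ∩ {0}ᶜ), hc (Filter.inter_mem hN (isOpen_compl_singleton.mem_nhds hx)),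
    fun x => v (h x), fun a ha => ?_, fun a ha b hb => h2 _ ha.1 _ hb.1⟩
  rw [uh, if_neg (show ¬ h a = 0 from ha.2), h1 _ ha.1]

end WSec

section Spaces
variable {Γ : Type} [AddCommGroup Γ] {p : ℕ} [hp : Fact p.Prime]

instance prodG {X Y : Type} [MetricSpace X] [MetricSpace Y] [GSp Γ X] [GSp Γ Y] : GSp Γ (X × Y) where
  act γ x := (act γ x.1, act γ x.2)
  act_zero x := by simp [act_zero]
  act_add a b x := by simp [act_add]
  act_dist a x y := by simp [Prod.dist_eq, act_dist]

theorem fst_eqv {X Y : Type} [MetricSpace X] [MetricSpace Y] [GSp Γ X] [GSp Γ Y] :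
    Eqv Γ (Prod.fst : X × Y → X) := fun _ _ => rfl
theorem snd_eqv {X Y : Type} [MetricSpace X] [MetricSpace Y] [GSp Γ X] [GSp Γ Y] :
    Eqv Γ (Prod.snd : X × Y → Y) := fun _ _ => rfl

/-- the circle with an action by a character -/
def Cir (χ : Γ →+ ZMod p) : Type := Metric.sphere (0 : ℂ) 1
noncomputable instance (χ : Γ →+ ZMod p) : MetricSpace (Cir χ) :=
  inferInstanceAs (MetricSpace (Metric.sphere (0 : ℂ) 1))
instance (χ : Γ →+ ZMod p) : CompactSpace (Cir χ) :=
  inferInstanceAs (CompactSpace (Metric.sphere (0 : ℂ) 1))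

def Cir.v {χ : Γ →+ ZMod p} (w : Cir χ) : ℂ := Subtype.val w
theorem Cir.norm {χ : Γ →+ ZMod p} (w : Cir χ) : ‖w.v‖ = 1 := by
  have := w.2
  rwa [mem_sphere_zero_iff_norm] at this
theorem Cir.ne {χ : Γ →+ ZMod p} (w : Cir χ) : w.v ≠ 0 := by
  intro h; have := w.norm; rw [h] at this; simp at this
def Cir.mk {χ : Γ →+ ZMod p} (z : ℂ) (h : ‖z‖ = 1) : Cir χ := ⟨z, mem_sphere_zero_iff_norm.2 h⟩
theorem Cir.v_mk {χ : Γ →+ ZMod p} (z : ℂ) (h : ‖z‖ = 1) : (Cir.mk (χ := χ) z h).v = z := rfl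
theorem Cir.ext {χ : Γ →+ ZMod p} {a b : Cir χ} (h : a.v = b.v) : a = b := Subtype.ext h
theorem Cir.cont {χ : Γ →+ ZMod p} : Continuous (Cir.v : Cir χ → ℂ) := continuous_subtype_val
theorem Cir.cont_mk {T : Type} [TopologicalSpace T] {χ : Γ →+ ZMod p} {f : T → Cir χ}
    (h : Continuous fun t => (f t).v) : Continuous f := Continuous.subtype_mk h fun t => (f t).2
theorem Cir.dist {χ : Γ →+ ZMod p} (a b : Cir χ) : Dist.dist a b = Dist.dist a.v b.v := rfl

noncomputable instance (χ : Γ →+ ZMod p) : GSp Γ (Cir χ) where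
  act γ w := Cir.mk (ch p (χ γ) * w.v) (by rw [norm_mul, ch_norm, w.norm, one_mul])
  act_zero w := Cir.ext (by rw [Cir.v_mk, map_zero, ch_zero, one_mul])
  act_add a b w := Cir.ext (by simp only [Cir.v_mk, map_add, ch_add, mul_assoc])
  act_dist a x y := by
    rw [Cir.dist, Cir.v_mk, Cir.v_mk, Cir.dist, dist_eq_norm, ← mul_sub, norm_mul, ch_norm, one_mul,
      dist_eq_norm]
theorem Cir.v_act {χ : Γ →+ ZMod p} (γ : Γ) (w : Cir χ) : (act γ w).v = ch p (χ γ) * w.v := rfl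

noncomputable def Cir.rot {χ : Γ →+ ZMod p} (s : ℝ) (w : Cir χ) : Cir χ :=
  Cir.mk (Complex.exp (s * Complex.I) * w.v) (by rw [norm_mul, Complex.norm_exp_ofReal_mul_I, w.norm, one_mul])
theorem Cir.v_rot {χ : Γ →+ ZMod p} (s : ℝ) (w : Cir χ) : (w.rot s).v = Complex.exp (s * Complex.I) * w.v := rfl

end Spaces
end Volo

namespace Volo
open scoped Topology
open GSp

section Fib
variable {Γ F R : Type} [AddCommGroup Γ] [Finite Γ] [MetricSpace F] [GSp Γ F] [Field R] [CompactSpace F]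

/-- the indicator cochain of the lower half circle -/
noncomputable def indC (q : F → ℂ) (lam : R) : List F → R
  | [a] => open Classical in if (q a).im < 0 then lam else 0
  | _ => 0

theorem CircL.fibStd {q : F → ℂ} {ρ : ℝ → F → F} (h : CircL Γ F q ρ) (hU : Unif Γ F) {τ : List F → R}
    (mτ : τ ∈ Coch Γ F R) {lam : R} (hl : lam ≠ 0)
    (h1 : ∀ x, -q x ∈ Complex.slitPlane → ∃ N ∈ 𝓝 x, ∀ a ∈ N, ∀ b ∈ N, τ [a, b] = 0)
    (h2 : ∀ x, 0 < (q x).re → ∃ N ∈ 𝓝 x, ∀ a ∈ N, ∀ b ∈ N, τ [a, b] = indC q lam [b] - indC q lam [a]) :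
    FibOK Γ F R True τ := by
  have mA : indC q lam ∈ Coch Γ F R := by
    refine ⟨rfl, fun γ l => ?_⟩
    rcases l with _ | ⟨a, _ | ⟨b, l⟩⟩
    · rfl
    · simp [indC, h.qi]
    · rfl
  obtain ⟨xp, hp⟩ := h.surj Complex.I (by simp)
  obtain ⟨xm, hm⟩ := h.surj (-Complex.I) (by simp)
  have key : ∀ x, q x ≠ 0 := fun x h0 => by have := h.qn x; rw [h0] at this; simp at this
  refine h.fibOK hU mτ mA (Submodule.zero_mem _) (fun x hx => ?_) (fun x hx => ?_) hp hm ?_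
  · rw [div_one] at hx
    rcases hx.lt_or_eq with hx | hx
    · obtain ⟨N, hN, hh⟩ := h2 x hx
      refine ⟨N, hN, fun l hl ha => ?_⟩
      obtain ⟨a, b, rfl⟩ := List.length_eq_two.1 hl
      simp only [List.mem_cons, List.not_mem_nil, or_false, forall_eq_or_imp, forall_eq] at ha
      rw [Pi.sub_apply, D_two _ mA.1, hh a ha.1 b ha.2, sub_self]
    · have him : (q x).im ≠ 0 := fun h0 => key x (Complex.ext hx.symm h0)
      obtain ⟨N, hN, hh⟩ := h1 x (Or.inr (by simpa using him))
      have hcI : ∀ᶠ a in 𝓝 x, ((q a).im < 0 ↔ (q x).im < 0) := by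
        have hc := (Complex.continuous_im.comp h.qc).continuousAt (x := x)
        rcases lt_or_gt_of_ne him with h3 | h3
        · filter_upwards [hc.eventually (Iio_mem_nhds h3)] with a ha
          exact ⟨fun _ => h3, fun _ => ha⟩
        · filter_upwards [hc.eventually (Ioi_mem_nhds h3)] with a ha
          exact ⟨fun h4 => absurd h4 (not_lt.2 (le_of_lt ha)), fun h4 => absurd h4 (not_lt.2 h3.le)⟩
      refine ⟨_, Filter.inter_mem hN hcI, fun l hl ha => ?_⟩
      obtain ⟨a, b, rfl⟩ := List.length_eq_two.1 hl
      simp only [List.mem_cons, List.not_mem_nil, or_false, forall_eq_or_imp, forall_eq] at ha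
      rw [Pi.sub_apply, D_two _ mA.1, hh a ha.1.1 b ha.2.1]
      have e1 : (q a).im < 0 ↔ (q x).im < 0 := ha.1.2
      have e2 : (q b).im < 0 ↔ (q x).im < 0 := ha.2.2
      simp only [indC, e1, e2]; simp
  · have hs : -q x ∈ Complex.slitPlane := by
      rw [div_neg, div_one, Complex.neg_re] at hx
      rcases hx.lt_or_eq with hx | hx
      · exact Or.inl (by simpa using hx)
      · refine Or.inr ?_
        intro h0
        rw [Complex.neg_im] at h0
        exact key x (Complex.ext (by simp; linarith) (by simp; linarith))
    obtain ⟨N, hN, hh⟩ := h1 x hs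
    refine ⟨N, hN, fun l hl ha => ?_⟩
    obtain ⟨a, b, rfl⟩ := List.length_eq_two.1 hl
    simp only [List.mem_cons, List.not_mem_nil, or_false, forall_eq_or_imp, forall_eq] at ha
    rw [Pi.sub_apply, D_two _ rfl, hh a ha.1 b ha.2]; simp
  · rw [sub_zero]
    simp [indC, hp, hm, hl, not_lt.2 (zero_le_one (α := ℝ))]

end Fib

section Gys
variable {Γ Y : Type} [AddCommGroup Γ] [Finite Γ] [MetricSpace Y] [GSp Γ Y] [CompactSpace Y]
variable {p : ℕ} [hp : Fact p.Prime]

/-- Gysin tau -/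
noncomputable def tauG (χ : Γ →+ ZMod p) (s : Y → ZMod p) : List (Y × Cir χ) → ZMod p :=
  WS (s ∘ Prod.fst) fun m => uu p m.2.v

theorem uC_sec (χ : Γ →+ ZMod p) : IsSec χ (fun m : Y × Cir χ => uu p m.2.v) := by
  intro γ m
  show uu p (act γ m.2).v = _
  rw [Cir.v_act, uu_ch _ m.2.ne]

theorem s_fst {χ : Γ →+ ZMod p} {s : Y → ZMod p} (hs : IsSec χ s) :
    IsSec χ (s ∘ Prod.fst : Y × Cir χ → ZMod p) := fun γ m => hs γ m.1

theorem tauG_mem {χ : Γ →+ ZMod p} {s : Y → ZMod p} (hs : IsSec χ s) :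
    tauG χ s ∈ Coch Γ (Y × Cir χ) (ZMod p) := WS_mem (s_fst hs) (uC_sec χ)

theorem uh_circ {χ : Γ →+ ZMod p} (s : Y → ZMod p) :
    uh (s ∘ Prod.fst) (fun m : Y × Cir χ => m.2.v) = fun m => uu p m.2.v := by
  funext m
  rw [uh, if_neg m.2.ne]

theorem tauG_Z0 (hodd : Odd p) {χ : Γ →+ ZMod p} (s : Y → ZMod p) (x : Y × Cir χ) :
    Z0 (pb Prod.fst (tS s) - D (tauG χ s)) x := by
  rw [tS_pb, tauG, ← uh_circ]
  exact uh_Z0 hodd _ (Cir.cont.comp continuous_snd).continuousAt x.2.ne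

theorem unif_prod {X : Type} [MetricSpace X] [GSp Γ X] (hU : Unif Γ Y)
   (h : ∀ (γ : Γ) (y : Y), act γ y = y → ∀ x : X, act γ x = x) : Unif Γ (Y × X) := by
  intro γ x y hx
  have h1 : act γ x.1 = x.1 := congrArg Prod.fst hx
  exact Prod.ext (hU γ _ _ h1) (h γ _ h1 _)

theorem orb_loc (y : Y) (x : Y) (hx : x ∈ orb Γ y) : ∃ N ∈ 𝓝 x, ∀ a ∈ N, a ∈ orb Γ y → a = x := by
  have h1 : ((orb Γ y) \ {x}).Finite := (orb_finite y).subset sdiff_subset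
  refine ⟨((orb Γ y) \ {x})ᶜ, h1.isClosed.isOpen_compl.mem_nhds (by simp), fun a ha hay => ?_⟩
  by_contra hne
  exact ha ⟨hay, hne⟩

theorem gysin_fib (hodd : Odd p) (hU : Unif Γ Y) (χ : Γ →+ ZMod p) (hst : ∀ γ (y : Y), act γ y = y → χ γ = 0)
    {s : Y → ZMod p} (hs : IsSec χ s) (y : Y) :
    letI := subG (fib_inv (Γ := Γ) (W := Y × Cir χ) fst_eqv y)
    FibOK Γ ((Prod.fst : Y × Cir χ → Y) ⁻¹' orb Γ y) (ZMod p) True (pb Subtype.val (tauG χ s)) := by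
  letI := subG (fib_inv (Γ := Γ) (W := Y × Cir χ) fst_eqv y)
  have hUW : Unif Γ (Y × Cir χ) := unif_prod hU fun γ y h x => Cir.ext (by
    rw [Cir.v_act, hst γ y h, ch_zero, one_mul])
  haveI : CompactSpace ((Prod.fst : Y × Cir χ → Y) ⁻¹' orb Γ y) :=
    isCompact_iff_compactSpace.1 (((orb_finite y).isClosed.preimage continuous_fst).isCompact)
  have hloc : ∀ x : ((Prod.fst : Y × Cir χ → Y) ⁻¹' orb Γ y), ∃ N ∈ 𝓝 x, ∀ a ∈ N, a.1.1 = x.1.1 := by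
    intro x
    obtain ⟨N, hN, h⟩ := orb_loc (Γ := Γ) y x.1.1 x.2
    exact ⟨_, (continuous_fst.comp continuous_subtype_val).continuousAt hN, fun a ha => h _ ha a.2⟩
  let q : ((Prod.fst : Y × Cir χ → Y) ⁻¹' orb Γ y) → ℂ := fun x => ch p (-s x.1.1) * x.1.2.v
  let ρ : ℝ → ((Prod.fst : Y × Cir χ → Y) ⁻¹' orb Γ y) → ((Prod.fst : Y × Cir χ → Y) ⁻¹' orb Γ y) := fun t x => ⟨(x.1.1, x.1.2.rot t), x.2⟩
  have qc : Continuous q := by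
    rw [continuous_iff_continuousAt]
    intro x
    obtain ⟨N, hN, h⟩ := hloc x
    have h1 : ContinuousAt (fun a : ((Prod.fst : Y × Cir χ → Y) ⁻¹' orb Γ y) => ch p (-s x.1.1) * a.1.2.v) x :=
      (continuous_const.mul (Cir.cont.comp (continuous_snd.comp continuous_subtype_val))).continuousAt
    refine h1.congr ?_
    filter_upwards [hN] with a ha
    simp only [q, h a ha]
  have qne : ∀ x, q x ≠ 0 := fun x => mul_ne_zero (ch_ne _) x.1.2.ne
  have hC : CircL Γ ((Prod.fst : Y × Cir χ → Y) ⁻¹' orb Γ y) q ρ := by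
    refine ⟨qc, fun x => ?_, fun γ x => ?_, fun x x' hq => ?_, ?_, fun t γ x => ?_, fun x => ?_, fun t x => ?_, ?_⟩
    · simp only [q, norm_mul, ch_norm, Cir.norm, one_mul]
    · show ch p (-s (act γ x.1.1)) * (act γ x.1.2).v = _
      rw [hs, Cir.v_act, ← mul_assoc, ← ch_add]
      simp [q]
    · obtain ⟨γ, hγ⟩ := x.2
      obtain ⟨γ', hγ'⟩ := x'.2
      have e : act (γ' - γ) x.1.1 = x'.1.1 := by
        rw [← hγ, ← hγ', ← act_add]; congr 1; abel
      refine ⟨γ' - γ, Subtype.ext (Prod.ext e (Cir.ext ?_))⟩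
      show (act (γ' - γ) x.1.2).v = _
      rw [Cir.v_act]
      simp only [q] at hq
      rw [← e, hs, neg_add, ch_add, mul_assoc] at hq
      have h3 := mul_left_cancel₀ (ch_ne _) hq
      rw [h3, ← mul_assoc, ← ch_add]; simp [ch_zero]
    · refine Continuous.subtype_mk (Continuous.prodMk (by fun_prop) (Cir.cont_mk ?_)) _
      simp only [Cir.v_rot]
      exact (by fun_prop : Continuous fun u : ℝ × ((Prod.fst : Y × Cir χ → Y) ⁻¹' orb Γ y) => Complex.exp (u.1 * Complex.I)).mul
        (Cir.cont.comp (continuous_snd.comp (continuous_subtype_val.comp continuous_snd)))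
    · refine Subtype.ext (Prod.ext rfl (Cir.ext ?_))
      show ((act γ x.1.2).rot t).v = (act γ (x.1.2.rot t)).v
      simp only [Cir.v_rot, Cir.v_act]; ring
    · refine Subtype.ext (Prod.ext rfl (Cir.ext ?_))
      show (x.1.2.rot 0).v = _
      simp [Cir.v_rot]
    · show ch p (-s x.1.1) * (x.1.2.rot t).v = _
      simp only [Cir.v_rot, q]; ring
    · exact ⟨⟨(y, Cir.mk 1 (by simp)), orb_self y⟩⟩
  have hq : ∀ a : ((Prod.fst : Y × Cir χ → Y) ⁻¹' orb Γ y), uu p a.1.2.v - s a.1.1 = uu p (q a) := by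
    intro a
    rw [show q a = ch p (-s a.1.1) * a.1.2.v from rfl, uu_ch _ a.1.2.ne]; ring
  -- evaluation of tau
  have ev : ∀ (a b : ((Prod.fst : Y × Cir χ → Y) ⁻¹' orb Γ y)) (va vb r : ℤ), a.1.1 = b.1.1 → uu p (q a) = va → uu p (q b) = vb → |vb - va| ≤ 1 →
      vb - va = ((uu p (q b)).val : ℤ) - ((uu p (q a)).val : ℤ) + p * r →
      pb Subtype.val (tauG χ s) [a, b] = ((-r : ℤ) : ZMod p) := by
    intro a b va vb r hab ha hb h1 h2
    have hp0 : (p : ℤ) ≠ 0 := by exact_mod_cast hp.out.ne_zero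
    show ((-rS (s ∘ Prod.fst) (fun m : Y × Cir χ => uu p m.2.v) a.1 b.1 : ℤ) : ZMod p) = _
    congr 2
    rw [rS]
    have e1 : nP (fun m : Y × Cir χ => uu p m.2.v) a.1 b.1 = (vb + (s a.1.1).val) - (va + (s a.1.1).val) := by
      haveI : NeZero p := ⟨hp.out.ne_zero⟩
      apply nP_eq hodd
      · push_cast
        rw [← ha, ← hq]; simp
      · push_cast
        rw [← hb, ← hq, hab]; simp
      · simpa using h1
    have e2 : nS (s ∘ Prod.fst) a.1 b.1 = 0 := by simp [nS, hab]
    rw [e1, e2, Function.comp, Function.comp, hq, hq]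
    rw [show (vb + (s a.1.1).val : ℤ) - (va + (s a.1.1).val) - 0 - (((uu p (q b)).val : ℤ) - ((uu p (q a)).val : ℤ)) = p * r by linarith]
    exact Int.mul_ediv_cancel_left _ hp0
  refine hC.fibStd (subG_unif _ hUW) (Coch.pb (tauG_mem hs) (subG_val _)) (lam := 1) one_ne_zero ?_ ?_
  · intro x hx
    obtain ⟨N, hN, h⟩ := hloc x
    obtain ⟨N', hN', h'⟩ := fl_near (p := p) (arg2_cont hx)
    have hop : IsOpen {x : ((Prod.fst : Y × Cir χ → Y) ⁻¹' orb Γ y) | -q x ∈ Complex.slitPlane} := Complex.isOpen_slitPlane.preimage qc.neg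
    refine ⟨_, Filter.inter_mem (Filter.inter_mem hN (qc.continuousAt hN')) (hop.mem_nhds hx), fun a ha b hb => ?_⟩
    rw [ev a b (fl p (arg2 (q a))) (fl p (arg2 (q b))) 0]
    · simp
    · rw [h a ha.1.1, h b hb.1.1]
    · exact uu_of (qne a) (arg2_exp _)
    · exact uu_of (qne b) (arg2_exp _)
    · exact h' _ ha.1.2 _ hb.1.2
    · rw [uu_val2 ha.2, uu_val2 hb.2]; ring
  · intro x hx
    obtain ⟨N, hN, h⟩ := hloc x
    obtain ⟨N', hN', h'⟩ := fl_near (p := p) (Complex.continuousAt_arg (Or.inl hx))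
    have hop : IsOpen {x : ((Prod.fst : Y × Cir χ → Y) ⁻¹' orb Γ y) | 0 < (q x).re} := isOpen_lt continuous_const (Complex.continuous_re.comp qc)
    refine ⟨_, Filter.inter_mem (Filter.inter_mem hN (qc.continuousAt hN')) (hop.mem_nhds hx), fun a ha b hb => ?_⟩
    rw [ev a b (fl p (Complex.arg (q a))) (fl p (Complex.arg (q b)))
      ((if (q a).im < 0 then 1 else 0) - (if (q b).im < 0 then 1 else 0))]
    · simp only [indC]
      push_cast
      split_ifs <;> simp
    · rw [h a ha.1.1, h b hb.1.1]
    · exact uu_of (qne a) (arg_exp _)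
    · exact uu_of (qne b) (arg_exp _)
    · exact h' _ ha.1.2 _ hb.1.2
    · rw [uu_val1 ha.2, uu_val1 hb.2]; ring

/-- tau for the second kind of circle bundle -/
noncomputable def tauF (Y : Type) [MetricSpace Y] [GSp Γ Y] (χ : Γ →+ ZMod p) : List (Y × Cir χ) → ZMod p :=
  c2 fun a b => uu p b.2.v - uu p a.2.v

theorem tauF_mem (χ : Γ →+ ZMod p) : tauF Y χ ∈ Coch Γ (Y × Cir χ) (ZMod p) := c2_mem fun γ a b => by
  have h1 := uC_sec (Y := Y) χ γ a
  have h2 := uC_sec (Y := Y) χ γ b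
  simp only at h1 h2
  rw [h1, h2]; ring

theorem tauF_D (χ : Γ →+ ZMod p) : D (tauF Y χ) = 0 := by
  refine eq_of_lv ((c2_lv _).D (by norm_num)) (fun _ _ => rfl) (len3 fun a b c => ?_)
  rw [D3]; simp only [c2, tauF, Pi.zero_apply]; ring

theorem floor_arg (z : ℂ) : ⌊Complex.arg z / (2 * Real.pi)⌋ = if z.im < 0 then -1 else 0 := by
  have h1 := Complex.neg_pi_lt_arg z
  have h2 := Complex.arg_le_pi z
  have h3 := Real.pi_pos
  split_ifs with h
  · have := Complex.arg_neg_iff.2 h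
    rw [Int.floor_eq_iff]
    push_cast
    constructor
    · rw [le_div_iff₀ (by positivity)]; linarith
    · rw [div_lt_iff₀ (by positivity)]; linarith
  · have := Complex.arg_nonneg_iff.2 (not_lt.1 h)
    rw [Int.floor_eq_iff]
    push_cast
    constructor
    · rw [le_div_iff₀ (by positivity)]; linarith
    · rw [div_lt_iff₀ (by positivity)]; linarith

theorem floor_arg2 {z : ℂ} (hz : -z ∈ Complex.slitPlane) : ⌊arg2 z / (2 * Real.pi)⌋ = 0 := by
  have h1 := Complex.neg_pi_lt_arg (-z)
  have h2 := lt_of_le_of_ne (Complex.arg_le_pi (-z)) (Complex.mem_slitPlane_iff_arg.1 hz).1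
  have h3 := Real.pi_pos
  rw [Int.floor_eq_iff, arg2]
  push_cast
  constructor
  · rw [le_div_iff₀ (by positivity)]; linarith
  · rw [div_lt_iff₀ (by positivity)]; linarith

theorem circ_fib (hodd : Odd p) (hU : Unif Γ Y) (χ : Γ →+ ZMod p)
    (hK : ∀ c, ∃ κ : Γ, (∀ y : Y, act κ y = y) ∧ χ κ = c) (hUW : Unif Γ (Y × Cir χ)) (y : Y) :
    letI := subG (fib_inv (Γ := Γ) (W := Y × Cir χ) fst_eqv y)
    FibOK Γ ((Prod.fst : Y × Cir χ → Y) ⁻¹' orb Γ y) (ZMod p) True (pb Subtype.val (tauF Y χ)) := by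
  letI := subG (fib_inv (Γ := Γ) (W := Y × Cir χ) fst_eqv y)
  haveI : CompactSpace ((Prod.fst : Y × Cir χ → Y) ⁻¹' orb Γ y) :=
    isCompact_iff_compactSpace.1 (((orb_finite y).isClosed.preimage continuous_fst).isCompact)
  have hp0 : (p : ℝ) ≠ 0 := by exact_mod_cast hp.out.ne_zero
  have hpc : (p : ℂ) ≠ 0 := by exact_mod_cast hp.out.ne_zero
  let q : ((Prod.fst : Y × Cir χ → Y) ⁻¹' orb Γ y) → ℂ := fun x => x.1.2.v ^ p
  let ρ : ℝ → ((Prod.fst : Y × Cir χ → Y) ⁻¹' orb Γ y) → ((Prod.fst : Y × Cir χ → Y) ⁻¹' orb Γ y) := fun t x => ⟨(x.1.1, x.1.2.rot (t / p)), x.2⟩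
  have vc : Continuous fun x : ((Prod.fst : Y × Cir χ → Y) ⁻¹' orb Γ y) => x.1.2.v := Cir.cont.comp (continuous_snd.comp continuous_subtype_val)
  have qc : Continuous q := vc.pow p
  have hC : CircL Γ ((Prod.fst : Y × Cir χ → Y) ⁻¹' orb Γ y) q ρ := by
    refine ⟨qc, fun x => ?_, fun γ x => ?_, fun x x' hq => ?_, ?_, fun t γ x => ?_, fun x => ?_, fun t x => ?_, ?_⟩
    · simp only [q, norm_pow, Cir.norm, one_pow]
    · show (act γ x.1.2).v ^ p = _
      rw [Cir.v_act, mul_pow, ch_pow, one_mul]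
    · obtain ⟨γ, hγ⟩ := x.2
      obtain ⟨γ', hγ'⟩ := x'.2
      have e : act (γ' - γ) x.1.1 = x'.1.1 := by
        rw [← hγ, ← hγ', ← act_add]; congr 1; abel
      simp only [q] at hq
      obtain ⟨c, hc⟩ := root_ch (p := p) (z := x'.1.2.v / x.1.2.v) (by
        rw [div_pow, hq, div_self (pow_ne_zero _ x'.1.2.ne)])
      obtain ⟨κ, hκ, hκc⟩ := hK (c - χ (γ' - γ))
      refine ⟨κ + (γ' - γ), Subtype.ext (Prod.ext ?_ (Cir.ext ?_))⟩
      · show act (κ + (γ' - γ)) x.1.1 = _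
        rw [act_add, e, hκ]
      · show (act (κ + (γ' - γ)) x.1.2).v = _
        rw [Cir.v_act, map_add, hκc, sub_add_cancel, hc, div_mul_cancel₀ _ x.1.2.ne]
    · refine Continuous.subtype_mk (Continuous.prodMk (by fun_prop) (Cir.cont_mk ?_)) _
      simp only [Cir.v_rot]
      exact (by fun_prop : Continuous fun u : ℝ × ((Prod.fst : Y × Cir χ → Y) ⁻¹' orb Γ y) => Complex.exp ((u.1 / p : ℝ) * Complex.I)).mul
        (Cir.cont.comp (continuous_snd.comp (continuous_subtype_val.comp continuous_snd)))
    · refine Subtype.ext (Prod.ext rfl (Cir.ext ?_))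
      show ((act γ x.1.2).rot (t / p)).v = (act γ (x.1.2.rot (t / p))).v
      simp only [Cir.v_rot, Cir.v_act]; ring
    · refine Subtype.ext (Prod.ext rfl (Cir.ext ?_))
      show (x.1.2.rot (0 / p)).v = _
      simp [Cir.v_rot]
    · show (x.1.2.rot (t / p)).v ^ p = _
      simp only [Cir.v_rot, q]
      rw [mul_pow, ← Complex.exp_nat_mul]
      congr 2
      push_cast; field_simp
    · exact ⟨⟨(y, Cir.mk 1 (by simp)), orb_self y⟩⟩
  refine hC.fibStd (subG_unif _ hUW) (Coch.pb (tauF_mem χ) (subG_val _)) (lam := -1) (by simp) ?_ ?_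
  · intro x hx
    obtain ⟨N, hN, m, h⟩ := uu_root (p := p) (w0 := x.1.2.v) (α := arg2) x.1.2.norm (arg2_cont hx) arg2_exp
    have hop : IsOpen {x : ((Prod.fst : Y × Cir χ → Y) ⁻¹' orb Γ y) | -q x ∈ Complex.slitPlane} := Complex.isOpen_slitPlane.preimage qc.neg
    refine ⟨_, Filter.inter_mem (vc.continuousAt hN) (hop.mem_nhds hx), fun a ha b hb => ?_⟩
    show uu p b.1.2.v - uu p a.1.2.v = 0
    rw [h _ ha.1 a.1.2.norm, h _ hb.1 b.1.2.norm, floor_arg2 ha.2, floor_arg2 hb.2]; simp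
  · intro x hx
    obtain ⟨N, hN, m, h⟩ := uu_root (p := p) (w0 := x.1.2.v) (α := Complex.arg) x.1.2.norm
      (Complex.continuousAt_arg (Or.inl hx)) arg_exp
    refine ⟨_, vc.continuousAt hN, fun a ha b hb => ?_⟩
    show uu p b.1.2.v - uu p a.1.2.v = _
    rw [h _ ha a.1.2.norm, h _ hb b.1.2.norm, floor_arg, floor_arg]
    simp only [indC, q]
    split_ifs <;> simp

end Gys
end Volo

namespace Volo
open scoped Topology
open GSp

section ZT
variable {Γ X X1 R : Type} [AddCommGroup Γ] [Finite Γ] [MetricSpace X] [MetricSpace X1] [GSp Γ X] [GSp Γ X1]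
  [CommRing R]

theorem toZ {f : List X → R} (hf : f [] = 0) {S : Set X}
    (h : ∀ n, ∃ g ∈ Coch Γ X R, ∀ x ∈ S, G0 (n + 1) (f - D g) x) :
    ∃ g ∈ Coch Γ X R, ∀ x ∈ S, Z0 (f - D g) x := by
  choose g hg h using h
  refine ⟨asm 0 g, asm_mem 0 hg, fun x hx n => ?_⟩
  cases n with
  | zero => exact G0_lvl0 (by simp [hf]) x
  | succ n =>
    obtain ⟨U, hU, hh⟩ := h n x hx
    refine ⟨U, hU, fun l hl ha => ?_⟩
    have e : D (asm 0 g) l = D (g n) l := by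
      refine D_congr_len (n := n) (fun l hl => ?_) l hl
      simp [asm, hl]
    rw [Pi.sub_apply, e]
    exact hh l hl ha

theorem tautZ [CompactSpace X1] (hU : Unif Γ X) (e : X1 → X)
    (he : Continuous e) (hi : Function.Injective e) (heq : Eqv Γ e) {f : List X → R}
    (hf : f ∈ Coch Γ X R) (hD : ∀ s, Z0 (D f) (e s)) {g : List X1 → R}
    (hg : g ∈ Coch Γ X1 R) (h : ∀ s, Z0 (pb e f - D g) s) :
    ∃ g' ∈ Coch Γ X R, ∀ s, Z0 (f - D g') (e s) := by
  obtain ⟨g', h1, h2⟩ := toZ (Γ := Γ) (S := range e) hf.1 fun n => by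
    obtain ⟨g', h1, h2⟩ := taut (n := n) hU e he hi heq hf (fun s => hD s _) hg (fun s => h s _)
    exact ⟨g', h1, by rintro _ ⟨s, rfl⟩; exact h2 s⟩
  exact ⟨g', h1, fun s => h2 _ ⟨s, rfl⟩⟩

theorem homotopyZ [CompactSpace X1] (H : ℝ → X1 → X) (hH : Continuous fun q : ℝ × X1 => H q.1 q.2)
    (heq : ∀ s, Eqv Γ (H s)) {f : List X → R}
    (hf : f ∈ Coch Γ X R) (hD : ∀ x, Z0 (D f) x) :
    ∃ g ∈ Coch Γ X1 R, ∀ x, Z0 (pb (H 1) f - pb (H 0) f - D g) x := by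
  obtain ⟨g', h1, h2⟩ := toZ (Γ := Γ) (S := (univ : Set X1)) (f := pb (H 1) f - pb (H 0) f)
    (by simp [pb_apply, hf.1]) fun n => by
    obtain ⟨g', h1, h2⟩ := homotopy (n := n) H hH heq hf (fun s => hD s _)
    exact ⟨g', h1, fun s _ => h2 s⟩
  exact ⟨g', h1, fun s => h2 _ trivial⟩

theorem mvZ {B C : Set X} (hB : IsClosed B) (hC : IsClosed C) (iB : InvS Γ B) (iC : InvS Γ C)
    {f g1 g2 m : List X → R} (hf : f [] = 0) (h1 : g1 ∈ Coch Γ X R) (h2 : g2 ∈ Coch Γ X R)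
    (hm : m ∈ Coch Γ X R) (e1 : ∀ x ∈ B, Z0 (f - D g1) x)
    (e2 : ∀ x ∈ C, Z0 (f - D g2) x) (e3 : ∀ x ∈ B ∩ C, Z0 (g1 - g2 - D m) x) :
    ∃ g ∈ Coch Γ X R, ∀ x ∈ B ∪ C, Z0 (f - D g) x :=
  toZ hf fun n => mv_glue (n := n) hB hC iB iC h1 h2 hm (fun x hx => e1 x hx _) (fun x hx => e2 x hx _)
    (fun x hx => e3 x hx _)

/-- extension of vanishing along a deformation -/
theorem extZ [CompactSpace X] (hU : Unif Γ X) {S : Set X} (hS : IsClosed S) (iS : InvS Γ S) {f : List X → R}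
    (hf : f ∈ Coch Γ X R) (hD : ∀ x ∈ S, Z0 (D f) x) (H : ℝ → S → S)
    (hH : Continuous fun q : ℝ × S => H q.1 q.2)
    (heq : letI := subG iS
      ∀ s, Eqv Γ (H s)) (h1 : ∀ x, H 1 x = x) {i : X1 → X} {ρ : S → X1} (hρ : Continuous ρ)
    (eρ : letI := subG iS
      Eqv Γ ρ) (h0 : ∀ x, (H 0 x).1 = i (ρ x)) {g : List X1 → R} (hg : g ∈ Coch Γ X1 R)
    (hi : ∀ x, Z0 (pb i f - D g) x) : ∃ g' ∈ Coch Γ X R, ∀ x ∈ S, Z0 (f - D g') x := by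
  letI := subG iS
  haveI : CompactSpace S := isCompact_iff_compactSpace.1 hS.isCompact
  have hv : Eqv Γ (Subtype.val : S → X) := subG_val iS
  obtain ⟨g1, m1, hg1⟩ := homotopyZ (Γ := Γ) H hH heq (f := pb Subtype.val f) (Coch.pb hf hv) fun x => by
    rw [← pb_D]
    exact (hD x.1 x.2).pb continuous_subtype_val.continuousAt
  have e1 : pb (H 1) (pb Subtype.val f) = pb Subtype.val f := by
    rw [show H 1 = id from funext h1]; funext l; simp [pb_apply]
  have e0 : pb (H 0) (pb Subtype.val f) = pb ρ (pb i f) := by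
    rw [pb_pb, pb_pb, show Subtype.val ∘ H 0 = i ∘ ρ from funext h0]
  rw [e1, e0] at hg1
  obtain ⟨g', m', hg'⟩ := tautZ hU (Subtype.val : S → X) continuous_subtype_val Subtype.val_injective hv hf
    (fun s => hD s.1 s.2) (g := g1 + pb ρ g) (add_mem m1 (Coch.pb hg eρ)) fun s => by
    refine ((hg1 s).add ((hi (ρ s)).pb hρ.continuousAt)).congr ?_
    rw [map_sub, pb_D, D_add_fun]; abel
  exact ⟨g', m', fun x hx => hg' ⟨x, hx⟩⟩

end ZT

section Hdef
variable (Γ X R : Type) [AddCommGroup Γ] [MetricSpace X] [GSp Γ X] [CommRing R]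

/-- cocycles -/
def Zc : Submodule R (List X → R) where
  carrier := {f | f ∈ Coch Γ X R ∧ ∀ x, Z0 (D f) x}
  add_mem' := by
    rintro f g ⟨h1, h2⟩ ⟨h3, h4⟩
    exact ⟨add_mem h1 h3, fun x => by rw [D_add_fun]; exact (h2 x).add (h4 x)⟩
  zero_mem' := ⟨zero_mem _, fun x => by rw [D_zero_fun]; exact Z0.zero x⟩
  smul_mem' := by
    rintro c f ⟨h1, h2⟩
    exact ⟨Submodule.smul_mem _ _ h1, fun x => by rw [D_smul_fun]; exact (h2 x).smul c⟩

/-- coboundaries -/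
def Bc : Submodule R (Zc Γ X R) where
  carrier := {f | ∃ g ∈ Coch Γ X R, ∀ x, Z0 (f.1 - D g) x}
  add_mem' := by
    rintro f g ⟨a, h1, h2⟩ ⟨b, h3, h4⟩
    refine ⟨a + b, add_mem h1 h3, fun x => ((h2 x).add (h4 x)).congr ?_⟩
    rw [D_add_fun, Submodule.coe_add]; abel
  zero_mem' := ⟨0, zero_mem _, fun x => by rw [D_zero_fun, Submodule.coe_zero, sub_zero]; exact Z0.zero x⟩
  smul_mem' := by
    rintro c f ⟨a, h1, h2⟩
    refine ⟨c • a, Submodule.smul_mem _ _ h1, fun x => ((h2 x).smul c).congr ?_⟩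
    rw [D_smul_fun, smul_sub]; rfl

/-- cohomology -/
abbrev HH : Type := Zc Γ X R ⧸ Bc Γ X R
end Hdef

section Hops
variable {Γ X X1 X2 R : Type} [AddCommGroup Γ] [MetricSpace X] [MetricSpace X1] [GSp Γ X] [GSp Γ X1]
  [MetricSpace X2] [GSp Γ X2] [CommRing R]

/-- class of a cocycle -/
def cls {f : List X → R} (h : f ∈ Zc Γ X R) : HH Γ X R := Submodule.Quotient.mk ⟨f, h⟩

theorem cls_ind {P : HH Γ X R → Prop} (h : ∀ f (hf : f ∈ Zc Γ X R), P (cls hf)) : ∀ u, P u := by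
  intro u
  induction u using Submodule.Quotient.induction_on with
  | H z => exact h z.1 z.2

theorem cls_eq {f g : List X → R} (hf : f ∈ Zc Γ X R) (hg : g ∈ Zc Γ X R) :
    cls hf = cls hg ↔ ∃ k ∈ Coch Γ X R, ∀ x, Z0 (f - g - D k) x := by
  rw [cls, cls, Submodule.Quotient.eq]; rfl

theorem cls_zero {f : List X → R} (hf : f ∈ Zc Γ X R) :
    cls hf = 0 ↔ ∃ k ∈ Coch Γ X R, ∀ x, Z0 (f - D k) x := by
  rw [cls, Submodule.Quotient.mk_eq_zero]; rfl

theorem cls_congr {f g : List X → R} {hf : f ∈ Zc Γ X R} {hg : g ∈ Zc Γ X R} (h : f = g) :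
    cls hf = cls hg := by subst h; rfl

theorem cls_add {f g : List X → R} (hf : f ∈ Zc Γ X R) (hg : g ∈ Zc Γ X R) :
    cls hf + cls hg = cls (add_mem hf hg) := rfl
theorem cls_sub {f g : List X → R} (hf : f ∈ Zc Γ X R) (hg : g ∈ Zc Γ X R) :
    cls hf - cls hg = cls (sub_mem hf hg) := rfl
theorem cls_neg {f : List X → R} (hf : f ∈ Zc Γ X R) : - cls hf = cls (neg_mem hf) := rfl
theorem cls_smul (c : R) {f : List X → R} (hf : f ∈ Zc Γ X R) :
    c • cls hf = cls (Submodule.smul_mem _ c hf) := rfl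

theorem Zc.pb {f : List X → R} (hf : f ∈ Zc Γ X R) {φ : X1 → X} (hc : Continuous φ) (he : Eqv Γ φ) :
    pb φ f ∈ Zc Γ X1 R :=
  ⟨Coch.pb hf.1 he, fun x => by rw [← pb_D]; exact (hf.2 _).pb hc.continuousAt⟩

theorem Zc.cup {f g : List X → R} (hf : f ∈ Zc Γ X R) (hg : g ∈ Zc Γ X R) : cup f g ∈ Zc Γ X R :=
  ⟨Coch.cup hf.1 hg.1, fun x => by
    rw [leibniz_fun _ _ hf.1.1 hg.1.1]
    exact ((hf.2 x).cup_left).add (hg.2 x).cup_right⟩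

theorem Zc.sg {f : List X → R} (hf : f ∈ Zc Γ X R) : sg f ∈ Zc Γ X R :=
  ⟨Coch.sg hf.1, fun x => by rw [D_sg]; exact (hf.2 x).sg.neg⟩

theorem Zc.D {f : List X → R} (hf : f ∈ Coch Γ X R) : D f ∈ Zc Γ X R :=
  ⟨Coch.D hf, fun x => by rw [DD]; exact Z0.zero x⟩

open Classical in
/-- pull-back in cohomology (zero for bad maps) -/
noncomputable def pull (Γ R : Type) {X X1 : Type} [AddCommGroup Γ] [MetricSpace X] [MetricSpace X1] [GSp Γ X] [GSp Γ X1]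
   [CommRing R] (φ : X1 → X) : HH Γ X R →ₗ[R] HH Γ X1 R :=
  if h : Continuous φ ∧ Eqv Γ φ then
    Submodule.mapQ _ _ (((Volo.pb φ).comp (Zc Γ X R).subtype).codRestrict (Zc Γ X1 R)
      fun f => Zc.pb f.2 h.1 h.2) (by
      rintro f ⟨g, h1, h2⟩
      refine ⟨Volo.pb φ g, Coch.pb h1 h.2, fun x => ((h2 (φ x)).pb h.1.continuousAt).congr ?_⟩
      rw [map_sub, pb_D]; rfl)
  else 0

theorem pull_cls {φ : X1 → X} (hc : Continuous φ) (he : Eqv Γ φ) {f : List X → R} (hf : f ∈ Zc Γ X R) :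
    pull Γ R φ (cls hf) = cls (Zc.pb hf hc he) := by
  rw [pull, dif_pos ⟨hc, he⟩]; rfl

theorem pull_pull {φ : X1 → X} (hc : Continuous φ) (he : Eqv Γ φ) {ψ : X2 → X1} (hc' : Continuous ψ)
    (he' : Eqv Γ ψ) (u : HH Γ X R) : pull Γ R ψ (pull Γ R φ u) = pull Γ R (φ ∘ ψ) u := by
  revert u
  refine cls_ind fun f hf => ?_
  have e3 : Eqv Γ (φ ∘ ψ) := fun γ x => by simp [he' γ, he γ]
  rw [pull_cls hc he, pull_cls hc' he', pull_cls (hc.comp hc') e3]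
  exact cls_congr (pb_pb _ _ _)

theorem pull_id (u : HH Γ X R) : pull Γ R (id : X → X) u = u := by
  revert u
  refine cls_ind fun f hf => ?_
  rw [pull_cls continuous_id (fun _ _ => rfl)]
  exact cls_congr (by funext l; simp [pb_apply])

theorem pull_htpy [Finite Γ] [CompactSpace X1] (H : ℝ → X1 → X) (hH : Continuous fun q : ℝ × X1 => H q.1 q.2)
    (heq : ∀ s, Eqv Γ (H s)) (u : HH Γ X R) : pull Γ R (H 1) u = pull Γ R (H 0) u := by
  revert u
  refine cls_ind fun f hf => ?_
  have hc : ∀ s, Continuous (H s) := fun s => hH.comp (continuous_const.prodMk continuous_id)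
  rw [pull_cls (hc 1) (heq 1), pull_cls (hc 0) (heq 0), cls_eq]
  exact homotopyZ H hH heq hf.1 hf.2

open Classical in
/-- right multiplication -/
noncomputable def rc (Γ : Type) {X R : Type} [AddCommGroup Γ] [MetricSpace X] [GSp Γ X] [CommRing R]
    (c : List X → R) : HH Γ X R →ₗ[R] HH Γ X R :=
  if h : c ∈ Zc Γ X R then
    Submodule.mapQ _ _ ((((cupL (R := R)).flip c).comp (Zc Γ X R).subtype).codRestrict (Zc Γ X R)
      fun f => Zc.cup f.2 h) (by
      rintro f ⟨g, h1, h2⟩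
      refine ⟨cup g c, Coch.cup h1 h.1, fun x => (((h2 x).cup_left (g := c)).sub ((h.2 x).cup_right (f := sg g))).congr ?_⟩
      rw [cup_sub_left, leibniz_fun _ _ h1.1 h.1.1]
      show _ = cup f.1 c - _
      abel)
  else 0

theorem rc_cls {c : List X → R} (hc : c ∈ Zc Γ X R) {f : List X → R} (hf : f ∈ Zc Γ X R) :
    rc Γ c (cls hf) = cls (Zc.cup hf hc) := by
  rw [rc, dif_pos hc]; rfl

theorem rc_congr {c c' k : List X → R} (hc : c ∈ Zc Γ X R) (hc' : c' ∈ Zc Γ X R) (hk : k ∈ Coch Γ X R)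
    (h : ∀ x, Z0 (c - c' - D k) x) : rc Γ c = rc Γ c' := by
  refine LinearMap.ext (cls_ind fun f hf => ?_)
  rw [rc_cls hc, rc_cls hc', cls_eq]
  refine ⟨cup (sg f) k, Coch.cup (Coch.sg hf.1) hk, fun x =>
    (((h x).cup_right (f := f)).sub (((hf.2 x).sg.neg).cup_left (g := k))).congr ?_⟩
  rw [leibniz_fun _ _ (Coch.sg hf.1).1 hk.1, sg_sg, D_sg, cup_sub_right, cup_sub_right]
  abel

theorem rc_add {c c' : List X → R} (hc : c ∈ Zc Γ X R) (hc' : c' ∈ Zc Γ X R) :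
    rc Γ (c + c') = rc Γ c + rc Γ c' := by
  refine LinearMap.ext (cls_ind fun f hf => ?_)
  rw [LinearMap.add_apply, rc_cls hc, rc_cls hc', rc_cls (add_mem hc hc'), cls_add]
  congr 1; simp [cup_add_right]

theorem rc_pull {c : List X → R} (hc : c ∈ Zc Γ X R) {φ : X1 → X} (hφ : Continuous φ) (he : Eqv Γ φ)
    (u : HH Γ X R) : pull Γ R φ (rc Γ c u) = rc Γ (pb φ c) (pull Γ R φ u) := by
  revert u
  refine cls_ind fun f hf => ?_
  rw [rc_cls hc, pull_cls hφ he, pull_cls hφ he, rc_cls (Zc.pb hc hφ he)]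
  congr 1; simp [pb_cup]

theorem rc_zero : rc Γ (0 : List X → R) = 0 := by
  have h : (0 : List X → R) ∈ Zc Γ X R := zero_mem _
  have := rc_add h h
  simpa using this

theorem rc_rc {c c' : List X → R} (hc : c ∈ Zc Γ X R) (hc' : c' ∈ Zc Γ X R) (u : HH Γ X R) :
    rc Γ c' (rc Γ c u) = rc Γ (cup c c') u := by
  revert u
  refine cls_ind fun f hf => ?_
  rw [rc_cls hc, rc_cls hc', rc_cls (Zc.cup hc hc')]
  congr 1; simp [cup_assoc]
end Hops
end Volo

namespace Volo
open scoped Topology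
open GSp

section Tops
variable {Γ X X1 : Type} [AddCommGroup Γ] [Finite Γ] [MetricSpace X] [GSp Γ X] [MetricSpace X1] [GSp Γ X1]
variable {p : ℕ} [hp : Fact p.Prime]

theorem tS_Zc {χ : Γ →+ ZMod p} {s : X → ZMod p} (hs : IsSec χ s) : tS s ∈ Zc Γ X (ZMod p) :=
  ⟨tS_mem hs, fun x => by rw [tS_D]; exact Z0.zero x⟩

theorem zero_sec : IsSec (0 : Γ →+ ZMod p) (fun _ : X => 0) := fun γ x => by simp

theorem IsSec.add {χ χ' : Γ →+ ZMod p} {s s' : X → ZMod p} (h : IsSec χ s) (h' : IsSec χ' s') :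
    IsSec (χ + χ') (s + s') := fun γ x => by
  simp only [Pi.add_apply, h γ, h' γ, AddMonoidHom.add_apply]; ring

theorem IsSec.comp {χ : Γ →+ ZMod p} {s : X → ZMod p} (h : IsSec χ s) {φ : X1 → X} (he : Eqv Γ φ) :
    IsSec χ (s ∘ φ) := fun γ x => by simp [he γ x, h γ]

/-- one-cocycle of a section -/
def yS (s : X → ZMod p) : List X → ZMod p := c2 fun a b => s b - s a

theorem yS_Zc {χ : Γ →+ ZMod p} {s : X → ZMod p} (hs : IsSec χ s) : yS s ∈ Zc Γ X (ZMod p) := by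
  refine ⟨c2_mem fun γ a b => by rw [hs γ, hs γ]; ring, fun x => ?_⟩
  have : D (yS s) = 0 := by
    refine eq_of_lv ((c2_lv _).D (by norm_num)) (fun _ _ => rfl) (len3 fun a b c => ?_)
    rw [D3]; simp only [c2, yS, Pi.zero_apply]; ring
  rw [this]; exact Z0.zero x

theorem yS_pb (s : X → ZMod p) (φ : X1 → X) : pb φ (yS s) = yS (s ∘ φ) := by
  funext l
  rcases l with _ | ⟨a, _ | ⟨b, _ | ⟨c, l⟩⟩⟩ <;> rfl

open Classical in
/-- multiplication by the Bockstein class of a character -/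
noncomputable def TT (X : Type) [MetricSpace X] [GSp Γ X] (χ : Γ →+ ZMod p) :
    HH Γ X (ZMod p) →ₗ[ZMod p] HH Γ X (ZMod p) :=
  if h : ∃ s : X → ZMod p, IsSec χ s then rc Γ (tS h.choose) else 0

open Classical in
/-- multiplication by the class of a character -/
noncomputable def YY (X : Type) [MetricSpace X] [GSp Γ X] (χ : Γ →+ ZMod p) :
    HH Γ X (ZMod p) →ₗ[ZMod p] HH Γ X (ZMod p) :=
  if h : ∃ s : X → ZMod p, IsSec χ s then rc Γ (yS h.choose) else 0

theorem rc_tS_congr {χ : Γ →+ ZMod p} {s s' : X → ZMod p} (hs : IsSec χ s) (hs' : IsSec χ s') :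
    rc Γ (tS s) = rc Γ (tS s') := by
  obtain ⟨r, hr, e⟩ := tS_add (s'' := s) hs' (zero_sec (X := X) (Γ := Γ)) (by rwa [add_zero])
  refine rc_congr (tS_Zc hs) (tS_Zc hs') hr fun x => (Z0.zero x).congr ?_
  rw [e, tS_zero]; abel

theorem TT_eq {χ : Γ →+ ZMod p} {s : X → ZMod p} (hs : IsSec χ s) : TT X χ = rc Γ (tS s) := by
  have h : ∃ s : X → ZMod p, IsSec χ s := ⟨s, hs⟩
  rw [TT, dif_pos h]
  exact rc_tS_congr h.choose_spec hs

theorem YY_eq {χ : Γ →+ ZMod p} {s : X → ZMod p} (hs : IsSec χ s) : YY X χ = rc Γ (yS s) := by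
  have h : ∃ s : X → ZMod p, IsSec χ s := ⟨s, hs⟩
  rw [YY, dif_pos h]
  have h' := h.choose_spec
  let k : List X → ZMod p := fun l => match l with
    | [a] => h.choose a - s a
    | _ => 0
  refine rc_congr (yS_Zc h') (yS_Zc hs) (k := k) ⟨rfl, fun γ l => ?_⟩ fun x => (Z0.zero x).congr ?_
  · rcases l with _ | ⟨a, _ | ⟨b, l⟩⟩
    · rfl
    · simp [k, h' γ, hs γ]
    · rfl
  · symm; rw [sub_eq_zero]
    have hk : Lv 1 k := by
      intro l hl
      rcases l with _ | ⟨a, _ | ⟨b, l⟩⟩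
      · rfl
      · simp at hl
      · rfl
    refine eq_of_lv (k := 2) ?_ (hk.D (by norm_num)) ?_
    · intro l hl
      rw [Pi.sub_apply, yS, yS, c2_lv _ l hl, c2_lv _ l hl, sub_zero]
    · intro l hl
      obtain ⟨a, b, rfl⟩ := List.length_eq_two.1 hl
      rw [D_two _ rfl]
      simp only [yS, c2, k, Pi.sub_apply]; ring

theorem TT_pull {χ : Γ →+ ZMod p} (h : ∃ s : X → ZMod p, IsSec χ s) {φ : X1 → X} (hc : Continuous φ)
    (he : Eqv Γ φ) (u : HH Γ X (ZMod p)) :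
    pull Γ (ZMod p) φ (TT X χ u) = TT X1 χ (pull Γ (ZMod p) φ u) := by
  obtain ⟨s, hs⟩ := h
  rw [TT_eq hs, TT_eq (hs.comp he), rc_pull (tS_Zc hs) hc he, tS_pb]

theorem YY_pull {χ : Γ →+ ZMod p} (h : ∃ s : X → ZMod p, IsSec χ s) {φ : X1 → X} (hc : Continuous φ)
    (he : Eqv Γ φ) (u : HH Γ X (ZMod p)) :
    pull Γ (ZMod p) φ (YY X χ u) = YY X1 χ (pull Γ (ZMod p) φ u) := by
  obtain ⟨s, hs⟩ := h
  rw [YY_eq hs, YY_eq (hs.comp he), rc_pull (yS_Zc hs) hc he, yS_pb]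

theorem TT_add {χ χ' : Γ →+ ZMod p} (h : ∃ s : X → ZMod p, IsSec χ s)
    (h' : ∃ s : X → ZMod p, IsSec χ' s) : TT X (χ + χ') = TT X χ + TT X χ' := by
  obtain ⟨s, hs⟩ := h
  obtain ⟨s', hs'⟩ := h'
  rw [TT_eq hs, TT_eq hs', TT_eq (hs.add hs'), ← rc_add (tS_Zc hs) (tS_Zc hs')]
  obtain ⟨r, hr, e⟩ := tS_add hs hs' (hs.add hs')
  refine rc_congr (tS_Zc (hs.add hs')) (add_mem (tS_Zc hs) (tS_Zc hs')) hr fun x => (Z0.zero x).congr ?_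
  rw [e]; abel

theorem TT_zero : TT X (0 : Γ →+ ZMod p) = 0 := by
  rw [TT_eq zero_sec, tS_zero, rc_zero]

theorem TT_nsmul {χ : Γ →+ ZMod p} (h : ∃ s : X → ZMod p, IsSec χ s) (n : ℕ) :
    TT X (n • χ) = n • TT X χ := by
  induction n with
  | zero => simp [TT_zero]
  | succ n ih =>
    rw [succ_nsmul, succ_nsmul, TT_add ?_ h, ih]
    obtain ⟨s, hs⟩ := h
    exact ⟨n • s, fun γ x => by simp [hs γ, mul_add]⟩

/-- cup-one product of two-cochains -/
def cup1 (a b : List X → ZMod p) : List X → ZMod p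
  | [x0, x1, x2, x3] => a [x0, x1, x3] * b [x1, x2, x3] - a [x0, x2, x3] * b [x0, x1, x2]
  | _ => 0

theorem cup1_comm {a b : List X → ZMod p} (ha : Lv 3 a) (hb : Lv 3 b) (da : D a = 0) (db : D b = 0) :
    cup a b - cup b a = D (cup1 a b) := by
  have hk : Lv 4 (cup1 a b) := by
    intro l hl
    rcases l with _ | ⟨x0, _ | ⟨x1, _ | ⟨x2, _ | ⟨x3, _ | ⟨x4, l⟩⟩⟩⟩⟩ <;> first | rfl | simp at hl
  have hc : ∀ {a b : List X → ZMod p}, Lv 3 a → Lv 3 b → Lv 5 (cup a b) := by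
    intro a b ha hb l hl
    refine cup_eq_sum_zero a b l fun l1 x l2 h => ?_
    by_cases h1 : (l1 ++ [x]).length = 3
    · rw [hb (x :: l2), mul_zero]
      subst h; simp at hl h1 ⊢; omega
    · rw [ha _ h1, zero_mul]
  refine eq_of_lv (k := 5) (fun l hl => by rw [Pi.sub_apply, hc ha hb l hl, hc hb ha l hl, sub_zero])
    (hk.D (by norm_num)) ?_
  intro l hl
  rcases l with _ | ⟨x0, _ | ⟨x1, _ | ⟨x2, _ | ⟨x3, _ | ⟨x4, _ | ⟨x5, l⟩⟩⟩⟩⟩⟩ <;> simp at hl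
  have ea : ∀ w x y z, a [x, y, z] - a [w, y, z] + a [w, x, z] - a [w, x, y] = 0 := fun w x y z => by
    rw [← D4, da]; rfl
  have eb : ∀ w x y z, b [x, y, z] - b [w, y, z] + b [w, x, z] - b [w, x, y] = 0 := fun w x y z => by
    rw [← D4, db]; rfl
  have a1 : ∀ x, a [x] = 0 := fun x => ha _ (by simp)
  have a2 : ∀ x y, a [x, y] = 0 := fun x y => ha _ (by simp)
  have a4 : ∀ x y z w, a [x, y, z, w] = 0 := fun x y z w => ha _ (by simp)
  have a5 : ∀ x y z w v, a [x, y, z, w, v] = 0 := fun x y z w v => ha _ (by simp)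
  have b1 : ∀ x, b [x] = 0 := fun x => hb _ (by simp)
  have b2 : ∀ x y, b [x, y] = 0 := fun x y => hb _ (by simp)
  have b4 : ∀ x y z w, b [x, y, z, w] = 0 := fun x y z w => hb _ (by simp)
  have b5 : ∀ x y z w v, b [x, y, z, w, v] = 0 := fun x y z w v => hb _ (by simp)
  simp only [Pi.sub_apply, cup, D, cup1, a1, a2, a4, a5, b1, b2, b4, b5]
  linear_combination -(a [x0, x1, x3]) * eb x0 x1 x2 x3 + a [x1, x3, x4] * eb x0 x1 x2 x3
    + a [x0, x1, x4] * eb x0 x1 x2 x4 - b [x2, x3, x4] * ea x0 x1 x2 x4 + b [x0, x1, x2] * ea x0 x1 x3 x4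
    - b [x0, x1, x3] * ea x0 x1 x3 x4 - a [x0, x1, x4] * eb x0 x1 x3 x4 + b [x0, x2, x3] * ea x0 x1 x3 x4
    - b [x0, x1, x2] * ea x0 x2 x3 x4 + a [x0, x1, x4] * eb x0 x2 x3 x4

theorem TT_comm {χ χ' : Γ →+ ZMod p} (h : ∃ s : X → ZMod p, IsSec χ s)
    (h' : ∃ s : X → ZMod p, IsSec χ' s) : Commute (TT X χ) (TT X χ') := by
  obtain ⟨s, hs⟩ := h
  obtain ⟨s', hs'⟩ := h'
  rw [TT_eq hs, TT_eq hs']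
  refine LinearMap.ext fun u => ?_
  rw [Module.End.mul_apply, Module.End.mul_apply, rc_rc (tS_Zc hs) (tS_Zc hs'), rc_rc (tS_Zc hs') (tS_Zc hs)]
  refine LinearMap.congr_fun (rc_congr (Zc.cup (tS_Zc hs') (tS_Zc hs)) (Zc.cup (tS_Zc hs) (tS_Zc hs'))
    (k := cup1 (tS s') (tS s)) ⟨rfl, fun γ l => ?_⟩ fun x => (Z0.zero x).congr ?_) u
  · rcases l with _ | ⟨x0, _ | ⟨x1, _ | ⟨x2, _ | ⟨x3, _ | ⟨x4, l⟩⟩⟩⟩⟩ <;> try rfl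
    have e1 := (tS_mem hs).2 γ
    have e2 := (tS_mem hs').2 γ
    have e1' : ∀ x y z, tS s [act γ x, act γ y, act γ z] = tS s [x, y, z] := fun x y z => e1 [x, y, z]
    have e2' : ∀ x y z, tS s' [act γ x, act γ y, act γ z] = tS s' [x, y, z] := fun x y z => e2 [x, y, z]
    simp [cup1, e1', e2']
  · rw [cup1_comm (tS_lv _) (tS_lv _) (tS_D _) (tS_D _), sub_self]

theorem cup_one_right (f : List X → ZMod p) (hf : f [] = 0) : cup f one = f := by
  have : ∀ (l : List X) (f : List X → ZMod p), l ≠ [] → cup f one l = f l := by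
    intro l
    induction l with
    | nil => intro f h; exact absurd rfl h
    | cons a l ih =>
      intro f _
      rw [cup]
      cases l with
      | nil => simp [one, cup]
      | cons b l => rw [ih _ (by simp)]; simp [one]
  funext l
  cases l with
  | nil => rw [hf]; rfl
  | cons a l => exact this _ _ (by simp)

/-- Euler class vanishing -/
theorem rc_list_zero (hodd : Odd p) (L : List ((Γ →+ ZMod p) × (X → ℂ)))
    (hs : ∀ q ∈ L, ∃ s : X → ZMod p, IsSec q.1 s) (hc : ∀ q ∈ L, Continuous q.2)
    (hh : ∀ q ∈ L, ∀ (γ : Γ) x, q.2 (act γ x) = ch p (q.1 γ) * q.2 x) :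
    ∃ c ∈ Zc Γ X (ZMod p), (∀ u, (L.map fun q => TT X q.1).prod u = rc Γ c u) ∧
      ∀ x, (∃ q ∈ L, q.2 x ≠ 0) → Z0 c x := by
  induction L with
  | nil =>
    refine ⟨one, ⟨one_mem, fun x => by rw [D_one]; exact Z0.zero x⟩, ?_, by simp⟩
    refine cls_ind fun f hf => ?_
    rw [rc_cls ⟨one_mem, fun x => by rw [D_one]; exact Z0.zero x⟩]
    simp only [List.map_nil, List.prod_nil, Module.End.one_apply]
    exact cls_congr (cup_one_right f hf.1.1).symm
  | cons q L ih =>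
    obtain ⟨c, hcz, h1, h2⟩ := ih (fun q hq => hs q (by simp [hq])) (fun q hq => hc q (by simp [hq]))
      (fun q hq => hh q (by simp [hq]))
    obtain ⟨s, hs⟩ := hs q (by simp)
    have hu := uh_sec hs (hh q (by simp))
    have hW := WS_mem hs hu
    have hZ : tS s - D (WS s (uh s q.2)) ∈ Zc Γ X (ZMod p) := sub_mem (tS_Zc hs) (Zc.D hW)
    refine ⟨cup c (tS s - D (WS s (uh s q.2))), Zc.cup hcz hZ, fun u => ?_, fun x hx => ?_⟩
    · rw [List.map_cons, List.prod_cons, Module.End.mul_apply, h1, TT_eq hs,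
        rc_congr (tS_Zc hs) hZ hW (fun x => (Z0.zero x).congr (by abel)), rc_rc hcz hZ]
    · obtain ⟨q', hq', hx⟩ := hx
      rcases List.mem_cons.1 hq' with rfl | hq'
      · exact (uh_Z0 hodd s (hc q' (by simp)).continuousAt hx).cup_right
      · exact (h2 x ⟨q', hq', hx⟩).cup_left

theorem rc_Z0 {c : List X → ZMod p} (hc : c ∈ Zc Γ X (ZMod p)) (h : ∀ x, Z0 c x) : rc Γ c = 0 := by
  rw [rc_congr hc (zero_mem _) (k := 0) (zero_mem _) (fun x => by rw [D_zero_fun, sub_zero, sub_zero]; exact h x), rc_zero]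

theorem TT_prod_zero (hodd : Odd p) (L : List ((Γ →+ ZMod p) × (X → ℂ)))
    (hs : ∀ q ∈ L, ∃ s : X → ZMod p, IsSec q.1 s) (hc : ∀ q ∈ L, Continuous q.2)
    (hh : ∀ q ∈ L, ∀ (γ : Γ) x, q.2 (act γ x) = ch p (q.1 γ) * q.2 x) (hx : ∀ x, ∃ q ∈ L, q.2 x ≠ 0) :
    (L.map fun q => TT X q.1).prod = 0 := by
  obtain ⟨c, hcz, h1, h2⟩ := rc_list_zero hodd L hs hc hh
  refine LinearMap.ext fun u => ?_
  rw [h1, rc_Z0 hcz fun x => h2 x (hx x)]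

end Tops

section Gys
variable {Γ Y : Type} [AddCommGroup Γ] [Finite Γ] [MetricSpace Y] [GSp Γ Y] [CompactSpace Y]
variable {p : ℕ} [hp : Fact p.Prime]

theorem cir_unif (hU : Unif Γ Y) (χ : Γ →+ ZMod p) (hst : ∀ γ (y : Y), act γ y = y → χ γ = 0) :
    Unif Γ (Y × Cir χ) := unif_prod hU fun γ y h x => Cir.ext (by
    rw [Cir.v_act, hst γ y h, ch_zero, one_mul])

theorem sec_st {χ : Γ →+ ZMod p} {s : Y → ZMod p} (hs : IsSec χ s) : ∀ γ (y : Y), act γ y = y → χ γ = 0 := by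
  intro γ y h
  have := hs γ y
  rw [h] at this
  simpa using this

theorem fst_surj (χ : Γ →+ ZMod p) : Function.Surjective (Prod.fst : Y × Cir χ → Y) :=
  fun y => ⟨(y, Cir.mk 1 (by simp)), rfl⟩

/-- Gysin form of LH -/
theorem LHg (hodd : Odd p) (hU : Unif Γ Y) {χ : Γ →+ ZMod p} {s : Y → ZMod p} (hs : IsSec χ s)
    {a0 a1 : List Y → ZMod p} {c : List (Y × Cir χ) → ZMod p} (m0 : a0 ∈ Coch Γ Y (ZMod p))
    (m1 : a1 ∈ Coch Γ Y (ZMod p)) (mc : c ∈ Coch Γ (Y × Cir χ) (ZMod p))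
    (h0 : ∀ y, Z0 (D a0 + cup (sg a1) (tS s)) y) (h1 : ∀ y, Z0 (D a1) y)
    (h2 : ∀ x, Z0 (pb Prod.fst a0 + cup (pb Prod.fst a1) (tauG χ s) - D c) x) :
    ∃ b0 ∈ Coch Γ Y (ZMod p), ∃ b1 ∈ Coch Γ Y (ZMod p), ∃ e ∈ Coch Γ (Y × Cir χ) (ZMod p),
      (∀ y, Z0 (a0 - (D b0 + cup (sg b1) (tS s))) y) ∧ (∀ y, Z0 (a1 - D b1) y) ∧
      ∀ x, Z0 (c - (pb Prod.fst b0 + cup (pb Prod.fst b1) (tauG χ s) - D e)) x := by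
  obtain ⟨b0, k0, b1, k1, e, ke, -, r⟩ := LH (Jp := True) hU (cir_unif hU χ (sec_st hs)) continuous_fst (fst_surj χ)
    fst_eqv (tauG_mem hs) (WS_lv _ _) (tS_mem hs) (tS_lv s) (fun y => by rw [tS_D]; exact Z0.zero y)
    (tauG_Z0 hodd s) (tS_diag s) (gysin_fib hodd hU χ (sec_st hs) hs) m0 m1 mc (by simp) h0 h1 h2
  exact ⟨b0, k0, b1, k1, e, ke, r⟩

theorem gysin_ker (hodd : Odd p) (hU : Unif Γ Y) {χ : Γ →+ ZMod p} (h : ∃ s : Y → ZMod p, IsSec χ s)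
    (u : HH Γ Y (ZMod p)) (hu : pull Γ (ZMod p) (Prod.fst : Y × Cir χ → Y) u = 0) : ∃ v, u = TT Y χ v := by
  obtain ⟨s, hs⟩ := h
  revert u
  refine cls_ind fun f hf hu => ?_
  rw [pull_cls continuous_fst fst_eqv, cls_zero] at hu
  obtain ⟨c, mc, hc⟩ := hu
  obtain ⟨b0, k0, b1, k1, e, ke, r0, r1, r2⟩ := LHg hodd hU hs hf.1 (zero_mem _) mc
    (fun y => (hf.2 y).congr (by rw [sg_zero, cup_zero_left, add_zero]))
    (fun y => by rw [D_zero_fun]; exact Z0.zero y)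
    (fun x => (hc x).congr (by rw [map_zero, cup_zero_left, add_zero]))
  have kz : b1 ∈ Zc Γ Y (ZMod p) := ⟨k1, fun y => ((r1 y).neg).congr (by abel)⟩
  refine ⟨cls (Zc.sg kz), ?_⟩
  rw [TT_eq hs, rc_cls (tS_Zc hs), cls_eq]
  exact ⟨b0, k0, fun y => (r0 y).congr (by abel)⟩

/-- circle with full stabilizers -/
theorem LHf (hodd : Odd p) (hU : Unif Γ Y) {χ : Γ →+ ZMod p}
    (hK : ∀ c, ∃ κ : Γ, (∀ y : Y, act κ y = y) ∧ χ κ = c) (hUW : Unif Γ (Y × Cir χ))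
    {a0 : List Y → ZMod p} {c : List (Y × Cir χ) → ZMod p} (m0 : a0 ∈ Coch Γ Y (ZMod p))
    (mc : c ∈ Coch Γ (Y × Cir χ) (ZMod p))
    (h0 : ∀ y, Z0 (D a0) y)
    (h2 : ∀ x, Z0 (pb Prod.fst a0 - D c) x) :
    ∃ b0 ∈ Coch Γ Y (ZMod p), ∃ b1 ∈ Coch Γ Y (ZMod p), ∃ e ∈ Coch Γ (Y × Cir χ) (ZMod p),
      (∀ y, Z0 (a0 - D b0) y) ∧ (∀ y, Z0 (D b1) y) ∧
      ∀ x, Z0 (c - (pb Prod.fst b0 + cup (pb Prod.fst b1) (tauF Y χ) - D e)) x := by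
  obtain ⟨b0, k0, b1, k1, e, ke, -, r0, r1, r2⟩ := LH (Jp := True) (θ := 0) (a1 := 0) hU hUW continuous_fst (fst_surj χ)
    fst_eqv (tauF_mem χ) (c2_lv _) (zero_mem _) (fun _ _ => rfl) (fun y => by rw [D_zero_fun]; exact Z0.zero y)
    (fun x => by rw [map_zero, tauF_D, sub_zero]; exact Z0.zero x) (fun _ => rfl) (circ_fib hodd hU χ hK hUW) m0 (zero_mem _) mc (by simp)
    (fun y => (h0 y).congr (by rw [sg_zero, cup_zero_left, add_zero]))
    (fun y => by rw [D_zero_fun]; exact Z0.zero y)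
    (fun x => (h2 x).congr (by rw [map_zero, cup_zero_left, add_zero]))
  exact ⟨b0, k0, b1, k1, e, ke, fun y => (r0 y).congr (by rw [cup_zero_right, add_zero]),
    fun y => ((r1 y).neg).congr (by abel), r2⟩

theorem circ_inj (hodd : Odd p) (hU : Unif Γ Y) {χ : Γ →+ ZMod p}
    (hK : ∀ c, ∃ κ : Γ, (∀ y : Y, act κ y = y) ∧ χ κ = c) (hUW : Unif Γ (Y × Cir χ)) 
    (u : HH Γ Y (ZMod p)) (hu : pull Γ (ZMod p) (Prod.fst : Y × Cir χ → Y) u = 0) : u = 0 := by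
  revert u
  refine cls_ind fun f hf hu => ?_
  rw [pull_cls continuous_fst fst_eqv, cls_zero] at hu
  obtain ⟨c, mc, hc⟩ := hu
  obtain ⟨b0, k0, b1, k1, e, ke, r0, r1, r2⟩ := LHf hodd hU hK hUW hf.1 mc hf.2 hc
  rw [cls_zero]
  exact ⟨b0, k0, r0⟩

theorem circ_surj (hodd : Odd p) (hU : Unif Γ Y) {χ : Γ →+ ZMod p}
    (hK : ∀ c, ∃ κ : Γ, (∀ y : Y, act κ y = y) ∧ χ κ = c) (hUW : Unif Γ (Y × Cir χ)) 
    (w : HH Γ (Y × Cir χ) (ZMod p)) : ∃ u u' : HH Γ Y (ZMod p),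
      w = pull Γ (ZMod p) Prod.fst u + YY (Y × Cir χ) χ (pull Γ (ZMod p) Prod.fst u') := by
  revert w
  refine cls_ind fun f hf => ?_
  obtain ⟨b0, k0, b1, k1, e, ke, r0, r1, r2⟩ := LHf hodd hU hK hUW (zero_mem _) hf.1
    (fun y => by rw [D_zero_fun]; exact Z0.zero y) (fun x => ((hf.2 x).neg).congr (by rw [map_zero]; abel))
  have z0 : b0 ∈ Zc Γ Y (ZMod p) := ⟨k0, fun y => ((r0 y).neg).congr (by abel)⟩
  have z1 : b1 ∈ Zc Γ Y (ZMod p) := ⟨k1, r1⟩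
  refine ⟨cls z0, cls z1, ?_⟩
  rw [pull_cls continuous_fst fst_eqv, pull_cls continuous_fst fst_eqv, YY_eq (uC_sec χ), rc_cls (yS_Zc (uC_sec χ)),
    cls_add, cls_eq]
  refine ⟨-e, neg_mem ke, fun x => (r2 x).congr ?_⟩
  rw [D_neg_fun, show yS (fun m : Y × Cir χ => uu p m.2.v) = tauF Y χ from rfl]
  abel
end Gys
end Volo

namespace Volo
open scoped Topology
open GSp

section Join
variable {Γ P A M : Type} [AddCommGroup Γ] [Finite Γ] [MetricSpace P] [GSp Γ P] [CompactSpace P]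
  [MetricSpace A] [GSp Γ A] [CompactSpace A] [MetricSpace M] [GSp Γ M]
variable {p : ℕ} [hp : Fact p.Prime]

/-- geometric data of a join with a circle -/
structure JoinD (χ : Γ →+ ZMod p) (j : A → P) (iM : M → P) where
  cj : Continuous j
  ej : Eqv Γ j
  ci : Continuous iM
  ei : Eqv Γ iM
  hl : P → ℂ
  chl : Continuous hl
  ehl : ∀ (γ : Γ) x, hl (act γ x) = ch p (χ γ) * hl x
  U : Set P
  V : Set P
  cU : IsClosed U
  cV : IsClosed V
  iU : InvS Γ U
  iV : InvS Γ V
  cov : U ∪ V = univ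
  hV : ∀ x ∈ V, hl x ≠ 0
  iMV : ∀ x, iM x ∈ V
  jU : ∀ x, j x ∈ U
  r : P → A
  er : Eqv Γ r
  cr : ∀ x ∈ U, ContinuousAt r x
  rj : ∀ a, r (j a) = a
  e : A × Cir χ → P
  ce : Continuous e
  ne : Function.Injective e
  ee : Eqv Γ e
  re : range e = U ∩ V
  κ : ℝ
  hκ : 0 < κ
  hle : ∀ m, hl (e m) = κ * m.2.v
  rre : ∀ m, r (e m) = m.1
  HU : ℝ → U → U
  cHU : Continuous fun q : ℝ × U => HU q.1 q.2
  eHU : letI := subG iU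
    ∀ s, Eqv Γ (HU s)
  HU1 : ∀ x, HU 1 x = x
  HU0 : ∀ x, (HU 0 x).1 = j (r x.1)
  HV : ℝ → V → V
  cHV : Continuous fun q : ℝ × V => HV q.1 q.2
  eHV : letI := subG iV
    ∀ s, Eqv Γ (HV s)
  HV1 : ∀ x, HV 1 x = x
  ρ : V → M
  cρ : Continuous ρ
  eρ : letI := subG iV
    Eqv Γ ρ
  HV0 : ∀ x, (HV 0 x).1 = iM (ρ x)
  K : ℝ → A × Cir χ → P
  cK : Continuous fun q : ℝ × (A × Cir χ) => K q.1 q.2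
  eK : ∀ s, Eqv Γ (K s)
  K0 : ∀ m, K 0 m = j m.1
  μ : A × Cir χ → M
  cμ : Continuous μ
  eμ : Eqv Γ μ
  K1 : ∀ m, K 1 m = iM (μ m)

variable {χ : Γ →+ ZMod p} {j : A → P} {iM : M → P}

theorem JoinD.extU (J : JoinD χ j iM) (hU : Unif Γ P) {f : List P → ZMod p} (hf : f ∈ Coch Γ P (ZMod p))
    (hD : ∀ x ∈ J.U, Z0 (D f) x) {g : List A → ZMod p} (hg : g ∈ Coch Γ A (ZMod p))
    (hi : ∀ x, Z0 (pb j f - D g) x) : ∃ g' ∈ Coch Γ P (ZMod p), ∀ x ∈ J.U, Z0 (f - D g') x :=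
  extZ hU J.cU J.iU hf hD J.HU J.cHU J.eHU J.HU1 (ρ := fun x => J.r x.1)
    (continuous_iff_continuousAt.2 fun x =>
      ContinuousAt.comp (f := Subtype.val) (g := J.r) (J.cr x.1 x.2) continuous_subtype_val.continuousAt)
    (fun γ x => J.er γ x.1) J.HU0 hg hi

theorem JoinD.extV (J : JoinD χ j iM) (hU : Unif Γ P) {f : List P → ZMod p} (hf : f ∈ Coch Γ P (ZMod p))
    (hD : ∀ x ∈ J.V, Z0 (D f) x) {g : List M → ZMod p} (hg : g ∈ Coch Γ M (ZMod p))
    (hi : ∀ x, Z0 (pb iM f - D g) x) : ∃ g' ∈ Coch Γ P (ZMod p), ∀ x ∈ J.V, Z0 (f - D g') x :=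
  extZ hU J.cV J.iV hf hD J.HV J.cHV J.eHV J.HV1 J.cρ J.eρ J.HV0 hg hi

theorem JoinD.W_mem (J : JoinD χ j iM) {s : A → ZMod p} (hs : IsSec χ s) :
    WS (s ∘ J.r) (uh (s ∘ J.r) J.hl) ∈ Coch Γ P (ZMod p) :=
  WS_mem (hs.comp J.er) (uh_sec (hs.comp J.er) J.ehl)

theorem JoinD.W_Z0 (hodd : Odd p) (J : JoinD χ j iM) (s : A → ZMod p) (x : P) (hx : x ∈ J.V) :
    Z0 (tS (s ∘ J.r) - D (WS (s ∘ J.r) (uh (s ∘ J.r) J.hl))) x :=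
  uh_Z0 hodd _ J.chl.continuousAt (J.hV x hx)

theorem JoinD.r_e (J : JoinD χ j iM) : J.r ∘ J.e = Prod.fst := funext J.rre

theorem JoinD.W_pb (J : JoinD χ j iM) (s : A → ZMod p) :
    pb J.e (WS (s ∘ J.r) (uh (s ∘ J.r) J.hl)) = tauG χ s := by
  rw [WS_pb, Function.comp_assoc, J.r_e, tauG]
  congr 1
  funext m
  have h : J.hl (J.e m) ≠ 0 := by
    rw [J.hle]; exact mul_ne_zero (by exact_mod_cast J.hκ.ne') m.2.ne
  rw [Function.comp_apply, uh, if_neg h, J.hle, uu_pos J.hκ]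

theorem JoinD.e_U (J : JoinD χ j iM) (m) : J.e m ∈ J.U := by
  have : J.e m ∈ J.U ∩ J.V := J.re ▸ mem_range_self m
  exact this.1
theorem JoinD.e_V (J : JoinD χ j iM) (m) : J.e m ∈ J.V := by
  have : J.e m ∈ J.U ∩ J.V := J.re ▸ mem_range_self m
  exact this.2

theorem JoinD.span (hodd : Odd p) (J : JoinD χ j iM) (hUP : Unif Γ P) (hUA : Unif Γ A)
    (hsA : ∃ s : A → ZMod p, IsSec χ s) (S : Submodule (ZMod p) (HH Γ P (ZMod p)))
    (hS : ∀ a, ∃ u ∈ S, pull Γ (ZMod p) j u = a) (w : HH Γ P (ZMod p)) (hw : pull Γ (ZMod p) iM w = 0) :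
    ∃ c ∈ S, w = TT P χ c := by
  obtain ⟨s, hs⟩ := hsA
  have hsP : IsSec χ (s ∘ J.r) := hs.comp J.er
  have hc1 : Continuous (Prod.fst : A × Cir χ → A) := continuous_fst
  have st1 : pull Γ (ZMod p) (Prod.fst : A × Cir χ → A) (pull Γ (ZMod p) j w) = 0 := by
    rw [pull_pull J.cj J.ej hc1 fst_eqv, show j ∘ (Prod.fst : A × Cir χ → A) = J.K 0 from funext fun m => (J.K0 m).symm,
      ← pull_htpy J.K J.cK J.eK, show J.K 1 = iM ∘ J.μ from funext J.K1, ← pull_pull J.ci J.ei J.cμ J.eμ, hw, map_zero]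
  obtain ⟨v, hv⟩ := gysin_ker hodd hUA ⟨s, hs⟩ _ st1
  obtain ⟨c0, hc0, rfl⟩ := hS v
  obtain ⟨w2, hw2⟩ : ∃ w2, w2 = w - TT P χ c0 := ⟨_, rfl⟩
  have q1 : pull Γ (ZMod p) j w2 = 0 := by
    rw [hw2, map_sub, TT_pull ⟨_, hsP⟩ J.cj J.ej, hv, sub_self]
  have q2 : pull Γ (ZMod p) iM w2 = 0 := by
    rw [hw2, map_sub, TT_pull ⟨_, hsP⟩ J.ci J.ei, hw]
    have := TT_prod_zero (X := M) hodd [(χ, J.hl ∘ iM)] (by simpa using ⟨_, hsP.comp J.ei⟩)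
      (by simpa using J.chl.comp J.ci) (by simp [J.ei _ _, J.ehl]) (fun x => by simpa using J.hV _ (J.iMV x))
    simp at this
    rw [this]; simp
  suffices h : ∃ c ∈ S, w2 = TT P χ c by
    obtain ⟨c, hc, h⟩ := h
    exact ⟨c0 + c, add_mem hc0 hc, by rw [map_add, ← h, hw2]; abel⟩
  clear hw2 st1 hv hw
  revert w2
  refine cls_ind fun f hf q1 q2 => ?_
  rw [pull_cls J.cj J.ej, cls_zero] at q1
  rw [pull_cls J.ci J.ei, cls_zero] at q2
  obtain ⟨k1, mk1, hk1⟩ := q1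
  obtain ⟨k2, mk2, hk2⟩ := q2
  obtain ⟨g1, mg1, hg1⟩ := J.extU hUP hf.1 (fun x _ => hf.2 x) mk1 hk1
  obtain ⟨g2, mg2, hg2⟩ := J.extV hUP hf.1 (fun x _ => hf.2 x) mk2 hk2
  obtain ⟨b0, mb0, b1, mb1, e', me', r0, r1, r2⟩ := LHg hodd hUA hs (zero_mem _) (zero_mem _)
    (c := pb J.e (g1 - g2)) (Coch.pb (sub_mem mg1 mg2) J.ee)
    (fun y => (Z0.zero y).congr (by rw [sg_zero, cup_zero_left, D_zero_fun, add_zero]))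
    (fun y => by rw [D_zero_fun]; exact Z0.zero y)
    (fun x => ((((hg1 _ (J.e_U x)).sub (hg2 _ (J.e_V x)))).pb J.ce.continuousAt).congr (by
      rw [map_zero, cup_zero_left, ← pb_D, D_sub_fun, add_zero, zero_sub, ← map_neg]
      congr 1; abel))
  have zb1 : b1 ∈ Zc Γ A (ZMod p) := ⟨mb1, fun y => ((r1 y).neg).congr (by abel)⟩
  obtain ⟨ct, hct, hq⟩ := hS (cls (Zc.sg zb1))
  refine ⟨-ct, neg_mem hct, ?_⟩
  clear hct
  revert ct
  refine cls_ind fun q zq hq => ?_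
  rw [pull_cls J.cj J.ej, cls_eq] at hq
  obtain ⟨m1, mm1, hm1⟩ := hq
  -- comparison near U
  obtain ⟨m2, mm2, hm2⟩ := J.extU hUP (f := sg q - pb J.r b1) (sub_mem (Coch.sg zq.1) (Coch.pb mb1 J.er))
    (fun x hx => ((((zq.2 x).sg.neg).sub ((zb1.2 _).pb (J.cr x hx)))).congr (by
      rw [D_sub_fun, D_sg, pb_D])) (g := -sg m1) (neg_mem (Coch.sg mm1)) (fun x => ((hm1 x).sg).congr (by
      rw [sg_sub, sg_sub, sg_sg, map_sub, pb_sg, pb_pb, show J.r ∘ j = id from funext J.rj, D_neg_fun, D_sg,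
        show pb (id : A → A) b1 = b1 by funext l; simp [pb_apply]]; abel))
  have tP : tS (s ∘ J.r) = pb J.r (tS s) := (tS_pb s J.r).symm
  have hb0 : ∀ y, Z0 (D b0 + cup (sg b1) (tS s)) y := fun y => ((r0 y).neg).congr (by abel)
  have mt := tS_mem hsP
  have mW := J.W_mem hs
  have zt := tS_Zc hsP
  -- primitive near U
  have pU : ∀ x ∈ J.U, Z0 (f + cup q (tS (s ∘ J.r)) - D (g1 - pb J.r b0 - cup (sg m2) (tS (s ∘ J.r)))) x := by
    intro x hx
    refine (((hg1 x hx).add ((hb0 _).pb (J.cr x hx))).add (((hm2 x hx).sg).cup_left (g := tS (s ∘ J.r)))).congr ?_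
    rw [D_sub_fun, D_sub_fun, leibniz_fun _ _ (Coch.sg mm2).1 mt.1, tS_D, cup_zero_right, D_sg, sg_sub, sg_sub, sg_sg,
      map_add, pb_D, pb_cup, ← tP, pb_sg, cup_sub_left, cup_sub_left, cup_neg_left]
    abel
  have pV : ∀ x ∈ J.V, Z0 (f + cup q (tS (s ∘ J.r)) - D (g2 + cup (sg q) (WS (s ∘ J.r) (uh (s ∘ J.r) J.hl)))) x := by
    intro x hx
    refine (((hg2 x hx).add ((J.W_Z0 hodd s x hx).cup_right (f := q))).add
      (((zq.2 x).sg).cup_left (g := WS (s ∘ J.r) (uh (s ∘ J.r) J.hl)))).congr ?_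
    rw [D_add_fun, leibniz_fun _ _ (Coch.sg zq.1).1 mW.1, sg_sg, D_sg, cup_sub_right, cup_neg_left]
    abel
  obtain ⟨g', mg', hg'⟩ := tautZ hUP J.e J.ce J.ne J.ee
    (f := g1 - pb J.r b0 - cup (sg m2) (tS (s ∘ J.r)) - (g2 + cup (sg q) (WS (s ∘ J.r) (uh (s ∘ J.r) J.hl))))
    (sub_mem (sub_mem (sub_mem mg1 (Coch.pb mb0 J.er)) (Coch.cup (Coch.sg mm2) mt))
      (add_mem mg2 (Coch.cup (Coch.sg zq.1) mW)))
    (fun m => ((pV _ (J.e_V m)).sub (pU _ (J.e_U m))).congr (by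
      rw [D_sub_fun (g1 - pb J.r b0 - cup (sg m2) (tS (s ∘ J.r)))]; abel))
    (g := -e' - cup (pb J.e m2) (tauG χ s)) (sub_mem (neg_mem me') (Coch.cup (Coch.pb mm2 J.ee) (tauG_mem hs)))
    (fun m => by
      have h1 := (((hm2 _ (J.e_U m)).pb J.ce.continuousAt).neg).cup_left (g := tauG χ s)
      have h2 := ((tauG_Z0 hodd s m).cup_right (f := sg (pb J.e m2))).neg
      refine (((r2 m).add h1).add h2).congr ?_
      rw [D_sub_fun, D_neg_fun, leibniz_fun _ _ (Coch.pb mm2 J.ee).1 (tauG_mem hs).1]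
      simp only [map_sub, map_add, pb_cup, pb_sg, J.W_pb, pb_pb, J.r_e, tS_pb, pb_D, cup_sub_left, cup_sub_right,
        cup_neg_left, Function.comp_assoc]
      abel)
  obtain ⟨g, mg, hg⟩ := mvZ (f := f + cup q (tS (s ∘ J.r))) J.cU J.cV J.iU J.iV (add_mem hf.1 (Coch.cup zq.1 mt)).1
    (sub_mem (sub_mem mg1 (Coch.pb mb0 J.er)) (Coch.cup (Coch.sg mm2) mt))
    (add_mem mg2 (Coch.cup (Coch.sg zq.1) mW)) mg' pU pV (by
      rintro x hx
      rw [← J.re] at hx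
      obtain ⟨m, rfl⟩ := hx
      exact hg' m)
  rw [map_neg, TT_eq hsP, rc_cls zt, cls_neg, cls_eq]
  refine ⟨g, mg, fun x => (hg x (by rw [J.cov]; trivial)).congr (by abel)⟩

theorem JoinD.free (hodd : Odd p) (J : JoinD χ j iM) (hUP : Unif Γ P) (hUA : Unif Γ A)
    (hsA : ∃ s : A → ZMod p, IsSec χ s) 
    (hM : ∀ a, ∃ u, pull Γ (ZMod p) iM u = a) (w : HH Γ P (ZMod p)) (hw : TT P χ w = 0) :
    pull Γ (ZMod p) j w = 0 := by
  obtain ⟨s, hs⟩ := hsA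
  have hsP : IsSec χ (s ∘ J.r) := hs.comp J.er
  have mt := tS_mem hsP
  have mW := J.W_mem hs
  have zt := tS_Zc hsP
  have tP : tS (s ∘ J.r) = pb J.r (tS s) := (tS_pb s J.r).symm
  have rj : J.r ∘ j = id := funext J.rj
  have pid : ∀ b : List A → ZMod p, pb (id : A → A) b = b := fun b => by funext l; simp [pb_apply]
  revert w
  refine cls_ind fun f hf hw => ?_
  rw [TT_eq hsP, rc_cls zt, cls_zero] at hw
  obtain ⟨e, me, he⟩ := hw
  have q1 : ∀ x ∈ J.V, Z0 (D (e - cup (sg f) (WS (s ∘ J.r) (uh (s ∘ J.r) J.hl)))) x := by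
    intro x hx
    refine ((((he x).neg).add ((J.W_Z0 hodd s x hx).cup_right (f := f))).add
      (((hf.2 x).sg).cup_left (g := WS (s ∘ J.r) (uh (s ∘ J.r) J.hl)))).congr ?_
    rw [D_sub_fun, leibniz_fun _ _ (Coch.sg hf.1).1 mW.1, sg_sg, D_sg, cup_sub_right, cup_neg_left]
    abel
  have me1 := sub_mem me (Coch.cup (Coch.sg hf.1) mW)
  have zM : pb iM (e - cup (sg f) (WS (s ∘ J.r) (uh (s ∘ J.r) J.hl))) ∈ Zc Γ M (ZMod p) := ⟨Coch.pb me1 J.ei,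
    fun x => by rw [← pb_D]; exact (q1 _ (J.iMV x)).pb J.ci.continuousAt⟩
  obtain ⟨u, hu⟩ := hM (cls zM)
  revert u
  refine cls_ind fun u zu hu => ?_
  rw [pull_cls J.ci J.ei, cls_eq] at hu
  obtain ⟨k, mk, hk⟩ := hu
  obtain ⟨m, mm, hm⟩ := J.extV hUP (f := e - cup (sg f) (WS (s ∘ J.r) (uh (s ∘ J.r) J.hl)) - u) (sub_mem me1 zu.1)
    (fun x hx => ((q1 x hx).sub (zu.2 x)).congr (by
      rw [D_sub_fun (e - cup (sg f) (WS (s ∘ J.r) (uh (s ∘ J.r) J.hl)))]))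
    (g := -k) (neg_mem mk) (fun x => ((hk x).neg).congr (by rw [D_neg_fun, map_sub (pb iM) _ u]; abel))
  obtain ⟨m2, mm2, hm2⟩ := J.extU hUP (f := f - pb J.r (pb j f)) (sub_mem hf.1 (Coch.pb (Coch.pb hf.1 J.ej) J.er))
    (fun x hx => ((hf.2 x).sub (((hf.2 _).pb J.cj.continuousAt).pb (J.cr x hx))).congr (by
      rw [D_sub_fun, pb_D, pb_D])) (g := 0) (zero_mem _) (fun x => (Z0.zero x).congr (by
      rw [map_sub, pb_pb j J.r, pb_pb, Function.comp_assoc, rj, D_zero_fun]; simp))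
  have mE := sub_mem (sub_mem me (Coch.cup mm2 mt)) zu.1
  have dE : ∀ x ∈ J.U, Z0 (D (e - cup m2 (tS (s ∘ J.r)) - u) - cup (pb J.r (pb j f)) (tS (s ∘ J.r))) x := by
    intro x hx
    refine ((((he x).neg).add ((hm2 x hx).cup_left (g := tS (s ∘ J.r)))).sub (zu.2 x)).congr ?_
    rw [D_sub_fun (e - cup m2 (tS (s ∘ J.r))), D_sub_fun, leibniz_fun _ _ mm2.1 mt.1, tS_D, cup_zero_right,
      cup_sub_left, cup_sub_left]
    abel
  have jt : pb j (tS (s ∘ J.r)) = tS s := by rw [tS_pb, Function.comp_assoc, rj]; rfl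
  have dA : ∀ y, Z0 (D (pb j (e - cup m2 (tS (s ∘ J.r)) - u)) - cup (pb j f) (tS s)) y := by
    intro y
    refine ((dE _ (J.jU y)).pb J.cj.continuousAt).congr ?_
    rw [map_sub, pb_D, pb_cup, pb_pb j, pb_pb, Function.comp_assoc, rj, jt]; rfl
  obtain ⟨m3, mm3, hm3⟩ := J.extU hUP
    (f := e - cup m2 (tS (s ∘ J.r)) - u - pb J.r (pb j (e - cup m2 (tS (s ∘ J.r)) - u)))
    (sub_mem mE (Coch.pb (Coch.pb mE J.ej) J.er))
    (fun x hx => ((dE x hx).sub ((dA _).pb (J.cr x hx))).congr (by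
      rw [D_sub_fun _ (pb J.r _), map_sub, pb_D, pb_cup, ← tP]; abel))
    (g := 0) (zero_mem _) (fun x => (Z0.zero x).congr (by
      rw [map_sub (pb j) _ (pb J.r _), pb_pb j J.r, pb_pb, Function.comp_assoc, rj, D_zero_fun]; simp))
  obtain ⟨b0, mb0, b1, mb1, e', me', r0, r1, r2⟩ := LHg hodd hUA hs
    (a0 := pb j (e - cup m2 (tS (s ∘ J.r)) - u)) (a1 := -sg (pb j f))
    (c := pb J.e m - pb J.e m3 - cup (sg (pb J.e m2)) (tauG χ s))
    (Coch.pb mE J.ej) (neg_mem (Coch.sg (Coch.pb hf.1 J.ej)))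
    (sub_mem (sub_mem (Coch.pb mm J.ee) (Coch.pb mm3 J.ee)) (Coch.cup (Coch.sg (Coch.pb mm2 J.ee)) (tauG_mem hs)))
    (fun y => (dA y).congr (by rw [sg_neg, sg_sg, cup_neg_left]; abel))
    (fun y => (((hf.2 _).pb J.cj.continuousAt).sg).congr (by rw [D_neg_fun, D_sg, pb_D]; abel))
    (fun x => by
      have h1 := (((hm2 _ (J.e_U x)).sg).pb J.ce.continuousAt).cup_left (g := tauG χ s)
      have h2 := ((tauG_Z0 hodd s x).cup_right (f := (pb J.e m2)))
      have h3 := ((hm3 _ (J.e_U x)).pb J.ce.continuousAt)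
      have h4 := ((hm _ (J.e_V x)).pb J.ce.continuousAt)
      refine (((h4.sub h3).add h1).sub h2).congr ?_
      rw [D_sub_fun _ (cup _ _), D_sub_fun, leibniz_fun _ _ (Coch.sg (Coch.pb mm2 J.ee)).1 (tauG_mem hs).1]
      simp only [map_sub, map_add, pb_cup, pb_sg, J.W_pb, pb_pb, J.r_e, tS_pb, pb_D, cup_sub_left, cup_sub_right,
        cup_neg_left, Function.comp_assoc, map_neg, D_sg, sg_sg, sg_sub]
      abel)
  rw [pull_cls J.cj J.ej, cls_zero]
  refine ⟨sg b1, Coch.sg mb1, fun y => ((r1 y).sg.neg).congr ?_⟩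
  rw [sg_sub, sg_neg, sg_sg, D_sg]; abel

end Join
end Volo

namespace Volo
open scoped Topology
open GSp

section Sph
variable {Γ ι : Type} [AddCommGroup Γ] [Fintype ι] [DecidableEq ι] {p : ℕ} [hp : Fact p.Prime]

/-- square norm -/
noncomputable def nsq (z : ι → ℂ) : ℝ := ∑ i, ‖z i‖ ^ 2

theorem nsq_nonneg (z : ι → ℂ) : 0 ≤ nsq z := Finset.sum_nonneg fun i _ => by positivity

theorem nsq_pos {z : ι → ℂ} {i : ι} (h : z i ≠ 0) : 0 < nsq z :=
  Finset.sum_pos' (fun i _ => by positivity) ⟨i, Finset.mem_univ _, by positivity⟩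

theorem nsq_cont : Continuous (nsq : (ι → ℂ) → ℝ) := by unfold nsq; fun_prop

theorem nsq_smul (c : ℝ) (z : ι → ℂ) : nsq (c • z) = c ^ 2 * nsq z := by
  simp [nsq, Finset.mul_sum, mul_pow]

/-- normalization -/
noncomputable def nz (z : ι → ℂ) : ι → ℂ := (√(nsq z))⁻¹ • z

theorem nsq_nz {z : ι → ℂ} (h : nsq z ≠ 0) : nsq (nz z) = 1 := by
  rw [nz, nsq_smul, inv_pow, Real.sq_sqrt (nsq_nonneg z), inv_mul_cancel₀ h]

theorem nz_one {z : ι → ℂ} (h : nsq z = 1) : nz z = z := by rw [nz, h]; simp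

theorem nz_smul {c : ℝ} (hc : 0 < c) (z : ι → ℂ) : nz (c • z) = nz z := by
  rw [nz, nsq_smul, Real.sqrt_mul (by positivity), Real.sqrt_sq hc.le, nz, smul_smul]
  congr 1
  rw [mul_inv, mul_comm c⁻¹, mul_assoc, inv_mul_cancel₀ hc.ne', mul_one]

theorem nz_contAt {z : ι → ℂ} (h : nsq z ≠ 0) : ContinuousAt nz z := by
  have : √(nsq z) ≠ 0 := by
    rw [Real.sqrt_ne_zero (nsq_nonneg z)]; exact h
  exact ((Real.continuous_sqrt.comp nsq_cont).continuousAt.inv₀ this).smul continuousAt_id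

theorem nz_cont {T : Type} [TopologicalSpace T] {f : T → ι → ℂ} (hf : Continuous f) (h : ∀ t, nsq (f t) ≠ 0) :
    Continuous fun t => nz (f t) :=
  continuous_iff_continuousAt.2 fun t => ContinuousAt.comp (f := f) (g := nz) (nz_contAt (h t)) hf.continuousAt

/-- the unit sphere on the coordinates `I` -/
def SI (χ : ι → Γ →+ ZMod p) (I : Finset ι) : Type := {z : ι → ℂ // nsq z = 1 ∧ ∀ i, i ∉ I → z i = 0}

variable {χ : ι → Γ →+ ZMod p} {I : Finset ι}
noncomputable instance : MetricSpace (SI χ I) :=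
  inferInstanceAs (MetricSpace {z : ι → ℂ // nsq z = 1 ∧ ∀ i, i ∉ I → z i = 0})

theorem SI_closed (I : Finset ι) : IsClosed {z : ι → ℂ | nsq z = 1 ∧ ∀ i, i ∉ I → z i = 0} := by
  refine IsClosed.inter (isClosed_eq nsq_cont continuous_const) ?_
  have : {z : ι → ℂ | ∀ i, i ∉ I → z i = 0} = ⋂ i : ι, ⋂ (_ : i ∉ I), {z | z i = 0} := by
    ext z; simp
  change IsClosed {z : ι → ℂ | ∀ i, i ∉ I → z i = 0}
  rw [this]
  exact isClosed_iInter fun i => isClosed_iInter fun _ => isClosed_eq (continuous_apply i) continuous_const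

instance : CompactSpace (SI χ I) := by
  refine isCompact_iff_compactSpace.1 (?_ : IsCompact {z : ι → ℂ | nsq z = 1 ∧ ∀ i, i ∉ I → z i = 0})
  refine Metric.isCompact_of_isClosed_isBounded (SI_closed I) ?_
  refine (Metric.isBounded_closedBall (x := (0 : ι → ℂ)) (r := 1)).subset fun z hz => ?_
  rw [mem_closedBall_zero_iff, pi_norm_le_iff_of_nonneg zero_le_one]
  intro i
  have h1 : ‖z i‖ ^ 2 ≤ nsq z := Finset.single_le_sum (f := fun i => ‖z i‖ ^ 2) (fun i _ => by positivity) (Finset.mem_univ i)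
  rw [hz.1] at h1
  nlinarith [norm_nonneg (z i)]

/-- coordinates -/
def SI.v (z : SI χ I) : ι → ℂ := Subtype.val z
theorem SI.nsq (z : SI χ I) : nsq z.v = 1 := z.2.1
theorem SI.supp (z : SI χ I) {i : ι} (h : i ∉ I) : z.v i = 0 := z.2.2 i h
theorem SI.ext {z w : SI χ I} (h : z.v = w.v) : z = w := Subtype.ext h
def SI.mk (z : ι → ℂ) (h : Volo.nsq z = 1) (h' : ∀ i, i ∉ I → z i = 0) : SI χ I := ⟨z, h, h'⟩
theorem SI.v_mk (z : ι → ℂ) (h : Volo.nsq z = 1) (h' : ∀ i, i ∉ I → z i = 0) : (SI.mk (χ := χ) z h h').v = z := rfl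
theorem SI.cont : Continuous (SI.v : SI χ I → ι → ℂ) := continuous_subtype_val
theorem SI.cont_i (i : ι) : Continuous fun z : SI χ I => z.v i := (continuous_apply i).comp SI.cont
theorem SI.cont_mk {T : Type} [TopologicalSpace T] {f : T → SI χ I} (h : Continuous fun t => (f t).v) : Continuous f :=
  continuous_induced_rng.2 h
theorem SI.contAt_mk {T : Type} [TopologicalSpace T] {f : T → SI χ I} {t : T}
    (h : ContinuousAt (fun t => (f t).v) t) : ContinuousAt f t :=
  Topology.IsInducing.subtypeVal.continuousAt_iff.2 h

/-- twisting -/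
noncomputable def tw (χ : ι → Γ →+ ZMod p) (γ : Γ) (z : ι → ℂ) : ι → ℂ := fun i => ch p (χ i γ) * z i

theorem nsq_tw (γ : Γ) (z : ι → ℂ) : nsq (tw χ γ z) = nsq z := by simp [nsq, tw, ch_norm]
theorem nz_tw (γ : Γ) (z : ι → ℂ) : nz (tw χ γ z) = tw χ γ (nz z) := by
  rw [nz, nsq_tw]
  funext i
  simp only [tw, nz, Pi.smul_apply, Complex.real_smul]; ring

noncomputable instance : GSp Γ (SI χ I) where
  act γ z := SI.mk (tw χ γ z.v) (by rw [nsq_tw, z.nsq]) (fun i h => by rw [tw, z.supp h, mul_zero])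
  act_zero z := SI.ext (by funext i; rw [SI.v_mk, tw, map_zero, ch_zero, one_mul])
  act_add a b z := SI.ext (by funext i; simp only [SI.v_mk, tw, map_add, ch_add, mul_assoc])
  act_dist a z w := by
    have : ∀ z w : SI χ I, dist z w = dist z.v w.v := fun _ _ => rfl
    rw [this, this]
    simp only [SI.v_mk, dist_pi_def]
    congr 2
    funext i
    rw [NNReal.eq_iff, coe_nndist, coe_nndist]
    simp only [tw]
    rw [dist_eq_norm, ← mul_sub, norm_mul, ch_norm, one_mul, dist_eq_norm]

theorem SI.v_act (γ : Γ) (z : SI χ I) : (act γ z).v = tw χ γ z.v := rfl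

/-- normalization into a sphere -/
noncomputable def SI.nor (z : ι → ℂ) (h : Volo.nsq z ≠ 0) (h' : ∀ i, i ∉ I → z i = 0) : SI χ I :=
  SI.mk (nz z) (nsq_nz h) (fun i hi => by simp [nz, h' i hi])
theorem SI.v_nor (z : ι → ℂ) (h : Volo.nsq z ≠ 0) (h' : ∀ i, i ∉ I → z i = 0) :
    (SI.nor (χ := χ) z h h').v = nz z := rfl

/-- inclusion of spheres -/
def SI.inc {J : Finset ι} (h : I ⊆ J) (z : SI χ I) : SI χ J := SI.mk z.v z.nsq fun i hi => z.supp fun h' => hi (h h')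
theorem SI.inc_v {J : Finset ι} (h : I ⊆ J) (z : SI χ I) : (z.inc h).v = z.v := rfl
theorem SI.inc_cont {J : Finset ι} (h : I ⊆ J) : Continuous (SI.inc (χ := χ) h) := SI.cont_mk SI.cont
theorem SI.inc_eqv {J : Finset ι} (h : I ⊆ J) : Eqv Γ (SI.inc (χ := χ) h) := fun _ _ => rfl

theorem SI.exists_ne (z : SI χ I) : ∃ i ∈ I, z.v i ≠ 0 := by
  by_contra! h
  have : Volo.nsq z.v = 0 := Finset.sum_eq_zero fun i _ => by
    by_cases hi : i ∈ I
    · simp [h i hi]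
    · simp [z.supp hi]
  rw [z.nsq] at this
  exact one_ne_zero this

/-- point on a coordinate circle -/
def SI.pt (i : ι) (hi : i ∈ I) (c : ℂ) (hc : ‖c‖ = 1) : SI χ I := SI.mk (Pi.single i c)
  (by rw [Volo.nsq, Finset.sum_eq_single i (fun b _ h => by simp [h]) (by simp)]; simp [hc])
  (fun j hj => by
    have h : j ≠ i := fun h => hj (h ▸ hi)
    simp [h])
theorem SI.pt_v (i : ι) (hi : i ∈ I) (c : ℂ) (hc : ‖c‖ = 1) : (SI.pt (χ := χ) i hi c hc).v = Pi.single i c := rfl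
theorem tw_single (γ : Γ) (i : ι) (c : ℂ) : tw χ γ (Pi.single i c) = Pi.single i (ch p (χ i γ) * c) := by
  funext j
  by_cases h : j = i
  · subst h; simp [tw]
  · simp [tw, h]
end Sph
end Volo

namespace Volo
open scoped Topology
open GSp

section Sph
variable {Γ ι : Type} [AddCommGroup Γ] [Finite Γ] [Fintype ι] [DecidableEq ι] {p : ℕ} [hp : Fact p.Prime]
variable {χ : ι → Γ →+ ZMod p} {I : Finset ι}

/-- joining coordinates -/
noncomputable def jn (l : ι) (a b : ℝ) (z : ι → ℂ) (w : ℂ) : ι → ℂ := fun i => if i = l then b * w else a * z i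

theorem nsq_jn (l : ι) (a b : ℝ) (z : ι → ℂ) (w : ℂ) :
    nsq (jn l a b z w) = a ^ 2 * (nsq z - ‖z l‖ ^ 2) + b ^ 2 * ‖w‖ ^ 2 := by
  rw [nsq, nsq, ← Finset.add_sum_erase _ _ (Finset.mem_univ l), ← Finset.add_sum_erase (a := l) _ _ (Finset.mem_univ l),
    add_sub_cancel_left, Finset.mul_sum, add_comm]
  congr 1
  · refine Finset.sum_congr rfl fun i hi => ?_
    rw [jn, if_neg (Finset.ne_of_mem_erase hi)]; simp [mul_pow]
  · rw [jn, if_pos rfl]; simp [mul_pow]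

theorem tw_jn (γ : Γ) (l : ι) (a b : ℝ) (z : ι → ℂ) (w : ℂ) :
    tw χ γ (jn l a b z w) = jn l a b (tw χ γ z) (ch p (χ l γ) * w) := by
  funext i
  by_cases h : i = l
  · subst h; simp [tw, jn]; ring
  · simp [tw, jn, h]; ring

theorem jn_supp {l : ι} {a b : ℝ} {z : ι → ℂ} {w : ℂ} (hz : ∀ i, i ∉ insert l I → z i = 0) :
    ∀ i, i ∉ insert l I → jn l a b z w i = 0 := by
  intro i hi
  have h : i ≠ l := fun h => hi (by simp [h])
  rw [jn, if_neg h, hz i hi, mul_zero]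

theorem jn_supp0 {l : ι} (hl : l ∉ I) {a b : ℝ} {z : ι → ℂ} (hz : ∀ i, i ∉ insert l I → z i = 0) :
    ∀ i, i ∉ I → jn l a b z 0 i = 0 := by
  intro i hi
  by_cases h : i = l
  · simp [jn, h]
  · rw [jn, if_neg h, hz i (by simp [h, hi]), mul_zero]

theorem jn_cont {T : Type} [TopologicalSpace T] {l : ι} {a b : T → ℝ} {z : T → ι → ℂ} {w : T → ℂ}
    (ha : Continuous a) (hb : Continuous b) (hz : Continuous z) (hw : Continuous w) :
    Continuous fun t => jn l (a t) (b t) (z t) (w t) := by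
  refine continuous_pi fun i => ?_
  by_cases h : i = l
  · simp only [jn, h, if_true]; fun_prop
  · simp only [jn, h, if_false]; fun_prop

/-- clamp -/
noncomputable def clp (s : ℝ) : ℝ := max 0 (min 1 s)
theorem clp_cont : Continuous clp := by unfold clp; fun_prop
theorem clp_zero : clp 0 = 0 := by simp [clp]
theorem clp_one : clp 1 = 1 := by simp [clp]
theorem clp_nonneg (s : ℝ) : 0 ≤ clp s := le_max_left _ _
theorem clp_le (s : ℝ) : clp s ≤ 1 := max_le zero_le_one (min_le_left _ _)

theorem nz_apply (z : ι → ℂ) (i : ι) : nz z i = ((√(nsq z))⁻¹ : ℝ) * z i := by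
  rw [nz, Pi.smul_apply, Complex.real_smul]

theorem nz_sq (z : ι → ℂ) (i : ι) : ‖nz z i‖ ^ 2 = ‖z i‖ ^ 2 / nsq z := by
  rw [nz_apply, norm_mul, mul_pow, Complex.norm_real, Real.norm_eq_abs, sq_abs, inv_pow,
    Real.sq_sqrt (nsq_nonneg z)]; field_simp

variable {Y : Type} [MetricSpace Y] [GSp Γ Y]

theorem joinD (χ : ι → Γ →+ ZMod p) (l : ι) (hl : l ∉ I) (hI : I.Nonempty)
    (hs : ∀ i, ∃ s : Y × SI χ (insert l I) → ZMod p, IsSec (χ i) s) :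
    Nonempty (JoinD (χ l) (fun x : Y × SI χ I => ((x.1, x.2.inc (Finset.subset_insert l I)) : Y × SI χ (insert l I)))
      (fun x : Y × Cir (χ l) => ((x.1, SI.pt l (Finset.mem_insert_self l I) x.2.v x.2.norm) : Y × SI χ (insert l I)))) := by
  classical
  obtain ⟨i0, hi0⟩ := hI
  obtain ⟨s, hs⟩ := hs i0
  have hlz : ∀ z : SI χ I, z.v l = 0 := fun z => z.supp hl
  have sup : ∀ z : SI χ (insert l I), ∀ i, i ∉ insert l I → z.v i = 0 := fun z i h => z.supp h
  have sup' : ∀ z : SI χ I, ∀ i, i ∉ insert l I → z.v i = 0 := fun z i h => z.supp fun h' => h (Finset.mem_insert_of_mem h')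
  have rext : ∀ a b : Y × SI χ I, a.1 = b.1 → a.2.v = b.2.v → a = b := fun a b h h' => Prod.ext h (SI.ext h')
  have pext : ∀ a b : Y × SI χ (insert l I), a.1 = b.1 → a.2.v = b.2.v → a = b := fun a b h h' => Prod.ext h (SI.ext h')
  have pa1 : ∀ (γ : Γ) (a : Y × SI χ (insert l I)), (act γ a).1 = act γ a.1 := fun _ _ => rfl
  have pa2 : ∀ (γ : Γ) (a : Y × SI χ (insert l I)), (act γ a).2.v = tw χ γ a.2.v := fun _ _ => rfl
  have ra1 : ∀ (γ : Γ) (a : Y × SI χ I), (act γ a).1 = act γ a.1 := fun _ _ => rfl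
  have ra2 : ∀ (γ : Γ) (a : Y × SI χ I), (act γ a).2.v = tw χ γ a.2.v := fun _ _ => rfl
  obtain ⟨r, r1, r2, r3⟩ : ∃ r : Y × SI χ (insert l I) → Y × SI χ I, (∀ x, (r x).1 = x.1) ∧
      (∀ x, nsq (jn l 1 0 x.2.v 0) ≠ 0 → (r x).2.v = nz (jn l 1 0 x.2.v 0)) ∧
      (∀ x, ¬ nsq (jn l 1 0 x.2.v 0) ≠ 0 → (r x).2.v = Pi.single i0 (ch p (s x))) := by
    refine ⟨fun x => if h : nsq (jn l 1 0 x.2.v 0) ≠ 0 then (x.1, SI.nor _ h (jn_supp0 hl (sup x.2)))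
      else (x.1, SI.pt i0 hi0 (ch p (s x)) (ch_norm _)), ?_, ?_, ?_⟩
    · intro x; dsimp only; split_ifs <;> rfl
    · intro x h; dsimp only; rw [dif_pos h]; rfl
    · intro x h; dsimp only; rw [dif_neg h]; rfl
  have n0 : ∀ z : SI χ (insert l I), nsq (jn l 1 0 z.v 0) = 1 - ‖z.v l‖ ^ 2 := by
    intro z; rw [nsq_jn, z.nsq]; simp
  have n1 : ∀ (z : SI χ I) (w : Cir (χ l)) a b, nsq (jn l a b z.v w.v) = a ^ 2 + b ^ 2 := by
    intro z w a b; rw [nsq_jn, z.nsq, hlz, w.norm]; simp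
  obtain ⟨e, e1, e2'⟩ : ∃ e : (Y × SI χ I) × Cir (χ l) → Y × SI χ (insert l I), (∀ m, (e m).1 = m.1.1) ∧
      ∀ m, (e m).2.v = nz (jn l 1 1 m.1.2.v m.2.v) :=
    ⟨fun m => (m.1.1, SI.nor (jn l 1 1 m.1.2.v m.2.v) (by rw [n1]; norm_num) (jn_supp (sup' _))), fun _ => rfl, fun _ => rfl⟩
  have e2 : ∀ m, (e m).2.v = (√2)⁻¹ • jn l 1 1 m.1.2.v m.2.v := by
    intro m; rw [e2', nz, n1]; norm_num
  have s2 : 0 < (√2)⁻¹ := by positivity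
  have jnz : ∀ z : SI χ I, ∀ c : ℝ, jn l c 0 z.v 0 = c • z.v := by
    intro z c; funext i
    by_cases h : i = l
    · subst h; simp [jn, hlz]
    · simp [jn, h]
  have re1 : ∀ m, jn l 1 0 (e m).2.v 0 = (√2)⁻¹ • m.1.2.v := by
    intro m; rw [e2, ← jnz]
    funext i
    by_cases h : i = l <;> simp [jn, h]
  have rre : ∀ m, r (e m) = m.1 := by
    intro m
    refine rext _ _ (by rw [r1, e1]) ?_
    have h := re1 m
    rw [r2 _ (by rw [h, nsq_smul, m.1.2.nsq]; positivity), h, nz_smul s2, nz_one m.1.2.nsq]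
  have hle : ∀ m, (e m).2.v l = ((√2)⁻¹ : ℝ) * m.2.v := by
    intro m; rw [e2]; simp [jn]
  have er : Eqv Γ r := by
    intro γ x
    have h2 : jn l 1 0 (act γ x).2.v 0 = tw χ γ (jn l 1 0 x.2.v 0) := by
      rw [tw_jn, mul_zero, pa2]
    refine rext _ _ (by rw [r1, ra1, r1, pa1]) ?_
    rw [ra2]
    by_cases h : nsq (jn l 1 0 x.2.v 0) ≠ 0
    · rw [r2 _ h, r2 _ (by rw [h2, nsq_tw]; exact h), h2, nz_tw]
    · rw [r3 _ h, r3 _ (by rw [h2, nsq_tw]; exact h), tw_single, hs γ x, ch_add, mul_comm]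
  have cl : Continuous fun x : Y × SI χ (insert l I) => x.2.v l := (SI.cont_i l).comp continuous_snd
  have pl : ∀ (γ : Γ) (x : Y × SI χ (insert l I)), (act γ x).2.v l = ch p (χ l γ) * x.2.v l := fun _ _ => rfl
  obtain ⟨U, hU⟩ : ∃ U : Set (Y × SI χ (insert l I)), U = {x | ‖x.2.v l‖ ^ 2 ≤ 1 / 2} := ⟨_, rfl⟩
  obtain ⟨V, hV⟩ : ∃ V : Set (Y × SI χ (insert l I)), V = {x | 1 / 2 ≤ ‖x.2.v l‖ ^ 2} := ⟨_, rfl⟩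
  have cU : IsClosed U := by rw [hU]; exact isClosed_le (cl.norm.pow 2) continuous_const
  have cV : IsClosed V := by rw [hV]; exact isClosed_le continuous_const (cl.norm.pow 2)
  have mU : ∀ x, x ∈ U ↔ ‖x.2.v l‖ ^ 2 ≤ 1 / 2 := fun x => by rw [hU]; rfl
  have mV : ∀ x, x ∈ V ↔ 1 / 2 ≤ ‖x.2.v l‖ ^ 2 := fun x => by rw [hV]; rfl
  clear hU hV
  have iU : InvS Γ U := fun γ x h => by
    rw [mU] at h ⊢; rwa [pl, norm_mul, ch_norm, one_mul]
  have iV : InvS Γ V := fun γ x h => by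
    rw [mV] at h ⊢; rwa [pl, norm_mul, ch_norm, one_mul]
  have Vne : ∀ x ∈ V, x.2.v l ≠ 0 := fun x h h0 => by
    rw [mV, h0] at h; norm_num at h
  have cr : ∀ x ∈ U, ContinuousAt r x := fun x hx => by
    rw [mU] at hx
    have c0 : Continuous fun x : Y × SI χ (insert l I) => jn l 1 0 x.2.v 0 :=
      jn_cont continuous_const continuous_const (SI.cont.comp continuous_snd) continuous_const
    have hx0 : nsq (jn l 1 0 x.2.v 0) ≠ 0 := by rw [n0]; linarith
    have q1 : ContinuousAt (fun x => (r x).1) x := by simpa only [r1] using continuous_fst.continuousAt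
    have q2 : ContinuousAt (fun x => (r x).2) x := by
      refine SI.contAt_mk ?_
      have := ContinuousAt.comp (x := x) (f := fun x : Y × SI χ (insert l I) => jn l 1 0 x.2.v 0) (g := nz) (nz_contAt hx0) c0.continuousAt
      refine this.congr ?_
      filter_upwards [(nsq_cont.comp c0).continuousAt.eventually_ne hx0] with y hy
      exact (r2 y hy).symm
    exact q1.prodMk q2
  have rj : ∀ a : Y × SI χ I, r (a.1, a.2.inc (Finset.subset_insert l I)) = a := fun a => by
    refine rext _ _ (r1 _) ?_
    have h : jn l 1 0 (a.2.inc (Finset.subset_insert l I)).v 0 = a.2.v := by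
      rw [SI.inc_v, jnz, one_smul]
    rw [r2 _ (by rw [h, a.2.nsq]; norm_num), h, nz_one a.2.nsq]
  have ce : Continuous e := by
    have : Continuous fun m => ((e m).1, (e m).2) := by
      refine Continuous.prodMk (by simp only [e1]; exact continuous_fst.comp continuous_fst) (SI.cont_mk ?_)
      simp only [e2']
      exact (nz_cont (jn_cont continuous_const continuous_const
        (SI.cont.comp (continuous_snd.comp continuous_fst)) (Cir.cont.comp continuous_snd)) (fun m => (by rw [n1]; norm_num : nsq (jn l 1 1 m.1.2.v m.2.v) ≠ 0)))
    exact this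
  have ne : Function.Injective e := fun m m' h => by
    refine Prod.ext (by rw [← rre m, ← rre m', h]) (Cir.ext ?_)
    have := hle m
    rw [h, hle m'] at this
    exact (mul_left_cancel₀ (by exact_mod_cast s2.ne') this).symm
  have ee : Eqv Γ e := fun γ m => pext _ _ (by rw [pa1, e1, e1]; rfl) (by
    rw [e2', pa2, e2', ← nz_tw, tw_jn]; rfl)
  have re : range e = U ∩ V := by
    ext x
    rw [mem_inter_iff, mU, mV]
    constructor
    · rintro ⟨m, rfl⟩
      have : ‖(e m).2.v l‖ ^ 2 = 1 / 2 := by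
        rw [hle, norm_mul, m.2.norm, Complex.norm_real, Real.norm_eq_abs, abs_of_pos s2]; norm_num
      exact ⟨this.le, this.ge⟩
    · rintro ⟨h1, h2⟩
      have h : ‖x.2.v l‖ ^ 2 = 1 / 2 := le_antisymm h1 h2
      have hh : nsq (jn l 1 0 x.2.v 0) = 1 / 2 := by rw [n0, h]; norm_num
      have hh0 : nsq (jn l 1 0 x.2.v 0) ≠ 0 := by rw [hh]; norm_num
      have hw : ‖((√2 : ℝ) : ℂ) * x.2.v l‖ = 1 := by
        rw [← sq_eq_sq₀ (norm_nonneg _) zero_le_one, norm_mul, mul_pow, h, Complex.norm_real, Real.norm_eq_abs, sq_abs]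
        norm_num
      refine ⟨((x.1, SI.nor _ hh0 (jn_supp0 hl (sup x.2))), Cir.mk _ hw), pext _ _ (e1 _) ?_⟩
      rw [e2', SI.v_nor, Cir.v_mk]
      have h3 : jn l 1 1 (nz (jn l 1 0 x.2.v 0)) ((√2 : ℝ) * x.2.v l) = √2 • x.2.v := by
        rw [nz, hh]
        funext i
        by_cases h : i = l
        · subst h; simp [jn]
        · simp [jn, h]
      rw [h3, nz_smul (by positivity), nz_one x.2.nsq]
  have U0 : ∀ (t : ℝ), ∀ x ∈ U, 0 < nsq (jn l 1 (clp t) x.2.v (x.2.v l)) := fun t x h => by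
    rw [mU] at h
    rw [nsq_jn, x.2.nsq]
    have : 0 ≤ clp t ^ 2 * ‖x.2.v l‖ ^ 2 := by positivity
    linarith
  have V0 : ∀ (t : ℝ), ∀ x ∈ V, 0 < nsq (jn l (clp t) 1 x.2.v (x.2.v l)) := fun t x h => by
    refine nsq_pos (i := l) ?_
    rw [jn, if_pos rfl, Complex.ofReal_one, one_mul]
    exact Vne x h
  obtain ⟨HU, HUa, HUb⟩ : ∃ HU : ℝ → U → U, (∀ t x, (HU t x).1.1 = x.1.1) ∧
      ∀ t x, (HU t x).1.2.v = nz (jn l 1 (clp t) x.1.2.v (x.1.2.v l)) := by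
    refine ⟨fun t x => ⟨(x.1.1, SI.nor (jn l 1 (clp t) x.1.2.v (x.1.2.v l)) (U0 t _ x.2).ne' (jn_supp (sup _))), ?_⟩,
      fun _ _ => rfl, fun _ _ => rfl⟩
    have h := (mU _).1 x.2
    rw [mU, SI.v_nor]
    have h0 : 0 ≤ clp t ^ 2 * ‖x.1.2.v l‖ ^ 2 := by positivity
    have h1 : clp t ^ 2 * ‖x.1.2.v l‖ ^ 2 ≤ 1 * (1 / 2) :=
      mul_le_mul (by nlinarith [clp_nonneg t, clp_le t]) h (by positivity) zero_le_one
    rw [nz_sq, div_le_iff₀ (U0 t _ x.2), nsq_jn, x.1.2.nsq, jn, if_pos rfl, norm_mul, mul_pow, Complex.norm_real,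
      Real.norm_eq_abs, sq_abs]
    linarith
  obtain ⟨HV, HVa, HVb⟩ : ∃ HV : ℝ → V → V, (∀ t x, (HV t x).1.1 = x.1.1) ∧
      ∀ t x, (HV t x).1.2.v = nz (jn l (clp t) 1 x.1.2.v (x.1.2.v l)) := by
    refine ⟨fun t x => ⟨(x.1.1, SI.nor (jn l (clp t) 1 x.1.2.v (x.1.2.v l)) (V0 t _ x.2).ne' (jn_supp (sup _))), ?_⟩,
      fun _ _ => rfl, fun _ _ => rfl⟩
    have h := (mV _).1 x.2
    rw [mV, SI.v_nor]
    have hn : 0 ≤ 1 - ‖x.1.2.v l‖ ^ 2 := by rw [← n0]; exact nsq_nonneg _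
    have h0 : 0 ≤ clp t ^ 2 * (1 - ‖x.1.2.v l‖ ^ 2) := by positivity
    have h1 : clp t ^ 2 * (1 - ‖x.1.2.v l‖ ^ 2) ≤ 1 * (1 / 2) :=
      mul_le_mul (by nlinarith [clp_nonneg t, clp_le t]) (by linarith) hn zero_le_one
    rw [nz_sq, le_div_iff₀ (V0 t _ x.2), nsq_jn, x.1.2.nsq, jn, if_pos rfl, norm_mul, mul_pow, Complex.norm_real,
      Real.norm_eq_abs, sq_abs]
    linarith
  have cHU : Continuous fun q : ℝ × U => HU q.1 q.2 := by
    refine continuous_induced_rng.2 (?_ : Continuous fun q : ℝ × U => ((HU q.1 q.2).1.1, (HU q.1 q.2).1.2))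
    simp only [HUa]
    refine (continuous_fst.comp (continuous_subtype_val.comp continuous_snd)).prodMk (SI.cont_mk ?_)
    simp only [HUb]
    exact nz_cont (jn_cont continuous_const (clp_cont.comp continuous_fst)
      (SI.cont.comp (continuous_snd.comp (continuous_subtype_val.comp continuous_snd)))
      (cl.comp (continuous_subtype_val.comp continuous_snd))) fun q => (U0 _ _ q.2.2).ne'
  have cHV : Continuous fun q : ℝ × V => HV q.1 q.2 := by
    refine continuous_induced_rng.2 (?_ : Continuous fun q : ℝ × V => ((HV q.1 q.2).1.1, (HV q.1 q.2).1.2))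
    simp only [HVa]
    refine (continuous_fst.comp (continuous_subtype_val.comp continuous_snd)).prodMk (SI.cont_mk ?_)
    simp only [HVb]
    exact nz_cont (jn_cont (clp_cont.comp continuous_fst) continuous_const
      (SI.cont.comp (continuous_snd.comp (continuous_subtype_val.comp continuous_snd)))
      (cl.comp (continuous_subtype_val.comp continuous_snd))) fun q => (V0 _ _ q.2.2).ne'
  have j1 : ∀ z : ι → ℂ, jn l 1 1 z (z l) = z := fun z => by
    funext i
    by_cases h : i = l
    · subst h; simp [jn]
    · simp [jn, h]
  have eHU : letI := subG iU
      ∀ s, Eqv Γ (HU s) := by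
    intro t γ x
    refine Subtype.ext (pext _ _ ?_ ?_)
    · rw [HUa, subG_val, subG_val, pa1, pa1, HUa]
    · rw [HUb, subG_val, subG_val, pa2, pa2, HUb, ← nz_tw, tw_jn]; rfl
  have eHV : letI := subG iV
      ∀ s, Eqv Γ (HV s) := by
    intro t γ x
    refine Subtype.ext (pext _ _ ?_ ?_)
    · rw [HVa, subG_val, subG_val, pa1, pa1, HVa]
    · rw [HVb, subG_val, subG_val, pa2, pa2, HVb, ← nz_tw, tw_jn]; rfl
  obtain ⟨ρ, ρ1, ρ2⟩ : ∃ ρ : V → Y × Cir (χ l), (∀ x, (ρ x).1 = x.1.1) ∧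
      ∀ x, (ρ x).2.v = ((‖x.1.2.v l‖⁻¹ : ℝ) : ℂ) * x.1.2.v l :=
    ⟨fun x => (x.1.1, Cir.mk (((‖x.1.2.v l‖⁻¹ : ℝ) : ℂ) * x.1.2.v l) (by
      have h0 : ‖x.1.2.v l‖ ≠ 0 := norm_ne_zero_iff.2 (Vne _ x.2)
      rw [norm_mul, Complex.norm_real, Real.norm_eq_abs, abs_of_nonneg (by positivity), inv_mul_cancel₀ h0])),
      fun _ => rfl, fun _ => rfl⟩
  have cρ : Continuous ρ := by
    have c := cl.comp (continuous_subtype_val (p := fun x => x ∈ V))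
    have : Continuous fun x => ((ρ x).1, (ρ x).2) := by
      simp only [ρ1]
      refine (continuous_fst.comp continuous_subtype_val).prodMk (Cir.cont_mk ?_)
      simp only [ρ2]
      exact Continuous.mul (Complex.continuous_ofReal.comp (Continuous.inv₀ c.norm fun x => norm_ne_zero_iff.2 (Vne _ x.2))) c
    exact this
  have eρ : letI := subG iV
      Eqv Γ ρ := by
    intro γ x
    refine Prod.ext ?_ (Cir.ext ?_)
    · rw [ρ1, subG_val, pa1]; change _ = act γ (ρ x).1; rw [ρ1]
    · rw [ρ2, subG_val, pl]; change _ = ch p (χ l γ) * (ρ x).2.v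
      rw [ρ2, norm_mul, ch_norm, one_mul]; ring
  have K00 : ∀ t (m : (Y × SI χ I) × Cir (χ l)), nsq (jn l (1 - clp t) (clp t) m.1.2.v m.2.v) ≠ 0 := fun t m => by
    rw [n1]; nlinarith [sq_nonneg (1 - clp t), sq_nonneg (clp t)]
  obtain ⟨K, Ka, Kb⟩ : ∃ K : ℝ → (Y × SI χ I) × Cir (χ l) → Y × SI χ (insert l I), (∀ t m, (K t m).1 = m.1.1) ∧
      ∀ t m, (K t m).2.v = nz (jn l (1 - clp t) (clp t) m.1.2.v m.2.v) :=
    ⟨fun t m => (m.1.1, SI.nor _ (K00 t m) (jn_supp (sup' _))), fun _ _ => rfl, fun _ _ => rfl⟩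
  have cK : Continuous fun q : ℝ × ((Y × SI χ I) × Cir (χ l)) => K q.1 q.2 := by
    have : Continuous fun q : ℝ × ((Y × SI χ I) × Cir (χ l)) => ((K q.1 q.2).1, (K q.1 q.2).2) := by
      simp only [Ka]
      refine (continuous_fst.comp (continuous_fst.comp continuous_snd)).prodMk (SI.cont_mk ?_)
      simp only [Kb]
      exact (nz_cont (jn_cont
        (continuous_const.sub (clp_cont.comp continuous_fst)) (clp_cont.comp continuous_fst)
        (SI.cont.comp (continuous_snd.comp (continuous_fst.comp continuous_snd)))
        (Cir.cont.comp (continuous_snd.comp continuous_snd)))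
        (fun m => K00 _ _))
    exact this
  have eK : ∀ s, Eqv Γ (K s) := fun t γ m => pext _ _ (by rw [Ka, pa1, Ka]; rfl) (by
    rw [Kb, pa2, Kb, ← nz_tw, tw_jn]; rfl)
  have hs1 : ∀ w : ℂ, ‖w‖ = 1 → nz (Pi.single l w) = Pi.single l w := fun w hw =>
    nz_one (SI.pt (χ := χ) l (Finset.mem_insert_self l I) w hw).nsq
  have ci : Continuous (fun x : Y × Cir (χ l) => ((x.1, SI.pt l (Finset.mem_insert_self l I) x.2.v x.2.norm) : Y × SI χ (insert l I))) :=
    continuous_fst.prodMk (SI.cont_mk ((continuous_single l).comp (Cir.cont.comp continuous_snd)))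
  have cj : Continuous (fun x : Y × SI χ I => ((x.1, x.2.inc (Finset.subset_insert l I)) : Y × SI χ (insert l I))) :=
    continuous_fst.prodMk ((SI.inc_cont _).comp continuous_snd)
  have ei : Eqv Γ (fun x : Y × Cir (χ l) => ((x.1, SI.pt l (Finset.mem_insert_self l I) x.2.v x.2.norm) : Y × SI χ (insert l I))) :=
    fun γ x => pext _ _ rfl (by rw [pa2, SI.pt_v, SI.pt_v, tw_single]; rfl)
  have cov : U ∪ V = univ := by
    ext x; rw [mem_union, mU, mV]; simp only [mem_univ, iff_true]; exact le_total _ _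
  have iMV : ∀ x : Y × Cir (χ l), ((x.1, SI.pt l (Finset.mem_insert_self l I) x.2.v x.2.norm) : Y × SI χ (insert l I)) ∈ V :=
    fun x => by rw [mV, SI.pt_v, Pi.single_eq_same, x.2.norm]; norm_num
  have jU : ∀ x : Y × SI χ I, ((x.1, x.2.inc (Finset.subset_insert l I)) : Y × SI χ (insert l I)) ∈ U :=
    fun x => by rw [mU, SI.inc_v, hlz]; norm_num
  have HU1 : ∀ x, HU 1 x = x := fun x => Subtype.ext (pext _ _ (HUa _ _) (by
      rw [HUb, clp_one, j1, nz_one x.1.2.nsq]))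
  have HV1 : ∀ x, HV 1 x = x := fun x => Subtype.ext (pext _ _ (HVa _ _) (by
      rw [HVb, clp_one, j1, nz_one x.1.2.nsq]))
  have HU0 : ∀ x : U, (HU 0 x).1 = ((r x.1).1, (r x.1).2.inc (Finset.subset_insert l I)) := fun x =>
    pext _ _ (by rw [HUa, r1]) (by
      have h := (mU _).1 x.2
      rw [SI.inc_v, r2 _ (by rw [n0]; linarith), HUb, clp_zero]
      congr 1; funext i
      simp [jn])
  have HV0 : ∀ x : V, (HV 0 x).1 = ((ρ x).1, SI.pt l (Finset.mem_insert_self l I) (ρ x).2.v (ρ x).2.norm) := fun x =>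
    pext _ _ (by rw [HVa, ρ1]) (by
      rw [SI.pt_v, HVb, clp_zero, ρ2]
      funext i
      rw [nz_apply, nsq_jn]
      by_cases h : i = l
      · subst h; simp [jn]
      · simp [jn, h])
  have K0 : ∀ m, K 0 m = (m.1.1, m.1.2.inc (Finset.subset_insert l I)) := fun m => pext _ _ (Ka _ _) (by
    have : jn l (1 - clp 0) (clp 0) m.1.2.v m.2.v = m.1.2.v := by
      rw [clp_zero]; funext i
      by_cases h : i = l
      · subst h; simp [jn, hlz]
      · simp [jn, h]
    rw [Kb, this, nz_one m.1.2.nsq]; rfl)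
  have K1 : ∀ m : (Y × SI χ I) × Cir (χ l), K 1 m = (m.1.1, SI.pt l (Finset.mem_insert_self l I) m.2.v m.2.norm) :=
    fun m => pext _ _ (Ka _ _) (by
      have : jn l (1 - clp 1) (clp 1) m.1.2.v m.2.v = Pi.single l m.2.v := by
        rw [clp_one]; funext i
        by_cases h : i = l
        · subst h; simp [jn]
        · simp [jn, h]
      rw [Kb, this, hs1 _ m.2.norm]; rfl)
  exact ⟨{
    cj := cj
    ej := fun _ _ => rfl
    ci := ci
    ei := ei
    hl := fun x => x.2.v l
    chl := cl
    ehl := pl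
    U := U
    V := V
    cU := cU
    cV := cV
    iU := iU
    iV := iV
    cov := cov
    hV := Vne
    iMV := iMV
    jU := jU
    r := r
    er := er
    cr := cr
    rj := rj
    e := e
    ce := ce
    ne := ne
    ee := ee
    re := re
    κ := (√2)⁻¹
    hκ := s2
    hle := hle
    rre := rre
    HU := HU
    cHU := cHU
    eHU := eHU
    HU1 := HU1
    HU0 := HU0
    HV := HV
    cHV := cHV
    eHV := eHV
    HV1 := HV1
    ρ := ρ
    cρ := cρ
    eρ := eρ
    HV0 := HV0
    K := K
    cK := cK
    eK := eK
    K0 := K0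
    μ := fun m => (m.1.1, m.2)
    cμ := (continuous_fst.comp continuous_fst).prodMk continuous_snd
    eμ := fun _ _ => rfl
    K1 := K1 }⟩

end Sph
end Volo

namespace Volo
open scoped Topology
open GSp

section KeyL
variable {Γ ι : Type} [AddCommGroup Γ] [Finite Γ] [Fintype ι] [DecidableEq ι] {p : ℕ} [hp : Fact p.Prime]
variable {Y : Type} [MetricSpace Y] [GSp Γ Y] [CompactSpace Y]

/-- admissible families of characters -/
structure Adm (Γ Y : Type) {ι : Type} [AddCommGroup Γ] [MetricSpace Y] [GSp Γ Y] {p : ℕ} (χ : ι → Γ →+ ZMod p) : Prop where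
  unif : Unif Γ Y
  agree : ∀ (γ : Γ) (y : Y), act γ y = y → ∀ i j, χ i γ = χ j γ
  surj : ∀ i c, ∃ κ : Γ, (∀ y : Y, act κ y = y) ∧ χ i κ = c

variable {χ : ι → Γ →+ ZMod p} {I J : Finset ι}

theorem Adm.fix (h : Adm Γ Y χ) (γ : Γ) (x : Y × SI χ I) : act γ x = x ↔ act γ x.1 = x.1 ∧ ∀ i, χ i γ = 0 := by
  constructor
  · intro hx
    have h1 : act γ x.1 = x.1 := congrArg Prod.fst hx
    obtain ⟨j, hj, hj0⟩ := x.2.exists_ne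
    have h2 : ch p (χ j γ) * x.2.v j = x.2.v j := congrFun (congrArg (fun x : Y × SI χ I => x.2.v) hx) j
    have h3 : χ j γ = 0 := ch_inj (by rw [ch_zero]; exact mul_right_cancel₀ hj0 (by rw [h2, one_mul]))
    exact ⟨h1, fun i => by rw [h.agree γ _ h1 i j, h3]⟩
  · rintro ⟨h1, h2⟩
    refine Prod.ext h1 (SI.ext (funext fun i => ?_))
    change ch p (χ i γ) * x.2.v i = x.2.v i
    rw [h2, ch_zero, one_mul]

theorem Adm.unifP (h : Adm Γ Y χ) (I : Finset ι) : Unif Γ (Y × SI χ I) := fun γ x y hx => by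
  rw [h.fix] at hx ⊢
  exact ⟨h.unif γ _ _ hx.1, hx.2⟩

theorem Adm.sec (h : Adm Γ Y χ) {I : Finset ι} (χ' : Γ →+ ZMod p)
    (h' : ∀ (γ : Γ) (y : Y), act γ y = y → (∀ i, χ i γ = 0) → χ' γ = 0) :
    ∃ s : Y × SI χ I → ZMod p, IsSec χ' s :=
  exists_sec χ' fun γ x hx => by
    rw [h.fix] at hx
    exact h' γ _ hx.1 hx.2

theorem Adm.seci (h : Adm Γ Y χ) (I : Finset ι) (i : ι) : ∃ s : Y × SI χ I → ZMod p, IsSec (χ i) s :=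
  h.sec (χ i) fun _ _ _ h => h i

/-- point inclusion of a coordinate circle -/
noncomputable def ptI (χ : ι → Γ →+ ZMod p) {I : Finset ι} (l : ι) (hl : l ∈ I) : Y × Cir (χ l) → Y × SI χ I :=
  fun x => (x.1, SI.pt l hl x.2.v x.2.norm)

theorem ptI_cont (l : ι) (hl : l ∈ I) : Continuous (ptI χ l hl : Y × Cir (χ l) → Y × SI χ I) :=
  continuous_fst.prodMk (SI.cont_mk ((continuous_single l).comp (Cir.cont.comp continuous_snd)))
theorem ptI_eqv (l : ι) (hl : l ∈ I) : Eqv Γ (ptI χ l hl : Y × Cir (χ l) → Y × SI χ I) :=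
  fun γ x => Prod.ext rfl (SI.ext (by
    change Pi.single l (ch p (χ l γ) * x.2.v) = tw χ γ (Pi.single l x.2.v)
    rw [tw_single]))

/-- inclusion -/
def incP (h : I ⊆ J) : Y × SI χ I → Y × SI χ J := fun x => (x.1, x.2.inc h)
theorem incP_cont (h : I ⊆ J) : Continuous (incP h : Y × SI χ I → Y × SI χ J) :=
  continuous_fst.prodMk ((SI.inc_cont _).comp continuous_snd)
theorem incP_eqv (h : I ⊆ J) : Eqv Γ (incP h : Y × SI χ I → Y × SI χ J) := fun _ _ => rfl

theorem Adm.cir_fix (h : Adm Γ Y χ) (l : ι) (γ : Γ) (x : Y × Cir (χ l)) : act γ x = x ↔ act γ x.1 = x.1 ∧ ∀ i, χ i γ = 0 := by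
  have e := h.fix (I := {l}) γ (ptI χ l (Finset.mem_singleton_self l) x)
  rw [← ptI_eqv] at e
  refine Iff.trans ?_ e
  constructor
  · intro h; rw [h]
  · intro h
    refine Prod.ext (congrArg (fun x : Y × SI χ {l} => x.1) h) (Cir.ext ?_)
    have := congrFun (congrArg (fun x : Y × SI χ {l} => x.2.v) h) l
    simpa [ptI, SI.pt_v] using this

theorem Adm.cir_unif (h : Adm Γ Y χ) (l : ι) : Unif Γ (Y × Cir (χ l)) := fun γ x y hx => by
  rw [h.cir_fix] at hx ⊢
  exact ⟨h.unif γ _ _ hx.1, hx.2⟩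

variable {P A : Type} [MetricSpace P] [GSp Γ P] [MetricSpace A] [GSp Γ A]

/-- submodule generated by the base -/
noncomputable def Gen (χ : ι → Γ →+ ZMod p) (π : P → Y) : Submodule (ZMod p) (HH Γ P (ZMod p)) :=
  sInf {S | (∀ u, pull Γ (ZMod p) π u ∈ S) ∧ ∀ i, ∀ s ∈ S, TT P (χ i) s ∈ S ∧ YY P (χ i) s ∈ S}

theorem Gen_base {π : P → Y} (u) : pull Γ (ZMod p) π u ∈ Gen χ π :=
  (Submodule.mem_sInf).2 fun S hS => hS.1 u
theorem Gen_TT {π : P → Y} (i : ι) {s} (h : s ∈ Gen χ π) : TT P (χ i) s ∈ Gen χ π :=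
  (Submodule.mem_sInf).2 fun S hS => (hS.2 i s ((Submodule.mem_sInf).1 h S hS)).1
theorem Gen_YY {π : P → Y} (i : ι) {s} (h : s ∈ Gen χ π) : YY P (χ i) s ∈ Gen χ π :=
  (Submodule.mem_sInf).2 fun S hS => (hS.2 i s ((Submodule.mem_sInf).1 h S hS)).2

theorem Gen_lift {π : P → Y} (hπ : Continuous π) (eπ : Eqv Γ π) {φ : A → P} (hφ : Continuous φ) (eφ : Eqv Γ φ)
    {π' : A → Y} (hh : π ∘ φ = π') (hs : ∀ i, ∃ s : P → ZMod p, IsSec (χ i) s) (ht : Gen χ π' = ⊤) (a) :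
    ∃ u ∈ Gen χ π, pull Γ (ZMod p) φ u = a := by
  have : Gen χ π' ≤ (Gen χ π).map (pull Γ (ZMod p) φ) := by
    refine sInf_le ⟨fun u => ⟨pull Γ (ZMod p) π u, Gen_base u, by rw [pull_pull hπ eπ hφ eφ, hh]⟩, ?_⟩
    rintro i _ ⟨s, h, rfl⟩
    exact ⟨⟨_, Gen_TT i h, TT_pull (hs i) hφ eφ s⟩, ⟨_, Gen_YY i h, YY_pull (hs i) hφ eφ s⟩⟩
  rw [ht] at this
  exact this (Submodule.mem_top (x := a))

theorem Adm.gen_cir (hodd : Odd p) (h : Adm Γ Y χ) (l : ι) : Gen χ (Prod.fst : Y × Cir (χ l) → Y) = ⊤ := by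
  refine eq_top_iff.2 fun w _ => ?_
  obtain ⟨u, u', rfl⟩ := circ_surj hodd h.unif (h.surj l) (h.cir_unif l) w
  exact add_mem (Gen_base _) (Gen_YY l (Gen_base _))

theorem Adm.gen (hodd : Odd p) (h : Adm Γ Y χ) (hI : I.Nonempty) : Gen χ (Prod.fst : Y × SI χ I → Y) = ⊤ := by
  induction hI using Finset.Nonempty.cons_induction with
  | singleton l =>
    refine eq_top_iff.2 fun w _ => ?_
    let a : Y × SI χ {l} → Y × Cir (χ l) := fun x => (x.1, Cir.mk (x.2.v l) (by
      have := x.2.nsq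
      rw [nsq, Finset.sum_eq_single l (fun b _ hb => by rw [x.2.supp (by simpa using hb)]; simp) (by simp)] at this
      rwa [← sq_eq_sq₀ (norm_nonneg _) zero_le_one, one_pow]))
    have ca : Continuous a := continuous_fst.prodMk (Cir.cont_mk ((SI.cont_i l).comp continuous_snd))
    have ea : Eqv Γ a := fun γ x => rfl
    have hb := ptI_cont (Y := Y) (χ := χ) l (Finset.mem_singleton_self l)
    have eb := ptI_eqv (Y := Y) (χ := χ) l (Finset.mem_singleton_self l)
    have e : w = pull Γ (ZMod p) a (pull Γ (ZMod p) (ptI χ l (Finset.mem_singleton_self l)) w) := by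
      rw [pull_pull hb eb ca ea]
      have : ptI χ l (Finset.mem_singleton_self l) ∘ a = (id : Y × SI χ {l} → _) := by
        funext x
        refine Prod.ext rfl (SI.ext (funext fun i => ?_))
        change (Pi.single l (x.2.v l) : ι → ℂ) i = x.2.v i
        by_cases hi : i = l
        · subst hi; simp
        · rw [x.2.supp (i := i) (by simpa using hi)]; simp [hi]
      rw [this, pull_id]
    obtain ⟨u, hu, hu2⟩ := Gen_lift (χ := χ) (Y := Y) (π := Prod.fst) (π' := Prod.fst) continuous_fst fst_eqv hb eb rfl (h.seci _)
      (h.gen_cir hodd l) (pull Γ (ZMod p) (ptI χ l (Finset.mem_singleton_self l)) w)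
    have : w = u := by
      rw [e, ← hu2, pull_pull hb eb ca ea]
      have : ptI χ l (Finset.mem_singleton_self l) ∘ a = (id : Y × SI χ {l} → _) := by
        funext x
        refine Prod.ext rfl (SI.ext (funext fun i => ?_))
        change (Pi.single l (x.2.v l) : ι → ℂ) i = x.2.v i
        by_cases hi : i = l
        · subst hi; simp
        · rw [x.2.supp (i := i) (by simpa using hi)]; simp [hi]
      rw [this, pull_id]
    rw [this]; exact hu
  | cons l I hl hI ih =>
    rw [Finset.cons_eq_insert]
    obtain ⟨jd⟩ := joinD (Y := Y) χ l hl hI (h.seci _)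
    refine eq_top_iff.2 fun w _ => ?_
    obtain ⟨β, hβ, hβ2⟩ := Gen_lift (χ := χ) (Y := Y) (π := Prod.fst) (π' := Prod.fst) continuous_fst fst_eqv jd.ci jd.ei rfl (h.seci _)
      (h.gen_cir hodd l) (pull Γ (ZMod p) _ w)
    obtain ⟨c, hc, e⟩ := jd.span hodd (h.unifP _) (h.unifP _) (h.seci _ l) (Gen χ Prod.fst)
      (fun a => Gen_lift (χ := χ) (Y := Y) (π := Prod.fst) (π' := Prod.fst) continuous_fst fst_eqv jd.cj jd.ej rfl (h.seci _) ih a)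
      (w - β) (by rw [map_sub, hβ2, sub_self])
    rw [← sub_add_cancel w β, e]
    exact add_mem (Gen_TT l hc) hβ

theorem Adm.free (hodd : Odd p) (h : Adm Γ Y χ) (l : ι) (hl : l ∉ I) (w : HH Γ (Y × SI χ (insert l I)) (ZMod p))
    (hw : TT _ (χ l) w = 0) : pull Γ (ZMod p) (incP (Finset.subset_insert l I)) w = 0 := by
  rcases I.eq_empty_or_nonempty with rfl | hI
  · haveI : IsEmpty (Y × SI χ (∅ : Finset ι)) := ⟨fun x => by
      obtain ⟨j, hj, _⟩ := x.2.exists_ne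
      simp at hj⟩
    revert w
    refine cls_ind fun f hf _ => ?_
    rw [pull_cls (incP_cont _) (incP_eqv _), cls_zero]
    exact ⟨0, zero_mem _, fun x => isEmptyElim x⟩
  obtain ⟨jd⟩ := joinD (Y := Y) χ l hl hI (h.seci _)
  exact jd.free hodd (h.unifP _) (h.unifP _) (h.seci _ l) (fun a => by
    obtain ⟨u, _, hu⟩ := Gen_lift (χ := χ) (Y := Y) (π := Prod.fst) (π' := Prod.fst) continuous_fst fst_eqv jd.ci jd.ei rfl (h.seci _)
      (h.gen_cir hodd l) a
    exact ⟨u, hu⟩) w hw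

theorem Adm.span (hodd : Odd p) (h : Adm Γ Y χ) (l : ι) (hl : l ∉ I) (hI : I.Nonempty) (w : HH Γ (Y × SI χ (insert l I)) (ZMod p))
    (hw : pull Γ (ZMod p) (ptI χ l (Finset.mem_insert_self l I)) w = 0) : ∃ c, w = TT _ (χ l) c := by
  obtain ⟨jd⟩ := joinD (Y := Y) χ l hl hI (h.seci _)
  obtain ⟨c, _, hc⟩ := jd.span hodd (h.unifP _) (h.unifP _) (h.seci _ l) (Gen χ Prod.fst)
      (fun a => Gen_lift (χ := χ) (Y := Y) (π := Prod.fst) (π' := Prod.fst) continuous_fst fst_eqv jd.cj jd.ej rfl (h.seci _)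
        (h.gen hodd hI) a) w hw
  exact ⟨c, hc⟩

theorem Adm.span' (hodd : Odd p) (h : Adm Γ Y χ) (l : ι) (hl : l ∈ J) (w : HH Γ (Y × SI χ J) (ZMod p))
    (hw : pull Γ (ZMod p) (ptI χ l hl) w = 0) : ∃ c, w = TT _ (χ l) c := by
  obtain ⟨I, hlI, rfl⟩ : ∃ I, l ∉ I ∧ J = insert l I := ⟨J.erase l, by simp, (Finset.insert_erase hl).symm⟩
  rcases I.eq_empty_or_nonempty with rfl | hI
  · refine ⟨0, ?_⟩
    have hb := ptI_cont (Y := Y) (χ := χ) l hl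
    have eb := ptI_eqv (Y := Y) (χ := χ) l hl
    let a : Y × SI χ (insert l ∅) → Y × Cir (χ l) := fun x => (x.1, Cir.mk (x.2.v l) (by
      have := x.2.nsq
      rw [nsq, Finset.sum_eq_single l (fun b _ hb => by rw [x.2.supp (by simpa using hb)]; simp) (by simp)] at this
      rwa [← sq_eq_sq₀ (norm_nonneg _) zero_le_one, one_pow]))
    have ca : Continuous a := continuous_fst.prodMk (Cir.cont_mk ((SI.cont_i l).comp continuous_snd))
    have ea : Eqv Γ a := fun γ x => rfl
    have this : ptI χ l hl ∘ a = (id : Y × SI χ (insert l ∅) → _) := by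
      funext x
      refine Prod.ext rfl (SI.ext (funext fun i => ?_))
      change (Pi.single l (x.2.v l) : ι → ℂ) i = x.2.v i
      by_cases hi : i = l
      · subst hi; simp
      · rw [x.2.supp (i := i) (by simpa using hi)]; simp [hi]
    rw [← pull_id w, ← this, ← pull_pull hb eb ca ea, hw, map_zero, map_zero]
  · exact h.span hodd l hlI hI w hw

theorem Adm.list (hodd : Odd p) (h : Adm Γ Y χ) (L : List ι) (hn : L.Nodup) (h0 : L ≠ []) (hL : L.toFinset ⊆ J)
    (w : HH Γ (Y × SI χ J) (ZMod p)) (hw : pull Γ (ZMod p) (incP hL) w = 0) :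
    ∃ c, w = (L.map fun i => TT (Y × SI χ J) (χ i)).prod c := by
  induction L generalizing w with
  | nil => exact absurd rfl h0
  | cons l L ih =>
    have hlJ : l ∈ J := hL (by simp)
    have e1 : pull Γ (ZMod p) (ptI χ l hlJ) w = 0 := by
      have : (ptI χ l hlJ : Y × Cir (χ l) → Y × SI χ J) = incP hL ∘ ptI χ l (by simp) := rfl
      rw [this, ← pull_pull (incP_cont _) (incP_eqv _) (ptI_cont _ _) (ptI_eqv _ _), hw, map_zero]
    obtain ⟨c, rfl⟩ := h.span' hodd l hlJ w e1
    by_cases hL0 : L = []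
    · subst hL0; exact ⟨c, by simp⟩
    rw [TT_pull (h.seci _ l) (incP_cont _) (incP_eqv _)] at hw
    have hl : l ∉ L.toFinset := by simpa using (List.nodup_cons.1 hn).1
    have key : ∀ (K : Finset ι) (hK : K = insert l L.toFinset) (hKJ : K ⊆ J),
        TT _ (χ l) (pull Γ (ZMod p) (incP hKJ) c) = 0 →
        ∀ h2 : L.toFinset ⊆ J, pull Γ (ZMod p) (incP h2) c = 0 := by
      rintro K rfl hKJ h1 h2
      have := h.free hodd l hl _ h1
      rw [pull_pull (incP_cont _) (incP_eqv _) (incP_cont _) (incP_eqv _)] at this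
      exact this
    have h2 : L.toFinset ⊆ J := fun x hx => hL (by simp at hx ⊢; exact Or.inr hx)
    obtain ⟨c', rfl⟩ := ih (List.nodup_cons.1 hn).2 hL0 h2 c (key _ (List.toFinset_cons) hL hw h2)
    exact ⟨c', by simp⟩

/-- key lemma A -/
theorem Adm.keyA (hodd : Odd p) (h : Adm Γ Y χ) (L : List ι) (l : ι) (hn : (l :: L).Nodup) (h0 : L ≠ [])
    (hJ : J = insert l L.toFinset)
    (w : HH Γ (Y × SI χ J) (ZMod p)) (hw : TT _ (χ l) w = 0) :
    ∃ c, w = (L.map fun i => TT (Y × SI χ J) (χ i)).prod c := by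
  subst hJ
  refine h.list hodd L (List.nodup_cons.1 hn).2 h0 (Finset.subset_insert _ _) w ?_
  exact h.free hodd l (by simpa using (List.nodup_cons.1 hn).1) w hw

/-- key lemma B -/
theorem Adm.keyB (hodd : Odd p) (h : Adm Γ Y χ) (t : Γ →+ ZMod p) (ht : ∀ i, χ i = t) (hI : I.Nonempty)
    (a : HH Γ Y (ZMod p)) (n : ℕ) (hn : n + 1 = I.card)
    (ha : (TT (Y × SI χ I) t ^ n) (pull Γ (ZMod p) Prod.fst a) = 0) : a = 0 := by
  have pp : ∀ {I J : Finset ι} (hIJ : I ⊆ J) (n : ℕ) (u : HH Γ (Y × SI χ J) (ZMod p)),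
      pull Γ (ZMod p) (incP hIJ) ((TT _ t ^ n) u) = (TT _ t ^ n) (pull Γ (ZMod p) (incP hIJ) u) := by
    intro I J hIJ n u
    rcases isEmpty_or_nonempty ι with hi | ⟨⟨i⟩⟩
    · exact absurd hI (by simp [Finset.eq_empty_of_isEmpty])
    rw [← ht i]
    induction n with
    | zero => rfl
    | succ n ih =>
      rw [pow_succ', pow_succ', Module.End.mul_apply, Module.End.mul_apply, ← ih, TT_pull (h.seci _ i) (incP_cont _) (incP_eqv _)]
  induction hI using Finset.Nonempty.cons_induction generalizing n with
  | singleton l =>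
    have hn0 : n = 0 := by simpa using hn
    subst hn0
    refine circ_inj hodd h.unif (h.surj l) (h.cir_unif l) a ?_
    have : (Prod.fst : Y × Cir (χ l) → Y) = Prod.fst ∘ ptI χ l (Finset.mem_singleton_self l) := rfl
    rw [this, ← pull_pull continuous_fst fst_eqv (ptI_cont _ _) (ptI_eqv _ _)]
    have ha' : pull Γ (ZMod p) (Prod.fst : Y × SI χ {l} → Y) a = 0 := ha
    rw [ha', map_zero]
  | cons l I hl hI ih =>
    rw [Finset.card_cons] at hn
    obtain ⟨m, rfl⟩ : ∃ m, n = m + 1 := ⟨n - 1, by have := hI.card_pos; omega⟩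
    refine ih m (by omega) ?_
    have key : ∀ (K : Finset ι) (hK : K = insert l I),
        (TT (Y × SI χ K) t ^ (m + 1)) (pull Γ (ZMod p) Prod.fst a) = 0 →
          (TT (Y × SI χ I) t ^ m) (pull Γ (ZMod p) Prod.fst a) = 0 := by
      rintro K rfl h1
      rw [pow_succ', Module.End.mul_apply] at h1
      nth_rewrite 1 [← ht l] at h1
      have := h.free hodd l hl _ h1
      rw [pp, pull_pull continuous_fst fst_eqv (incP_cont _) (incP_eqv _)] at this
      exact this
    exact key _ (Finset.cons_eq_insert l I hl) ha
end KeyL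
end Volo

namespace Volo
open scoped Topology
open GSp

section Sph
/-- even dimensional sphere -/
def Sph (m : ℕ) : Type := {q : ℝ × (Fin m → ℂ) // q.1 ^ 2 + nsq q.2 = 1}
variable {m : ℕ}
noncomputable instance : MetricSpace (Sph m) :=
  inferInstanceAs (MetricSpace {q : ℝ × (Fin m → ℂ) // q.1 ^ 2 + nsq q.2 = 1})
def Sph.v (q : Sph m) : ℝ × (Fin m → ℂ) := Subtype.val q
theorem Sph.eq (q : Sph m) : q.v.1 ^ 2 + nsq q.v.2 = 1 := q.2
theorem Sph.ext {q r : Sph m} (h : q.v = r.v) : q = r := Subtype.ext h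
def Sph.mk (q : ℝ × (Fin m → ℂ)) (h : q.1 ^ 2 + nsq q.2 = 1) : Sph m := ⟨q, h⟩
theorem Sph.v_mk (q : ℝ × (Fin m → ℂ)) (h : q.1 ^ 2 + nsq q.2 = 1) : (Sph.mk q h).v = q := rfl
theorem Sph.cont : Continuous (Sph.v : Sph m → _) := continuous_subtype_val
theorem Sph.cont_mk {T : Type} [TopologicalSpace T] {f : T → Sph m} (h : Continuous fun t => (f t).v) : Continuous f :=
  continuous_induced_rng.2 h
theorem nsq_neg (z : Fin m → ℂ) : nsq (-z) = nsq z := by simp [nsq]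

instance : CompactSpace (Sph m) := by
  refine isCompact_iff_compactSpace.1 (?_ : IsCompact {q : ℝ × (Fin m → ℂ) | q.1 ^ 2 + nsq q.2 = 1})
  refine Metric.isCompact_of_isClosed_isBounded (isClosed_eq ((continuous_fst.pow 2).add (nsq_cont.comp continuous_snd)) continuous_const) ?_
  refine (Metric.isBounded_closedBall (x := (0 : ℝ × (Fin m → ℂ))) (r := 1)).subset fun z hz => ?_
  have hz' : z.1 ^ 2 + nsq z.2 = 1 := hz
  rw [mem_closedBall_zero_iff, Prod.norm_def, max_le_iff, pi_norm_le_iff_of_nonneg zero_le_one]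
  have h0 := nsq_nonneg z.2
  constructor
  · rw [Real.norm_eq_abs, abs_le]; constructor <;> nlinarith
  intro i
  have h1 : ‖z.2 i‖ ^ 2 ≤ nsq z.2 := Finset.single_le_sum (f := fun i => ‖z.2 i‖ ^ 2) (fun i _ => by positivity) (Finset.mem_univ i)
  nlinarith [norm_nonneg (z.2 i), sq_nonneg z.1]

/-- antipode -/
def Sph.al (q : Sph m) : Sph m := Sph.mk (-q.v) (by
  have := q.eq
  rw [Prod.fst_neg, Prod.snd_neg, nsq_neg]; rwa [neg_sq])
theorem Sph.al_al (q : Sph m) : q.al.al = q := Sph.ext (neg_neg _)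
theorem Sph.al_cont : Continuous (Sph.al : Sph m → Sph m) := Sph.cont_mk Sph.cont.neg
theorem Sph.al_dist (q r : Sph m) : dist q.al r.al = dist q r := dist_neg_neg q.v r.v

/-- action of an involution -/
@[reducible] def invG {X : Type} [MetricSpace X] (α : X → X) (h : ∀ x, α (α x) = x) (hd : ∀ x y, dist (α x) (α y) = dist x y) :
    GSp (ZMod 2) X where
  act ε x := if ε = 0 then x else α x
  act_zero x := if_pos rfl
  act_add a b x := by
    have h01 : ∀ a : ZMod 2, a = 0 ∨ a = 1 := by decide
    have e2 : (1 : ZMod 2) + 1 = 0 := by decide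
    have e1 : (1 : ZMod 2) ≠ 0 := by decide
    rcases h01 a with rfl | rfl <;> rcases h01 b with rfl | rfl
    · rw [add_zero, if_pos rfl, if_pos rfl]
    · rw [zero_add, if_neg e1, if_pos rfl]
    · rw [add_zero, if_neg e1, if_pos rfl, if_neg e1]
    · rw [e2, if_pos rfl, if_neg e1, if_neg e1, h]
  act_dist a x y := by
    by_cases ha : a = 0 <;> simp [ha, hd]

noncomputable instance : GSp (ZMod 2) (Sph m) := invG Sph.al Sph.al_al Sph.al_dist

/-- trivial group -/
@[reducible] def trivG (X : Type) [MetricSpace X] : GSp PUnit.{1} X where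
  act _ x := x
  act_zero _ := rfl
  act_add _ _ _ := rfl
  act_dist _ _ _ := rfl

theorem mem_triv {X R : Type} [MetricSpace X] [CommRing R] {f : List X → R} :
    letI := trivG X
    f ∈ Coch PUnit.{1} X R ↔ f [] = 0 := by
  letI := trivG X
  rw [mem_Coch_iff]
  refine ⟨fun h => h.1, fun h => ⟨h, fun γ => ?_⟩⟩
  funext l
  change f (l.map fun x => x) = f l
  rw [List.map_id']

theorem mem_inv {R : Type} [CommRing R] {f : List (Sph m) → R} :
    f ∈ Coch (ZMod 2) (Sph m) R ↔ f [] = 0 ∧ pb Sph.al f = f := by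
  rw [mem_Coch_iff]
  have e1 : (act (1 : ZMod 2) : Sph m → Sph m) = Sph.al := funext fun x => if_neg (by decide)
  have e0 : (act (0 : ZMod 2) : Sph m → Sph m) = id := funext fun x => if_pos rfl
  refine and_congr_right fun _ => ⟨fun h => by rw [← e1]; exact h 1, fun h γ => ?_⟩
  have hγ : γ = 0 ∨ γ = 1 := by revert γ; decide
  rcases hγ with rfl | rfl
  · rw [e0]; funext l; rw [pb_apply, List.map_id]
  · rw [e1]; exact h

theorem Sph.nsq_le (q : Sph m) : nsq q.v.2 ≤ 1 := by have := q.eq; nlinarith [sq_nonneg q.v.1]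

/-- contraction of a half sphere -/
noncomputable def Sph.ct (t : ℝ) (q : Sph m) : Sph m :=
  Sph.mk (√(1 - (1 - clp t) ^ 2 * nsq q.v.2), (1 - clp t) • q.v.2) (by
    have h1 := clp_nonneg t
    have h2 := clp_le t
    have h3 := q.nsq_le
    have h4 := nsq_nonneg q.v.2
    have h5 : (1 - clp t) ^ 2 ≤ 1 := by nlinarith
    rw [Real.sq_sqrt (by nlinarith [sq_nonneg (1 - clp t)]), nsq_smul]; ring)
theorem Sph.ct_cont : Continuous fun q : ℝ × Sph m => Sph.ct q.1 q.2 := by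
  refine Sph.cont_mk ?_
  change Continuous fun q : ℝ × Sph m => (√(1 - (1 - clp q.1) ^ 2 * nsq q.2.v.2), (1 - clp q.1) • q.2.v.2)
  have h1 : Continuous fun q : ℝ × Sph m => clp q.1 := clp_cont.comp continuous_fst
  have h2 : Continuous fun q : ℝ × Sph m => q.2.v.2 := continuous_snd.comp (Sph.cont.comp continuous_snd)
  have h3 : Continuous fun q : ℝ × Sph m => nsq q.2.v.2 := nsq_cont.comp h2
  fun_prop
theorem Sph.ct_zero (q : Sph m) (h : 0 ≤ q.v.1) : Sph.ct 0 q = q := by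
  refine Sph.ext (Prod.ext ?_ ?_)
  · change √(1 - (1 - clp 0) ^ 2 * nsq q.v.2) = _
    rw [clp_zero, sub_zero, one_pow, one_mul, ← q.eq, add_sub_cancel_right, Real.sqrt_sq h]
  · change (1 - clp 0) • q.v.2 = _
    rw [clp_zero, sub_zero, one_smul]
/-- north pole -/
noncomputable def Sph.np : Sph m := Sph.mk (1, 0) (by simp [nsq])
theorem Sph.ct_one (q : Sph m) : Sph.ct 1 q = Sph.np := by
  refine Sph.ext (Prod.ext ?_ ?_)
  · change √(1 - (1 - clp 1) ^ 2 * nsq q.v.2) = 1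
    rw [clp_one]; simp
  · change (1 - clp 1) • q.v.2 = 0
    rw [clp_one, sub_self, zero_smul]

theorem Sph.fib (p : ℕ) [Fact p.Prime] (hodd : Odd p) : FibOK (ZMod 2) (Sph m) (ZMod p) False 0 := by
  letI := trivG (Sph m)
  have hU : Unif PUnit.{1} (Sph m) := fun _ _ _ _ => rfl
  have iI : ∀ S : Set (Sph m), InvS PUnit.{1} S := fun S γ x h => h
  have hc1 : IsClosed {q : Sph m | 0 ≤ q.v.1} := isClosed_le continuous_const (continuous_fst.comp Sph.cont)
  have hc2 : IsClosed {q : Sph m | q.v.1 ≤ 0} := isClosed_le (continuous_fst.comp Sph.cont) continuous_const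
  have hc0 : IsClosed {q : Sph m | q.v.1 = 0} := isClosed_eq (continuous_fst.comp Sph.cont) continuous_const
  have h2 : (2 : ZMod p) ≠ 0 := by
    have hp := (Fact.out : p.Prime)
    rw [show (2 : ZMod p) = ((2 : ℕ) : ZMod p) by norm_num, Ne, ZMod.natCast_eq_zero_iff]
    intro h
    have := (Nat.prime_dvd_prime_iff_eq hp Nat.prime_two).1 h
    subst this
    exact absurd hodd (by decide)
  have cc : Continuous fun q : ℝ × {q : Sph m | 0 ≤ q.v.1} => Sph.ct q.1 q.2.1 :=
    Sph.ct_cont.comp (g := fun q : ℝ × Sph m => Sph.ct q.1 q.2) (f := fun q : ℝ × {q : Sph m | 0 ≤ q.v.1} => (q.1, q.2.1))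
      (continuous_fst.prodMk (continuous_subtype_val.comp continuous_snd))
  refine ⟨fun f hf hD => ?_, fun n f hf hD => ?_, fun h => h.elim⟩
  · rw [mem_inv] at hf
    refine ⟨f [Sph.np], fun x => G0_one_of x fun y => ?_⟩
    have key : ∀ x : Sph m, 0 ≤ x.v.1 → f [x] = f [Sph.np] := contr1 (Γ := PUnit.{1}) (iI {q : Sph m | 0 ≤ q.v.1}) hc1.isCompact Sph.np
      (fun t q => Sph.ct t q.1) cc
      (fun t γ x => rfl) (fun a => Sph.ct_zero a.1 a.2) (fun a => ⟨0, (Sph.ct_one a.1).symm⟩) (mem_triv.2 hf.1) hD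
    have hy : f [y] = f [Sph.np] := by
      rcases le_total 0 y.v.1 with h | h
      · exact key y h
      · have := congrFun hf.2 [y]
        rw [pb_apply] at this
        rw [← this]
        exact key y.al (by change 0 ≤ -y.v.1; linarith)
    simp [hy, one]
  · rw [mem_inv] at hf
    refine ⟨0, fun _ => rfl, ?_⟩
    have pD : pb Sph.al (D f) = D f := by rw [pb_D, hf.2]
    obtain ⟨g1, m1, r1⟩ := contr (Γ := PUnit.{1}) hU (iI {q : Sph m | 0 ≤ q.v.1}) hc1.isCompact Sph.np
      (fun t q => Sph.ct t q.1) cc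
      (fun t γ x => rfl) (fun a => Sph.ct_zero a.1 a.2) (fun a => ⟨0, (Sph.ct_one a.1).symm⟩) (mem_triv.2 hf.1) hD
    have m2 : pb Sph.al g1 ∈ Coch PUnit.{1} (Sph m) (ZMod p) := by
      have h := mem_triv.1 m1
      exact mem_triv.2 h
    have r2 : ∀ x ∈ {q : Sph m | q.v.1 ≤ 0}, G0 (n + 2) (f - D (pb Sph.al g1)) x := fun x hx => by
      have := (r1 x.al (by change 0 ≤ -x.v.1; linarith [show x.v.1 ≤ 0 from hx])).pb Sph.al_cont.continuousAt
      rwa [map_sub, pb_D, hf.2] at this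
    have pp : pb Sph.al (pb Sph.al g1) = g1 := by
      rw [pb_pb, show Sph.al ∘ Sph.al = (id : Sph m → _) from funext Sph.al_al]
      funext l; rw [pb_apply, List.map_id]
    obtain ⟨k, hk, hk2⟩ : ∃ k ∈ Coch PUnit.{1} (Sph m) (ZMod p), ∀ x ∈ {q : Sph m | q.v.1 = 0},
        G0 (n + 1) (g1 - pb Sph.al g1 - D k) x := by
      letI := trivG {q : Sph m | q.v.1 = 0}
      haveI : CompactSpace {q : Sph m | q.v.1 = 0} := isCompact_iff_compactSpace.1 hc0.isCompact
      let Rt : ℝ → {q : Sph m | q.v.1 = 0} → {q : Sph m | q.v.1 = 0} := fun t x =>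
        ⟨Sph.mk (0, fun i => Complex.exp ((Real.pi * t : ℝ) * Complex.I) * x.1.v.2 i) (by
          have h1 := x.1.eq
          have h0 : x.1.v.1 = 0 := x.2
          rw [h0] at h1
          simp only [nsq, norm_mul, Complex.norm_exp_ofReal_mul_I, one_mul]
          exact h1), rfl⟩
      have cR : Continuous fun q : ℝ × {q : Sph m | q.v.1 = 0} => Rt q.1 q.2 := by
        refine Continuous.subtype_mk (Sph.cont_mk ?_) _
        change Continuous fun q : ℝ × {q : Sph m | q.v.1 = 0} => ((0 : ℝ), fun i => Complex.exp ((Real.pi * q.1 : ℝ) * Complex.I) * q.2.1.v.2 i)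
        have h2 : Continuous fun q : ℝ × {q : Sph m | q.v.1 = 0} => q.2.1.v.2 :=
          continuous_snd.comp (Sph.cont.comp (continuous_subtype_val.comp continuous_snd))
        refine continuous_const.prodMk (continuous_pi fun i => ?_)
        have h3 := (continuous_apply i).comp h2
        exact (Complex.continuous_exp.comp ((Complex.continuous_ofReal.comp (continuous_const.mul continuous_fst)).mul continuous_const)).mul h3
      have R0 : Subtype.val ∘ Rt 0 = Subtype.val := funext fun x => Sph.ext (Prod.ext (show (0 : ℝ) = _ from (show x.1.v.1 = 0 from x.2).symm) (by
        funext i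
        change Complex.exp ((Real.pi * 0 : ℝ) * Complex.I) * x.1.v.2 i = x.1.v.2 i
        simp))
      have R1 : Subtype.val ∘ Rt 1 = Sph.al ∘ Subtype.val := funext fun x => Sph.ext (Prod.ext (by
          change (0 : ℝ) = - x.1.v.1
          rw [show x.1.v.1 = 0 from x.2, neg_zero]) (by
        funext i
        change Complex.exp ((Real.pi * 1 : ℝ) * Complex.I) * x.1.v.2 i = - x.1.v.2 i
        rw [mul_one, Complex.exp_pi_mul_I, neg_one_mul]))
      have hh0 : (pb Subtype.val (g1 - pb Sph.al g1) : List {q : Sph m | q.v.1 = 0} → ZMod p) ∈ Coch PUnit.{1} _ (ZMod p) :=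
by
        have h := mem_triv.1 (sub_mem m1 m2)
        exact mem_triv.2 h
      have hD1 : ∀ x ∈ {q : Sph m | q.v.1 = 0}, G0 (n + 2) (D (g1 - pb Sph.al g1)) x := fun x hx => by
        refine ((r2 x (le_of_eq hx)).sub (r1 x (ge_of_eq hx))).congr ?_
        rw [D_sub_fun]; abel
      obtain ⟨g, hg, h⟩ := homotopy (Γ := PUnit.{1}) Rt cR (fun _ _ _ => rfl) (n := n) hh0
        (fun x => by rw [← pb_D]; exact (hD1 x.1 x.2).pb continuous_subtype_val.continuousAt)
      rw [pb_pb, pb_pb, R0, R1] at h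
      obtain ⟨g', hg', h'⟩ := taut hU (Subtype.val : {q : Sph m | q.v.1 = 0} → Sph m) continuous_subtype_val
        Subtype.val_injective (fun _ _ => rfl) (n := n) (sub_mem m1 m2) (fun s => hD1 s.1 s.2)
        (g := (- (2 : ZMod p)⁻¹) • g) (Submodule.smul_mem _ _ hg) (fun s => by
          refine ((h s).smul (- (2 : ZMod p)⁻¹)).congr ?_
          have e : pb (Sph.al ∘ Subtype.val) (g1 - pb Sph.al g1) = - (pb Subtype.val (g1 - pb Sph.al g1) : List {q : Sph m | q.v.1 = 0} → ZMod p) := by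
            rw [← pb_pb, map_sub, pp, ← map_neg, neg_sub]
          rw [e, D_smul_fun, smul_sub, neg_sub_left, neg_smul, smul_neg, neg_neg, ← two_smul (ZMod p), smul_smul, inv_mul_cancel₀ h2, one_smul])
      exact ⟨g', hg', fun x hx => h' ⟨x, hx⟩⟩
    obtain ⟨g, hg, r⟩ := mv_glue (Γ := PUnit.{1}) hc1 hc2 (iI _) (iI _) m1 m2 hk r1 r2 (fun x hx => hk2 x (le_antisymm hx.2 hx.1))
    have r' : ∀ x, G0 (n + 2) (f - D g) x := fun x => r x (le_total 0 x.v.1)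
    have pp' : pb Sph.al (pb Sph.al g) = g := by
      rw [pb_pb, show Sph.al ∘ Sph.al = (id : Sph m → _) from funext Sph.al_al]
      funext l; rw [pb_apply, List.map_id]
    refine ⟨(2 : ZMod p)⁻¹ • (g + pb Sph.al g), mem_inv.2 ⟨?_, ?_⟩, fun x => ?_⟩
    · have := mem_triv.1 hg
      simp [pb_apply, this]
    · rw [map_smul, map_add, pp', add_comm]
    · have e1 := (r' x.al).pb Sph.al_cont.continuousAt
      rw [map_sub, pb_D, hf.2] at e1
      refine (((r' x).add e1).smul (2 : ZMod p)⁻¹).congr ?_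
      rw [D_smul_fun, D_add_fun, zero_smul, sub_zero]
      have : f = (2 : ZMod p)⁻¹ • (f + f) := by rw [← two_smul (ZMod p), smul_smul, inv_mul_cancel₀ h2, one_smul]
      nth_rewrite 3 [this]
      rw [← smul_sub]; congr 1; abel
end Sph
end Volo

namespace Volo
open scoped Topology
open GSp

section F3
theorem FibOK.transfer {Γ1 Γ2 F S R : Type} [AddCommGroup Γ1] [AddCommGroup Γ2] [MetricSpace F] [MetricSpace S] [GSp Γ1 F] [GSp Γ2 S]
    [CommRing R] (h : FibOK Γ2 S R False 0) {φ : F → S} {ψ : S → F} (cφ : Continuous φ) (cψ : Continuous ψ)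
    (hφ : ∀ g ∈ Coch Γ2 S R, pb φ g ∈ Coch Γ1 F R) (hψ : ∀ f ∈ Coch Γ1 F R, pb ψ f ∈ Coch Γ2 S R)
    (hZ : ∀ f ∈ Coch Γ1 F R, ∀ x, Z0 (f - pb φ (pb ψ f)) x) : FibOK Γ1 F R False 0 := by
  refine ⟨fun f hf hD => ?_, fun n f hf hD => ?_, fun h => h.elim⟩
  · obtain ⟨c, hc⟩ := h.lv1 (pb ψ f) (hψ f hf) (fun x => by rw [← pb_D]; exact (hD _).pb cψ.continuousAt)
    refine ⟨c, fun x => ((hZ f hf x 1).add ((hc (φ x)).pb cφ.continuousAt)).congr ?_⟩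
    rw [map_sub, map_smul, pb_one]; abel
  · obtain ⟨c, hc0, g, hg, hc⟩ := h.lv2 n (pb ψ f) (hψ f hf) (fun x => by rw [← pb_D]; exact (hD _).pb cψ.continuousAt)
    refine ⟨c, hc0, pb φ g, hφ g hg, fun x => ((hZ f hf x (n + 2)).add ((hc (φ x)).pb cφ.continuousAt)).congr ?_⟩
    rw [map_sub, map_sub, smul_zero, smul_zero, map_zero, pb_D]; abel

variable {Γ Y W : Type} [AddCommGroup Γ] [Finite Γ] [MetricSpace Y] [MetricSpace W] [GSp Γ Y] [GSp Γ W]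

/-- product action with an involution -/
@[reducible] def dblG (α : W → W) (h : ∀ x, α (α x) = x) (hd : ∀ x y, dist (α x) (α y) = dist x y)
    (hc : ∀ (γ : Γ) x, α (act γ x) = act γ (α x)) : GSp (Γ × ZMod 2) W where
  act γ x := act γ.1 ((invG α h hd).act γ.2 x)
  act_zero x := by
    rw [Prod.fst_zero, Prod.snd_zero, act_zero]; exact (invG α h hd).act_zero x
  act_add a b x := by
    rw [Prod.fst_add, Prod.snd_add, (invG α h hd).act_add, act_add]
    congr 1
    change act b.1 (if a.2 = 0 then _ else _) = if a.2 = 0 then _ else _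
    by_cases h0 : a.2 = 0
    · rw [if_pos h0, if_pos h0]
    · rw [if_neg h0, if_neg h0, hc]
  act_dist a x y := by rw [act_dist]; exact (invG α h hd).act_dist _ _ _

theorem mem_dbl {R : Type} [CommRing R] (α : W → W) (h : ∀ x, α (α x) = x) (hd : ∀ x y, dist (α x) (α y) = dist x y)
    (hc : ∀ (γ : Γ) x, α (act γ x) = act γ (α x)) {f : List W → R} :
    letI : GSp (Γ × ZMod 2) W := dblG α h hd hc
    f ∈ Coch (Γ × ZMod 2) W R ↔ f ∈ Coch Γ W R ∧ pb α f = f := by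
  letI : GSp (Γ × ZMod 2) W := dblG α h hd hc
  rw [mem_Coch_iff, mem_Coch_iff]
  constructor
  · rintro ⟨h0, h1⟩
    refine ⟨⟨h0, fun γ => h1 (γ, 0)⟩, ?_⟩
    have e : (act ((0, 1) : Γ × ZMod 2) : W → W) = α := funext fun x => act_zero (Γ := Γ) (α x)
    rw [← e]; exact h1 _
  · rintro ⟨⟨h0, h1⟩, h2⟩
    refine ⟨h0, fun γ => ?_⟩
    have e : (act γ : W → W) = act γ.1 ∘ (fun x => if γ.2 = 0 then x else α x) := rfl
    rw [e, ← pb_pb, h1]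
    by_cases h0 : γ.2 = 0
    · simp only [h0, if_true]
      funext l; rw [pb_apply, List.map_id']
    · simp only [h0, if_false]
      exact h2

theorem F3 [CompactSpace Y] [CompactSpace W] {p : ℕ} [Fact p.Prime] (hodd : Odd p) {π : W → Y} (hc : Continuous π)
    (hs : Function.Surjective π) (he : Eqv Γ π) (hst : ∀ (γ : Γ) (y : Y), act γ y = y → ∀ w : W, act γ w = w)
    {α : W → W} (ha : ∀ x, α (α x) = x) (had : ∀ x y, dist (α x) (α y) = dist x y)
    (hac : ∀ (γ : Γ) x, α (act γ x) = act γ (α x)) (hne : ∀ x, α x ≠ x) (hπ : ∀ x, π (α x) = π x)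
    (hfib : ∀ y, ∃ m, ∃ φ : π ⁻¹' {y} → Sph m, ∃ ψ : Sph m → W, Continuous φ ∧ Continuous ψ ∧ (∀ s, π (ψ s) = y) ∧
      (∀ w, ψ (φ w) = w.1) ∧ (∀ s, ψ s.al = α (ψ s)) ∧ ∀ w w' : π ⁻¹' {y}, w'.1 = α w.1 → φ w' = (φ w).al)
    (u : HH Γ Y (ZMod p)) (hu : pull Γ (ZMod p) π u = 0) : u = 0 := by
  revert u
  refine cls_ind fun f hf hu => ?_
  rw [pull_cls hc he, cls_zero] at hu
  obtain ⟨c, mc, hcc⟩ := hu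
  have hst' : ∀ (γ : Γ) (y : Y), act γ y = y → ∀ y' : Y, act γ y' = y' := fun γ y h y' => by
    obtain ⟨w, rfl⟩ := hs y'
    rw [← he, hst γ y h]
  have haY : ∀ y : Y, id (id y) = y := fun _ => rfl
  have hdY : ∀ x y : Y, dist (id x) (id y) = dist x y := fun _ _ => rfl
  have hcY : ∀ (γ : Γ) (x : Y), id (act γ x) = act γ (id x) := fun _ _ => rfl
  letI iW : GSp (Γ × ZMod 2) W := dblG α ha had hac
  letI iY : GSp (Γ × ZMod 2) Y := dblG id haY hdY hcY
  have aY : ∀ (γ : Γ × ZMod 2) (y : Y), act γ y = act γ.1 y := fun γ y => by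
    change act γ.1 (if γ.2 = 0 then y else y) = _
    rw [ite_self]
  have aW : ∀ (γ : Γ × ZMod 2) (w : W), act γ w = act γ.1 (if γ.2 = 0 then w else α w) := fun γ y => rfl
  have he' : Eqv (Γ × ZMod 2) π := fun γ x => by
    rw [aY, aW, he]
    by_cases h0 : γ.2 = 0
    · rw [if_pos h0]
    · rw [if_neg h0, hπ]
  have hUY : Unif (Γ × ZMod 2) Y := fun γ x y h => by
    rw [aY] at h ⊢; exact hst' _ _ h _
  have hUW : Unif (Γ × ZMod 2) W := fun γ x y h => by
    have h1 : act γ.1 (π x) = π x := by rw [← aY, ← he', h]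
    have h2 := hst _ _ h1
    rw [aW, h2] at h ⊢
    by_cases h0 : γ.2 = 0
    · rw [if_pos h0]
    · rw [if_neg h0] at h
      exact absurd h (hne x)
  have h2 : (2 : ZMod p) ≠ 0 := by
    have hp := (Fact.out : p.Prime)
    rw [show (2 : ZMod p) = ((2 : ℕ) : ZMod p) by norm_num, Ne, ZMod.natCast_eq_zero_iff]
    intro h
    have := (Nat.prime_dvd_prime_iff_eq hp Nat.prime_two).1 h
    subst this
    exact absurd hodd (by decide)
  have hac' : Continuous α := (Isometry.of_dist_eq had).continuous
  have mf : f ∈ Coch (Γ × ZMod 2) Y (ZMod p) := by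
    refine (mem_dbl id haY hdY hcY).2 ⟨hf.1, ?_⟩
    funext l; rw [pb_apply, List.map_id]
  have pp : pb α (pb α c) = c := by
    rw [pb_pb, show α ∘ α = id from funext ha]
    funext l; rw [pb_apply, List.map_id]
  have pf : pb α (pb π f) = pb π f := by
    rw [pb_pb]; congr 1; exact congrArg pb (funext hπ)
  have mc' : (2 : ZMod p)⁻¹ • (c + pb α c) ∈ Coch (Γ × ZMod 2) W (ZMod p) := by
    refine (mem_dbl α ha had hac).2 ⟨Submodule.smul_mem _ _ (add_mem mc (Coch.pb mc fun γ x => hac γ x)), ?_⟩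
    rw [map_smul, map_add, pp, add_comm]
  have hcc' : ∀ x, Z0 (pb π f - D ((2 : ZMod p)⁻¹ • (c + pb α c))) x := fun x => by
    have e1 : Z0 (pb π f - D (pb α c)) x := by
      have := (hcc (α x)).pb hac'.continuousAt
      rwa [map_sub, pb_D, pf] at this
    refine (((hcc x).add e1).smul (2 : ZMod p)⁻¹).congr ?_
    rw [D_smul_fun, D_add_fun]
    have : pb π f = (2 : ZMod p)⁻¹ • (pb π f + pb π f) := by rw [← two_smul (ZMod p), smul_smul, inv_mul_cancel₀ h2, one_smul]
    nth_rewrite 3 [this]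
    rw [← smul_sub]; congr 1; abel
  have hF : ∀ y, letI := subG (fib_inv he' y)
      FibOK (Γ × ZMod 2) (π ⁻¹' orb (Γ × ZMod 2) y) (ZMod p) False (pb Subtype.val (0 : List W → ZMod p)) := by
    intro y
    letI := subG (fib_inv he' y)
    rw [map_zero]
    obtain ⟨m, φ, ψ, cφ, cψ, h1, h2, h3, h4⟩ := hfib y
    have hu : ∀ z, ∃ γ : Γ, z ∈ orb (Γ × ZMod 2) y → act γ y = z := fun z => by
      by_cases hz : z ∈ orb (Γ × ZMod 2) y
      · obtain ⟨γ, hγ⟩ := id hz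
        exact ⟨γ.1, fun _ => by rw [← hγ]; exact (aY γ y).symm⟩
      · exact ⟨0, fun h => absurd h hz⟩
    choose u hu using hu
    have hin : ∀ x : π ⁻¹' orb (Γ × ZMod 2) y, π (act (-u (π x.1)) x.1) = y := fun x => by
      rw [he]
      nth_rewrite 2 [← hu (π x.1) x.2]
      rw [act_neg]
    have hloc : ∀ x : π ⁻¹' orb (Γ × ZMod 2) y, ∃ N ∈ 𝓝 x, ∀ a ∈ N, π a.1 = π x.1 := by
      intro x
      obtain ⟨N, hN, h⟩ := orb_loc (Γ := Γ × ZMod 2) y (π x.1) x.2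
      exact ⟨_, (hc.comp continuous_subtype_val).continuousAt hN, fun a ha => h _ ha a.2⟩
    have hcon : Continuous fun x : π ⁻¹' orb (Γ × ZMod 2) y => act (-u (π x.1)) x.1 := by
      rw [continuous_iff_continuousAt]
      intro x
      obtain ⟨N, hN, h⟩ := hloc x
      refine (((act_cont (-u (π x.1))).comp continuous_subtype_val).continuousAt (x := x)).congr ?_
      filter_upwards [hN] with a ha
      rw [h a ha]; rfl
    have hmem : ∀ s, ψ s ∈ π ⁻¹' orb (Γ × ZMod 2) y := fun s => by
      change π (ψ s) ∈ orb (Γ × ZMod 2) y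
      rw [h1]; exact orb_self y
    refine FibOK.transfer (Γ1 := Γ × ZMod 2) (Sph.fib (m := m) p hodd) (φ := fun x => φ ⟨act (-u (π x.1)) x.1, hin x⟩)
      (ψ := fun s => ⟨ψ s, hmem s⟩) (cφ.comp (hcon.subtype_mk _)) (cψ.subtype_mk _) ?_ ?_ ?_
    · intro g hg
      rw [mem_inv] at hg
      refine ⟨hg.1, fun γ l => ?_⟩
      have key : ∀ x : π ⁻¹' orb (Γ × ZMod 2) y,
          act (-u (π (act γ x).1)) (act γ x).1 = if γ.2 = 0 then act (-u (π x.1)) x.1 else α (act (-u (π x.1)) x.1) := by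
        intro x
        have e1 : (act γ x).1 = act γ.1 (if γ.2 = 0 then x.1 else α x.1) := rfl
        have e3 : π (act γ x).1 = act γ.1 (π x.1) := by
          rw [e1, he]
          by_cases h0 : γ.2 = 0
          · rw [if_pos h0]
          · rw [if_neg h0, hπ]
        have e2 : act (-u (π (act γ x).1) + γ.1 + u (π x.1)) y = y := by
          rw [act_add, act_add, hu _ x.2, ← e3]
          nth_rewrite 2 [← hu _ (act γ x).2]
          rw [act_neg]
        have e4 := hst _ _ e2
        have e5 : ∀ w : W, act (-u (π (act γ x).1)) (act γ.1 w) = act (-u (π x.1)) w := fun w => by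
          have := e4 (act (-u (π x.1)) w)
          rwa [act_add, act_neg', act_add] at this
        nth_rewrite 2 [e1]
        rw [e5]
        by_cases h0 : γ.2 = 0
        · rw [if_pos h0, if_pos h0]
        · rw [if_neg h0, if_neg h0, hac]
      have f0 : γ.2 = 0 → ∀ x : π ⁻¹' orb (Γ × ZMod 2) y, φ ⟨_, hin (act γ x)⟩ = φ ⟨_, hin x⟩ := fun h0 x =>
        congrArg φ (Subtype.ext ((key x).trans (if_pos h0)))
      have f1 : γ.2 ≠ 0 → ∀ x : π ⁻¹' orb (Γ × ZMod 2) y, φ ⟨_, hin (act γ x)⟩ = (φ ⟨_, hin x⟩).al := fun h0 x =>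
        h4 _ _ ((key x).trans (if_neg h0))
      rw [pb_apply, pb_apply, List.map_map]
      by_cases h0 : γ.2 = 0
      · exact congrArg g (List.map_congr_left fun x _ => f0 h0 x)
      · refine Eq.trans ?_ (congrFun hg.2 _)
        rw [pb_apply, List.map_map]
        exact congrArg g (List.map_congr_left fun x _ => f1 h0 x)
    · intro f hf
      rw [mem_inv]
      refine ⟨hf.1, ?_⟩
      funext l
      rw [pb_apply, pb_apply, pb_apply, List.map_map, ← hf.2 (0, 1) (List.map _ l), List.map_map]
      congr 2
      funext s
      refine Subtype.ext ?_
      change act (0 : Γ) (α (ψ s.al)) = ψ s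
      rw [act_zero, h3, ha]
    · intro f hf x n
      obtain ⟨N, hN, h⟩ := hloc x
      refine ⟨N, hN, fun l _ hl => ?_⟩
      rw [Pi.sub_apply, pb_apply, pb_apply, List.map_map, sub_eq_zero, ← hf.2 (-u (π x.1), 0) l]
      congr 1
      refine List.map_congr_left fun a ha => Subtype.ext ?_
      change act (-u (π x.1)) a.1 = ψ (φ _)
      rw [h2]
      change _ = act (-u (π a.1)) a.1
      rw [h a (hl a ha)]
  obtain ⟨b0, k0, b1, k1, e, ke, -, r0, -, -⟩ := LH (Γ := Γ × ZMod 2) (Jp := False) (θ := 0) (τ := 0) (a1 := 0) hUY hUW hc hs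
    he' (zero_mem _) (fun _ _ => rfl) (zero_mem _) (fun _ _ => rfl) (fun y => by rw [D_zero_fun]; exact Z0.zero y)
    (fun x => by rw [map_zero, D_zero_fun, sub_zero]; exact Z0.zero x) (fun _ => rfl) hF mf (zero_mem _) mc' (by simp)
    (fun y => (hf.2 y).congr (by rw [sg_zero, cup_zero_left, add_zero]))
    (fun y => by rw [D_zero_fun]; exact Z0.zero y)
    (fun x => (hcc' x).congr (by rw [map_zero, cup_zero_left, add_zero]))
  rw [cls_zero]
  exact ⟨b0, ((mem_dbl id haY hdY hcY).1 k0).1, fun y => (r0 y).congr (by rw [cup_zero_right, add_zero])⟩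
end F3
end Volo

namespace Volo
open scoped Topology
open GSp

section GoodS
variable {Γ X : Type} [AddCommGroup Γ] [Finite Γ] [MetricSpace X] [GSp Γ X]
variable {p : ℕ} [hp : Fact p.Prime]

/-- a representative of a power of the Euler class supported on a set, commuting with it -/
structure Good (χ : Γ →+ ZMod p) (s : X → ZMod p) (Q : Set X) (n : ℕ) (τ : List X → ZMod p) : Prop where
  mem : τ ∈ Zc Γ X (ZMod p)
  off : ∀ x ∉ Q, Z0 τ x
  com : ∃ k ∈ Coch Γ X (ZMod p), (∀ x, Z0 (cup (tS s) τ - cup τ (tS s) - D k) x) ∧ ∀ x ∉ Q, Z0 k x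
  pow : ∃ c : ZMod p, c ≠ 0 ∧ rc Γ τ = c • TT X χ ^ n

theorem Good.mul {χ : Γ →+ ZMod p} {s : X → ZMod p} (hs : IsSec χ s) {Q Q' : Set X} {n n' : ℕ}
    {τ τ' : List X → ZMod p} (h : Good χ s Q n τ) (h' : Good χ s Q' n' τ') :
    Good χ s (Q ∩ Q') (n + n') (cup τ τ') := by
  have st : ∀ x, x ∉ Q ∩ Q' → x ∉ Q ∨ x ∉ Q' := fun x hx => by
    by_contra! h; exact hx h
  obtain ⟨k, mk, hk, ok⟩ := h.com
  obtain ⟨k', mk', hk', ok'⟩ := h'.com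
  obtain ⟨c, c0, hc⟩ := h.pow
  obtain ⟨c', c0', hc'⟩ := h'.pow
  refine ⟨Zc.cup h.mem h'.mem, fun x hx => ?_, ⟨cup k τ' + cup (sg τ) k', add_mem (Coch.cup mk h'.mem.1)
    (Coch.cup (Coch.sg h.mem.1) mk'), fun x => ?_, fun x hx => ?_⟩, ⟨c' * c, mul_ne_zero c0' c0, ?_⟩⟩
  · rcases st x hx with hx | hx
    · exact (h.off x hx).cup_left
    · exact (h'.off x hx).cup_right
  · refine (((((hk x).cup_left (g := τ')).add ((hk' x).cup_right (f := τ))).sub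
      ((h'.mem.2 x).cup_right (f := sg k))).sub (((Zc.sg h.mem).2 x).cup_left (g := k'))).congr ?_
    rw [D_add_fun, leibniz_fun _ _ mk.1 h'.mem.1.1, leibniz_fun _ _ (Coch.sg h.mem.1).1 mk'.1, sg_sg]
    simp only [cup_sub_left, cup_sub_right, cup_assoc]
    abel
  · rcases st x hx with hx | hx
    · exact ((ok x hx).cup_left).add ((h.off x hx).sg.cup_left)
    · exact ((h'.off x hx).cup_right).add ((ok' x hx).cup_right)
  · refine LinearMap.ext fun u => ?_
    rw [← rc_rc h.mem h'.mem, hc, hc', add_comm n, pow_add]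
    simp [smul_smul, mul_comm]

theorem Good.base {χ : Γ →+ ZMod p} {s : X → ZMod p} (hs : IsSec χ s) {Q : Set X}
    {τ V : List X → ZMod p} (mτ : τ ∈ Zc Γ X (ZMod p)) (mV : V ∈ Coch Γ X (ZMod p)) (c : ZMod p) (c0 : c ≠ 0)
    (e : tS s = c • τ + D V) (off : ∀ x ∉ Q, Z0 τ x) : Good χ s Q 1 τ := by
  refine ⟨mτ, off, ⟨cup V τ - cup (sg τ) V, sub_mem (Coch.cup mV mτ.1) (Coch.cup (Coch.sg mτ.1) mV),
    fun x => ?_, fun x hx => ((off x hx).cup_right).sub ((off x hx).sg.cup_left)⟩, ⟨c⁻¹, inv_ne_zero c0, ?_⟩⟩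
  · refine ((((Zc.sg mτ).2 x).cup_left (g := V)).sub ((mτ.2 x).cup_right (f := sg V))).congr ?_
    rw [D_sub_fun, leibniz_fun _ _ mV.1 mτ.1.1, leibniz_fun _ _ (Coch.sg mτ.1).1 mV.1, sg_sg, e]
    simp only [cup_add_left, cup_add_right, cup_smul_left, cup_smul_right]
    abel
  · have mc : c • τ ∈ Zc Γ X (ZMod p) := Submodule.smul_mem _ _ mτ
    have : rc Γ (tS s) = c • rc Γ τ := by
      rw [rc_congr (tS_Zc hs) mc mV (fun x => (Z0.zero x).congr (by rw [e]; abel))]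
      refine LinearMap.ext (cls_ind fun f hf => ?_)
      rw [LinearMap.smul_apply, rc_cls mc, rc_cls mτ, cls_smul]
      exact cls_congr (by simp [cup_smul_right])
    rw [pow_one, TT_eq hs, this, smul_smul, inv_mul_cancel₀ c0, one_smul]

theorem Good.one {χ : Γ →+ ZMod p} (hodd : Odd p) {s : X → ZMod p} (hs : IsSec χ s) {h : X → ℂ} (hc : Continuous h)
    (hh : ∀ (γ : Γ) x, h (act γ x) = ch p (χ γ) * h x) : ∃ τ, Good χ s {x | h x = 0} 1 τ := by
  have hu := uh_sec hs hh
  have hW := WS_mem hs hu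
  have hZ : tS s - D (WS s (uh s h)) ∈ Zc Γ X (ZMod p) := sub_mem (tS_Zc hs) (Zc.D hW)
  exact ⟨_, Good.base hs hZ hW 1 one_ne_zero (by rw [one_smul]; abel)
    fun x hx => uh_Z0 hodd s hc.continuousAt hx⟩

theorem Good.two {χ : Γ →+ ZMod p} (hodd : Odd p) {s : X → ZMod p} (hs : IsSec χ s) {h : X → ℂ} (hc : Continuous h)
    (hh : ∀ (γ : Γ) x, h (act γ x) = ch p ((χ + χ) γ) * h x) : ∃ τ, Good χ s {x | h x = 0} 1 τ := by
  have hs' := hs.add hs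
  obtain ⟨r, mr, hr⟩ := tS_add hs hs hs'
  have hu := uh_sec hs' hh
  have hW := WS_mem hs' hu
  have h2 : (2 : ZMod p) ≠ 0 := by
    intro h
    have : (p : ℕ) ∣ 2 := (ZMod.natCast_eq_zero_iff 2 p).1 (by exact_mod_cast h)
    have := (Nat.prime_dvd_prime_iff_eq hp.out Nat.prime_two).1 this
    subst this; exact absurd hodd (by decide)
  have hZ : tS (fun x => s x + s x) - D (WS (fun x => s x + s x) (uh (fun x => s x + s x) h)) ∈ Zc Γ X (ZMod p) :=
    sub_mem (tS_Zc hs') (Zc.D hW)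
  have hV : (2⁻¹ : ZMod p) • (WS (fun x => s x + s x) (uh (fun x => s x + s x) h) - r) ∈ Coch Γ X (ZMod p) :=
    Submodule.smul_mem _ _ (sub_mem hW mr)
  refine ⟨_, Good.base hs hZ hV (2⁻¹) (inv_ne_zero h2) ?_ fun x hx => uh_Z0 hodd _ hc.continuousAt hx⟩
  have hr' : tS (fun x => s x + s x) = tS s + tS s + D r := hr
  rw [D_smul_fun, D_sub_fun (WS _ _) r, ← smul_add, hr', show tS s + tS s + D r - D (WS (fun x => s x + s x) (uh (fun x => s x + s x) h)) +
    (D (WS (fun x => s x + s x) (uh (fun x => s x + s x) h)) - D r) = (2 : ZMod p) • tS s by rw [two_smul]; abel,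
    smul_smul, inv_mul_cancel₀ h2, one_smul]

theorem Good.list {χ : Γ →+ ZMod p} (hodd : Odd p) {s : X → ZMod p} (hs : IsSec χ s) {h : X → ℂ} (hc : Continuous h)
    (hh : ∀ (γ : Γ) x, h (act γ x) = ch p ((χ + χ) γ) * h x) (L : List (X → ℂ)) (hL : ∀ h ∈ L, Continuous h)
    (hL' : ∀ h ∈ L, ∀ (γ : Γ) x, h (act γ x) = ch p (χ γ) * h x) :
    ∃ τ, Good χ s {x | (∀ h ∈ L, h x = 0) ∧ h x = 0} (L.length + 1) τ := by
  induction L with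
  | nil => simpa using Good.two hodd hs hc hh
  | cons g L ih =>
    obtain ⟨τ, hτ⟩ := ih (fun h hh => hL h (by simp [hh])) (fun h hh => hL' h (by simp [hh]))
    obtain ⟨τ', hτ'⟩ := Good.one hodd hs (hL g (by simp)) (hL' g (by simp))
    refine ⟨cup τ τ', ?_⟩
    convert hτ.mul hs hτ' using 1
    ext x
    simp only [List.mem_cons, forall_eq_or_imp, Set.mem_ofPred_eq, Set.mem_inter_iff]
    tauto
    rfl

theorem even_abs [CompactSpace X] (hodd : Odd p) (hU : Unif Γ X) {χ : Γ →+ ZMod p} {s : X → ZMod p} (hs : IsSec χ s)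
    {Q : Set X} (hQ : IsClosed Q) (iQ : InvS Γ Q) {n : ℕ} {τ : List X → ZMod p} (hτ : Good χ s Q (n + 1) τ)
    (u : HH Γ X (ZMod p))
    (hu : letI := subG iQ
      pull Γ (ZMod p) (fun q : Q × Cir χ => (q.1 : X)) u = 0) :
    ∃ (c : ZMod p) (w : HH Γ X (ZMod p)), c ≠ 0 ∧ TT X χ (c • (TT X χ ^ n) u - w) = 0 ∧
      ∀ (W : Type) [MetricSpace W] [GSp Γ W] (φ : W → X), Continuous φ → Eqv Γ φ → (∀ x, φ x ∉ Q) →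
        pull Γ (ZMod p) φ w = 0 := by
  obtain ⟨c, c0, hc⟩ := hτ.pow
  have e1 : ∀ w, TT X χ (c • (TT X χ ^ n) u - w) = rc Γ τ u - TT X χ w := fun w => by
    rw [hc, map_sub, pow_succ']; simp
  rcases isEmpty_or_nonempty Q with hE | hE
  · refine ⟨c, 0, c0, ?_, fun W _ _ φ _ _ _ => map_zero _⟩
    rw [e1, map_zero, rc_Z0 hτ.mem fun x => hτ.off x fun hx => hE.false ⟨x, hx⟩]
    simp
  letI := subG iQ
  haveI : CompactSpace Q := isCompact_iff_compactSpace.1 hQ.isCompact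
  have hv : Eqv Γ (Subtype.val : Q → X) := subG_val iQ
  have hvc : Continuous (Subtype.val : Q → X) := continuous_subtype_val
  have hsQ : IsSec χ (s ∘ (Subtype.val : Q → X)) := hs.comp hv
  obtain ⟨v, hvv⟩ := gysin_ker hodd (subG_unif iQ hU) ⟨_, hsQ⟩ (pull Γ (ZMod p) Subtype.val u) (by
    rw [pull_pull hvc hv continuous_fst fst_eqv]; exact hu)
  rw [TT_eq hsQ] at hvv
  clear hu
  revert v
  refine cls_ind fun b hb => ?_
  revert u
  refine cls_ind fun a ha e1 hvv => ?_
  rw [pull_cls hvc hv, rc_cls (tS_Zc hsQ), cls_eq] at hvv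
  obtain ⟨m', mm', hm'⟩ := hvv
  obtain ⟨r, re, rr, rcont⟩ := exists_retract hU (Subtype.val : Q → X) hvc Subtype.val_injective hv
  have mB : pb r b ∈ Coch Γ X (ZMod p) := Coch.pb hb.1 re
  have dB : ∀ x ∈ Q, Z0 (D (pb r b)) x := fun x hx => by
    rw [← pb_D]
    exact (hb.2 _).pb (rcont ⟨x, hx⟩)
  have eB : pb Subtype.val (pb r b) = b := by
    rw [pb_pb, show r ∘ Subtype.val = id from funext rr]; funext l; simp [pb_apply]
  obtain ⟨B, hB⟩ : ∃ B, B = pb r b := ⟨_, rfl⟩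
  rw [← hB] at mB dB eB
  have mf : a - cup B (tS s) ∈ Coch Γ X (ZMod p) := sub_mem ha.1 (Coch.cup mB (tS_mem hs))
  obtain ⟨m, mm, hm⟩ := tautZ hU (Subtype.val : Q → X) hvc Subtype.val_injective hv mf (fun x => by
      rw [D_sub_fun, leibniz_fun _ _ mB.1 (tS_mem hs).1]
      exact (ha.2 _).sub (((dB x.1 x.2).cup_left).add (((tS_Zc hs).2 _).cup_right))) mm' (fun x =>
      (hm' x).congr (by rw [map_sub, pb_cup, eB, tS_pb]))
  have nQ : ∀ x, x ∈ Q ∨ x ∉ Q := fun x => em _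
  have mc : cup B τ ∈ Zc Γ X (ZMod p) := ⟨Coch.cup mB hτ.mem.1, fun x => by
    rw [leibniz_fun _ _ mB.1 hτ.mem.1.1]
    refine Z0.add ?_ ((hτ.mem.2 x).cup_right)
    rcases nQ x with hx | hx
    · exact (dB x hx).cup_left
    · exact (hτ.off x hx).cup_right⟩
  obtain ⟨k, mk, hk, ok⟩ := hτ.com
  refine ⟨c, cls mc, c0, ?_, ?_⟩
  · rw [e1, TT_eq hs, rc_cls hτ.mem, rc_cls (tS_Zc hs), sub_eq_zero, cls_eq]
    refine ⟨cup m τ + cup (sg B) k, add_mem (Coch.cup mm hτ.mem.1) (Coch.cup (Coch.sg mB) mk), fun x => ?_⟩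
    have z1 : Z0 (cup (a - cup B (tS s) - D m) τ) x := by
      rcases nQ x with hx | hx
      · exact (hm ⟨x, hx⟩).cup_left
      · exact (hτ.off x hx).cup_right
    have z2 : Z0 (cup (D (sg B)) k) x := by
      rcases nQ x with hx | hx
      · refine Z0.cup_left ?_
        rw [D_sg]; exact (dB x hx).sg.neg
      · exact (ok x hx).cup_right
    refine (((z1.add ((hk x).cup_right (f := B))).sub ((hτ.mem.2 x).cup_right (f := sg m))).sub z2).congr ?_
    rw [D_add_fun, leibniz_fun _ _ mm.1 hτ.mem.1.1, leibniz_fun _ _ (Coch.sg mB).1 mk.1, sg_sg]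
    simp only [cup_sub_left, cup_sub_right, cup_assoc]
    abel
  · intro W _ _ φ hφ he hn
    rw [pull_cls hφ he, cls_zero]
    refine ⟨0, zero_mem _, fun x => ?_⟩
    rw [D_zero_fun, sub_zero]
    exact (Z0.cup_right (hτ.off _ (hn x))).pb hφ.continuousAt
end GoodS
end Volo

namespace Volo
open scoped Topology
open GSp

section Alg
variable {p : ℕ} [hp : Fact p.Prime]

theorem prod_field {K : Type} [Field K] [Algebra (ZMod p) K] (Z w : K) :
    ∏ c : ZMod p, (Z + c • w) = Z ^ p - w ^ (p - 1) * Z := by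
  have hp1 : 1 < p := hp.out.one_lt
  have key : ∏ c : ZMod p, (Polynomial.X - Polynomial.C c) = (Polynomial.X ^ p - Polynomial.X : Polynomial (ZMod p)) := by
    have hr := FiniteField.roots_X_pow_card_sub_X (ZMod p)
    rw [ZMod.card] at hr
    have hm : (Polynomial.X ^ p - Polynomial.X : Polynomial (ZMod p)).Monic :=
      Polynomial.monic_X_pow_sub (by rw [Polynomial.degree_X]; exact_mod_cast hp1)
    have := Polynomial.prod_multiset_X_sub_C_of_monic_of_roots_card_eq hm (by
      rw [hr, FiniteField.X_pow_card_sub_X_natDegree_eq _ hp1]; simp [ZMod.card])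
    rw [hr] at this
    exact this
  have key2 : ∀ u : K, ∏ c : ZMod p, (u + algebraMap _ K c) = u ^ p - u := fun u => by
    have := congrArg (Polynomial.aeval u) key
    simp only [map_prod, map_sub, map_pow, Polynomial.aeval_X, Polynomial.aeval_C] at this
    rw [← this]
    exact Fintype.prod_equiv (Equiv.neg _) _ _ fun c => by simp
  by_cases hw : w = 0
  · subst hw
    simp [ZMod.card, zero_pow (Nat.sub_ne_zero_of_lt hp1)]
  · have : ∀ c : ZMod p, Z + c • w = w * (Z / w + algebraMap _ K c) := fun c => by
      rw [Algebra.smul_def]; field_simp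
    rw [Finset.prod_congr rfl fun c _ => this c, Finset.prod_mul_distrib, key2]
    simp only [Finset.prod_const, Finset.card_univ, ZMod.card]
    have : w ^ p = w ^ (p - 1) * w := by rw [← pow_succ, Nat.sub_add_cancel hp1.le]
    rw [mul_sub, ← mul_pow, mul_div_cancel₀ _ hw, this, mul_assoc, mul_div_cancel₀ _ hw]

theorem prod_ring {A : Type} [CommRing A] [Algebra (ZMod p) A] (Z w : A) :
    ∏ c : ZMod p, (Z + c • w) = Z ^ p - w ^ (p - 1) * Z := by
  let S := MvPolynomial (Fin 2) (ZMod p)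
  have h : ∏ c : ZMod p, ((MvPolynomial.X 0 : S) + c • MvPolynomial.X 1) =
      MvPolynomial.X 0 ^ p - MvPolynomial.X 1 ^ (p - 1) * MvPolynomial.X 0 := by
    apply IsFractionRing.injective S (FractionRing S)
    have := prod_field (p := p) (algebraMap S (FractionRing S) (MvPolynomial.X 0)) (algebraMap S (FractionRing S) (MvPolynomial.X 1))
    rw [map_prod, map_sub, map_mul, map_pow, map_pow, ← this]
    refine Finset.prod_congr rfl fun c _ => ?_
    rw [map_add, Algebra.smul_def, Algebra.smul_def, map_mul, ← IsScalarTower.algebraMap_apply]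
  have := congrArg (MvPolynomial.aeval ![Z, w]) h
  simpa using this

theorem prod_all {A : Type} [CommRing A] [Algebra (ZMod p) A] (hodd : Odd p) (k : ℕ) (x : ℕ → A)
    (hx : ∀ i < k, x i ^ (p ^ i * ((p - 1) / 2) + 1) = 0) (t : A) :
    ∏ a : Fin k → ZMod p, (t + ∑ i, a i • x i) = t ^ p ^ k := by
  induction k generalizing t with
  | zero => simp
  | succ k ih =>
    rw [← (Fin.snocEquiv fun _ : Fin (k + 1) => ZMod p).prod_comp, Fintype.prod_prod_type]
    have : ∀ c : ZMod p, ∏ a : Fin k → ZMod p, (t + ∑ i, (Fin.snocEquiv (fun _ : Fin (k + 1) => ZMod p) (c, a)) i • x i) =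
        t ^ p ^ k + c • x k ^ p ^ k := fun c => by
      have e : (t + c • x k) ^ p ^ k = t ^ p ^ k + c • x k ^ p ^ k := by
        rcases subsingleton_or_nontrivial A with h | h
        · exact Subsingleton.elim _ _
        · haveI := charP_of_injective_algebraMap (algebraMap (ZMod p) A).injective p
          rw [add_pow_char_pow, smul_pow, ZMod.pow_card_pow]
      rw [← e, ← ih (fun i hi => hx i (by omega))]
      refine Finset.prod_congr rfl fun a _ => ?_
      rw [Fin.sum_univ_castSucc]
      simp [Fin.snocEquiv]
      ring
    rw [Finset.prod_congr rfl fun c _ => this c, prod_ring, ← pow_mul, ← pow_succ]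
    have hpp : 3 ≤ p := by
      have := hp.out.two_le
      rcases hodd with ⟨m, rfl⟩; omega
    have h2 : x k ^ (p ^ k * (p - 1)) = 0 := by
      have h1 : p ^ k * ((p - 1) / 2) + 1 ≤ p ^ k * (p - 1) := by
        have : 0 < p ^ k := by positivity
        have h3 : (p - 1) / 2 + 1 ≤ p - 1 := by omega
        nlinarith
      rw [← Nat.add_sub_cancel' h1, pow_add, hx k (by omega), zero_mul]
    rw [← pow_mul, h2, zero_mul, sub_zero]

theorem prod_ne {A : Type} [CommRing A] [Algebra (ZMod p) A] (hodd : Odd p) (k : ℕ) (x : ℕ → A)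
    (hx : ∀ i < k, x i ^ (p ^ i * ((p - 1) / 2) + 1) = 0) (t : A) :
    ∏ a ∈ Finset.univ.erase (0 : Fin k → ZMod p), (t + ∑ i, a i • x i) = t ^ (p ^ k - 1) := by
  have h := prod_all hodd k (fun i => Polynomial.C (x i)) (fun i hi => by rw [← map_pow, hx i hi, map_zero]) Polynomial.X
  rw [← Finset.mul_prod_erase _ _ (Finset.mem_univ 0)] at h
  have h1 : 0 < p ^ k := pow_pos hp.out.pos k
  have h2 : (Polynomial.X : Polynomial A) * ∏ a ∈ Finset.univ.erase (0 : Fin k → ZMod p), (Polynomial.X + ∑ i, a i • Polynomial.C (x i)) =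
      Polynomial.X * Polynomial.X ^ (p ^ k - 1) := by
    rw [← pow_succ', Nat.sub_add_cancel h1, ← h]; simp
  have h3 := congrArg (Polynomial.aeval t) (Polynomial.monic_X.isRegular.left h2)
  simpa [map_prod, Polynomial.eval_finset_sum] using h3

theorem half_exists (hodd : Odd p) (k : ℕ) : ∃ H : Finset (Fin k → ZMod p), (∀ a, a ≠ 0 → a ∈ H ∨ -a ∈ H) ∧
    ∀ {A : Type} [CommRing A] [Algebra (ZMod p) A] (x : ℕ → A),
      (∀ i < k, x i ^ (p ^ i * ((p - 1) / 2) + 1) = 0) →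
      ∃ c : ZMod p, c ≠ 0 ∧ ∏ a ∈ H, (∑ i, a i • x i) = c • ∏ i ∈ Finset.range k, x i ^ (p ^ i * ((p - 1) / 2)) := by
  classical
  induction k with
  | zero =>
    exact ⟨∅, fun a ha => absurd (Subsingleton.elim a 0) ha, fun x _ => ⟨1, one_ne_zero, by simp⟩⟩
  | succ k ih =>
    obtain ⟨H, h1, h2⟩ := ih
    let C : Finset (ZMod p) := (Finset.Icc 1 ((p - 1) / 2)).image fun n : ℕ => (n : ZMod p)
    have hC0 : ∀ c ∈ C, c ≠ 0 := by
      intro c hc h0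
      obtain ⟨n, hn, rfl⟩ := Finset.mem_image.1 hc
      rw [Finset.mem_Icc] at hn
      have := Nat.le_of_dvd (by omega) ((ZMod.natCast_eq_zero_iff n p).1 h0)
      omega
    have hCc : C.card = (p - 1) / 2 := by
      rw [Finset.card_image_of_injOn, Nat.card_Icc]
      · omega
      · intro a ha b hb hab
        simp only [Finset.coe_Icc, Set.mem_Icc] at ha hb
        have := (ZMod.natCast_eq_natCast_iff' a b p).1 hab
        rwa [Nat.mod_eq_of_lt (by omega), Nat.mod_eq_of_lt (by omega)] at this
    have hCs : ∀ c : ZMod p, c ≠ 0 → c ∈ C ∨ -c ∈ C := by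
      intro c hc
      have hv := ZMod.val_lt c
      have hv0 : c.val ≠ 0 := fun h => hc ((ZMod.val_eq_zero c).1 h)
      by_cases hle : c.val ≤ (p - 1) / 2
      · exact Or.inl (Finset.mem_image.2 ⟨c.val, Finset.mem_Icc.2 ⟨by omega, hle⟩, ZMod.natCast_zmod_val c⟩)
      · refine Or.inr (Finset.mem_image.2 ⟨p - c.val, Finset.mem_Icc.2 ⟨by omega, ?_⟩, ?_⟩)
        · rcases hodd with ⟨m, hm⟩; omega
        · rw [Nat.cast_sub hv.le]; simp
    let e := Fin.snocEquiv fun _ : Fin (k + 1) => ZMod p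
    refine ⟨((({0} : Finset (ZMod p)) ×ˢ H) ∪ (C ×ˢ Finset.univ)).map e.toEmbedding, fun a ha => ?_, ?_⟩
    · simp only [Finset.mem_map_equiv, Finset.mem_union, Finset.mem_product, Finset.mem_singleton, Finset.mem_univ, and_true]
      have n1 : (e.symm (-a)).1 = -(e.symm a).1 := rfl
      have n2 : (e.symm (-a)).2 = -(e.symm a).2 := rfl
      rw [n1, n2]
      by_cases h0 : (e.symm a).1 = 0
      · have : (e.symm a).2 ≠ 0 := fun h => ha (by
          apply e.symm.injective
          exact Prod.ext h0 h)
        rcases h1 _ this with h | h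
        · exact Or.inl (Or.inl ⟨h0, h⟩)
        · exact Or.inr (Or.inl ⟨by rw [h0, neg_zero], h⟩)
      · rcases hCs _ h0 with h | h
        · exact Or.inl (Or.inr h)
        · exact Or.inr (Or.inr h)
    · intro A _ _ x hx
      obtain ⟨c, c0, hc⟩ := h2 x fun i hi => hx i (by omega)
      have es : ∀ (c : ZMod p) (a : Fin k → ZMod p), ∑ i, (e (c, a)) i • x i = c • x k + ∑ i, a i • x i := fun c a => by
        rw [Fin.sum_univ_castSucc]
        simp [e, Fin.snocEquiv, add_comm]
      refine ⟨c * ∏ c ∈ C, c ^ p ^ k, mul_ne_zero c0 (Finset.prod_ne_zero_iff.2 fun c hc => pow_ne_zero _ (hC0 c hc)), ?_⟩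
      rw [Finset.prod_map, Finset.prod_union, Finset.prod_product, Finset.prod_product, Finset.prod_singleton,
        Finset.prod_range_succ]
      · simp only [Equiv.coe_toEmbedding, es, zero_smul, zero_add, hc]
        rw [Finset.prod_congr rfl fun c _ => prod_all hodd k x (fun i hi => hx i (by omega)) (c • x k)]
        simp only [smul_pow]
        rw [show ∏ c ∈ C, c ^ p ^ k • x k ^ p ^ k = (∏ c ∈ C, c ^ p ^ k) • x k ^ (p ^ k * ((p - 1) / 2)) by
          simp only [Algebra.smul_def, Finset.prod_mul_distrib, Finset.prod_const, hCc, map_prod, pow_mul]]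
        simp only [Algebra.smul_def, map_mul]
        ring
      · rw [Finset.disjoint_left]
        rintro ⟨c, a⟩ h h'
        simp only [Finset.mem_product, Finset.mem_singleton] at h h'
        exact hC0 _ h'.1 h.1

theorem comm_lift {B M : Type} [Ring B] [Algebra (ZMod p) B] [AddCommGroup M] [Module (ZMod p) M] (ψ : M →ₗ[ZMod p] B)
    (h : ∀ a b, Commute (ψ a) (ψ b)) : ∃ (A : Type) (_ : CommRing A) (_ : Algebra (ZMod p) A) (φ : M →ₗ[ZMod p] A)
    (j : A →ₐ[ZMod p] B), Function.Injective j ∧ ∀ a, j (φ a) = ψ a := by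
  have hc : ∀ a ∈ range ψ, ∀ b ∈ range ψ, a * b = b * a := by
    rintro _ ⟨a, rfl⟩ _ ⟨b, rfl⟩; exact h a b
  letI : CommRing (Algebra.adjoin (ZMod p) (range ψ)) := Algebra.adjoinCommRingOfComm (ZMod p) hc
  refine ⟨Algebra.adjoin (ZMod p) (range ψ), inferInstance, inferInstance,
    ψ.codRestrict (Subalgebra.toSubmodule (Algebra.adjoin (ZMod p) (range ψ))) fun a => Algebra.subset_adjoin ⟨a, rfl⟩,
    (Algebra.adjoin (ZMod p) (range ψ)).val, Subtype.val_injective, fun a => rfl⟩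

/-- ordered product -/
def pr {B : Type} [Monoid B] (x : ℕ → B) : ℕ → B
  | 0 => 1
  | j + 1 => x j * pr x j

theorem pr_comm {A : Type} [CommMonoid A] (x : ℕ → A) (j : ℕ) : pr x j = ∏ i ∈ Finset.range j, x i := by
  induction j with
  | zero => rfl
  | succ j ih => rw [Finset.prod_range_succ, pr, ih, mul_comm]

theorem pr_map {A B : Type} [Monoid A] [Monoid B] (f : A →* B) (x : ℕ → A) (j : ℕ) : f (pr x j) = pr (fun i => f (x i)) j := by
  induction j with
  | zero => simp [pr]
  | succ j ih => simp [pr, ih]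
end Alg
end Volo

namespace Volo
open scoped Topology
open GSp

section Frames
variable {p k r : ℕ} [hp : Fact p.Prime]

theorem frame_compl {G ι : Type} [Fintype G] [Fintype ι] [DecidableEq ι] (v : Fin r → G → ℝ)
    (hv : ∀ i j, v i ⬝ᵥ v j = if i = j then 1 else 0) (hc : r + Fintype.card ι = Fintype.card G) :
    ∃ e : ι → G → ℝ, (∀ a b, e a ⬝ᵥ e b = if a = b then 1 else 0) ∧ (∀ a i, v i ⬝ᵥ e a = 0) ∧
      ∀ x, (∀ i, v i ⬝ᵥ x = 0) → x = ∑ a, (e a ⬝ᵥ x) • e a := by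
  let w : Fin r → EuclideanSpace ℝ G := fun i => WithLp.toLp 2 (v i)
  have ip : ∀ a b : EuclideanSpace ℝ G, inner ℝ a b = a.ofLp ⬝ᵥ b.ofLp := fun a b => by
    rw [EuclideanSpace.inner_eq_star_dotProduct, dotProduct_comm]; rfl
  have hw : Orthonormal ℝ w := by
    rw [orthonormal_iff_ite]
    intro i j
    rw [ip]; exact hv i j
  let S := Submodule.span ℝ (range w)
  have hS : Module.finrank ℝ S = r := by
    rw [finrank_span_eq_card hw.linearIndependent, Fintype.card_fin]
  have hS' : Module.finrank ℝ Sᗮ = Fintype.card ι := by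
    have := Submodule.finrank_add_finrank_orthogonal S
    rw [hS, finrank_euclideanSpace] at this
    omega
  let b := ((stdOrthonormalBasis ℝ Sᗮ).reindex (finCongr hS')).reindex (Fintype.equivFin ι).symm
  have m1 : ∀ x : EuclideanSpace ℝ G, x ∈ Sᗮ ↔ ∀ i, v i ⬝ᵥ x.ofLp = 0 := fun x => by
    rw [Submodule.mem_orthogonal]
    constructor
    · intro h i
      have := h (w i) (Submodule.subset_span ⟨i, rfl⟩)
      rwa [ip] at this
    · intro h u hu
      induction hu using Submodule.span_induction with
      | mem x hx => obtain ⟨i, rfl⟩ := hx; rw [ip]; exact h i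
      | zero => simp
      | add x y _ _ h1 h2 => rw [inner_add_left, h1, h2, add_zero]
      | smul c x _ h1 => rw [inner_smul_left, h1, mul_zero]
  refine ⟨fun a => (b a : EuclideanSpace ℝ G).ofLp, fun i j => ?_, fun a => (m1 _).1 (b a).2, fun x hx => ?_⟩
  · have := orthonormal_iff_ite.1 b.orthonormal i j
    rw [Submodule.coe_inner, ip] at this
    exact this
  · have hx' : WithLp.toLp 2 x ∈ Sᗮ := (m1 _).2 hx
    have := congrArg (fun y : Sᗮ => (y : EuclideanSpace ℝ G).ofLp) (b.sum_repr' ⟨_, hx'⟩)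
    simp only [Submodule.coe_inner, ip] at this
    conv_lhs => rw [← this]
    ext g
    simp

variable (p k r) in
/-- orthonormal frames -/
def Fr : Type := {v : Fin r → (Fin k → ZMod p) → ℝ // ∀ i j, v i ⬝ᵥ v j = if i = j then 1 else 0}

noncomputable instance : MetricSpace (Fr p k r) :=
  inferInstanceAs (MetricSpace {v : Fin r → (Fin k → ZMod p) → ℝ // ∀ i j, v i ⬝ᵥ v j = if i = j then 1 else 0})
def Fr.v (q : Fr p k r) : Fin r → (Fin k → ZMod p) → ℝ := Subtype.val q
theorem Fr.on (q : Fr p k r) : ∀ i j, q.v i ⬝ᵥ q.v j = if i = j then 1 else 0 := q.2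
theorem Fr.ext {q w : Fr p k r} (h : q.v = w.v) : q = w := Subtype.ext h
def Fr.mk (v : Fin r → (Fin k → ZMod p) → ℝ) (h : ∀ i j, v i ⬝ᵥ v j = if i = j then 1 else 0) : Fr p k r := ⟨v, h⟩
theorem Fr.v_mk (v : Fin r → (Fin k → ZMod p) → ℝ) (h) : (Fr.mk v h).v = v := rfl
theorem Fr.cont : Continuous (Fr.v : Fr p k r → _) := continuous_subtype_val
theorem Fr.cont_i (i : Fin r) : Continuous fun q : Fr p k r => q.v i := (continuous_apply i).comp Fr.cont
theorem Fr.cont_ix (i : Fin r) (x : Fin k → ZMod p) : Continuous fun q : Fr p k r => q.v i x :=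
  (continuous_apply x).comp (Fr.cont_i i)
theorem Fr.cont_mk {T : Type} [TopologicalSpace T] {f : T → Fr p k r} (h : Continuous fun t => (f t).v) : Continuous f :=
  continuous_induced_rng.2 h
theorem Fr.dist_def (q w : Fr p k r) : dist q w = dist q.v w.v := rfl

instance : CompactSpace (Fr p k r) := by
  refine isCompact_iff_compactSpace.1
    (?_ : IsCompact {v : Fin r → (Fin k → ZMod p) → ℝ | ∀ i j, v i ⬝ᵥ v j = if i = j then 1 else 0})
  refine Metric.isCompact_of_isClosed_isBounded ?_ ?_
  · have : {v : Fin r → (Fin k → ZMod p) → ℝ | ∀ i j, v i ⬝ᵥ v j = if i = j then 1 else 0} =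
        ⋂ i, ⋂ j, {v | v i ⬝ᵥ v j = if i = j then 1 else 0} := by ext; simp
    rw [this]
    refine isClosed_iInter fun i => isClosed_iInter fun j => isClosed_eq ?_ continuous_const
    unfold dotProduct; fun_prop
  · refine (Metric.isBounded_closedBall (x := (0 : Fin r → (Fin k → ZMod p) → ℝ)) (r := 1)).subset fun v hv => ?_
    rw [mem_closedBall_zero_iff, pi_norm_le_iff_of_nonneg zero_le_one]
    intro i
    rw [pi_norm_le_iff_of_nonneg zero_le_one]
    intro x
    have h1 : v i x * v i x ≤ v i ⬝ᵥ v i :=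
      Finset.single_le_sum (f := fun x => v i x * v i x) (fun x _ => mul_self_nonneg _) (Finset.mem_univ x)
    rw [hv i i, if_pos rfl] at h1
    rw [Real.norm_eq_abs, abs_le]
    constructor <;> nlinarith

theorem dot_shift (g : Fin k → ZMod p) (a b : (Fin k → ZMod p) → ℝ) :
    (fun x => a (x + g)) ⬝ᵥ (fun x => b (x + g)) = a ⬝ᵥ b :=
  Equiv.sum_comp (Equiv.addRight g) fun x => a x * b x

variable (p k) in
/-- the group -/
abbrev Gam : Type := (Fin k → ZMod p) × ZMod p

noncomputable instance : GSp (Gam p k) (Fr p k r) where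
  act γ q := Fr.mk (fun i x => q.v i (x + γ.1)) fun i j => by rw [dot_shift, q.on]
  act_zero q := Fr.ext (by funext i x; simp [Fr.v_mk])
  act_add a b q := Fr.ext (by funext i x; simp [Fr.v_mk, add_assoc])
  act_dist γ q w := by
    simp only [Fr.dist_def, Fr.v_mk]
    apply le_antisymm
    · refine (dist_pi_le_iff dist_nonneg).2 fun i => (dist_pi_le_iff dist_nonneg).2 fun x => ?_
      exact (dist_le_pi_dist (q.v i) (w.v i) (x + γ.1)).trans (dist_le_pi_dist q.v w.v i)
    · refine (dist_pi_le_iff dist_nonneg).2 fun i => (dist_pi_le_iff dist_nonneg).2 fun x => ?_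
      have h1 := (dist_le_pi_dist (fun x => q.v i (x + γ.1)) (fun x => w.v i (x + γ.1)) (x - γ.1)).trans
        (dist_le_pi_dist (fun i x => q.v i (x + γ.1)) (fun i x => w.v i (x + γ.1)) i)
      simpa using h1

theorem Fr.v_act (γ : Gam p k) (q : Fr p k r) : (act γ q).v = fun i x => q.v i (x + γ.1) := rfl
theorem Fr.act_triv (γ : Gam p k) (h : γ.1 = 0) (q : Fr p k r) : act γ q = q :=
  Fr.ext (by rw [Fr.v_act, h]; simp)

/-- forget the last vector -/
def Fr.drop (q : Fr p k (r + 1)) : Fr p k r := Fr.mk (fun i => q.v i.castSucc) fun i j => by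
  rw [q.on]; simp
theorem Fr.drop_cont : Continuous (Fr.drop : Fr p k (r + 1) → Fr p k r) :=
  Fr.cont_mk (continuous_pi fun i => Fr.cont_i i.castSucc)

/-- add a vector -/
def Fr.snoc (q : Fr p k r) (w : (Fin k → ZMod p) → ℝ) (h : w ⬝ᵥ w = 1) (h' : ∀ i, q.v i ⬝ᵥ w = 0) : Fr p k (r + 1) :=
  Fr.mk (Fin.snoc (α := fun _ => (Fin k → ZMod p) → ℝ) q.v w) fun i j => by
    refine Fin.lastCases ?_ (fun i => ?_) i <;> refine Fin.lastCases ?_ (fun j => ?_) j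
    · simp [h]
    · simp [dotProduct_comm w, h', (Fin.castSucc_lt_last _).ne']
    · simp [h', (Fin.castSucc_lt_last _).ne]
    · simp [q.on]
theorem Fr.snoc_drop (q : Fr p k r) (w : (Fin k → ZMod p) → ℝ) (h h') : (q.snoc w h h').drop = q :=
  Fr.ext (by funext i; simp [Fr.drop, Fr.snoc, Fr.v_mk])
theorem Fr.snoc_last (q : Fr p k r) (w : (Fin k → ZMod p) → ℝ) (h h') : (q.snoc w h h').v (Fin.last r) = w := by
  simp [Fr.snoc, Fr.v_mk]
theorem Fr.snoc_castSucc (q : Fr p k r) (w : (Fin k → ZMod p) → ℝ) (h h') (i : Fin r) :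
    (q.snoc w h h').v i.castSucc = q.v i := by
  simp [Fr.snoc, Fr.v_mk]
theorem Fr.ext' {q w : Fr p k (r + 1)} (h : q.drop = w.drop) (h' : q.v (Fin.last r) = w.v (Fin.last r)) : q = w :=
  Fr.ext (by
    funext i
    refine Fin.lastCases h' (fun i => ?_) i
    exact congrFun (congrArg Fr.v h) i)
theorem Fr.cont' {T : Type} [TopologicalSpace T] {f : T → Fr p k (r + 1)} (h : Continuous fun t => (f t).drop)
    (h' : Continuous fun t => (f t).v (Fin.last r)) : Continuous f :=
  Fr.cont_mk (continuous_pi fun i => by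
    refine Fin.lastCases h' (fun i => ?_) i
    exact (Fr.cont_i i).comp h)

/-- flip the last vector -/
def Fr.flip (q : Fr p k (r + 1)) : Fr p k (r + 1) := q.drop.snoc (-q.v (Fin.last r))
  (by rw [neg_dotProduct_neg, q.on, if_pos rfl])
  (fun i => by rw [dotProduct_neg, Fr.drop, Fr.v_mk, q.on, if_neg (Fin.castSucc_lt_last _).ne, neg_zero])
theorem Fr.flip_drop (q : Fr p k (r + 1)) : q.flip.drop = q.drop := Fr.snoc_drop _ _ _ _
theorem Fr.flip_last (q : Fr p k (r + 1)) : q.flip.v (Fin.last r) = -q.v (Fin.last r) := Fr.snoc_last _ _ _ _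
theorem Fr.flip_castSucc (q : Fr p k (r + 1)) (i : Fin r) : q.flip.v i.castSucc = q.v i.castSucc := Fr.snoc_castSucc _ _ _ _ _
theorem Fr.flip_dist (q w : Fr p k (r + 1)) : dist q.flip w.flip = dist q w := by
  rw [Fr.dist_def, Fr.dist_def, dist_pi_def, dist_pi_def]
  congr 2
  funext i
  refine Fin.lastCases ?_ (fun i => ?_) i
  · rw [Fr.flip_last, Fr.flip_last, nndist_neg_neg]
  · rw [Fr.flip_castSucc, Fr.flip_castSucc]

variable {Y : Type} [MetricSpace Y] [GSp (Gam p k) Y] [CompactSpace Y]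

/-- forget the last vector, relative version -/
def drp : Y × Fr p k (r + 1) → Y × Fr p k r := fun q => (q.1, q.2.drop)
theorem drp_cont : Continuous (drp : Y × Fr p k (r + 1) → Y × Fr p k r) :=
  continuous_fst.prodMk (Fr.drop_cont.comp continuous_snd)
theorem drp_eqv : Eqv (Gam p k) (drp : Y × Fr p k (r + 1) → Y × Fr p k r) := fun γ q => rfl

theorem odd_step (hodd : Odd p) (hY : ∀ (γ : Gam p k) (y : Y), act γ y = y ↔ γ.1 = 0) (m : ℕ)
    (hm : r + (1 + (m + m)) = p ^ k) (u : HH (Gam p k) (Y × Fr p k r) (ZMod p))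
    (hu : pull (Gam p k) (ZMod p) (drp : Y × Fr p k (r + 1) → Y × Fr p k r) u = 0) : u = 0 := by
  have fib : ∀ y : Y × Fr p k r, ∃ m, ∃ φ : (drp : Y × Fr p k (r + 1) → Y × Fr p k r) ⁻¹' {y} → Sph m,
      ∃ ψ : Sph m → Y × Fr p k (r + 1), Continuous φ ∧ Continuous ψ ∧ (∀ s, drp (ψ s) = y) ∧
      (∀ w, ψ (φ w) = w.1) ∧ (∀ s, ψ s.al = ((ψ s).1, (ψ s).2.flip)) ∧
      ∀ w w' : (drp : Y × Fr p k (r + 1) → Y × Fr p k r) ⁻¹' {y}, w'.1 = (w.1.1, w.1.2.flip) → φ w' = (φ w).al := by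
    rintro ⟨y, v⟩
    obtain ⟨e, e1, e2, e3⟩ := frame_compl (ι := Option (Fin m ⊕ Fin m)) v.v v.on (by
      simp only [Fintype.card_option, Fintype.card_sum, Fintype.card_fin, Fintype.card_pi, ZMod.card, Finset.prod_const,
        Finset.card_univ]
      omega)
    obtain ⟨co, hco⟩ : ∃ co : ℝ × (Fin m → ℂ) → Option (Fin m ⊕ Fin m) → ℝ, co = fun q o =>
      o.elim q.1 (Sum.elim (fun j => (q.2 j).re) fun j => (q.2 j).im) := ⟨_, rfl⟩
    obtain ⟨oc, hoc⟩ : ∃ oc : (Option (Fin m ⊕ Fin m) → ℝ) → ℝ × (Fin m → ℂ), oc = fun c =>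
      (c none, fun j => ⟨c (some (Sum.inl j)), c (some (Sum.inr j))⟩) := ⟨_, rfl⟩
    have co_oc : ∀ c, co (oc c) = c := fun c => by
      rw [hco, hoc]; funext o; rcases o with _ | (o | o) <;> rfl
    have co_neg : ∀ q, co (-q) = -co q := fun q => by
      rw [hco]; funext o; rcases o with _ | (o | o) <;> simp
    have oc_neg : ∀ q, oc (-q) = -oc q := fun q => by
      rw [hoc]; refine Prod.ext rfl (funext fun j => Complex.ext ?_ ?_) <;> simp
    have co_sq : ∀ q, ∑ o, co q o * co q o = q.1 ^ 2 + nsq q.2 := fun q => by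
      rw [hco, Fintype.sum_option, Fintype.sum_sum_type, ← Finset.sum_add_distrib, nsq]
      have h1 : ∀ j, (q.2 j).re * (q.2 j).re + (q.2 j).im * (q.2 j).im = ‖q.2 j‖ ^ 2 := fun j => by
        rw [← Complex.normSq_eq_norm_sq, Complex.normSq_apply]
      rw [sq, ← Finset.sum_congr rfl fun j _ => h1 j]
      rfl
    have co_c : Continuous co := by
      rw [hco]
      refine continuous_pi fun o => ?_
      rcases o with _ | (o | o)
      · exact continuous_fst
      · exact Complex.continuous_re.comp ((continuous_apply o).comp continuous_snd)
      · exact Complex.continuous_im.comp ((continuous_apply o).comp continuous_snd)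
    have oc_c : Continuous oc := by
      rw [hoc]
      refine (continuous_apply _).prodMk (continuous_pi fun j => ?_)
      have : (fun c : Option (Fin m ⊕ Fin m) → ℝ => (⟨c (some (Sum.inl j)), c (some (Sum.inr j))⟩ : ℂ)) =
        fun c => (c (some (Sum.inl j)) : ℂ) + (c (some (Sum.inr j)) : ℂ) * Complex.I := by
        funext c; apply Complex.ext <;> simp
      rw [this]; fun_prop
    have edot : ∀ c : Option (Fin m ⊕ Fin m) → ℝ, ∀ a, e a ⬝ᵥ (∑ b, c b • e b) = c a := fun c a => by
      rw [dotProduct_sum]; simp [e1]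
    have eself : ∀ c : Option (Fin m ⊕ Fin m) → ℝ, (∑ b, c b • e b) ⬝ᵥ (∑ b, c b • e b) = ∑ b, c b * c b := fun c => by
      rw [sum_dotProduct]; exact Finset.sum_congr rfl fun b _ => by rw [smul_dotProduct, edot]; rfl
    have eorth : ∀ (c : Option (Fin m ⊕ Fin m) → ℝ) i, v.v i ⬝ᵥ (∑ b, c b • e b) = 0 := fun c i => by
      rw [dotProduct_sum]; simp [e2]
    have hw : ∀ w : (drp : Y × Fr p k (r + 1) → Y × Fr p k r) ⁻¹' {(y, v)}, ∀ i, v.v i ⬝ᵥ w.1.2.v (Fin.last r) = 0 := fun w i => by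
      have h2 : w.1.2.drop = v := congrArg Prod.snd w.2
      have h3 : w.1.2.drop.v i = v.v i := by rw [h2]
      rw [← h3]
      exact (w.1.2.on _ _).trans (if_neg (Fin.castSucc_lt_last _).ne)
    have hn : ∀ s : Sph m, (∑ b, co s.v b • e b) ⬝ᵥ (∑ b, co s.v b • e b) = 1 := fun s => by
      rw [eself, co_sq]; exact s.eq
    refine ⟨m, fun w => Sph.mk (oc fun a => e a ⬝ᵥ w.1.2.v (Fin.last r)) ?_,
      fun s => (y, v.snoc (∑ b, co s.v b • e b) (hn s) (eorth _)), ?_, ?_, fun s => ?_, fun w => ?_, fun s => ?_, fun w w' h => ?_⟩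
    · rw [← co_sq, co_oc, ← eself, ← e3 _ (hw w), w.1.2.on, if_pos rfl]
    · refine Sph.cont_mk (oc_c.comp (continuous_pi fun a => ?_))
      have : Continuous fun w : (drp : Y × Fr p k (r + 1) → Y × Fr p k r) ⁻¹' {(y, v)} => w.1.2.v (Fin.last r) :=
        (Fr.cont_i _).comp (continuous_snd.comp continuous_subtype_val)
      unfold dotProduct
      exact continuous_finsetSum _ fun x _ => continuous_const.mul ((continuous_apply x).comp this)
    · refine continuous_const.prodMk (Fr.cont' ?_ ?_)
      · simp only [Fr.snoc_drop]; exact continuous_const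
      · simp only [Fr.snoc_last]
        exact continuous_finsetSum _ fun b _ => ((continuous_apply b).comp (co_c.comp Sph.cont)).smul continuous_const
    · exact Prod.ext rfl (Fr.snoc_drop _ _ (hn s) (eorth _))
    · have h2 := w.2
      refine Prod.ext (congrArg Prod.fst h2).symm (Fr.ext' ?_ ?_)
      · exact (Fr.snoc_drop _ _ (hn _) (eorth _)).trans (congrArg Prod.snd h2).symm
      · refine (Fr.snoc_last _ _ (hn _) (eorth _)).trans ?_
        rw [Sph.v_mk, co_oc, ← e3 _ (hw w)]
    · refine Prod.ext rfl (Fr.ext' ?_ ?_)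
      · simp only [Fr.flip_drop, Fr.snoc_drop]
      · simp only [Fr.flip_last, Fr.snoc_last, Sph.al, Sph.v_mk, co_neg]
        simp
    · refine Sph.ext ?_
      simp only [Sph.al, Sph.v_mk, h, Fr.flip_last]
      rw [← oc_neg]
      congr 1
      funext a
      simp
  refine F3 hodd drp_cont (fun y => ?_) drp_eqv (fun γ y h w => ?_) (α := fun q => (q.1, q.2.flip)) (fun q => ?_)
    (fun q w => ?_) (fun γ q => ?_) (fun q h => ?_) (fun q => ?_) fib u hu
  · obtain ⟨m, φ, ψ, -, -, h, -⟩ := fib y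
    exact ⟨ψ Sph.np, h _⟩
  · have h0 := (hY γ _).1 (congrArg Prod.fst h)
    exact Prod.ext ((hY γ _).2 h0) (Fr.act_triv γ h0 _)
  · refine Prod.ext rfl (Fr.ext' ?_ ?_)
    · simp only [Fr.flip_drop]
    · simp only [Fr.flip_last, neg_neg]
  · simp only [Prod.dist_eq, Fr.flip_dist]
  · refine Prod.ext rfl (Fr.ext' ?_ ?_)
    · rw [Fr.flip_drop]
      exact congrArg (act γ) (Fr.flip_drop q.2).symm
    · rw [Fr.flip_last]
      funext x
      exact (congrFun (Fr.flip_last q.2) (x + γ.1)).symm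
  · have h1 : q.2.flip = q.2 := congrArg Prod.snd h
    have h2 := Fr.flip_last q.2
    rw [h1] at h2
    have h3 : q.2.v (Fin.last r) = 0 := by
      funext x
      have := congrFun h2 x
      simp only [Pi.neg_apply] at this
      simp only [Pi.zero_apply]
      linarith
    have := q.2.on (Fin.last r) (Fin.last r)
    rw [h3] at this
    simp at this
  · exact Prod.ext rfl (Fr.flip_drop _)
end Frames
end Volo

namespace Volo
open scoped Topology
open GSp

section Four
variable {p k : ℕ} [hp : Fact p.Prime]

theorem ch_neg (c : ZMod p) : ch p (-c) = (starRingEnd ℂ) (ch p c) := AddChar.map_neg_eq_conj _ _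

theorem ch_sum (x : Fin k → ZMod p) : ∑ a : Fin k → ZMod p, ch p (a ⬝ᵥ x) = if x = 0 then ((p : ℂ) ^ k) else 0 := by
  have h := AddChar.sum_eq_ite (ZMod.stdAddChar.compAddMonoidHom
    (AddMonoidHom.mk' (fun a : Fin k → ZMod p => a ⬝ᵥ x) fun a b => add_dotProduct a b x) : AddChar (Fin k → ZMod p) ℂ)
  have hz : (ZMod.stdAddChar.compAddMonoidHom (AddMonoidHom.mk' (fun a : Fin k → ZMod p => a ⬝ᵥ x)
      fun a b => add_dotProduct a b x) : AddChar (Fin k → ZMod p) ℂ) = 0 ↔ x = 0 := by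
    constructor
    · intro h
      funext i
      have h1 := DFunLike.congr_fun h (Pi.single i 1)
      have h2 : ch p (x i) = ch p 0 := by
        rw [ch_zero]
        have h3 : ZMod.stdAddChar (x i) = (1 : ℂ) := by simpa using h1
        exact h3
      exact ch_inj h2
    · rintro rfl
      ext a
      simp
  rw [if_congr hz rfl rfl] at h
  refine Eq.trans h ?_
  simp

/-- Fourier transform -/
noncomputable def Fo (z : (Fin k → ZMod p) → ℂ) (x : Fin k → ZMod p) : ℂ := ∑ a, ch p (a ⬝ᵥ x) * z a

theorem Fo_Fo (z : (Fin k → ZMod p) → ℂ) (x : Fin k → ZMod p) : Fo (fun a => Fo z (-a)) x = (p : ℂ) ^ k * z x := by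
  simp only [Fo, Finset.mul_sum]
  rw [Finset.sum_comm]
  have h : ∀ b a : Fin k → ZMod p, ch p (a ⬝ᵥ x) * (ch p (b ⬝ᵥ -a) * z b) = ch p (a ⬝ᵥ (x - b)) * z b := fun b a => by
    rw [← mul_assoc, ← ch_add, dotProduct_neg, dotProduct_comm b a, ← sub_eq_add_neg, ← dotProduct_sub]
  simp only [h, ← Finset.sum_mul, ch_sum, sub_eq_zero]
  simp

theorem Fo_add (z w : (Fin k → ZMod p) → ℂ) : Fo (z + w) = Fo z + Fo w := by
  funext x; simp [Fo, mul_add, Finset.sum_add_distrib]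
theorem Fo_mul (c : ℂ) (z : (Fin k → ZMod p) → ℂ) (x) : Fo (fun a => c * z a) x = c * Fo z x := by
  simp only [Fo, Finset.mul_sum]; exact Finset.sum_congr rfl fun a _ => by ring
theorem Fo_cont : Continuous (Fo : ((Fin k → ZMod p) → ℂ) → (Fin k → ZMod p) → ℂ) :=
  continuous_pi fun x => continuous_finsetSum _ fun a _ => continuous_const.mul (continuous_apply a)
theorem pk_ne : (p : ℂ) ^ k ≠ 0 := pow_ne_zero _ (Nat.cast_ne_zero.2 hp.out.ne_zero)
theorem Fo_inj {z : (Fin k → ZMod p) → ℂ} (h : ∀ x, Fo z x = 0) : z = 0 := by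
  funext x
  have h1 := Fo_Fo z x
  simp only [h] at h1
  have h2 : Fo (fun _ : Fin k → ZMod p => (0 : ℂ)) x = 0 := by simp [Fo]
  rw [h2] at h1
  exact (mul_eq_zero.1 h1.symm).resolve_left pk_ne
theorem Fo_shift (z : (Fin k → ZMod p) → ℂ) (g x : Fin k → ZMod p) :
    Fo (fun y => z (y - g)) x = ch p (x ⬝ᵥ g) * Fo z x := by
  simp only [Fo, Finset.mul_sum]
  rw [← Equiv.sum_comp (Equiv.addRight g)]
  refine Finset.sum_congr rfl fun a _ => ?_
  simp only [Equiv.coe_addRight, add_sub_cancel_right, add_dotProduct, ch_add]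
  rw [dotProduct_comm g x]
  ring

/-- characters of the group -/
def xc (a : Fin k → ZMod p) (c : ZMod p) : Gam p k →+ ZMod p :=
  AddMonoidHom.mk' (fun γ => a ⬝ᵥ γ.1 + c * γ.2) fun x y => by
    simp only [Prod.fst_add, Prod.snd_add, dotProduct_add, mul_add]; abel
theorem xc_apply (a : Fin k → ZMod p) (c : ZMod p) (γ : Gam p k) : xc a c γ = a ⬝ᵥ γ.1 + c * γ.2 := rfl
theorem xc_add (a b : Fin k → ZMod p) (c d : ZMod p) : xc (a + b) (c + d) = xc a c + xc b d := by
  ext γ <;> simp [xc_apply, add_dotProduct, add_mul]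
  abel

theorem Fo_tw (γ : Gam p k) (z : (Fin k → ZMod p) → ℂ) (x : Fin k → ZMod p) :
    Fo (tw (fun a => xc a 1) γ z) x = ch p γ.2 * Fo z (x + γ.1) := by
  simp only [Fo, tw, Finset.mul_sum, xc_apply, one_mul, ch_add, dotProduct_add]
  exact Finset.sum_congr rfl fun a _ => by ring
end Four

section Ring
variable {Γ X : Type} [AddCommGroup Γ] [Finite Γ] [MetricSpace X] [GSp Γ X] {p : ℕ} [hp : Fact p.Prime]

theorem TT_lin {M : Type} [AddCommGroup M] [Module (ZMod p) M] (θ : M →+ (Γ →+ ZMod p))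
    (hs : ∀ m, ∃ s : X → ZMod p, IsSec (θ m) s) :
    ∃ (A : Type) (_ : CommRing A) (_ : Algebra (ZMod p) A) (φ : M →ₗ[ZMod p] A)
      (j : A →ₐ[ZMod p] Module.End (ZMod p) (HH Γ X (ZMod p))), Function.Injective j ∧ ∀ m, j (φ m) = TT X (θ m) := by
  let f : M →+ Module.End (ZMod p) (HH Γ X (ZMod p)) := AddMonoidHom.mk' (fun m => TT X (θ m)) fun a b => by
    rw [map_add, TT_add (hs a) (hs b)]
  exact comm_lift (f.toZModLinearMap p) fun a b => TT_comm (hs a) (hs b)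

/-- enough functions -/
def Nil (Γ X : Type) [AddCommGroup Γ] [MetricSpace X] [GSp Γ X] (χ : Γ →+ ZMod p) (n : ℕ) : Prop :=
  ∃ L : List (X → ℂ), L.length = n ∧ (∀ h ∈ L, Continuous h ∧ ∀ (γ : Γ) x, h (act γ x) = ch p (χ γ) * h x) ∧
    ∀ x, ∃ h ∈ L, h x ≠ 0

variable {X1 : Type} [MetricSpace X1] [GSp Γ X1]
theorem Nil.comp {χ : Γ →+ ZMod p} {n : ℕ} (h : Nil Γ X χ n) {φ : X1 → X} (hc : Continuous φ) (he : Eqv Γ φ) :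
    Nil Γ X1 χ n := by
  obtain ⟨L, h1, h2, h3⟩ := h
  refine ⟨L.map fun h => h ∘ φ, by simpa using h1, fun h hh => ?_, fun x => ?_⟩
  · obtain ⟨g, hg, rfl⟩ := List.mem_map.1 hh
    refine ⟨(h2 g hg).1.comp hc, fun γ x => ?_⟩
    simp only [Function.comp_apply]
    rw [he, (h2 g hg).2]
  · obtain ⟨h, hh, hx⟩ := h3 (φ x)
    exact ⟨_, List.mem_map.2 ⟨h, hh, rfl⟩, hx⟩

theorem Nil.pow (hodd : Odd p) {χ : Γ →+ ZMod p} {n : ℕ} (h : Nil Γ X χ n) (hs : ∃ s : X → ZMod p, IsSec χ s) :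
    TT X χ ^ n = 0 := by
  obtain ⟨L, h1, h2, h3⟩ := h
  have := TT_prod_zero hodd (L.map fun h => (χ, h)) (X := X) (fun q hq => ?_) (fun q hq => ?_) (fun q hq => ?_) (fun x => ?_)
  · rw [List.map_map] at this
    rw [← this, ← h1, ← List.prod_replicate, ← List.map_const']
    rfl
  · obtain ⟨g, hg, rfl⟩ := List.mem_map.1 hq; exact hs
  · obtain ⟨g, hg, rfl⟩ := List.mem_map.1 hq; exact (h2 g hg).1
  · obtain ⟨g, hg, rfl⟩ := List.mem_map.1 hq; exact (h2 g hg).2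
  · obtain ⟨h, hh, hx⟩ := h3 x
    exact ⟨_, List.mem_map.2 ⟨h, hh, rfl⟩, hx⟩

theorem Nil.sphere (χ : Γ →+ ZMod p) (n : ℕ) : Nil Γ (SI (fun _ : Fin n => χ) Finset.univ) χ n := by
  refine ⟨List.ofFn fun i z => z.v i, by simp, fun h hh => ?_, fun z => ?_⟩
  · obtain ⟨i, rfl⟩ := List.mem_ofFn.1 hh
    exact ⟨SI.cont_i i, fun γ z => rfl⟩
  · obtain ⟨i, -, hi⟩ := z.exists_ne
    exact ⟨_, List.mem_ofFn.2 ⟨i, rfl⟩, hi⟩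

theorem pull_prod {ι : Type} (θ : ι → Γ →+ ZMod p) (hs : ∀ i, ∃ s : X → ZMod p, IsSec (θ i) s) {φ : X1 → X}
    (hc : Continuous φ) (he : Eqv Γ φ) (L : List ι) (u : HH Γ X (ZMod p)) :
    pull Γ (ZMod p) φ ((L.map fun i => TT X (θ i)).prod u) = (L.map fun i => TT X1 (θ i)).prod (pull Γ (ZMod p) φ u) := by
  induction L with
  | nil => rfl
  | cons i L ih =>
    simp only [List.map_cons, List.prod_cons, Module.End.mul_apply]
    rw [TT_pull (hs i) hc he, ih]

theorem pull_pow (χ : Γ →+ ZMod p) (hs : ∃ s : X → ZMod p, IsSec χ s) {φ : X1 → X}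
    (hc : Continuous φ) (he : Eqv Γ φ) (n : ℕ) (u : HH Γ X (ZMod p)) :
    pull Γ (ZMod p) φ ((TT X χ ^ n) u) = (TT X1 χ ^ n) (pull Γ (ZMod p) φ u) := by
  have := pull_prod (fun _ : Unit => χ) (fun _ => hs) hc he (List.replicate n ()) u
  simpa using this
end Ring
end Volo

namespace Volo
open scoped Topology
open GSp

section Calc
variable {p k : ℕ} [hp : Fact p.Prime] {X : Type} [MetricSpace X] [GSp (Gam p k) X]

variable (p k) in
/-- basic characters -/
def xi (i : ℕ) : Gam p k →+ ZMod p := if h : i < k then xc (Pi.single ⟨i, h⟩ 1) 0 else 0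

theorem xi_triv (i : ℕ) (γ : Gam p k) (h : γ.1 = 0) : xi p k i γ = 0 := by
  unfold xi
  split_ifs
  · simp [xc_apply, h]
  · rfl

theorem xi_eq {i : ℕ} (h : i < k) : xi p k i = xc (Pi.single ⟨i, h⟩ 1) 0 := dif_pos h

theorem sec_of (h0 : ∀ (γ : Gam p k) (x : X), act γ x = x → γ.1 = 0) (a : Fin k → ZMod p) :
    ∃ s : X → ZMod p, IsSec (xc a 0) s :=
  exists_sec _ fun γ x h => by simp [xc_apply, h0 γ x h]

theorem lin_sum {A : Type} [CommRing A] [Algebra (ZMod p) A] (φ : (Fin k → ZMod p) →ₗ[ZMod p] A) (x : ℕ → A)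
    (hx : ∀ i : Fin k, x i = φ (Pi.single i 1)) (a : Fin k → ZMod p) : φ a = ∑ i : Fin k, a i • x i := by
  rw [LinearMap.pi_apply_eq_sum_univ φ a]
  refine Finset.sum_congr rfl fun i _ => ?_
  rw [hx]
  congr 2
  funext j
  simp [Pi.single_apply, eq_comm]


theorem theta_zero (hodd : Odd p) (h0 : ∀ (γ : Gam p k) (x : X), act γ x = x → γ = 0)
    (hN : ∀ i < k, Nil (Gam p k) X (xi p k i) (p ^ i * ((p - 1) / 2) + 1)) {m : ℕ} (hm : m ≤ p ^ k - 1)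
    (hM : Nil (Gam p k) X (xc 0 1) m) :
    ((Finset.univ.erase (0 : Fin k → ZMod p)).toList.map fun a => TT X (xc a 1)).prod = 0 := by
  have hs : ∀ a c, ∃ s : X → ZMod p, IsSec (xc (k := k) a c) s := fun a c =>
    exists_sec _ fun γ x h => by rw [h0 γ x h, map_zero]
  obtain ⟨A, _, _, φ, j, ji, hj⟩ := TT_lin (X := X) (p := p) (M := (Fin k → ZMod p) × ZMod p)
    (AddMonoidHom.mk' (fun m => xc m.1 m.2) fun a b => xc_add _ _ _ _) (fun m => hs _ _)
  simp only [AddMonoidHom.mk'_apply] at hj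
  have ji0 : ∀ a, j a = 0 → a = 0 := fun a h => ji (by rw [h, map_zero])
  obtain ⟨x, hx⟩ : ∃ x : ℕ → A, ∀ i : Fin k, x i = φ (Pi.single i 1, 0) :=
    ⟨fun i => if h : i < k then φ (Pi.single ⟨i, h⟩ 1, 0) else 0, fun i => by simp⟩
  have h1 := prod_ne hodd k x (fun i hi => by
    apply ji0
    have := hx ⟨i, hi⟩
    simp only at this
    rw [map_pow, this, hj, ← xi_eq hi]
    exact (hN i hi).pow hodd (by rw [xi_eq hi]; exact hs _ _)) (φ (0, 1))
  have h2 : φ (0, 1) ^ (p ^ k - 1) = 0 := by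
    have : φ (0, 1) ^ m = 0 := by
      apply ji0
      rw [map_pow, hj]
      exact hM.pow hodd (hs _ _)
    exact pow_eq_zero_of_le hm this
  have h3 : ∀ a, φ (0, 1) + ∑ i : Fin k, a i • x i = φ (a, 1) := fun a => by
    rw [← lin_sum (φ.comp (LinearMap.inl _ _ _)) x hx]
    simp [← map_add]
  simp only [h3] at h1
  rw [h2] at h1
  have h4 := congrArg j h1
  rw [map_zero, ← Finset.prod_map_toList, map_list_prod, List.map_map] at h4
  rw [← h4]
  congr 1
  exact List.map_congr_left fun a _ => (hj (a, 1)).symm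

theorem half_zero (hodd : Odd p) (h0 : ∀ (γ : Gam p k) (x : X), act γ x = x → γ.1 = 0)
    (hN : ∀ i < k, Nil (Gam p k) X (xi p k i) (p ^ i * ((p - 1) / 2) + 1)) :
    ∃ H : Finset (Fin k → ZMod p), (∀ a, a ≠ 0 → a ∈ H ∨ -a ∈ H) ∧
      ((H.toList.map fun a => TT X (xc a 0)).prod = 0 → pr (fun i => TT X (xi p k i) ^ (p ^ i * ((p - 1) / 2))) k = 0) := by
  have hs := sec_of h0
  obtain ⟨A, _, _, φ, j, ji, hj⟩ := TT_lin (X := X) (p := p) (M := (Fin k → ZMod p))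
    (AddMonoidHom.mk' (fun m => xc m 0) fun a b => by rw [← xc_add, add_zero]) (fun m => hs _)
  simp only [AddMonoidHom.mk'_apply] at hj
  have ji0 : ∀ a, j a = 0 → a = 0 := fun a h => ji (by rw [h, map_zero])
  obtain ⟨x, hx⟩ : ∃ x : ℕ → A, (∀ i : Fin k, x i = φ (Pi.single i 1)) ∧ ∀ i, k ≤ i → x i = 0 :=
    ⟨fun i => if h : i < k then φ (Pi.single ⟨i, h⟩ 1) else 0, fun i => by simp, fun i hi => dif_neg (by omega)⟩
  have hxi : ∀ i, j (x i) = TT X (xi p k i) := fun i => by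
    by_cases hi : i < k
    · rw [xi_eq hi, ← hj, ← hx.1 ⟨i, hi⟩]
    · rw [hx.2 i (by omega), xi, dif_neg hi, map_zero, TT_zero]
  obtain ⟨H, hH, hH'⟩ := half_exists hodd k (p := p)
  refine ⟨H, hH, fun h => ?_⟩
  obtain ⟨c, hc, h1⟩ := hH' x (fun i hi => by
    apply ji0
    rw [map_pow, hxi]
    exact (hN i hi).pow hodd (by rw [xi_eq hi]; exact hs _))
  have h2 : ∏ a ∈ H, ∑ i : Fin k, a i • x i = 0 := by
    apply ji0
    rw [← Finset.prod_map_toList, map_list_prod, List.map_map, ← h]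
    congr 1
    exact List.map_congr_left fun a _ => by
      simp only [Function.comp_apply]
      rw [← lin_sum φ x hx.1, hj]
  rw [h2] at h1
  have h3 := (smul_eq_zero.1 h1.symm).resolve_left hc
  rw [← pr_comm] at h3
  have h4 := congrArg j h3
  rw [map_zero] at h4
  have h5 := pr_map (j : A →* Module.End (ZMod p) (HH (Gam p k) X (ZMod p))) (fun i => x i ^ (p ^ i * ((p - 1) / 2))) k
  rw [← h4]
  refine Eq.trans ?_ h5.symm
  congr 1
  funext i
  refine Eq.trans ?_ (map_pow j _ _).symm
  rw [hxi]
end Calc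
end Volo

namespace Volo
open scoped Topology
open GSp

section Even
variable {p k r : ℕ} [hp : Fact p.Prime]

/-- add the real and imaginary parts of an isotropic vector -/
theorem two_exists (v : Fr p k r) (z : (Fin k → ZMod p) → ℂ) (h1 : nsq z = 1) (h2 : ∑ x, z x ^ 2 = 0)
    (h3 : ∀ i, ∑ x, (v.v i x : ℂ) * z x = 0) :
    ∃ q : Fr p k (r + 1 + 1), q.drop.drop = v ∧ (q.drop.v (Fin.last r) = fun x => √2 * (z x).re) ∧
      q.v (Fin.last (r + 1)) = fun x => √2 * (z x).im := by
  have e1 : ∑ x, ((z x).re * (z x).re + (z x).im * (z x).im) = 1 := by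
    rw [← h1, nsq]
    exact Finset.sum_congr rfl fun x _ => by rw [← Complex.normSq_eq_norm_sq, Complex.normSq_apply]
  have e2 : ∑ x, ((z x).re * (z x).re - (z x).im * (z x).im) = 0 := by
    have := congrArg Complex.re h2
    simpa [sq] using this
  have e3 : ∑ x, ((z x).re * (z x).im) = 0 := by
    have := congrArg Complex.im h2
    simp only [sq, Complex.im_sum, Complex.mul_im, Complex.zero_im, Finset.sum_add_distrib] at this
    have h : ∑ x, (z x).im * (z x).re = ∑ x, (z x).re * (z x).im := Finset.sum_congr rfl fun x _ => mul_comm _ _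
    rw [h] at this
    linarith
  rw [Finset.sum_add_distrib] at e1
  rw [Finset.sum_sub_distrib] at e2
  have s2 : √2 * √2 = 2 := Real.mul_self_sqrt (by norm_num)
  have d1 : (fun x => √2 * (z x).re) ⬝ᵥ (fun x => √2 * (z x).re) = 1 := by
    have : (fun x => √2 * (z x).re) ⬝ᵥ (fun x => √2 * (z x).re) = 2 * ∑ x, (z x).re * (z x).re := by
      rw [dotProduct, Finset.mul_sum]; exact Finset.sum_congr rfl fun x _ => by linear_combination ((z x).re * (z x).re) * s2
    rw [this]; linarith
  have d2 : (fun x => √2 * (z x).im) ⬝ᵥ (fun x => √2 * (z x).im) = 1 := by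
    have : (fun x => √2 * (z x).im) ⬝ᵥ (fun x => √2 * (z x).im) = 2 * ∑ x, (z x).im * (z x).im := by
      rw [dotProduct, Finset.mul_sum]; exact Finset.sum_congr rfl fun x _ => by linear_combination ((z x).im * (z x).im) * s2
    rw [this]; linarith
  have d3 : (fun x => √2 * (z x).re) ⬝ᵥ (fun x => √2 * (z x).im) = 0 := by
    have : (fun x => √2 * (z x).re) ⬝ᵥ (fun x => √2 * (z x).im) = 2 * ∑ x, (z x).re * (z x).im := by
      rw [dotProduct, Finset.mul_sum]; exact Finset.sum_congr rfl fun x _ => by linear_combination ((z x).re * (z x).im) * s2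
    rw [this, e3, mul_zero]
  have d4 : ∀ i, v.v i ⬝ᵥ (fun x => √2 * (z x).re) = 0 := fun i => by
    have h := congrArg Complex.re (h3 i)
    simp only [Complex.re_sum, Complex.re_ofReal_mul, Complex.zero_re] at h
    have : v.v i ⬝ᵥ (fun x => √2 * (z x).re) = √2 * ∑ x, v.v i x * (z x).re := by
      rw [dotProduct, Finset.mul_sum]; exact Finset.sum_congr rfl fun x _ => by ring
    rw [this, h, mul_zero]
  have d5 : ∀ i, v.v i ⬝ᵥ (fun x => √2 * (z x).im) = 0 := fun i => by
    have h := congrArg Complex.im (h3 i)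
    simp only [Complex.im_sum, Complex.im_ofReal_mul, Complex.zero_im] at h
    have : v.v i ⬝ᵥ (fun x => √2 * (z x).im) = √2 * ∑ x, v.v i x * (z x).im := by
      rw [dotProduct, Finset.mul_sum]; exact Finset.sum_congr rfl fun x _ => by ring
    rw [this, h, mul_zero]
  refine ⟨(v.snoc _ d1 d4).snoc _ d2 fun i => ?_, ?_, ?_, ?_⟩
  · refine Fin.lastCases ?_ (fun i => ?_) i
    · rw [Fr.snoc_last]; exact d3
    · rw [Fr.snoc_castSucc]; exact d5 i
  · rw [Fr.snoc_drop, Fr.snoc_drop]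
  · rw [Fr.snoc_drop, Fr.snoc_last]
  · rw [Fr.snoc_last]

variable {Y : Type} [MetricSpace Y] [GSp (Gam p k) Y] [CompactSpace Y]

theorem fixF (hY : ∀ (γ : Gam p k) (y : Y), act γ y = y ↔ γ.1 = 0) (γ : Gam p k) (q : Y × Fr p k r) :
    act γ q = q ↔ γ.1 = 0 :=
  ⟨fun h => (hY γ q.1).1 (congrArg Prod.fst h), fun h => Prod.ext ((hY γ q.1).2 h) (Fr.act_triv γ h _)⟩

theorem adm_of {B : Type} [MetricSpace B] [GSp (Gam p k) B] (hB : ∀ (γ : Gam p k) (y : B), act γ y = y ↔ γ.1 = 0)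
    {ι : Type} (a : ι → Fin k → ZMod p) : Adm (Gam p k) B (fun i => xc (a i) 1) where
  unif γ x y h := (hB γ y).2 ((hB γ x).1 h)
  agree γ y h i j := by simp [xc_apply, (hB γ y).1 h]
  surj i c := ⟨(0, c), fun y => (hB _ y).2 rfl, by simp [xc_apply]⟩

theorem freeP {B : Type} [MetricSpace B] [GSp (Gam p k) B] [CompactSpace B]
    (hB : ∀ (γ : Gam p k) (y : B), act γ y = y ↔ γ.1 = 0)
    {ι : Type} [Fintype ι] [DecidableEq ι] [Nonempty ι] (a : ι → Fin k → ZMod p) (I : Finset ι) (γ : Gam p k)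
    (x : B × SI (fun i => xc (a i) 1) I) (h : act γ x = x) : γ = 0 := by
  obtain ⟨h1, h2⟩ := ((adm_of hB a).fix γ x).1 h
  have h3 := (hB _ _).1 h1
  obtain ⟨i⟩ := ‹Nonempty ι›
  have h4 := h2 i
  rw [xc_apply, h3, dotProduct_zero, one_mul, zero_add] at h4
  exact Prod.ext h3 h4

variable (Y r) in
/-- frames together with a projective direction -/
abbrev PP : Type := (Y × Fr p k r) × SI (fun a : Fin k → ZMod p => xc a 1) Finset.univ

/-- equations -/
noncomputable def eqh (i : Fin r) (q : PP (p := p) (k := k) r Y) : ℂ := ∑ x, (q.1.2.v i x : ℂ) * Fo q.2.v x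
noncomputable def eqs (q : PP (p := p) (k := k) r Y) : ℂ := ∑ x, Fo q.2.v x ^ 2

theorem Fo_act (γ : Gam p k) (q : PP (p := p) (k := k) r Y) (x : Fin k → ZMod p) :
    Fo (act γ q).2.v x = ch p γ.2 * Fo q.2.v (x + γ.1) := Fo_tw γ q.2.v x

theorem Fo_cont' (x : Fin k → ZMod p) : Continuous fun q : PP (p := p) (k := k) r Y => Fo q.2.v x :=
  (continuous_apply x).comp (Fo_cont.comp (SI.cont.comp continuous_snd))

theorem eqh_cont (i : Fin r) : Continuous (eqh (p := p) (k := k) (Y := Y) i) :=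
  continuous_finsetSum _ fun x _ => (Complex.continuous_ofReal.comp
    ((Fr.cont_ix i x).comp (continuous_snd.comp continuous_fst))).mul (Fo_cont' x)
theorem eqs_cont : Continuous (eqs (p := p) (k := k) (r := r) (Y := Y)) :=
  continuous_finsetSum _ fun x _ => (Fo_cont' x).pow 2
theorem eqh_act (i : Fin r) (γ : Gam p k) (q : PP (p := p) (k := k) r Y) :
    eqh i (act γ q) = ch p (xc 0 1 γ) * eqh i q := by
  rw [eqh, eqh, Finset.mul_sum]
  refine Eq.trans (Finset.sum_congr rfl fun x _ => ?_)
    (Equiv.sum_comp (Equiv.addRight γ.1) fun x => ch p (xc 0 1 γ) * ((q.1.2.v i x : ℂ) * Fo q.2.v x))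
  rw [Fo_act, xc_apply, zero_dotProduct, zero_add, one_mul, Equiv.coe_addRight]
  change ((q.1.2.v i (x + γ.1) : ℝ) : ℂ) * _ = _
  ring
theorem eqs_act (γ : Gam p k) (q : PP (p := p) (k := k) r Y) :
    eqs (act γ q) = ch p ((xc 0 1 + xc 0 1 : Gam p k →+ ZMod p) γ) * eqs q := by
  rw [eqs, eqs, Finset.mul_sum]
  refine Eq.trans (Finset.sum_congr rfl fun x _ => ?_)
    (Equiv.sum_comp (Equiv.addRight γ.1) fun x => ch p ((xc 0 1 + xc 0 1 : Gam p k →+ ZMod p) γ) * (Fo q.2.v x) ^ 2)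
  rw [Fo_act, AddMonoidHom.add_apply, ch_add, xc_apply, zero_dotProduct, zero_add, one_mul, Equiv.coe_addRight]
  ring

variable (p k r Y) in
/-- the zero set of the equations -/
def QQ : Set (PP (p := p) (k := k) r Y) := {q | (∀ h ∈ List.ofFn (eqh (p := p) (k := k) (r := r) (Y := Y)), h q = 0) ∧ eqs q = 0}
theorem mem_QQ (q : PP (p := p) (k := k) r Y) : q ∈ QQ p k r Y ↔ (∀ i, eqh i q = 0) ∧ eqs q = 0 := by
  rw [QQ, Set.mem_ofPred_eq, List.forall_mem_ofFn_iff]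
theorem QQ_closed : IsClosed (QQ p k r Y) := by
  have : QQ p k r Y = (⋂ i, {q | eqh i q = 0}) ∩ {q | eqs q = 0} := by
    ext q; rw [mem_QQ]; simp
  rw [this]
  exact (isClosed_iInter fun i => isClosed_eq (eqh_cont i) continuous_const).inter (isClosed_eq eqs_cont continuous_const)
theorem QQ_inv : InvS (Gam p k) (QQ p k r Y) := fun γ q hq => by
  rw [mem_QQ] at hq ⊢
  exact ⟨fun i => by rw [eqh_act, hq.1, mul_zero], by rw [eqs_act, hq.2, mul_zero]⟩

theorem Fo_nsq (q : PP (p := p) (k := k) r Y) : nsq (Fo q.2.v) ≠ 0 := by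
  intro h
  obtain ⟨i, -, hi⟩ := q.2.exists_ne
  refine hi (congrFun (Fo_inj fun x => ?_) i)
  by_contra hx
  exact (nsq_pos hx).ne' h

theorem nz_shift {z z' : (Fin k → ZMod p) → ℂ} {c : ℂ} (hc : ‖c‖ = 1) (g : Fin k → ZMod p) (h : ∀ x, z' x = c * z (x + g))
    (x : Fin k → ZMod p) : nz z' x = c * nz z (x + g) := by
  have : nsq z' = nsq z := by
    simp only [nsq, h, norm_mul, hc, one_mul]
    exact Equiv.sum_comp (Equiv.addRight g) fun x => ‖z x‖ ^ 2
  rw [nz, nz, this, Pi.smul_apply, Pi.smul_apply, h, mul_smul_comm]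

theorem even_map : letI := subG (QQ_inv (p := p) (k := k) (r := r) (Y := Y))
    ∃ E : QQ p k r Y × Cir (xc (p := p) (k := k) 0 1) → Y × Fr p k (r + 1 + 1), Continuous E ∧ Eqv (Gam p k) E ∧
      ∀ q, drp (drp (E q)) = q.1.1.1 := by
  letI := subG (QQ_inv (p := p) (k := k) (r := r) (Y := Y))
  obtain ⟨Z, hZ⟩ : ∃ Z : QQ p k r Y × Cir (xc (p := p) (k := k) 0 1) → (Fin k → ZMod p) → ℂ,
    ∀ q x, Z q x = (starRingEnd ℂ) q.2.v * nz (Fo q.1.1.2.v) x := ⟨_, fun _ _ => rfl⟩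
  have hn : ∀ q : QQ p k r Y × Cir (xc (p := p) (k := k) 0 1), ‖(starRingEnd ℂ) q.2.v‖ = 1 := fun q => by
    rw [RCLike.norm_conj, q.2.norm]
  have h1 : ∀ q, nsq (Z q) = 1 := fun q => by
    rw [← nsq_nz (Fo_nsq q.1.1)]
    simp only [nsq, hZ, norm_mul, hn, one_mul]
  have h2 : ∀ q, ∑ x, Z q x ^ 2 = 0 := fun q => by
    have h := ((mem_QQ _).1 q.1.2).2
    rw [eqs] at h
    simp only [hZ, nz, Pi.smul_apply, Complex.real_smul, mul_pow, ← Finset.mul_sum, h, mul_zero]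
  have h3 : ∀ q i, ∑ x, (q.1.1.1.2.v i x : ℂ) * Z q x = 0 := fun q i => by
    have h := ((mem_QQ _).1 q.1.2).1 i
    rw [eqh] at h
    simp only [hZ, nz, Pi.smul_apply, Complex.real_smul]
    rw [← mul_zero ((starRingEnd ℂ) q.2.v * (((√(nsq (Fo q.1.1.2.v)))⁻¹ : ℝ) : ℂ)), ← h, Finset.mul_sum]
    exact Finset.sum_congr rfl fun x _ => by ring
  choose F f1 f2 f3 using fun q => two_exists q.1.1.1.2 (Z q) (h1 q) (h2 q) (h3 q)
  have hv : Continuous fun q : QQ p k r Y × Cir (xc (p := p) (k := k) 0 1) => q.1.1 :=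
    continuous_subtype_val.comp continuous_fst
  have hZc : ∀ x, Continuous fun q => Z q x := fun x => by
    simp only [hZ]
    refine (Complex.continuous_conj.comp (Cir.cont.comp continuous_snd)).mul ((continuous_apply x).comp ?_)
    exact nz_cont (Fo_cont.comp (SI.cont.comp (continuous_snd.comp hv))) fun q => Fo_nsq _
  have hZa : ∀ (γ : Gam p k) q x, Z (act γ q) x = Z q (x + γ.1) := fun γ q x => by
    rw [hZ, hZ]
    have e1 : (act γ q).2.v = ch p γ.2 * q.2.v := by
      refine (Cir.v_act γ q.2).trans ?_
      rw [xc_apply, zero_dotProduct, zero_add, one_mul]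
    have e2 : nz (Fo (act γ q).1.1.2.v) x = ch p γ.2 * nz (Fo q.1.1.2.v) (x + γ.1) :=
      nz_shift (ch_norm _) γ.1 (fun x => Fo_act γ q.1.1 x) x
    rw [e1, e2, map_mul, ← ch_neg]
    have e3 : ch p (-γ.2) * ch p γ.2 = 1 := by rw [← ch_add, neg_add_cancel, ch_zero]
    linear_combination ((starRingEnd ℂ) q.2.v * nz (Fo q.1.1.2.v) (x + γ.1)) * e3
  refine ⟨fun q => (q.1.1.1.1, F q), ?_, fun γ q => ?_, fun q => Prod.ext rfl (f1 q)⟩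
  · refine (continuous_fst.comp (continuous_fst.comp hv)).prodMk (Fr.cont' (Fr.cont' ?_ ?_) ?_)
    · simp only [f1]; exact continuous_snd.comp (continuous_fst.comp hv)
    · simp only [f2]; exact continuous_pi fun x => continuous_const.mul (Complex.continuous_re.comp (hZc x))
    · simp only [f3]; exact continuous_pi fun x => continuous_const.mul (Complex.continuous_im.comp (hZc x))
  · refine Prod.ext rfl (Fr.ext' (Fr.ext' ?_ ?_) ?_)
    · exact (f1 _).trans (congrArg (act γ) (f1 q)).symm
    · refine (f2 _).trans (funext fun x => ?_)
      rw [hZa]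
      exact (congrFun (f2 q) (x + γ.1)).symm
    · refine (f3 _).trans (funext fun x => ?_)
      rw [hZa]
      exact (congrFun (f3 q) (x + γ.1)).symm
end Even
end Volo

namespace Volo
open scoped Topology
open GSp

section Even2
variable {p k r : ℕ} [hp : Fact p.Prime]
variable {Y : Type} [MetricSpace Y] [GSp (Gam p k) Y] [CompactSpace Y]

variable (p k r Y) in
/-- frames together with a combination -/
abbrev WW : Type := (Y × Fr p k (r + 1)) × SI (fun _ : Fin (r + 1) => xc (p := p) (k := k) 0 1) Finset.univ

theorem back_map : ∃ Φ : WW p k r Y → PP (p := p) (k := k) r Y, Continuous Φ ∧ Eqv (Gam p k) Φ ∧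
    (∀ q, (Φ q).1 = drp q.1) ∧ ∀ q, Φ q ∉ QQ p k r Y := by
  obtain ⟨y, hy⟩ : ∃ y : WW p k r Y → (Fin k → ZMod p) → ℂ, ∀ q x, y q x = ∑ i, q.2.v i * (q.1.2.v i x : ℂ) :=
    ⟨_, fun _ _ => rfl⟩
  have yc : Continuous y := continuous_pi fun x => by
    simp only [hy]
    exact continuous_finsetSum _ fun i _ => ((SI.cont_i i).comp continuous_snd).mul
      (Complex.continuous_ofReal.comp ((Fr.cont_ix i x).comp (continuous_snd.comp continuous_fst)))
  have ya : ∀ (γ : Gam p k) q x, y (act γ q) x = ch p γ.2 * y q (x + γ.1) := fun γ q x => by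
    rw [hy, hy, Finset.mul_sum]
    refine Finset.sum_congr rfl fun i _ => ?_
    change (ch p (xc 0 1 γ) * q.2.v i) * (q.1.2.v i (x + γ.1) : ℂ) = _
    rw [xc_apply, zero_dotProduct, zero_add, one_mul, mul_assoc]
  have yd : ∀ q (i : Fin (r + 1)), ∑ x, (q.1.2.v i x : ℂ) * y q x = q.2.v i := fun q i => by
    simp only [hy, Finset.mul_sum]
    rw [Finset.sum_comm]
    have : ∀ j, ∑ x, (q.1.2.v i x : ℂ) * (q.2.v j * (q.1.2.v j x : ℂ)) = q.2.v j * (if i = j then 1 else 0) := fun j => by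
      have h := congrArg (fun c : ℝ => (c : ℂ)) (q.1.2.on i j)
      simp only [dotProduct, Complex.ofReal_sum, Complex.ofReal_mul] at h
      have h' : (((if i = j then 1 else 0 : ℝ)) : ℂ) = if i = j then 1 else 0 := by split_ifs <;> simp
      rw [← h', ← h, Finset.mul_sum]
      exact Finset.sum_congr rfl fun x _ => by ring
    simp only [this]
    simp
  have ys : ∀ q, ∑ x, y q x ^ 2 = ∑ i, q.2.v i ^ 2 := fun q => by
    have : ∀ x, y q x ^ 2 = ∑ i, q.2.v i * ((q.1.2.v i x : ℂ) * y q x) := fun x => by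
      rw [sq]
      nth_rewrite 1 [hy]
      rw [Finset.sum_mul]
      exact Finset.sum_congr rfl fun i _ => by ring
    simp only [this]
    rw [Finset.sum_comm]
    exact Finset.sum_congr rfl fun i _ => by rw [← Finset.mul_sum, yd, sq]
  have y0 : ∀ q, nsq (fun a => Fo (y q) (-a)) ≠ 0 := fun q h => by
    have h1 : y q = 0 := Fo_inj fun x => by
      by_contra hx
      have : Fo (y q) (- -x) ≠ 0 := by rwa [neg_neg]
      exact (nsq_pos (z := fun a => Fo (y q) (-a)) (i := -x) this).ne' h
    obtain ⟨i, -, hi⟩ := q.2.exists_ne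
    apply hi
    rw [← yd, h1]
    simp
  have yF : ∀ (γ : Gam p k) q, (fun a => Fo (y (act γ q)) (-a)) = tw (fun a => xc a 1) γ (fun a => Fo (y q) (-a)) := fun γ q => by
    funext a
    have : y (act γ q) = fun x => ch p γ.2 * (fun x => y q (x - -γ.1)) x := by
      funext x; simp only [ya, sub_neg_eq_add]
    rw [this, Fo_mul, Fo_shift, tw, xc_apply, neg_dotProduct_neg, ch_add, one_mul]
    ring
  refine ⟨fun q => (drp q.1, SI.nor (fun a => Fo (y q) (-a)) (y0 q) (fun i h => absurd (Finset.mem_univ i) h)), ?_, fun γ q => ?_,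
    fun q => rfl, fun q hq => ?_⟩
  · refine (drp_cont.comp continuous_fst).prodMk (SI.cont_mk ?_)
    simp only [SI.v_nor]
    exact nz_cont (continuous_pi fun a => (continuous_apply (-a)).comp (Fo_cont.comp yc)) y0
  · refine Prod.ext rfl (SI.ext ?_)
    refine (SI.v_nor _ (y0 _) (fun i h => absurd (Finset.mem_univ i) h)).trans ?_
    rw [yF, nz_tw]
    exact congrArg (tw _ γ) (SI.v_nor _ (y0 q) (fun i h => absurd (Finset.mem_univ i) h)).symm
  · rw [mem_QQ] at hq
    obtain ⟨C, hC⟩ : ∃ C : ℂ, C = (((√(nsq (fun a => Fo (y q) (-a))))⁻¹ : ℝ) : ℂ) := ⟨_, rfl⟩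
    have C0 : C ≠ 0 := by
      rw [hC]
      have := (nsq_nonneg _).lt_of_ne' (y0 q)
      exact_mod_cast (inv_pos.2 (Real.sqrt_pos.2 this)).ne'
    have hF : ∀ x, Fo (nz (fun a => Fo (y q) (-a))) x = C * (p : ℂ) ^ k * y q x := fun x => by
      have : nz (fun a => Fo (y q) (-a)) = fun a => C * (fun a => Fo (y q) (-a)) a := by
        funext a
        rw [nz, Pi.smul_apply, Complex.real_smul, hC]
      rw [this, Fo_mul, Fo_Fo]; ring
    have D0 : C * (p : ℂ) ^ k ≠ 0 := mul_ne_zero C0 pk_ne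
    have k1 : ∀ i : Fin r, q.2.v i.castSucc = 0 := fun i => by
      have h := hq.1 i
      simp only [eqh, SI.v_nor, hF] at h
      rw [← yd]
      refine (mul_eq_zero.1 (Eq.trans ?_ h)).resolve_left D0
      rw [Finset.mul_sum]
      refine Finset.sum_congr rfl fun x _ => ?_
      change _ * ((q.1.2.v i.castSucc x : ℂ) * _) = (q.1.2.v i.castSucc x : ℂ) * _
      ring
    have k2 : q.2.v (Fin.last r) = 0 := by
      have h := hq.2
      simp only [eqs, SI.v_nor, hF, mul_pow, ← Finset.mul_sum, ys] at h
      rw [← mul_pow] at h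
      have h := (mul_eq_zero.1 h).resolve_left (pow_ne_zero _ D0)
      rw [Fin.sum_univ_castSucc] at h
      simp only [k1] at h
      simpa using h
    obtain ⟨i, -, hi⟩ := q.2.exists_ne
    exact hi (Fin.lastCases k2 k1 i)

end Even2
end Volo

namespace Volo
open scoped Topology
open GSp
section Even2
variable {p k r : ℕ} [hp : Fact p.Prime]
variable {Y : Type} [MetricSpace Y] [GSp (Gam p k) Y] [CompactSpace Y]

theorem WW_theta (hodd : Odd p) (hY : ∀ (γ : Gam p k) (y : Y), act γ y = y ↔ γ.1 = 0)
    (hN : ∀ i < k, Nil (Gam p k) Y (xi p k i) (p ^ i * ((p - 1) / 2) + 1)) (hr : r + 1 ≤ p ^ k - 1) :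
    ((Finset.univ.erase (0 : Fin k → ZMod p)).toList.map fun a => TT (WW p k r Y) (xc a 1)).prod = 0 := by
  have hB' := fixF (r := r + 1) hY
  have pf : Eqv (Gam p k) (fun q : WW p k r Y => q.1.1) := fun γ q => rfl
  have pn : Eqv (Gam p k) (Prod.snd : WW p k r Y → SI (fun _ : Fin (r + 1) => xc (p := p) (k := k) 0 1) Finset.univ) := snd_eqv
  have fr : ∀ (γ : Gam p k) (x : WW p k r Y), act γ x = x → γ = 0 := fun γ x h =>
    freeP hB' (fun _ : Fin (r + 1) => 0) Finset.univ γ x h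
  have pN : ∀ i < k, Nil (Gam p k) (WW p k r Y) (xi p k i) (p ^ i * ((p - 1) / 2) + 1) := fun i hi =>
    (hN i hi).comp (continuous_fst.comp continuous_fst) pf
  have pM : Nil (Gam p k) (WW p k r Y) (xc 0 1) (r + 1) :=
    Nil.comp (φ := (Prod.snd : WW p k r Y → SI (fun _ : Fin (r + 1) => xc (p := p) (k := k) 0 1) Finset.univ))
      (Nil.sphere (xc (p := p) (k := k) 0 1) (r + 1)) continuous_snd pn
  exact theta_zero hodd fr pN hr pM

theorem WW_pow (Φ : WW p k r Y → PP (p := p) (k := k) r Y) (f1 : Continuous Φ) (f2 : Eqv (Gam p k) Φ)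
    (f3 : ∀ q, (Φ q).1 = drp q.1) (hs : ∃ s : PP (p := p) (k := k) r Y → ZMod p, IsSec (xc (p := p) (k := k) 0 1) s)
    (u : HH (Gam p k) (Y × Fr p k r) (ZMod p)) :
    pull (Gam p k) (ZMod p) Φ ((TT (PP (p := p) (k := k) r Y) (xc 0 1) ^ r) (pull (Gam p k) (ZMod p) Prod.fst u)) =
      (TT (WW p k r Y) (xc 0 1) ^ r) (pull (Gam p k) (ZMod p) Prod.fst (pull (Gam p k) (ZMod p) drp u)) := by
  have fe : Eqv (Gam p k) (Prod.fst : PP (p := p) (k := k) r Y → Y × Fr p k r) := fst_eqv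
  have fe' : Eqv (Gam p k) (Prod.fst : WW p k r Y → Y × Fr p k (r + 1)) := fst_eqv
  have g0 : (Prod.fst : PP (p := p) (k := k) r Y → Y × Fr p k r) ∘ Φ = drp ∘ (Prod.fst : WW p k r Y → Y × Fr p k (r + 1)) := funext f3
  refine (pull_pow (xc 0 1) hs f1 f2 r _).trans ?_
  refine congrArg _ ((pull_pull continuous_fst fe f1 f2 u).trans ?_)
  refine Eq.trans ?_ (pull_pull drp_cont drp_eqv continuous_fst fe' u).symm
  exact congrArg (fun φ => pull (Gam p k) (ZMod p) φ u) g0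

theorem even_step (hodd : Odd p) (hY : ∀ (γ : Gam p k) (y : Y), act γ y = y ↔ γ.1 = 0)
    (hN : ∀ i < k, Nil (Gam p k) Y (xi p k i) (p ^ i * ((p - 1) / 2) + 1)) (m : ℕ) (hm : r + (1 + (m + m)) = p ^ k)
    (hm0 : 0 < m) (u : HH (Gam p k) (Y × Fr p k r) (ZMod p))
    (hu : pull (Gam p k) (ZMod p) (drp ∘ drp : Y × Fr p k (r + 1 + 1) → Y × Fr p k r) u = 0) : u = 0 := by
  refine odd_step hodd hY m hm u ?_
  have hB := fixF (r := r) hY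
  have ad : Adm (Gam p k) (Y × Fr p k r) (fun a : Fin k → ZMod p => xc a 1) := adm_of hB id
  obtain ⟨s, hs⟩ := ad.seci Finset.univ 0
  obtain ⟨τ, hτ⟩ := Good.list hodd hs (eqs_cont (p := p) (k := k) (r := r) (Y := Y)) eqs_act (List.ofFn eqh)
    (fun h hh => by obtain ⟨i, rfl⟩ := List.mem_ofFn.1 hh; exact eqh_cont i)
    (fun h hh => by obtain ⟨i, rfl⟩ := List.mem_ofFn.1 hh; exact eqh_act i)
  rw [List.length_ofFn] at hτ
  have fe : Eqv (Gam p k) (Prod.fst : PP (p := p) (k := k) r Y → Y × Fr p k r) := fst_eqv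
  obtain ⟨c, w, hc, h1, h2⟩ := even_abs hodd (ad.unifP Finset.univ) hs (QQ_closed (p := p) (k := k) (r := r) (Y := Y))
    QQ_inv hτ (pull (Gam p k) (ZMod p) Prod.fst u) (by
      letI := subG (QQ_inv (p := p) (k := k) (r := r) (Y := Y))
      obtain ⟨E, e1, e2, e3⟩ := even_map (p := p) (k := k) (r := r) (Y := Y)
      have ve : Eqv (Gam p k) (fun q : QQ p k r Y × Cir (xc (p := p) (k := k) 0 1) => q.1.1) := fun γ q => rfl
      refine (pull_pull continuous_fst fe (continuous_subtype_val.comp continuous_fst) ve u).trans ?_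
      have : (Prod.fst ∘ fun q : QQ p k r Y × Cir (xc (p := p) (k := k) 0 1) => q.1.1) = (drp ∘ drp) ∘ E := by
        funext q; exact (e3 q).symm
      refine (congrArg (fun f => pull (Gam p k) (ZMod p) f u) this).trans ?_
      rw [ ← pull_pull (drp_cont.comp drp_cont) (fun γ q => rfl) e1 e2, hu, map_zero])
  have kk : 2 ≤ p ^ k := by omega
  have k0 : k ≠ 0 := by rintro rfl; simp at kk
  obtain ⟨L, hL⟩ : ∃ L, L = (Finset.univ.erase (0 : Fin k → ZMod p)).toList := ⟨_, rfl⟩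
  have hLf : L.toFinset = Finset.univ.erase (0 : Fin k → ZMod p) := by rw [hL, Finset.toList_toFinset]
  obtain ⟨c', h3⟩ := ad.keyA hodd L 0 (by
      rw [List.nodup_cons, hL]
      exact ⟨by simp, Finset.nodup_toList _⟩)
    (by
      rintro h0
      rw [h0] at hLf
      have : (1 : Fin k → ZMod p) ∈ Finset.univ.erase (0 : Fin k → ZMod p) := by
        haveI : Nonempty (Fin k) := ⟨⟨0, Nat.pos_of_ne_zero k0⟩⟩
        simp
      rw [← hLf] at this
      simp at this)
    (by rw [hLf, Finset.insert_erase (Finset.mem_univ _)]) _ h1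
  obtain ⟨Φ, f1, f2, f3, f4⟩ := back_map (p := p) (k := k) (r := r) (Y := Y)
  have h4 := congrArg (pull (Gam p k) (ZMod p) Φ) h3
  have hB' := fixF (r := r + 1) hY
  have tz := WW_theta (r := r) hodd hY hN (by omega)
  rw [← hL] at tz
  have g1 := WW_pow Φ f1 f2 f3 ⟨s, hs⟩ u
  have g2 := pull_prod (fun a : Fin k → ZMod p => xc a 1) (ad.seci Finset.univ) f1 f2 L c'
  have g3 := h4.trans g2
  rw [tz, LinearMap.zero_apply, map_sub, map_smul, h2 _ _ f1 f2 f4, sub_zero] at g3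
  have h5 := (smul_eq_zero.1 g3).resolve_left hc
  have h5 := g1.symm.trans h5
  exact (adm_of hB' (fun _ : Fin (r + 1) => 0)).keyB hodd (xc 0 1) (fun _ => rfl) Finset.univ_nonempty _ r (by simp) h5
end Even2
end Volo

namespace Volo
open scoped Topology
open GSp
section Econ
variable {p k : ℕ} [hp : Fact p.Prime]

theorem xi_val {i : ℕ} (h : i < k) (γ : Gam p k) : xi p k i γ = γ.1 ⟨i, h⟩ := by
  rw [xi_eq h, xc_apply]; simp

section Step
variable {Y : Type} [MetricSpace Y] [GSp (Gam p k) Y] [CompactSpace Y]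

variable (p k Y) in
/-- adding a sphere -/
abbrev YS (j n : ℕ) : Type := Y × SI (fun _ : Fin (n + 1) => xi p k j) Finset.univ

theorem YS_adm {j : ℕ} (hj : j < k) (n : ℕ) (hY : ∀ (γ : Gam p k) (y : Y), act γ y = y ↔ ∀ i < j, xi p k i γ = 0) :
    Adm (Gam p k) Y (fun _ : Fin (n + 1) => xi p k j) where
  unif γ x y h := (hY γ y).2 ((hY γ x).1 h)
  agree γ y h i j := rfl
  surj i c := by
    refine ⟨(Pi.single ⟨j, hj⟩ c, 0), fun y => (hY _ y).2 fun i hi => ?_, ?_⟩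
    · rw [xi_val (hi.trans hj)]
      have : (⟨i, hi.trans hj⟩ : Fin k) ≠ ⟨j, hj⟩ := fun h => hi.ne (congrArg Fin.val h)
      simp [this]
    · rw [xi_val hj]; simp

theorem pull_pr {X X1 : Type} [MetricSpace X] [MetricSpace X1] [GSp (Gam p k) X] [GSp (Gam p k) X1] {φ : X1 → X}
    (hc : Continuous φ) (he : Eqv (Gam p k) φ) (n : ℕ → ℕ) (j : ℕ)
    (hs : ∀ i < j, ∃ s : X → ZMod p, IsSec (xi p k i) s) (u : HH (Gam p k) X (ZMod p)) :
    pull (Gam p k) (ZMod p) φ (pr (fun i => TT X (xi p k i) ^ n i) j u) =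
      pr (fun i => TT X1 (xi p k i) ^ n i) j (pull (Gam p k) (ZMod p) φ u) := by
  induction j with
  | zero => rfl
  | succ j ih =>
    refine (pull_pow (xi p k j) (hs j (Nat.lt_succ_self j)) hc he (n j) _).trans ?_
    rw [ih fun i hi => hs i (hi.trans (Nat.lt_succ_self j))]
    rfl

theorem YS_step (hodd : Odd p) {j : ℕ} (hj : j < k) (n : ℕ → ℕ)
    (hY : ∀ (γ : Gam p k) (y : Y), act γ y = y ↔ ∀ i < j, xi p k i γ = 0)
    (hN : ∀ i < j, Nil (Gam p k) Y (xi p k i) (n i + 1))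
    (u : HH (Gam p k) Y (ZMod p)) (hu : pr (fun i => TT Y (xi p k i) ^ n i) j u ≠ 0) :
    (∀ (γ : Gam p k) (y : YS p k Y j (n j)), act γ y = y ↔ ∀ i < j + 1, xi p k i γ = 0) ∧
    (∀ i < j + 1, Nil (Gam p k) (YS p k Y j (n j)) (xi p k i) (n i + 1)) ∧
    pr (fun i => TT (YS p k Y j (n j)) (xi p k i) ^ n i) (j + 1) (pull (Gam p k) (ZMod p) Prod.fst u) ≠ 0 := by
  have ad := YS_adm hj (n j) hY
  have fe : Eqv (Gam p k) (Prod.fst : YS p k Y j (n j) → Y) := fst_eqv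
  have se : Eqv (Gam p k) (Prod.snd : YS p k Y j (n j) → SI (fun _ : Fin (n j + 1) => xi p k j) Finset.univ) := snd_eqv
  refine ⟨fun γ y => ?_, fun i hi => ?_, fun h => hu ?_⟩
  · rw [ad.fix, hY]
    constructor
    · rintro ⟨h1, h2⟩ i hi
      rcases Nat.lt_succ_iff_lt_or_eq.1 hi with h | rfl
      · exact h1 i h
      · exact h2 0
    · exact fun h => ⟨fun i hi => h i (hi.trans (Nat.lt_succ_self j)), fun _ => h j (Nat.lt_succ_self j)⟩
  · rcases Nat.lt_succ_iff_lt_or_eq.1 hi with h | rfl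
    · exact Nil.comp (φ := (Prod.fst : YS p k Y j (n j) → Y)) (hN i h) continuous_fst fe
    · exact Nil.comp (φ := (Prod.snd : YS p k Y i (n i) → SI (fun _ : Fin (n i + 1) => xi p k i) Finset.univ))
        (Nil.sphere (xi p k i) (n i + 1)) continuous_snd se
  · refine ad.keyB hodd (xi p k j) (fun _ => rfl) Finset.univ_nonempty _ (n j) (by simp) (Eq.trans ?_ h)
    rw [pull_pr continuous_fst fe n j fun i hi => exists_sec _ fun γ x hx => (hY γ x).1 hx i hi]
    rfl
end Step

theorem base_ne : ∃ (_ : GSp (Gam p k) Unit), (∀ (γ : Gam p k) (y : Unit), act γ y = y) ∧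
    ∃ u : HH (Gam p k) Unit (ZMod p), u ≠ 0 := by
  letI G : GSp (Gam p k) Unit := ⟨fun _ x => x, fun _ => rfl, fun _ _ _ => rfl, fun _ _ _ => rfl⟩
  refine ⟨G, fun _ _ => rfl, ?_⟩
  have h1 : (one : List Unit → ZMod p) ∈ Zc (Gam p k) Unit (ZMod p) :=
    ⟨one_mem, fun x => by rw [D_one]; exact Z0.zero x⟩
  refine ⟨cls h1, fun h => ?_⟩
  rw [cls_zero] at h
  obtain ⟨g, hg, h⟩ := h
  obtain ⟨U, hU, h⟩ := h () 1
  have h := h [()] rfl fun a ha => mem_of_mem_nhds hU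
  simp [one, D, hg.1] at h

theorem exists_E (hodd : Odd p) (n : ℕ → ℕ) (j : ℕ) (hj : j ≤ k) :
    ∃ (Y : Type) (_ : MetricSpace Y) (_ : GSp (Gam p k) Y) (_ : CompactSpace Y),
      (∀ (γ : Gam p k) (y : Y), act γ y = y ↔ ∀ i < j, xi p k i γ = 0) ∧
      (∀ i < j, Nil (Gam p k) Y (xi p k i) (n i + 1)) ∧
      ∃ u : HH (Gam p k) Y (ZMod p), pr (fun i => TT Y (xi p k i) ^ n i) j u ≠ 0 := by
  induction j with
  | zero =>
    obtain ⟨G, h1, u, hu⟩ := base_ne (p := p) (k := k)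
    exact ⟨Unit, inferInstance, G, inferInstance, fun γ y => ⟨fun _ i hi => absurd hi (Nat.not_lt_zero i), fun _ => h1 γ y⟩,
      fun i hi => absurd hi (Nat.not_lt_zero i), u, hu⟩
  | succ j ih =>
    obtain ⟨Y, i1, i2, i3, h1, h2, u, hu⟩ := ih (Nat.le_of_succ_le hj)
    obtain ⟨g1, g2, g3⟩ := YS_step hodd hj n h1 h2 u hu
    exact ⟨YS p k Y j (n j), inferInstance, inferInstance, inferInstance, g1, g2, _, g3⟩
end Econ
end Volo

namespace Volo
open scoped Topology
open GSp
section Tower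
variable {p k : ℕ} [hp : Fact p.Prime]
variable {Y : Type} [MetricSpace Y] [GSp (Gam p k) Y] [CompactSpace Y]

variable (p k Y) in
/-- the projection of the frame bundle is injective in cohomology -/
def Inj (r : ℕ) : Prop := ∀ u : HH (Gam p k) Y (ZMod p), pull (Gam p k) (ZMod p) (Prod.fst : Y × Fr p k r → Y) u = 0 → u = 0

theorem inj_zero : Inj p k Y 0 := fun u hu => by
  have v0 : Fr p k 0 := Fr.mk (fun i => i.elim0) (fun i => i.elim0)
  have he : Eqv (Gam p k) (fun y : Y => (y, v0)) := fun γ y => Prod.ext rfl (Fr.ext (funext fun i => i.elim0))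
  have fe : Eqv (Gam p k) (Prod.fst : Y × Fr p k 0 → Y) := fst_eqv
  have h := congrArg (pull (Gam p k) (ZMod p) (fun y : Y => (y, v0))) hu
  have hc : Continuous (fun y : Y => (y, v0)) := continuous_id.prodMk continuous_const
  rw [pull_pull continuous_fst fe hc he, map_zero] at h
  exact (pull_id u).symm.trans h

theorem inj_two (hodd : Odd p) (hY : ∀ (γ : Gam p k) (y : Y), act γ y = y ↔ γ.1 = 0)
    (hN : ∀ i < k, Nil (Gam p k) Y (xi p k i) (p ^ i * ((p - 1) / 2) + 1)) {r : ℕ} (m : ℕ) (hm : r + (1 + (m + m)) = p ^ k)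
    (hm0 : 0 < m) (h : Inj p k Y r) : Inj p k Y (r + 1 + 1) := fun u hu => by
  have fe : Eqv (Gam p k) (Prod.fst : Y × Fr p k r → Y) := fst_eqv
  have de : Eqv (Gam p k) (drp ∘ drp : Y × Fr p k (r + 1 + 1) → Y × Fr p k r) := fun γ q => rfl
  exact h u (even_step hodd hY hN m hm hm0 _ ((pull_pull continuous_fst fe (drp_cont.comp drp_cont) de u).trans hu))

theorem inj_one (hodd : Odd p) (hY : ∀ (γ : Gam p k) (y : Y), act γ y = y ↔ γ.1 = 0)
    {r : ℕ} (m : ℕ) (hm : r + (1 + (m + m)) = p ^ k)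
    (h : Inj p k Y r) : Inj p k Y (r + 1) := fun u hu => by
  have fe : Eqv (Gam p k) (Prod.fst : Y × Fr p k r → Y) := fst_eqv
  exact h u (odd_step hodd hY m hm _ ((pull_pull continuous_fst fe drp_cont drp_eqv u).trans hu))

theorem inj_all (hodd : Odd p) (hY : ∀ (γ : Gam p k) (y : Y), act γ y = y ↔ γ.1 = 0)
    (hN : ∀ i < k, Nil (Gam p k) Y (xi p k i) (p ^ i * ((p - 1) / 2) + 1)) : Inj p k Y (p ^ k) := by
  have key : ∀ t m : ℕ, (t + t) + (1 + (m + m)) = p ^ k → Inj p k Y (t + t) := fun t => by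
    induction t with
    | zero => exact fun m _ => inj_zero
    | succ t ih =>
      intro m hm
      rw [show t + 1 + (t + 1) = t + t + 1 + 1 by omega]
      exact inj_two hodd hY hN (m + 1) (by omega) (Nat.succ_pos m) (ih (m + 1) (by omega))
  obtain ⟨t, ht⟩ := hodd.pow (n := k)
  rw [show p ^ k = t + t + 1 by omega]
  exact inj_one hodd hY 0 (by omega) (key t 0 (by omega))
end Tower
end Volo

namespace Volo
open scoped Topology
open GSp
section Fin
variable {p k : ℕ} [hp : Fact p.Prime]

theorem det_perm (hodd : Odd p) (g : Fin k → ZMod p) : ((Equiv.addLeft g).permMatrix ℝ).det = 1 := by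
  rw [Matrix.det_permutation]
  have h1 : (Equiv.addLeft g) ^ p = 1 := by
    have : ∀ n : ℕ, ∀ x, ((Equiv.addLeft g) ^ n) x = n • g + x := fun n x => by
      induction n with
      | zero => simp
      | succ n ih => rw [pow_succ', Equiv.Perm.mul_apply, ih, succ_nsmul', add_assoc]; rfl
    ext x i
    rw [this]
    simp
  have h2 : Equiv.Perm.sign (Equiv.addLeft g) ^ p = 1 := by rw [← map_pow, h1, map_one]
  rcases Int.units_eq_one_or (Equiv.Perm.sign (Equiv.addLeft g)) with h | h
  · simp [h]
  · rw [h, hodd.neg_one_pow] at h2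
    exact absurd h2 (by decide)

/-- the frame matrix -/
theorem exists_M (hodd : Odd p) : ∃ M : Fr p k (p ^ k) → {A : Matrix (Fin k → ZMod p) (Fin k → ZMod p) ℝ //
        A ∈ Matrix.orthogonalGroup (Fin k → ZMod p) ℝ ∧ A.det = 1}, Continuous M ∧
      ∀ (γ : Gam p k) q, ((M (act γ q)).1 : Matrix (Fin k → ZMod p) (Fin k → ZMod p) ℝ) =
        (Equiv.addLeft γ.1).permMatrix ℝ * (M q).1 := by
  have e : (Fin k → ZMod p) ≃ Fin (p ^ k) := Fintype.equivFinOfCardEq (by simp [ZMod.card])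
  obtain ⟨A, hA⟩ : ∃ A : Fr p k (p ^ k) → Matrix (Fin k → ZMod p) (Fin k → ZMod p) ℝ, ∀ q x y, A q x y = q.v (e y) x :=
    ⟨fun q => Matrix.of fun x y => q.v (e y) x, fun _ _ _ => rfl⟩
  have Ac : Continuous A := continuous_matrix fun x y => by
    simp only [hA]; exact Fr.cont_ix _ _
  have Ao : ∀ q, (A q)ᵀ * A q = 1 := fun q => by
    ext x y
    rw [Matrix.mul_apply, Matrix.one_apply]
    simp only [Matrix.transpose_apply, hA]
    have := q.on (e x) (e y)
    simp only [e.injective.eq_iff] at this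
    exact this
  have Ad : ∀ q, (A q).det * (A q).det = 1 := fun q => by
    have := congrArg Matrix.det (Ao q)
    rwa [Matrix.det_mul, Matrix.det_transpose, Matrix.det_one] at this
  have Aa : ∀ (γ : Gam p k) q, A (act γ q) = (Equiv.addLeft γ.1).permMatrix ℝ * A q := fun γ q => by
    ext x y
    rw [Equiv.Perm.permMatrix, PEquiv.toMatrix_toPEquiv_mul, hA]
    simp only [Matrix.submatrix_apply, hA, Equiv.coe_addLeft, id, Fr.v_act, add_comm]
  obtain ⟨E, hE⟩ : ∃ E : ℝ → Matrix (Fin k → ZMod p) (Fin k → ZMod p) ℝ, ∀ c, E c = diagonal (fun y => if y = 0 then c else 1) :=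
    ⟨_, fun _ => rfl⟩
  have Ec : Continuous E := by
    rw [show E = fun c => diagonal (fun y => if y = 0 then c else 1) from funext hE]
    refine Continuous.matrix_diagonal (continuous_pi fun y => ?_)
    split_ifs
    · exact continuous_id
    · exact continuous_const
  have Ed : ∀ c, (E c).det = c := fun c => by
    rw [hE, det_diagonal]
    simp
  have Eo : ∀ c : ℝ, c * c = 1 → (E c)ᵀ * E c = 1 := fun c hc => by
    rw [hE, diagonal_transpose, diagonal_mul_diagonal, ← diagonal_one]
    congr 1
    funext y
    split_ifs
    · exact hc
    · simp
  refine ⟨fun q => ⟨A q * E (A q).det, ?_, ?_⟩, ?_, fun γ q => ?_⟩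
  · rw [Matrix.mem_orthogonalGroup_iff']
    rw [Matrix.transpose_mul, Matrix.mul_assoc, ← Matrix.mul_assoc _ (A q), Ao, Matrix.one_mul, Eo _ (Ad q)]
  · rw [det_mul, Ed, Ad]
  · exact (Ac.matrix_mul (Ec.comp Ac.matrix_det)).subtype_mk _
  · change A (act γ q) * E (A (act γ q)).det = _ * (A q * E (A q).det)
    rw [Aa, det_mul, det_perm hodd, one_mul, Matrix.mul_assoc]

theorem main (hodd : Odd p)
    (f : {A : Matrix (Fin k → ZMod p) (Fin k → ZMod p) ℝ //
        A ∈ Matrix.orthogonalGroup (Fin k → ZMod p) ℝ ∧ A.det = 1} → (Fin k → ZMod p) → ℝ)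
    (hcont : Continuous f)
    (hsum : ∀ A, ∑ x : Fin k → ZMod p, f A x = 0)
    (hequiv : ∀ (g : Fin k → ZMod p) (A B :
        {A : Matrix (Fin k → ZMod p) (Fin k → ZMod p) ℝ //
          A ∈ Matrix.orthogonalGroup (Fin k → ZMod p) ℝ ∧ A.det = 1}),
      (B : Matrix (Fin k → ZMod p) (Fin k → ZMod p) ℝ) =
          (Equiv.addLeft g).permMatrix ℝ * (A : Matrix (Fin k → ZMod p) (Fin k → ZMod p) ℝ) →
        f B = fun x => f A (x - g)) :
    ∃ A, f A = 0 := by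
  by_contra! hne
  obtain ⟨M, Mc, Ma⟩ := exists_M (p := p) (k := k) hodd
  obtain ⟨Y, i1, i2, i3, h1, hN, u, hu⟩ := exists_E (p := p) (k := k) hodd (fun i => p ^ i * ((p - 1) / 2)) k le_rfl
  have hY : ∀ (γ : Gam p k) (y : Y), act γ y = y ↔ γ.1 = 0 := fun γ y => by
    rw [h1]
    constructor
    · intro h
      funext i
      have := h i i.2
      rwa [xi_val i.2] at this
    · exact fun h i _ => xi_triv i γ h
  have fe : Eqv (Gam p k) (Prod.fst : Y × Fr p k (p ^ k) → Y) := fst_eqv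
  have hB := fixF (r := p ^ k) hY
  obtain ⟨H, H1, H2⟩ := half_zero (X := Y × Fr p k (p ^ k)) hodd (fun γ x h => (hB γ x).1 h) fun i hi =>
    Nil.comp (φ := (Prod.fst : Y × Fr p k (p ^ k) → Y)) (hN i hi) continuous_fst fe
  obtain ⟨F, hF⟩ : ∃ F : (Fin k → ZMod p) → Y × Fr p k (p ^ k) → ℂ, ∀ a q, F a q = Fo (fun x => (f (M q.2) x : ℂ)) a :=
    ⟨_, fun _ _ => rfl⟩
  have Fc : ∀ a, Continuous (F a) := fun a => by
    rw [show F a = fun q => Fo (fun x => (f (M q.2) x : ℂ)) a from funext (hF a)]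
    refine (continuous_apply a).comp (Fo_cont.comp (continuous_pi fun x => Complex.continuous_ofReal.comp ?_))
    exact (continuous_apply x).comp (hcont.comp (Mc.comp continuous_snd))
  have Fa : ∀ a (γ : Gam p k) q, F a (act γ q) = ch p (xc a 0 γ) * F a q := fun a γ q => by
    have h := hequiv γ.1 (M q.2) (M (act γ q.2)) (Ma γ q.2)
    rw [hF, hF, xc_apply, zero_mul, add_zero, ← Fo_shift]
    change Fo (fun x => (f (M (act γ q.2)) x : ℂ)) a = _
    rw [h]
  have Fz : ∀ q, ∃ a ∈ H, F a q ≠ 0 := fun q => by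
    by_contra! h
    apply hne (M q.2)
    have cj : ∀ a, F (-a) q = (starRingEnd ℂ) (F a q) := fun a => by
      rw [hF, hF, Fo, Fo, map_sum]
      refine Finset.sum_congr rfl fun x _ => ?_
      rw [map_mul, ← ch_neg, dotProduct_neg, Complex.conj_ofReal]
    have h0 : (fun x => (f (M q.2) x : ℂ)) = 0 := Fo_inj fun a => by
      rw [← hF]
      by_cases ha : a = 0
      · subst ha
        rw [hF, Fo]
        simp only [dotProduct_zero, ch_zero, one_mul]
        exact_mod_cast hsum (M q.2)
      · rcases H1 a ha with h' | h'
        · exact h a h'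
        · have := cj (-a)
          rw [neg_neg, h _ h', map_zero] at this
          exact this
    funext x
    exact Complex.ofReal_eq_zero.1 (congrFun h0 x)
  have T := TT_prod_zero hodd (H.toList.map fun a => (xc (p := p) (k := k) a 0, F a))
    (fun q hq => by
      obtain ⟨a, -, rfl⟩ := List.mem_map.1 hq
      exact sec_of (fun γ x h => (hB γ x).1 h) a)
    (fun q hq => by obtain ⟨a, -, rfl⟩ := List.mem_map.1 hq; exact Fc a)
    (fun q hq => by obtain ⟨a, -, rfl⟩ := List.mem_map.1 hq; exact Fa a)
    (fun x => by
      obtain ⟨a, ha, hx⟩ := Fz x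
      exact ⟨_, List.mem_map.2 ⟨a, Finset.mem_toList.2 ha, rfl⟩, hx⟩)
  rw [List.map_map] at T
  have P := H2 T
  refine hu (inj_all hodd hY hN _ ?_)
  rw [pull_pr continuous_fst fe (fun i => p ^ i * ((p - 1) / 2)) k fun i hi => exists_sec _ fun γ x hx => (h1 γ x).1 hx i hi]
  rw [P, LinearMap.zero_apply]
end Fin
end Volo

/-- Volovikov's theorem used in the paper: let `p` be an odd prime, `d = p^k`,
`G = (ℤ/p)^k`, acting freely on `SO(d)` (realized as special orthogonal matrices indexed by
`G`) by left multiplication by the permutation matrices of the regular action, and let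
`V = ℝ[G]/ℝ` be the reduced regular representation, realized as the sum-zero subspace of
`G → ℝ` with the translation action (so `V^G = 0`).  Then every continuous `G`-equivariant map
`f : SO(d) → V` has a zero. -/
theorem stmt14 (p k : ℕ) [hp : Fact p.Prime] (hodd : Odd p)
    (f : {A : Matrix (Fin k → ZMod p) (Fin k → ZMod p) ℝ //
        A ∈ Matrix.orthogonalGroup (Fin k → ZMod p) ℝ ∧ A.det = 1} → (Fin k → ZMod p) → ℝ)
    (hcont : Continuous f)
    (hsum : ∀ A, ∑ x : Fin k → ZMod p, f A x = 0)
    (hequiv : ∀ (g : Fin k → ZMod p) (A B :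
        {A : Matrix (Fin k → ZMod p) (Fin k → ZMod p) ℝ //
          A ∈ Matrix.orthogonalGroup (Fin k → ZMod p) ℝ ∧ A.det = 1}),
      (B : Matrix (Fin k → ZMod p) (Fin k → ZMod p) ℝ) =
          (Equiv.addLeft g).permMatrix ℝ * (A : Matrix (Fin k → ZMod p) (Fin k → ZMod p) ℝ) →
        f B = fun x => f A (x - g)) :
    ∃ A, f A = 0 := by
  exact Volo.main hodd f hcont hsum hequiv
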